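/- For every ε > 0 there exists a homotopically non-trivial C¹ map from S^7 to S^4 with 3-dilation less than ε. (The class of such a map is a non-trivial torsion element of π_7(S^4) which is a double suspension of an element of π_5(S^2).) -/

import Mathlib

/-!
Basic notions: the unit sphere `S^{d-1} ⊆ ℝ^d`, the norm `‖Λ^k A‖` of the induced map on
`k`-th exterior powers of a linear map between inner product spaces, and the `k`-dilation of a
`C¹` map between unit spheres.  A (`C¹`) map from `S^{d₁-1}` to `S^{d₂-1}` is represented by a
(`C¹`) ambient map `F : ℝ^{d₁} → ℝ^{d₂}` mapping the unit sphere into the unit sphere; its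
`k`-dilation only depends on the restriction of `F` to the sphere, since the derivative is
restricted to the tangent space of the sphere.
-/

open scoped RealInnerProductSpace
open Set

noncomputable section

abbrev EucA (d : ℕ) := EuclideanSpace ℝ (Fin d)

/-- The unit sphere `S^{d-1}` in `ℝ^d` (with the round metric induced from `ℝ^d`). -/
def usph (d : ℕ) : Set (EucA d) := Metric.sphere 0 1

/-- The operator norm `‖Λ^k A‖` of the induced map on `k`-th exterior powers (with their induced
inner products): the supremum, over orthonormal `k`-frames `v` of the domain, of the `k`-volume
`√ det (⟪A vᵢ, A vⱼ⟫)` of the image frame `A v₁, …, A v_k`. -/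
noncomputable def lamNorm {E F : Type*} [NormedAddCommGroup E] [InnerProductSpace ℝ E]
    [NormedAddCommGroup F] [InnerProductSpace ℝ F] (k : ℕ) (A : E →ₗ[ℝ] F) : ℝ :=
  ⨆ v : {v : Fin k → E // Orthonormal ℝ v},
    Real.sqrt (Matrix.of fun (i j : Fin k) => ⟪A (v.1 i), A (v.1 j)⟫).det

/-- The `k`-dilation of a map of the unit sphere `S^{d-1}` into an inner product space (e.g. into
`ℝ^{d₂}`, for a map to the sphere `S^{d₂-1}`), the map being given by an ambient map `F`: the
supremum over points `x` of the sphere of `‖Λ^k df_x‖`, where `df_x` is the derivative of `F` at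
`x` restricted to the tangent space `(ℝ∙x)ᗮ` of the sphere at `x`. -/
noncomputable def kDilation {d : ℕ} {F' : Type*} [NormedAddCommGroup F']
    [InnerProductSpace ℝ F'] (k : ℕ) (F : EucA d → F') : ℝ :=
  ⨆ x : usph d,
    lamNorm k ((fderiv ℝ F (x : EucA d)).toLinearMap ∘ₗ ((ℝ ∙ (x : EucA d))ᗮ).subtype)

/-- A free homotopy, through maps of the unit sphere `S^{d-1}` into `T`, between (the
restrictions to the sphere of) `f` and `g`: a map `H` on `[0,1] × S^{d-1}`, continuous there,
with values in `T`, starting at `f` and ending at `g`. -/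
def FreelyHomotopic {d : ℕ} {E : Type*} [NormedAddCommGroup E] (T : Set E)
    (f g : EucA d → E) : Prop :=
  ∃ H : ℝ → EucA d → E,
    ContinuousOn (fun q : ℝ × EucA d => H q.1 q.2) (Icc (0:ℝ) 1 ×ˢ usph d) ∧
    (∀ t ∈ Icc (0:ℝ) 1, MapsTo (H t) (usph d) T) ∧
    EqOn (H 0) f (usph d) ∧ EqOn (H 1) g (usph d)

/-- A based homotopy (rel the basepoint `x₀` of the sphere, with basepoint value `y₀`), through
maps of the unit sphere `S^{d-1}` into `T`, between `f` and `g`. -/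
def BasedHomotopic {d : ℕ} {E : Type*} [NormedAddCommGroup E] (T : Set E)
    (x₀ : EucA d) (y₀ : E) (f g : EucA d → E) : Prop :=
  ∃ H : ℝ → EucA d → E,
    ContinuousOn (fun q : ℝ × EucA d => H q.1 q.2) (Icc (0:ℝ) 1 ×ˢ usph d) ∧
    (∀ t ∈ Icc (0:ℝ) 1, MapsTo (H t) (usph d) T) ∧
    (∀ t ∈ Icc (0:ℝ) 1, H t x₀ = y₀) ∧
    EqOn (H 0) f (usph d) ∧ EqOn (H 1) g (usph d)

/-- A sphere-valued map is nullhomotopic if it is freely homotopic, through sphere maps, to a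
constant map; a map is homotopically non-trivial if it is not nullhomotopic. -/
def SphereNullhomotopic {d₁ d₂ : ℕ} (F : EucA d₁ → EucA d₂) : Prop :=
  ∃ y ∈ usph d₂, FreelyHomotopic (usph d₂) F (fun _ => y)

set_option autoImplicit false

section LinearAlgebra

variable {k V W V' W' : Type*} [Field k] [AddCommGroup V] [Module k V] [AddCommGroup W] [Module k W]
  [AddCommGroup V'] [Module k V'] [AddCommGroup W'] [Module k W']

/-- The index `dim ker T - dim coker T` of a linear map. -/
def fidx (T : V →ₗ[k] W) : ℤ :=
  (Module.finrank k (LinearMap.ker T) : ℤ) - Module.finrank k (W ⧸ LinearMap.range T)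

theorem fidx_border {K C : Type*} [AddCommGroup K] [Module k K] [AddCommGroup C] [Module k C]
    [FiniteDimensional k K] [FiniteDimensional k C] (T : V →ₗ[k] W)
    (M : (V × C) ≃ₗ[k] (W × K)) (hM : ∀ x, (M (x, 0)).1 = T x) :
    fidx T = (Module.finrank k K : ℤ) - Module.finrank k C := by
  have hN : ∀ w κ, M.symm (w, κ) = M.symm (w, 0) + M.symm (0, κ) := fun w κ => by
    rw [← map_add]; simp
  have hMx : ∀ x, M (x, 0) = (T x, (M (x, 0)).2) := fun x => by rw [← hM x]
  set D : K →ₗ[k] C := LinearMap.snd k V C ∘ₗ M.symm.toLinearMap ∘ₗ LinearMap.inr k W K with hD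
  have hDa : ∀ κ, D κ = (M.symm (0, κ)).2 := fun κ => rfl
  have h1 : Module.finrank k (LinearMap.ker T) = Module.finrank k (LinearMap.ker D) := by
    have key : ∀ κ, D κ = 0 → M ((M.symm (0, κ)).1, 0) = (0, κ) := by
      intro κ hκ
      have : M.symm (0, κ) = ((M.symm (0, κ)).1, 0) := Prod.ext rfl (by rw [← hDa, hκ])
      rw [← this, LinearEquiv.apply_symm_apply]
    refine LinearEquiv.finrank_eq (LinearEquiv.ofLinearMap
      (((LinearMap.snd k W K ∘ₗ M.toLinearMap ∘ₗ LinearMap.inl k V C) ∘ₗ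
        (LinearMap.ker T).subtype).codRestrict _ ?_)
      (((LinearMap.fst k V C ∘ₗ M.symm.toLinearMap ∘ₗ LinearMap.inr k W K) ∘ₗ
        (LinearMap.ker D).subtype).codRestrict _ ?_) ?_ ?_)
    · rintro ⟨x, hx⟩
      have hx' : T x = 0 := hx
      have h2 : (0, (M (x, 0)).2) = M (x, 0) := by rw [hMx x, hx']
      change D ((M (x, 0)).2) = 0
      rw [hDa, h2, LinearEquiv.symm_apply_apply]
    · rintro ⟨κ, hκ⟩
      change T ((M.symm (0, κ)).1) = 0
      rw [← hM, key κ hκ]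
    · ext ⟨κ, hκ⟩
      change (M ((M.symm (0, κ)).1, 0)).2 = κ
      rw [key κ hκ]
    · ext ⟨x, hx⟩
      have hx' : T x = 0 := hx
      have h2 : (0, (M (x, 0)).2) = M (x, 0) := by rw [hMx x, hx']
      change (M.symm (0, (M (x, 0)).2)).1 = x
      rw [h2, LinearEquiv.symm_apply_apply]
  have h2 : Module.finrank k (W ⧸ LinearMap.range T) =
      Module.finrank k (C ⧸ LinearMap.range D) := by
    let q : W →ₗ[k] (C ⧸ LinearMap.range D) := (LinearMap.range D).mkQ ∘ₗ
      LinearMap.snd k V C ∘ₗ M.symm.toLinearMap ∘ₗ LinearMap.inl k W K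
    have hq : Function.Surjective q := by
      intro c
      obtain ⟨c, rfl⟩ := Submodule.mkQ_surjective _ c
      obtain ⟨w, κ, h5⟩ : ∃ w κ, M (0, c) = (w, κ) := ⟨_, _, rfl⟩
      refine ⟨w, ?_⟩
      have h3 := hN w κ
      rw [← h5, LinearEquiv.symm_apply_apply] at h3
      change (LinearMap.range D).mkQ (M.symm (w, 0)).2 = _
      rw [Submodule.mkQ_apply, Submodule.mkQ_apply, Submodule.Quotient.eq]
      refine ⟨-κ, ?_⟩
      have h4 : c = (M.symm (w, 0)).2 + (M.symm (0, κ)).2 := congrArg Prod.snd h3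
      rw [map_neg, hDa, h4]
      abel
    have hker : LinearMap.ker q = LinearMap.range T := by
      ext w
      rw [LinearMap.mem_ker]
      change (LinearMap.range D).mkQ (M.symm (w, 0)).2 = 0 ↔ _
      rw [Submodule.mkQ_apply, Submodule.Quotient.mk_eq_zero]
      constructor
      · rintro ⟨κ, hκ⟩
        refine ⟨(M.symm (w, -κ)).1, ?_⟩
        rw [← hM]
        have : M.symm (w, -κ) = ((M.symm (w, -κ)).1, 0) := by
          refine Prod.ext rfl ?_
          rw [hN w (-κ), Prod.snd_add, ← hDa, map_neg, hκ]; simp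
        rw [← this, LinearEquiv.apply_symm_apply]
      · rintro ⟨x, rfl⟩
        refine ⟨-(M (x, 0)).2, ?_⟩
        have h3 := congrArg M.symm (hMx x)
        rw [LinearEquiv.symm_apply_apply, hN] at h3
        have h4 := congrArg Prod.snd h3
        rw [map_neg, hDa, neg_eq_iff_add_eq_zero, add_comm]
        exact h4.symm
    exact ((Submodule.quotEquivOfEq _ _ hker.symm).trans
      (q.quotKerEquivOfSurjective hq)).finrank_eq
  have h3 := D.finrank_range_add_finrank_ker
  have h4 := (LinearMap.range D).finrank_quotient_add_finrank
  rw [fidx, h1, h2]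
  omega

theorem fidx_equiv (e : V ≃ₗ[k] V') (e' : W ≃ₗ[k] W') (T : V →ₗ[k] W) (T' : V' →ₗ[k] W')
    (h : ∀ x, T' (e x) = e' (T x)) : fidx T' = fidx T := by
  have h0 : T' = e'.toLinearMap ∘ₗ T ∘ₗ e.symm.toLinearMap := by
    ext x; simpa using h (e.symm x)
  have h1 : (LinearMap.ker T').map e.symm.toLinearMap = LinearMap.ker T := by
    ext x; simp [h0]
  have h2 : (LinearMap.range T).map e'.toLinearMap = LinearMap.range T' := by
    rw [h0, ← LinearMap.comp_assoc, LinearMap.range_comp_of_range_eq_top _ (LinearEquiv.range _),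
      LinearMap.range_comp]
  rw [fidx, fidx, ← h1, LinearEquiv.finrank_map_eq,
    (Submodule.Quotient.equiv _ _ e' h2).finrank_eq]

theorem fidx_prodMap (T : V →ₗ[k] W) (T' : V' →ₗ[k] W')
    [FiniteDimensional k (LinearMap.ker T)] [FiniteDimensional k (LinearMap.ker T')]
    [FiniteDimensional k (W ⧸ LinearMap.range T)] [FiniteDimensional k (W' ⧸ LinearMap.range T')] :
    fidx (T.prodMap T') = fidx T + fidx T' := by
  have h1 : Module.finrank k (LinearMap.ker (T.prodMap T')) =
      Module.finrank k (LinearMap.ker T) + Module.finrank k (LinearMap.ker T') := by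
    rw [LinearMap.ker_prodMap, ← Module.finrank_prod]
    exact LinearEquiv.finrank_eq
      { toFun := fun x => (⟨x.1.1, x.2.1⟩, ⟨x.1.2, x.2.2⟩)
        invFun := fun y => ⟨(y.1, y.2), y.1.2, y.2.2⟩
        map_add' := fun _ _ => rfl
        map_smul' := fun _ _ => rfl
        left_inv := fun _ => rfl
        right_inv := fun _ => rfl }
  have h2 : Module.finrank k ((W × W') ⧸ LinearMap.range (T.prodMap T')) =
      Module.finrank k (W ⧸ LinearMap.range T) + Module.finrank k (W' ⧸ LinearMap.range T') := by
    rw [← Module.finrank_prod]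
    let q := (LinearMap.range T).mkQ.prodMap (LinearMap.range T').mkQ
    have hq : Function.Surjective q :=
      (Submodule.mkQ_surjective _).prodMap (Submodule.mkQ_surjective _)
    have hk : LinearMap.ker q = LinearMap.range (T.prodMap T') := by
      rw [LinearMap.ker_prodMap, LinearMap.range_prodMap, Submodule.ker_mkQ, Submodule.ker_mkQ]
    exact ((Submodule.quotEquivOfEq _ _ hk.symm).trans
      (q.quotKerEquivOfSurjective hq)).finrank_eq
  rw [fidx, fidx, fidx, h1, h2]; push_cast; ring

end LinearAlgebra

/-- A finite dimensional complex vector space with a quaternionic structure has even dimension. -/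
theorem even_finrank_of_quaternionic {V : Type*} [AddCommGroup V] [Module ℂ V]
    (J : V →ₛₗ[starRingEnd ℂ] V) (hJ : ∀ v, J (J v) = -v) :
    Even (Module.finrank ℂ V) := by
  by_cases hfin : FiniteDimensional ℂ V
  swap
  · rw [Module.finrank_of_not_finite hfin]; exact Even.zero
  let b := Module.finBasis ℂ V
  set n := Module.finrank ℂ V
  let A : Matrix (Fin n) (Fin n) ℂ := Matrix.of fun i j => b.repr (J (b j)) i
  have hA : A * A.map (starRingEnd ℂ) = -1 := by
    ext i j
    have h1 : J (b j) = ∑ l, A l j • b l := by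
      conv_lhs => rw [← b.sum_repr (J (b j))]
      rfl
    have h2 : J (J (b j)) = ∑ l, (starRingEnd ℂ) (A l j) • J (b l) := by
      rw [h1, map_sum]; simp
    have h3 := congrArg (fun v => b.repr v i) h2
    simp only [hJ, map_neg, map_sum, map_smul, Finsupp.neg_apply, Finsupp.coe_finsetSum,
      Finset.sum_apply, Finsupp.smul_apply, smul_eq_mul, Module.Basis.repr_self] at h3
    rw [Matrix.mul_apply, Matrix.neg_apply, Matrix.one_apply]
    simp only [Matrix.map_apply]
    rw [Finsupp.single_apply] at h3
    rw [show (if i = j then (1:ℂ) else 0) = if j = i then 1 else 0 by simp [eq_comm], h3]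
    exact Finset.sum_congr rfl fun l _ => mul_comm _ _
  have h4 := congrArg Matrix.det hA
  rw [Matrix.det_mul, ← RingHom.mapMatrix_apply, ← RingHom.map_det, Complex.mul_conj,
    Matrix.det_neg, Matrix.det_one, mul_one, Fintype.card_fin] at h4
  by_contra hodd
  rw [Nat.not_even_iff_odd] at hodd
  rw [hodd.neg_one_pow] at h4
  have h5 := congrArg Complex.re h4
  simp at h5
  linarith [Complex.normSq_nonneg A.det]

section Compact

variable {E F G : Type*} [NormedAddCommGroup E] [NormedSpace ℂ E] [NormedAddCommGroup F]
  [NormedSpace ℂ F] [NormedAddCommGroup G] [NormedSpace ℂ G]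

theorem hasFiniteRange_comp_clm {R : E →L[ℂ] F} (hR : R.toLinearMap.HasFiniteRange)
    (S : F →L[ℂ] G) : (S ∘L R).toLinearMap.HasFiniteRange :=
  hR.comp_left S.toLinearMap

theorem hasFiniteRange_clm_comp {R : F →L[ℂ] G} (hR : R.toLinearMap.HasFiniteRange)
    (S : E →L[ℂ] F) : (R ∘L S).toLinearMap.HasFiniteRange :=
  hR.comp_right S.toLinearMap

/-- Norm limits of finite rank operators. -/
def Cpt (T : E →L[ℂ] F) : Prop :=
  ∀ ε : ℝ, 0 < ε → ∃ R : E →L[ℂ] F, R.toLinearMap.HasFiniteRange ∧ ‖T - R‖ < ε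

theorem Cpt.of_finiteRange {T : E →L[ℂ] F} (h : T.toLinearMap.HasFiniteRange) : Cpt T :=
  fun ε hε => ⟨T, h, by simpa using hε⟩

theorem Cpt.zero : Cpt (0 : E →L[ℂ] F) := Cpt.of_finiteRange (by simp)

theorem Cpt.of_approx {T : E →L[ℂ] F} (h : ∀ ε : ℝ, 0 < ε → ∃ R, Cpt R ∧ ‖T - R‖ < ε) : Cpt T := by
  intro ε hε
  obtain ⟨R, hR, h1⟩ := h (ε / 2) (by linarith)
  obtain ⟨S, hS, h2⟩ := hR (ε / 2) (by linarith)
  refine ⟨S, hS, ?_⟩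
  calc ‖T - S‖ = ‖(T - R) + (R - S)‖ := by congr 1; abel
    _ ≤ _ := norm_add_le _ _
    _ < ε := by linarith

theorem Cpt.add {T S : E →L[ℂ] F} (hT : Cpt T) (hS : Cpt S) : Cpt (T + S) := by
  intro ε hε
  obtain ⟨R, hR, h1⟩ := hT (ε / 2) (by linarith)
  obtain ⟨Q, hQ, h2⟩ := hS (ε / 2) (by linarith)
  refine ⟨R + Q, by simpa using hR.add hQ, ?_⟩
  calc ‖T + S - (R + Q)‖ = ‖(T - R) + (S - Q)‖ := by congr 1; abel
    _ ≤ _ := norm_add_le _ _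
    _ < ε := by linarith

theorem Cpt.clm_comp {T : E →L[ℂ] F} (hT : Cpt T) (S : F →L[ℂ] G) : Cpt (S ∘L T) := by
  intro ε hε
  obtain ⟨R, hR, h1⟩ := hT (ε / (‖S‖ + 1)) (by positivity)
  refine ⟨S ∘L R, hasFiniteRange_comp_clm hR _, ?_⟩
  rw [← ContinuousLinearMap.comp_sub]
  have h2 := S.opNorm_comp_le (T - R)
  have h3 : (‖S‖ + 1) * ‖T - R‖ < ε := by
    rw [lt_div_iff₀ (by positivity)] at h1; linarith
  nlinarith [norm_nonneg (T - R)]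

theorem Cpt.comp_clm {T : F →L[ℂ] G} (hT : Cpt T) (S : E →L[ℂ] F) : Cpt (T ∘L S) := by
  intro ε hε
  obtain ⟨R, hR, h1⟩ := hT (ε / (‖S‖ + 1)) (by positivity)
  refine ⟨R ∘L S, hasFiniteRange_clm_comp hR _, ?_⟩
  rw [← ContinuousLinearMap.sub_comp]
  have h2 := (T - R).opNorm_comp_le S
  have h3 : ‖T - R‖ * (‖S‖ + 1) < ε := by
    rw [lt_div_iff₀ (by positivity)] at h1; linarith
  nlinarith [norm_nonneg (T - R)]

theorem Cpt.neg {T : E →L[ℂ] F} (hT : Cpt T) : Cpt (-T) := by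
  have := hT.clm_comp (-ContinuousLinearMap.id ℂ F)
  convert this using 1
  ext x; simp

theorem Cpt.smul {T : E →L[ℂ] F} (hT : Cpt T) (c : ℂ) : Cpt (c • T) := by
  have := hT.clm_comp (c • ContinuousLinearMap.id ℂ F)
  convert this using 1
  ext x; simp

theorem Cpt.sub {T S : E →L[ℂ] F} (hT : Cpt T) (hS : Cpt S) : Cpt (T - S) := by
  rw [sub_eq_add_neg]; exact hT.add hS.neg

theorem Cpt.sum {ι : Type*} (s : Finset ι) {T : ι → E →L[ℂ] F} (h : ∀ i ∈ s, Cpt (T i)) :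
    Cpt (∑ i ∈ s, T i) := by
  classical
  induction s using Finset.induction_on with
  | empty => simpa using Cpt.zero
  | insert a s ha ih =>
    rw [Finset.sum_insert ha]
    exact (h a (by simp)).add (ih fun i hi => h i (by simp [hi]))

theorem Cpt.congr_right {T S : E →L[ℂ] F} (h : Cpt (T - S)) : Cpt T ↔ Cpt S :=
  ⟨fun hT => by simpa using hT.sub h, fun hS => by simpa using h.add hS⟩

variable [CompleteSpace E] [CompleteSpace F]

/-- Invertibility modulo compact operators. -/
def Fred (T : E →L[ℂ] F) : Prop :=
  ∃ S : F →L[ℂ] E, Cpt (S ∘L T - ContinuousLinearMap.id ℂ E) ∧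
    Cpt (T ∘L S - ContinuousLinearMap.id ℂ F)

theorem exists_finiteRange_left {T : E →L[ℂ] F} {S : F →L[ℂ] E}
    (h : Cpt (S ∘L T - ContinuousLinearMap.id ℂ E)) :
    ∃ L : F →L[ℂ] E, (L ∘L T - ContinuousLinearMap.id ℂ E).toLinearMap.HasFiniteRange := by
  obtain ⟨R, hR, h1⟩ := h 1 one_pos
  have hu := isUnit_one_sub_of_norm_lt_one
    (x := -(S ∘L T - ContinuousLinearMap.id ℂ E - R)) (by rwa [norm_neg])
  obtain ⟨u, hu⟩ := hu
  refine ⟨(u⁻¹ : (E →L[ℂ] E)ˣ).1 ∘L S, ?_⟩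
  have h2 : S ∘L T = u.1 + R := by
    rw [hu, ContinuousLinearMap.one_def]; abel
  have h3 : (u⁻¹ : (E →L[ℂ] E)ˣ).1 ∘L u.1 = ContinuousLinearMap.id ℂ E := u.inv_mul
  rw [ContinuousLinearMap.comp_assoc, h2, ContinuousLinearMap.comp_add, h3, add_sub_cancel_left]
  exact hasFiniteRange_comp_clm hR _

theorem exists_finiteRange_right {T : E →L[ℂ] F} {S : F →L[ℂ] E}
    (h : Cpt (T ∘L S - ContinuousLinearMap.id ℂ F)) :
    ∃ L : F →L[ℂ] E, (T ∘L L - ContinuousLinearMap.id ℂ F).toLinearMap.HasFiniteRange := by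
  obtain ⟨R, hR, h1⟩ := h 1 one_pos
  have hu := isUnit_one_sub_of_norm_lt_one
    (x := -(T ∘L S - ContinuousLinearMap.id ℂ F - R)) (by rwa [norm_neg])
  obtain ⟨u, hu⟩ := hu
  refine ⟨S ∘L (u⁻¹ : (F →L[ℂ] F)ˣ).1, ?_⟩
  have h2 : T ∘L S = u.1 + R := by
    rw [hu, ContinuousLinearMap.one_def]; abel
  have h3 : u.1 ∘L (u⁻¹ : (F →L[ℂ] F)ˣ).1 = ContinuousLinearMap.id ℂ F := u.mul_inv
  rw [← ContinuousLinearMap.comp_assoc, h2, ContinuousLinearMap.add_comp, h3, add_sub_cancel_left]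
  exact hasFiniteRange_clm_comp hR _

theorem Fred.isFredholm {T : E →L[ℂ] F} (h : Fred T) : T.IsFredholm := by
  obtain ⟨S, h1, h2⟩ := h
  obtain ⟨L, hL⟩ := exists_finiteRange_left h1
  obtain ⟨R, hR⟩ := exists_finiteRange_right h2
  refine ContinuousLinearMap.IsFredholm.of_isQuasiInverse (v := L) ⟨?_, ?_⟩
  · exact LinearMap.FiniteRangeSetoid.equiv_iff_hasFiniteRange.mpr hL
  · refine LinearMap.FiniteRangeSetoid.equiv_iff_hasFiniteRange.mpr ?_
    set A := L ∘L T - ContinuousLinearMap.id ℂ E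
    set B := T ∘L R - ContinuousLinearMap.id ℂ F
    have hLR : T ∘L L - ContinuousLinearMap.id ℂ F = B - T ∘L L ∘L B + T ∘L A ∘L R := by
      ext x; simp [A, B]; abel
    have h3 := ((hR.sub (hasFiniteRange_comp_clm (hasFiniteRange_comp_clm hR L) T)).add
      (hasFiniteRange_comp_clm (hasFiniteRange_clm_comp hL R) T))
    have h4 : (T ∘L L - ContinuousLinearMap.id ℂ F).toLinearMap =
      B.toLinearMap - (T ∘L L ∘L B).toLinearMap + (T ∘L A ∘L R).toLinearMap := by
      rw [hLR]; rfl
    rw [← h4] at h3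
    exact h3

theorem Fred.exists_border {T : E →L[ℂ] F} (h : Fred T) :
    ∃ (K : Submodule ℂ E) (C : Submodule ℂ F) (q : E →L[ℂ] K) (M : (E × C) ≃L[ℂ] (F × K)),
      FiniteDimensional ℂ K ∧ FiniteDimensional ℂ C ∧
      (M : (E × C) →L[ℂ] (F × K)) =
        (T ∘L ContinuousLinearMap.fst ℂ E C + C.subtypeL ∘L ContinuousLinearMap.snd ℂ E C).prod
          (q ∘L ContinuousLinearMap.fst ℂ E C) := by
  obtain ⟨pkg⟩ := h.isFredholm.nonempty_fredholmPackage
  let K := pkg.decDom.X₀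
  let C := pkg.decCodom.X₀
  let q : E →L[ℂ] K := K.projectionOntoL pkg.decDom.X₁ pkg.decDom.isTopCompl.symm
  let q' : F →L[ℂ] C := C.projectionOntoL pkg.decCodom.X₁ pkg.decCodom.isTopCompl.symm
  let A : (E × C) →L[ℂ] (F × K) :=
    (T ∘L ContinuousLinearMap.fst ℂ E C + C.subtypeL ∘L ContinuousLinearMap.snd ℂ E C).prod
          (q ∘L ContinuousLinearMap.fst ℂ E C)
  let B : (F × K) →L[ℂ] (E × C) :=
    (pkg.quasiInverse ∘L ContinuousLinearMap.fst ℂ F K +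
      K.subtypeL ∘L ContinuousLinearMap.snd ℂ F K).prod (q' ∘L ContinuousLinearMap.fst ℂ F K)
  have hT : ∀ x, T x = pkg.equiv (pkg.decDom.proj x) := fun x => by
    conv_lhs => rw [pkg.eq_equiv]
    rfl
  have hsum : ∀ x : E, (pkg.decDom.X₁.projection pkg.decDom.X₀ pkg.decDom.isTopCompl.isCompl) x + (q x : E) = x :=
    fun x => Submodule.projection_add_projection_eq_self pkg.decDom.isTopCompl.isCompl x
  have hsum' : ∀ x : F, (pkg.decCodom.X₁.projection pkg.decCodom.X₀ pkg.decCodom.isTopCompl.isCompl) x +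
      (q' x : F) = x :=
    fun x => Submodule.projection_add_projection_eq_self pkg.decCodom.isTopCompl.isCompl x
  refine ⟨K, C, q, ContinuousLinearEquiv.equivOfInverse A B ?_ ?_, pkg.decDom.finite_X₀,
    pkg.decCodom.finite_X₀, rfl⟩
  · rintro ⟨x, c⟩
    simp only [A, B, ContinuousLinearMap.FredholmPackage.quasiInverse, hT]
    have h1 := Submodule.projectionOntoL_apply_left pkg.decCodom.isTopCompl
    have h2 := Submodule.projectionOntoL_apply_right pkg.decCodom.isTopCompl
    have h3 := Submodule.projectionOntoL_apply_left pkg.decCodom.isTopCompl.symm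
    have h4 := Submodule.projectionOntoL_apply_right pkg.decCodom.isTopCompl.symm
    refine Prod.ext ?_ ?_
    · simp [hT, h1, h2, C, hsum]
    · simp [hT, h3, h4, C, q']
  · rintro ⟨w, κ⟩
    have h1 := Submodule.projectionOntoL_apply_left pkg.decDom.isTopCompl
    have h2 := Submodule.projectionOntoL_apply_right pkg.decDom.isTopCompl
    have h3 := Submodule.projectionOntoL_apply_left pkg.decDom.isTopCompl.symm
    have h4 := Submodule.projectionOntoL_apply_right pkg.decDom.isTopCompl.symm
    refine Prod.ext ?_ ?_
    · simp [A, B, ContinuousLinearMap.FredholmPackage.quasiInverse, hT, h1, h2, K, hsum']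
    · simp [A, B, ContinuousLinearMap.FredholmPackage.quasiInverse, h3, h4, K, q]

theorem Fred.fidx_eventually {T : E →L[ℂ] F} (h : Fred T) :
    ∀ᶠ S in nhds T, fidx (S : E →L[ℂ] F).toLinearMap = fidx T.toLinearMap := by
  obtain ⟨K, C, q, M, hK, hC, hM⟩ := h.exists_border
  let B : (E →L[ℂ] F) → ((E × C) →L[ℂ] (F × K)) := fun S =>
    (S ∘L ContinuousLinearMap.fst ℂ E C + C.subtypeL ∘L ContinuousLinearMap.snd ℂ E C).prod
          (q ∘L ContinuousLinearMap.fst ℂ E C)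
  have hB : Continuous B := by
    have h1 : Continuous fun S : E →L[ℂ] F => S ∘L ContinuousLinearMap.fst ℂ E C + C.subtypeL ∘L ContinuousLinearMap.snd ℂ E C := by
      fun_prop
    exact (ContinuousLinearMap.prodₗᵢ ℂ (E := E × C) (F := F) (G := K)).continuous.comp (h1.prodMk continuous_const)
  have key : ∀ S, B S ∈ Set.range ((↑) : ((E × C) ≃L[ℂ] (F × K)) → _) →
      fidx (S : E →L[ℂ] F).toLinearMap =
        (Module.finrank ℂ K : ℤ) - Module.finrank ℂ C := by
    rintro S ⟨N, hN⟩
    refine fidx_border S.toLinearMap N.toLinearEquiv fun x => ?_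
    have := congrArg (fun A => (A (x, 0)).1) hN
    simpa [B] using this
  have hopen := (ContinuousLinearEquiv.isOpen (𝕜 := ℂ) (E := E × C) (F := F × K)).preimage hB
  have hT : T ∈ B ⁻¹' Set.range ((↑) : ((E × C) ≃L[ℂ] (F × K)) → _) := ⟨M, hM⟩
  filter_upwards [hopen.mem_nhds hT] with S hS
  rw [key S hS, key T hT]

end Compact

section Ceq

variable {E F G : Type*} [NormedAddCommGroup E] [NormedSpace ℂ E] [NormedAddCommGroup F]
  [NormedSpace ℂ F] [NormedAddCommGroup G] [NormedSpace ℂ G]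

/-- Equality modulo compact operators. -/
def Ceq (T S : E →L[ℂ] F) : Prop := Cpt (T - S)

theorem Ceq.of_eq {T S : E →L[ℂ] F} (h : T = S) : Ceq T S := by
  subst h; rw [Ceq, sub_self]; exact Cpt.zero

theorem Ceq.refl (T : E →L[ℂ] F) : Ceq T T := Ceq.of_eq rfl

theorem Ceq.symm {T S : E →L[ℂ] F} (h : Ceq T S) : Ceq S T := by
  have := Cpt.neg h; rwa [neg_sub] at this

theorem Ceq.trans {T S R : E →L[ℂ] F} (h : Ceq T S) (h' : Ceq S R) : Ceq T R := by
  have := Cpt.add h h'; rwa [sub_add_sub_cancel] at this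

instance : Trans (Ceq (E := E) (F := F)) Ceq Ceq := ⟨Ceq.trans⟩

theorem Ceq.clm_comp {T S : E →L[ℂ] F} (h : Ceq T S) (R : F →L[ℂ] G) :
    Ceq (R ∘L T) (R ∘L S) := by
  have := Cpt.clm_comp h R; rwa [ContinuousLinearMap.comp_sub] at this

theorem Ceq.comp_clm {T S : F →L[ℂ] G} (h : Ceq T S) (R : E →L[ℂ] F) :
    Ceq (T ∘L R) (S ∘L R) := by
  have := Cpt.comp_clm h R; rwa [ContinuousLinearMap.sub_comp] at this

theorem Ceq.add {T S T' S' : E →L[ℂ] F} (h : Ceq T S) (h' : Ceq T' S') :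
    Ceq (T + T') (S + S') := by
  have := Cpt.add h h'; rwa [← add_sub_add_comm] at this

theorem Ceq.sum {ι : Type*} (s : Finset ι) {T S : ι → E →L[ℂ] F} (h : ∀ i ∈ s, Ceq (T i) (S i)) :
    Ceq (∑ i ∈ s, T i) (∑ i ∈ s, S i) := by
  rw [Ceq, ← Finset.sum_sub_distrib]; exact Cpt.sum s h

theorem Ceq.smul {T S : E →L[ℂ] F} (h : Ceq T S) (c : ℂ) : Ceq (c • T) (c • S) := by
  have := Cpt.smul h c; rwa [smul_sub] at this

theorem ceq_zero_iff {T : E →L[ℂ] F} : Ceq T 0 ↔ Cpt T := by rw [Ceq, sub_zero]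

end Ceq

section Banach

variable {E F : Type*} [NormedAddCommGroup E] [NormedSpace ℂ E] [NormedAddCommGroup F]
  [NormedSpace ℂ F] [CompleteSpace E] [CompleteSpace F]

theorem Fred.congr {T S : E →L[ℂ] F} (h : Fred T) (hS : Ceq S T) : Fred S := by
  obtain ⟨R, h1, h2⟩ := h
  exact ⟨R, (hS.clm_comp R).trans h1, (hS.comp_clm R).trans h2⟩

theorem fidx_path {T : ℝ → E →L[ℂ] F} (hc : ContinuousOn T (Icc 0 1))
    (hT : ∀ t ∈ Icc (0:ℝ) 1, Fred (T t)) :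
    fidx (T 0).toLinearMap = fidx (T 1).toLinearMap := by
  refine isPreconnected_Icc.constant (f := fun t => fidx (T t).toLinearMap) ?_
    (by simp : (0:ℝ) ∈ Icc (0:ℝ) 1) (by simp)
  intro t ht
  refine tendsto_const_nhds.congr' ?_
  filter_upwards [(hc t ht).eventually (hT t ht).fidx_eventually] with s hs using hs.symm

theorem Fred.fidx_congr {T S : E →L[ℂ] F} (h : Fred T) (hS : Ceq S T) :
    fidx S.toLinearMap = fidx T.toLinearMap := by
  have := fidx_path (T := fun t : ℝ => S + (t : ℂ) • (T - S)) (by fun_prop) fun t _ => by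
    refine h.congr ?_
    rw [Ceq, show S + (t : ℂ) • (T - S) - T = ((t : ℂ) - 1) • (T - S) by
      rw [sub_smul, one_smul]; abel]
    exact Cpt.smul hS.symm _
  simpa using this

end Banach

section Hilbert

variable {E F : Type*} [NormedAddCommGroup E] [InnerProductSpace ℂ E] [NormedAddCommGroup F]
  [InnerProductSpace ℂ F] [CompleteSpace E] [CompleteSpace F]

open ContinuousLinearMap in
theorem hasFiniteRange_adjoint {R : E →L[ℂ] F} (hR : R.toLinearMap.HasFiniteRange) :
    (adjoint R).toLinearMap.HasFiniteRange := by
  have hK : FiniteDimensional ℂ R.toLinearMap.range := Module.Finite.iff_fg.mpr hR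
  have : (adjoint R).toLinearMap.range = (R.toLinearMap.range).map (adjoint R).toLinearMap := by
    apply le_antisymm
    · rintro _ ⟨y, rfl⟩
      obtain ⟨p, hp, q, hq, rfl⟩ := (R.toLinearMap.range).exists_add_mem_mem_orthogonal y
      refine ⟨p, hp, ?_⟩
      rw [ContinuousLinearMap.orthogonal_range] at hq
      have hq' : adjoint R q = 0 := hq
      simp [hq']
    · rintro _ ⟨y, _, rfl⟩
      exact ⟨y, rfl⟩
  rw [LinearMap.HasFiniteRange, this]
  exact Submodule.FG.map _ hR

open ContinuousLinearMap in
theorem Cpt.adjoint {T : E →L[ℂ] F} (h : Cpt T) : Cpt (adjoint T) := by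
  intro ε hε
  obtain ⟨R, hR, h1⟩ := h ε hε
  refine ⟨ContinuousLinearMap.adjoint R, hasFiniteRange_adjoint hR, ?_⟩
  rwa [← map_sub, LinearIsometryEquiv.norm_map]

open ContinuousLinearMap in
theorem Ceq.adjoint {T S : E →L[ℂ] F} (h : Ceq T S) : Ceq (adjoint T) (adjoint S) := by
  have := Cpt.adjoint h; rwa [map_sub] at this

open ContinuousLinearMap in
theorem Fred.adjoint {T : E →L[ℂ] F} (h : Fred T) : Fred (adjoint T) := by
  obtain ⟨S, h1, h2⟩ := h
  refine ⟨ContinuousLinearMap.adjoint S, ?_, ?_⟩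
  · have := h2.adjoint
    rwa [map_sub, adjoint_comp, adjoint_id] at this
  · have := h1.adjoint
    rwa [map_sub, adjoint_comp, adjoint_id] at this

open ContinuousLinearMap in
theorem Fred.finrank_coker {T : E →L[ℂ] F} (h : Fred T) :
    Module.finrank ℂ (F ⧸ T.toLinearMap.range) =
      Module.finrank ℂ (ContinuousLinearMap.adjoint T).toLinearMap.ker := by
  have hc : IsClosed (T.toLinearMap.range : Set F) := h.isFredholm.isClosed_range
  have : CompleteSpace T.toLinearMap.range := hc.completeSpace_coe
  rw [← ContinuousLinearMap.orthogonal_range]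
  exact (Submodule.quotientEquivOfIsCompl _ _
    (Submodule.isCompl_orthogonal _)).finrank_eq

theorem Fred.fidx_eq {T : E →L[ℂ] F} (h : Fred T) :
    fidx T.toLinearMap = (Module.finrank ℂ T.toLinearMap.ker : ℤ) -
      Module.finrank ℂ (ContinuousLinearMap.adjoint T).toLinearMap.ker := by
  rw [fidx, h.finrank_coker]

theorem Fred.fidx_adjoint {T : E →L[ℂ] F} (h : Fred T) :
    fidx (ContinuousLinearMap.adjoint T).toLinearMap = - fidx T.toLinearMap := by
  rw [h.fidx_eq, h.adjoint.fidx_eq, ContinuousLinearMap.adjoint_adjoint]; ring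

end Hilbert

/-- The Hilbert space `ℓ²(X)`. -/
abbrev L2 (X : Type) := lp (fun _ : X => ℂ) 2

section Shortcuts

variable (X Y : Type)

instance : NormedAddCommGroup (L2 X) := inferInstance
instance : SeminormedAddCommGroup (L2 X) := inferInstance
instance : InnerProductSpace ℂ (L2 X) := inferInstance
instance : NormedSpace ℂ (L2 X) := inferInstance
instance : Module ℂ (L2 X) := inferInstance
instance : AddCommGroup (L2 X) := inferInstance
instance : AddCommMonoid (L2 X) := inferInstance
instance : TopologicalSpace (L2 X) := inferInstance
instance : IsTopologicalAddGroup (L2 X) := inferInstance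
instance : CompleteSpace (L2 X) := inferInstance
instance : NormedAddCommGroup (L2 X →L[ℂ] L2 Y) := inferInstance
instance : SeminormedAddCommGroup (L2 X →L[ℂ] L2 Y) := inferInstance
instance : NormedSpace ℂ (L2 X →L[ℂ] L2 Y) := inferInstance
instance : Module ℂ (L2 X →L[ℂ] L2 Y) := inferInstance
instance : AddCommGroup (L2 X →L[ℂ] L2 Y) := inferInstance
instance : AddCommMonoid (L2 X →L[ℂ] L2 Y) := inferInstance
instance : TopologicalSpace (L2 X →L[ℂ] L2 Y) := inferInstance
instance : Zero (L2 X →L[ℂ] L2 Y) := inferInstance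
instance : Add (L2 X →L[ℂ] L2 Y) := inferInstance
instance : Sub (L2 X →L[ℂ] L2 Y) := inferInstance
instance : Neg (L2 X →L[ℂ] L2 Y) := inferInstance
instance : SMul ℂ (L2 X →L[ℂ] L2 Y) := inferInstance

end Shortcuts

section EllTwo

variable {X Y Z : Type}

theorem L2.summable_sq (x : L2 X) : Summable fun i => ‖x i‖ ^ (2:ENNReal).toReal :=
  (memℓp_gen_iff (by norm_num)).1 (lp.memℓp x)

/-- Restriction along an injection. -/
def Rs (φ : X ↪ Y) : L2 Y →L[ℂ] L2 X :=
  LinearMap.mkContinuous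
    { toFun := fun y => ⟨fun i => y (φ i),
        (memℓp_gen_iff (by norm_num)).2 ((L2.summable_sq y).comp_injective φ.injective)⟩
      map_add' := fun _ _ => rfl
      map_smul' := fun _ _ => rfl } 1 (fun y => by
      rw [one_mul]
      refine lp.norm_le_of_tsum_le (by norm_num) (norm_nonneg _) ?_
      rw [lp.norm_rpow_eq_tsum (by norm_num)]
      exact tsum_comp_le_tsum_of_inj (L2.summable_sq y) (fun i => by positivity) φ.injective)

@[simp] theorem Rs_apply (φ : X ↪ Y) (y : L2 Y) (i : X) : Rs φ y i = y (φ i) := rfl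

/-- Extension by zero along an injection. -/
def Is (φ : X ↪ Y) : L2 X →L[ℂ] L2 Y := ContinuousLinearMap.adjoint (Rs φ)

open Classical in
/-- The standard basis of `ℓ²(X)`. -/
def del (i : X) : L2 X := lp.single 2 i 1

open Classical in
theorem del_apply (i j : X) : (del i : L2 X) j = if j = i then 1 else 0 := by
  simp [del, Pi.single_apply]

theorem inner_del (i : X) (x : L2 X) : inner ℂ (del i) x = x i := by
  classical
  simp [del, lp.inner_single_left]

theorem adjoint_Rs (φ : X ↪ Y) : ContinuousLinearMap.adjoint (Rs φ) = Is φ := rfl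
theorem adjoint_Is (φ : X ↪ Y) : ContinuousLinearMap.adjoint (Is φ) = Rs φ :=
  ContinuousLinearMap.adjoint_adjoint _

theorem Is_apply_eq (φ : X ↪ Y) (x : L2 X) (j : Y) : Is φ x j = inner ℂ (Rs φ (del j)) x := by
  rw [← inner_del, Is, ContinuousLinearMap.adjoint_inner_right]

theorem Is_apply (φ : X ↪ Y) (x : L2 X) (i : X) : Is φ x (φ i) = x i := by
  rw [Is_apply_eq, show Rs φ (del (φ i)) = del i by ext k; by_cases h : k = i <;> simp [del_apply, φ.injective.eq_iff, h], inner_del]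

theorem Is_apply_of_notMem (φ : X ↪ Y) (x : L2 X) (j : Y) (h : ∀ i, φ i ≠ j) : Is φ x j = 0 := by
  rw [Is_apply_eq, show Rs φ (del j) = 0 by ext k; simp [del_apply, h], inner_zero_left]

@[simp] theorem Rs_Is (φ : X ↪ Y) (x : L2 X) : Rs φ (Is φ x) = x := by
  ext i; simp [Is_apply]

theorem Rs_comp_Is (φ : X ↪ Y) : Rs φ ∘L Is φ = ContinuousLinearMap.id ℂ _ := by
  ext1 x; simp

@[simp] theorem Is_del (φ : X ↪ Y) (i : X) : Is φ (del i) = del (φ i) := by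
  ext j
  by_cases h : ∃ k, φ k = j
  · obtain ⟨k, rfl⟩ := h
    by_cases h : k = i <;> simp [Is_apply, del_apply, φ.injective.eq_iff, h]
  · push Not at h
    rw [Is_apply_of_notMem _ _ _ h, del_apply, if_neg (fun h' => h i h'.symm)]

theorem Rs_del_of (φ : X ↪ Y) (i : X) : Rs φ (del (φ i)) = del i := by
  rw [← Is_del, Rs_Is]

theorem Rs_del_of_notMem (φ : X ↪ Y) (j : Y) (h : ∀ i, φ i ≠ j) : Rs φ (del j) = 0 := by
  ext k; simp [del_apply, h]

theorem clm_ext_del {E : Type*} [NormedAddCommGroup E] [NormedSpace ℂ E] {T S : L2 X →L[ℂ] E}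
    (h : ∀ i, T (del i) = S (del i)) : T = S := by
  classical
  ext1 x
  have hx := lp.hasSum_single (p := 2) (by norm_num) x
  have h1 := hx.mapL T
  have h2 := hx.mapL S
  have hs : ∀ i, lp.single 2 i (x i) = x i • (del i : L2 X) := fun i => by
    rw [del, ← lp.single_smul]; simp
  simp only [hs, map_smul, h] at h1 h2
  exact h1.unique h2

/-- The inclusion of a subset. -/
def incl (A : Set X) : A ↪ X := ⟨Subtype.val, Subtype.val_injective⟩

theorem incl_apply (A : Set X) (i : A) : incl A i = i := rfl

/-- The coordinate projection onto a subset. -/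
def Pr (A : Set X) : L2 X →L[ℂ] L2 X :=
  Is (incl A) ∘L Rs (incl A)

open Classical in
theorem Pr_apply (A : Set X) (x : L2 X) (i : X) : Pr A x i = if i ∈ A then x i else 0 := by
  split_ifs with h
  · have h1 := Is_apply (incl A) (Rs (incl A) x) ⟨i, h⟩
    rw [Rs_apply, incl_apply] at h1
    rw [Pr, ContinuousLinearMap.comp_apply, h1]
  · rw [Pr, ContinuousLinearMap.comp_apply]
    refine Is_apply_of_notMem _ _ _ ?_
    rintro ⟨j, hj⟩ rfl
    exact h hj

open Classical in
theorem Pr_del (A : Set X) (i : X) : Pr A (del i) = if i ∈ A then del i else 0 := by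
  ext j
  rw [Pr_apply, del_apply]
  by_cases h : j = i
  · subst h; by_cases h2 : j ∈ A <;> simp [h2, del_apply]
  · by_cases h2 : i ∈ A <;> simp [h, h2, del_apply]

theorem adjoint_Pr (A : Set X) : ContinuousLinearMap.adjoint (Pr A) = Pr A := by
  rw [Pr, ContinuousLinearMap.adjoint_comp, adjoint_Is, adjoint_Rs]

theorem Pr_comp_Pr (A B : Set X) : Pr A ∘L Pr B = Pr (A ∩ B) := by
  refine clm_ext_del fun i => ?_
  simp only [ContinuousLinearMap.comp_apply, Pr_del]
  by_cases h1 : i ∈ A <;> by_cases h2 : i ∈ B <;> simp [h1, h2, Pr_del]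

theorem Pr_add_Pr {A B : Set X} (h : Disjoint A B) : Pr A + Pr B = Pr (A ∪ B) := by
  refine clm_ext_del fun i => ?_
  simp only [add_apply, Pr_del]
  by_cases h1 : i ∈ A
  · simp [h1, Set.disjoint_left.1 h h1]
  · by_cases h2 : i ∈ B <;> simp [h1, h2]

theorem Pr_empty : Pr (∅ : Set X) = 0 := by
  refine clm_ext_del fun i => ?_
  simp [Pr_del]

theorem Pr_univ : Pr (univ : Set X) = ContinuousLinearMap.id ℂ _ := by
  refine clm_ext_del fun i => ?_
  simp [Pr_del]

theorem Pr_image (φ : X ↪ Y) (A : Set X) : Pr (φ '' A) = Is φ ∘L Pr A ∘L Rs φ := by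
  refine clm_ext_del fun j => ?_
  by_cases h : ∃ k, φ k = j
  · obtain ⟨k, rfl⟩ := h
    simp only [ContinuousLinearMap.comp_apply, Pr_del, Rs_del_of]
    by_cases hk : k ∈ A <;> simp [hk]
  · push Not at h
    simp only [ContinuousLinearMap.comp_apply, Pr_del]
    rw [Rs_del_of_notMem _ _ h, if_neg (by rintro ⟨k, _, hk⟩; exact h k hk)]
    simp

end EllTwo

theorem clm_comp_assoc {E F G H : Type*} [NormedAddCommGroup E] [NormedSpace ℂ E] [NormedAddCommGroup F]
    [NormedSpace ℂ F] [NormedAddCommGroup G] [NormedSpace ℂ G] [NormedAddCommGroup H] [NormedSpace ℂ H]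
    (R : G →L[ℂ] H) (S : F →L[ℂ] G) (T : E →L[ℂ] F) : (R ∘L S) ∘L T = R ∘L (S ∘L T) := by
  ext x; rfl

section Blocks

variable {X Y Z : Type}

theorem Rs_Pr {A B : Set X} (h : A ⊆ B) : Rs (incl A) ∘L Pr B = Rs (incl A) := by
  ext x i
  simp [Pr_apply, incl_apply, h i.2]

theorem Pr_Is {A B : Set X} (h : A ⊆ B) : Pr B ∘L Is (incl A) = Is (incl A) := by
  have := congrArg ContinuousLinearMap.adjoint (Rs_Pr h)
  rwa [ContinuousLinearMap.adjoint_comp, adjoint_Pr, adjoint_Rs] at this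

theorem Rs_Is_of_disjoint {A B : Set X} (h : Disjoint A B) : Rs (incl A) ∘L Is (incl B) = 0 := by
  ext x i
  simp only [ContinuousLinearMap.comp_apply, Rs_apply]
  rw [Is_apply_of_notMem]
  · rfl
  · rintro j hj
    exact Set.disjoint_left.1 h i.2 (by rw [incl_apply, incl_apply] at hj; rw [← hj]; exact j.2)

/-- The block of an operator from `ℓ²(A)` to `ℓ²(B)`. -/
def blk (T : L2 X →L[ℂ] L2 X) (A B : Set X) : L2 A →L[ℂ] L2 B := Rs (incl B) ∘L T ∘L Is (incl A)

theorem blk_congr {T T' : L2 X →L[ℂ] L2 X} {A B : Set X} (h : Ceq (T ∘L Pr A) (T' ∘L Pr A)) :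
    Ceq (blk T A B) (blk T' A B) := by
  have := (h.comp_clm (Is (incl A))).clm_comp (Rs (incl B))
  rwa [clm_comp_assoc, clm_comp_assoc, Pr_Is le_rfl] at this

theorem blk_fred {T : L2 X →L[ℂ] L2 X} {A B : Set X} (h1 : Ceq (T ∘L Pr A) (Pr B ∘L T ∘L Pr A))
    (h2 : Ceq (T ∘L Pr B) (Pr A ∘L T ∘L Pr B)) (i1 : Ceq (T ∘L T ∘L Pr A) (Pr A))
    (i2 : Ceq (T ∘L T ∘L Pr B) (Pr B)) : Fred (blk T A B) := by
  have key : ∀ {A B : Set X}, Ceq (T ∘L Pr A) (Pr B ∘L T ∘L Pr A) →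
      Ceq (T ∘L T ∘L Pr A) (Pr A) →
      Ceq (blk T B A ∘L blk T A B) (ContinuousLinearMap.id ℂ _) := by
    intro A B h1 i1
    have e : blk T B A ∘L blk T A B = Rs (incl A) ∘L T ∘L (Pr B ∘L T ∘L Pr A) ∘L Is (incl A) := by
      simp only [blk, clm_comp_assoc, Pr_Is le_rfl]
      simp only [Pr, clm_comp_assoc]
    rw [e]
    refine Ceq.trans (((h1.symm.comp_clm _).clm_comp T).clm_comp _) ?_
    have := (i1.comp_clm (Is (incl A))).clm_comp (Rs (incl A))
    rw [Pr_Is le_rfl, Rs_comp_Is] at this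
    exact this
  exact ⟨blk T B A, key h1 i1, key h2 i2⟩

theorem adjoint_blk {T : L2 X →L[ℂ] L2 X} (hT : ContinuousLinearMap.adjoint T = T) (A B : Set X) :
    ContinuousLinearMap.adjoint (blk T A B) = blk T B A := by
  rw [blk, ContinuousLinearMap.adjoint_comp, ContinuousLinearMap.adjoint_comp, hT, adjoint_Is,
    adjoint_Rs, blk, clm_comp_assoc]

/-- Splitting `ℓ²` of a disjoint union. -/
def splitEquiv {A B C : Set X} (h : Disjoint A B) (hC : C = A ∪ B) :
    L2 C ≃ₗ[ℂ] L2 A × L2 B :=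
  LinearEquiv.ofLinear
    ((Rs (incl A) ∘L Is (incl C)).toLinearMap.prod (Rs (incl B) ∘L Is (incl C)).toLinearMap)
    ((Rs (incl C) ∘L Is (incl A)).toLinearMap.coprod (Rs (incl C) ∘L Is (incl B)).toLinearMap)
    (by
      have hA : A ⊆ C := hC ▸ subset_union_left
      have hB : B ⊆ C := hC ▸ subset_union_right
      have e1 : ∀ x, Is (incl C) (Rs (incl C) (Is (incl A) x)) = Is (incl A) x := fun x =>
        congrArg (fun T => T x) (Pr_Is hA)
      have e2 : ∀ x, Is (incl C) (Rs (incl C) (Is (incl B) x)) = Is (incl B) x := fun x =>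
        congrArg (fun T => T x) (Pr_Is hB)
      have e3 : ∀ x, Rs (incl A) (Is (incl B) x) = 0 := fun x =>
        congrArg (fun T => T x) (Rs_Is_of_disjoint h)
      have e4 : ∀ x, Rs (incl B) (Is (incl A) x) = 0 := fun x =>
        congrArg (fun T => T x) (Rs_Is_of_disjoint h.symm)
      refine LinearMap.ext ?_
      rintro ⟨x, y⟩
      simp [e1, e2, e3, e4])
    (by
      refine LinearMap.ext fun x => ?_
      have := congrArg (fun T => Rs (incl C) (T (Is (incl C) x))) (Pr_add_Pr h)
      simp only [← hC, add_apply, map_add] at this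
      have e := congrArg (fun T => T (Is (incl C) x)) (Rs_Pr (le_refl C))
      simp only [ContinuousLinearMap.comp_apply, Rs_Is] at e
      rw [e] at this
      exact this)

theorem splitEquiv_symm_apply {A B C : Set X} (h : Disjoint A B) (hC : C = A ∪ B)
    (x : L2 A × L2 B) : (splitEquiv h hC).symm x =
      Rs (incl C) (Is (incl A) x.1 + Is (incl B) x.2) := by
  rw [map_add]; rfl

theorem fidx_blk_union {T : L2 X →L[ℂ] L2 X} {A A₁ A₂ B B₁ B₂ : Set X} (hA : A = A₁ ∪ A₂)
    (hB : B = B₁ ∪ B₂) (dA : Disjoint A₁ A₂) (dB : Disjoint B₁ B₂)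
    (h1 : Ceq (Pr B₁ ∘L T ∘L Pr A₂) 0) (h2 : Ceq (Pr B₂ ∘L T ∘L Pr A₁) 0)
    (f1 : Fred (blk T A₁ B₁)) (f2 : Fred (blk T A₂ B₂)) (f : Fred (blk T A B)) :
    fidx (blk T A B).toLinearMap =
      fidx (blk T A₁ B₁).toLinearMap + fidx (blk T A₂ B₂).toLinearMap := by
  set T₀ := Pr B₁ ∘L T ∘L Pr A₁ + Pr B₂ ∘L T ∘L Pr A₂
  have e1 : Ceq (blk T₀ A B) (blk T A B) := by
    have hB' : Rs (incl B) = Rs (incl B) ∘L (Pr B₁ + Pr B₂) := by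
      rw [Pr_add_Pr dB, ← hB, Rs_Pr le_rfl]
    have hA' : Is (incl A) = (Pr A₁ + Pr A₂) ∘L Is (incl A) := by
      rw [Pr_add_Pr dA, ← hA, Pr_Is le_rfl]
    have e : blk T A B = Rs (incl B) ∘L (T₀ + (Pr B₁ ∘L T ∘L Pr A₂ + Pr B₂ ∘L T ∘L Pr A₁)) ∘L
        Is (incl A) := by
      rw [blk, hB', hA']
      conv_rhs => rw [← hB', ← hA']
      simp only [T₀, ContinuousLinearMap.comp_add, ContinuousLinearMap.add_comp,
        clm_comp_assoc]
      abel
    rw [e, blk]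
    refine Ceq.symm (Ceq.clm_comp (Ceq.comp_clm ?_ _) _)
    have := (Ceq.refl T₀).add (h1.add h2)
    simpa using this
  rw [← f.fidx_congr e1]
  have := f1.isFredholm.finite_ker
  have := f2.isFredholm.finite_ker
  have := f1.isFredholm.finite_coker
  have := f2.isFredholm.finite_coker
  have t1 : FiniteDimensional ℂ (L2 B₁ ⧸ (blk T A₁ B₁).toLinearMap.range) :=
    f1.isFredholm.finite_coker
  have t2 : FiniteDimensional ℂ (L2 B₂ ⧸ (blk T A₂ B₂).toLinearMap.range) :=
    f2.isFredholm.finite_coker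
  rw [← fidx_prodMap]
  refine fidx_equiv (splitEquiv dA hA).symm (splitEquiv dB hB).symm _ _ ?_
  rintro ⟨x, y⟩
  rw [splitEquiv_symm_apply, splitEquiv_symm_apply]
  have hAA : Is (incl A) (Rs (incl A) (Is (incl A₁) x + Is (incl A₂) y)) =
      Is (incl A₁) x + Is (incl A₂) y := by
    rw [map_add, map_add]
    congr 1
    · exact congrArg (fun T => T x) (Pr_Is (hA ▸ subset_union_left))
    · exact congrArg (fun T => T y) (Pr_Is (hA ▸ subset_union_right))
  have p1 : Pr A₁ (Is (incl A₁) x + Is (incl A₂) y) = Is (incl A₁) x := by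
    rw [map_add, Pr, ContinuousLinearMap.comp_apply, ContinuousLinearMap.comp_apply, Rs_Is]
    have := congrArg (fun T => T y) (Rs_Is_of_disjoint dA)
    simp only [ContinuousLinearMap.comp_apply] at this
    rw [this]; simp
  have p2 : Pr A₂ (Is (incl A₁) x + Is (incl A₂) y) = Is (incl A₂) y := by
    rw [map_add, Pr, ContinuousLinearMap.comp_apply, ContinuousLinearMap.comp_apply, Rs_Is]
    have := congrArg (fun T => T x) (Rs_Is_of_disjoint dA.symm)
    simp only [ContinuousLinearMap.comp_apply] at this
    rw [this]; simp
  change Rs (incl B) (T₀ (Is (incl A) (Rs (incl A) _))) = _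
  rw [hAA]
  simp only [T₀, add_apply, ContinuousLinearMap.comp_apply, p1, p2]
  rfl

/-- `ℓ²` of an image. -/
def imageEquiv (φ : Y ↪ X) (A : Set Y) : L2 A ≃ₗ[ℂ] L2 (φ '' A) :=
  LinearEquiv.ofLinear (Rs (incl (φ '' A)) ∘L Is φ ∘L Is (incl A)).toLinearMap
    (Rs (incl A) ∘L Rs φ ∘L Is (incl (φ '' A))).toLinearMap
    (by
      refine LinearMap.ext fun x => ?_
      have h := congrArg (fun T => Rs (incl (φ '' A)) (T (Is (incl (φ '' A)) x))) (Pr_image φ A)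
      have e := congrArg (fun T => T (Is (incl (φ '' A)) x)) (Rs_Pr (le_refl (φ '' A)))
      simp only [ContinuousLinearMap.comp_apply, Rs_Is] at e h
      rw [e] at h
      exact h.symm)
    (by
      refine LinearMap.ext fun x => ?_
      have h := congrArg (fun T => Rs (incl A) (Rs φ (T (Is φ (Is (incl A) x))))) (Pr_image φ A)
      have e := congrArg (fun T => T x) (Pr_Is (le_refl A))
      simp only [ContinuousLinearMap.comp_apply, Rs_Is] at e h
      rw [e, Rs_Is] at h
      exact h)

theorem Pr_image_Is (φ : Y ↪ X) (A : Set Y) (x : L2 A) :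
    Pr (φ '' A) (Is φ (Is (incl A) x)) = Is φ (Is (incl A) x) := by
  have e := congrArg (fun T => T x) (Pr_Is (le_refl A))
  simp only [ContinuousLinearMap.comp_apply] at e
  simp [Pr_image, e]

theorem Rs_Pr_image (φ : Y ↪ X) (A : Set Y) (x : L2 X) :
    Rs (incl A) (Rs φ (Pr (φ '' A) x)) = Rs (incl A) (Rs φ x) := by
  have e := congrArg (fun T => T (Rs φ x)) (Rs_Pr (le_refl A))
  simp only [ContinuousLinearMap.comp_apply] at e
  simp [Pr_image, e]

theorem fidx_blk_image (φ : Y ↪ X) (T : L2 X →L[ℂ] L2 X) (A B : Set Y) :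
    fidx (blk T (φ '' A) (φ '' B)).toLinearMap =
      fidx (blk (Rs φ ∘L T ∘L Is φ) A B).toLinearMap := by
  refine fidx_equiv (imageEquiv φ A) (imageEquiv φ B) _ _ fun x => ?_
  apply (imageEquiv φ B).symm.injective
  rw [LinearEquiv.symm_apply_apply]
  change Rs (incl B) (Rs φ (Pr (φ '' B) (T (Pr (φ '' A) (Is φ (Is (incl A) x)))))) = _
  rw [Pr_image_Is, Rs_Pr_image]
  rfl

end Blocks

section SuperIndex

variable {X Y : Type}

/-- The part of `A` of parity `b`. -/
def pt (p : X → Bool) (A : Set X) (b : Bool) : Set X := {x | x ∈ A ∧ p x = b}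

/-- The index of a block. -/
def bidx (T : L2 X →L[ℂ] L2 X) (A B : Set X) : ℤ := fidx (blk T A B).toLinearMap

/-- The index of an odd operator localised at `A`, from the even to the odd part. -/
def sidx (T : L2 X →L[ℂ] L2 X) (p : X → Bool) (A : Set X) : ℤ :=
  bidx T (pt p A true) (pt p A false)

/-- `T` is odd, self-adjoint, and modulo compact operators it is local at `A` and an involution
there. -/
structure Good (T : L2 X →L[ℂ] L2 X) (p : X → Bool) (A : Set X) : Prop where
  sa : ContinuousLinearMap.adjoint T = T
  odd : ∀ x y, p x = p y → T (del x) y = 0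
  loc : Ceq (T ∘L Pr A) (Pr A ∘L T ∘L Pr A)
  inv : Ceq (T ∘L T ∘L Pr A) (Pr A)

theorem pt_union_pt (p : X → Bool) (A : Set X) (b : Bool) : pt p A b ∪ pt p A (!b) = A := by
  ext x
  simp only [pt, mem_union, mem_setOf_eq]
  cases b <;> cases p x <;> simp

theorem pt_disjoint (p : X → Bool) (A : Set X) (b : Bool) :
    Disjoint (pt p A b) (pt p A (!b)) := by
  rw [Set.disjoint_left]
  rintro x ⟨_, h⟩ ⟨_, h'⟩
  rw [h] at h'
  cases b <;> simp at h'

theorem pt_subset (p : X → Bool) (A : Set X) (b : Bool) : pt p A b ⊆ A := fun _ h => h.1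

theorem Pr_comp_of_subset {A B : Set X} (h : A ⊆ B) : Pr B ∘L Pr A = Pr A := by
  rw [Pr_comp_Pr, inter_eq_self_of_subset_right h]

namespace Good

variable {T T' : L2 X →L[ℂ] L2 X} {p : X → Bool} {A B : Set X}

theorem pr_odd (h : Good T p A) (C : Set X) (b : Bool) :
    Pr (pt p A b) ∘L T ∘L Pr (pt p C b) = 0 := by
  classical
  refine clm_ext_del fun i => ?_
  ext j
  simp only [ContinuousLinearMap.comp_apply, Pr_del, Pr_apply]
  split_ifs with h1 h2
  · exact h.odd i j (h2.2.trans h1.2.symm)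
  · simp
  · rfl

theorem loc_pt (h : Good T p A) (b : Bool) :
    Ceq (T ∘L Pr (pt p A b)) (Pr (pt p A (!b)) ∘L T ∘L Pr (pt p A b)) := by
  have h1 := h.loc.comp_clm (Pr (pt p A b))
  rw [ContinuousLinearMap.comp_assoc, ContinuousLinearMap.comp_assoc,
    clm_comp_assoc, Pr_comp_of_subset (pt_subset p A b)] at h1
  refine h1.trans (Ceq.of_eq ?_)
  have e : Pr A = Pr (pt p A b) + Pr (pt p A (!b)) := by
    rw [Pr_add_Pr (pt_disjoint p A b), pt_union_pt]
  rw [e, ContinuousLinearMap.add_comp, h.pr_odd, zero_add]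

theorem inv_pt (h : Good T p A) (b : Bool) : Ceq (T ∘L T ∘L Pr (pt p A b)) (Pr (pt p A b)) := by
  have h1 := h.inv.comp_clm (Pr (pt p A b))
  rwa [ContinuousLinearMap.comp_assoc, ContinuousLinearMap.comp_assoc,
    Pr_comp_of_subset (pt_subset p A b)] at h1

theorem fred (h : Good T p A) (b : Bool) : Fred (blk T (pt p A b) (pt p A (!b))) :=
  blk_fred (h.loc_pt b) (by simpa using h.loc_pt (!b)) (h.inv_pt b) (h.inv_pt (!b))

theorem loc_adj (h : Good T p A) : Ceq (Pr A ∘L T) (Pr A ∘L T ∘L Pr A) := by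
  have := h.loc.adjoint
  simpa only [ContinuousLinearMap.adjoint_comp, adjoint_Pr, h.sa,
    clm_comp_assoc] using this

theorem cross (h : Good T p A) {C D : Set X} (hC : C ⊆ A) (hD : Disjoint A D) :
    Ceq (Pr D ∘L T ∘L Pr C) 0 := by
  have h1 := (h.loc.comp_clm (Pr C)).clm_comp (Pr D)
  simp only [clm_comp_assoc, Pr_comp_of_subset hC] at h1
  refine h1.trans (Ceq.of_eq ?_)
  rw [← ContinuousLinearMap.comp_assoc, Pr_comp_Pr, inter_comm, disjoint_iff_inter_eq_empty.1 hD,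
    Pr_empty, ContinuousLinearMap.zero_comp]

theorem union (hA : Good T p A) (hB : Good T p B) (d : Disjoint A B) : Good T p (A ∪ B) where
  sa := hA.sa
  odd := hA.odd
  loc := by
    rw [← Pr_add_Pr d]
    simp only [ContinuousLinearMap.comp_add, ContinuousLinearMap.add_comp]
    have := (hA.loc.add hB.loc).add ((hA.cross le_rfl d).symm.add (hB.cross le_rfl d.symm).symm)
    rw [add_zero, add_zero] at this
    refine this.trans (Ceq.of_eq ?_)
    abel
  inv := by
    rw [← Pr_add_Pr d]
    simp only [ContinuousLinearMap.comp_add]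
    exact hA.inv.add hB.inv

theorem sidx_union (hA : Good T p A) (hB : Good T p B) (d : Disjoint A B) :
    sidx T p (A ∪ B) = sidx T p A + sidx T p B := by
  have hpt : ∀ b, pt p (A ∪ B) b = pt p A b ∪ pt p B b := fun b => by
    ext x; simp only [pt, mem_union, mem_setOf_eq]; tauto
  exact fidx_blk_union (hpt _) (hpt _) (d.mono (pt_subset _ _ _) (pt_subset _ _ _))
    (d.mono (pt_subset _ _ _) (pt_subset _ _ _))
    (hB.cross (pt_subset _ _ _) (d.symm.mono_right (pt_subset _ _ _)))
    (hA.cross (pt_subset _ _ _) (d.mono_right (pt_subset _ _ _)))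
    (hA.fred true) (hB.fred true) ((hA.union hB d).fred true)

theorem empty (sa : ContinuousLinearMap.adjoint T = T) (odd : ∀ x y, p x = p y → T (del x) y = 0) :
    Good T p (∅ : Set X) :=
  ⟨sa, odd, Ceq.of_eq (by simp [Pr_empty]), Ceq.of_eq (by simp [Pr_empty])⟩

theorem sidx_empty : sidx T p (∅ : Set X) = 0 := by
  have : ∀ b, pt p (∅ : Set X) b = ∅ := fun b => by ext; simp [pt]
  rw [sidx, this, this, bidx, fidx]
  have : Subsingleton (L2 (∅ : Set X)) := ⟨fun x y => by ext i; exact i.2.elim⟩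
  rw [Module.finrank_zero_of_subsingleton, Module.finrank_zero_of_subsingleton]; simp

theorem biUnion {ι : Type} (s : Finset ι) {A : ι → Set X}
    (sa : ContinuousLinearMap.adjoint T = T) (odd : ∀ x y, p x = p y → T (del x) y = 0)
    (h : ∀ i ∈ s, Good T p (A i)) (d : Pairwise fun i j => Disjoint (A i) (A j)) :
    Good T p (⋃ i ∈ s, A i) ∧ sidx T p (⋃ i ∈ s, A i) = ∑ i ∈ s, sidx T p (A i) := by
  classical
  induction s using Finset.induction_on with
  | empty => simpa using ⟨empty sa odd, sidx_empty⟩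
  | insert a s ha ih =>
    obtain ⟨h1, h2⟩ := ih fun i hi => h i (by simp [hi])
    have hd : Disjoint (A a) (⋃ i ∈ s, A i) := by
      simp only [Set.disjoint_iUnion_right]
      intro i hi
      exact d (fun e => ha (e ▸ hi))
    rw [Finset.set_biUnion_insert, Finset.sum_insert ha]
    have ha' := h a (by simp)
    exact ⟨ha'.union h1 hd, by rw [ha'.sidx_union h1 hd, h2]⟩

theorem sidx_congr (h : Good T p A) (h' : Ceq (T' ∘L Pr A) (T ∘L Pr A)) :
    sidx T' p A = sidx T p A := by
  refine (h.fred true).fidx_congr (blk_congr ?_)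
  have := h'.comp_clm (Pr (pt p A true))
  rwa [ContinuousLinearMap.comp_assoc, ContinuousLinearMap.comp_assoc,
    Pr_comp_of_subset (pt_subset p A true)] at this

theorem sidx_path {T : ℝ → L2 X →L[ℂ] L2 X} (hc : ContinuousOn T (Icc 0 1))
    (h : ∀ t ∈ Icc (0:ℝ) 1, Good (T t) p A) : sidx (T 0) p A = sidx (T 1) p A := by
  refine fidx_path (T := fun t => blk (T t) (pt p A true) (pt p A false)) ?_
    fun t ht => (h t ht).fred true
  exact continuousOn_const.clm_comp (hc.clm_comp continuousOn_const)

theorem sidx_flip (h : Good T p A) : sidx T (fun x => !(p x)) A = - sidx T p A := by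
  have hpt : ∀ b, pt (fun x => !(p x)) A b = pt p A (!b) := fun b => by
    ext x; simp only [pt, mem_setOf_eq, Bool.not_eq_eq_eq_not]
  rw [sidx, hpt, hpt, sidx, bidx, bidx]
  have := (h.fred true).fidx_adjoint
  rw [adjoint_blk h.sa] at this
  exact this

end Good

theorem sidx_image {T : L2 X →L[ℂ] L2 X} {T' : L2 Y →L[ℂ] L2 Y} {p : X → Bool} {p' : Y → Bool}
    {A : Set Y} (φ : Y ↪ X) (h : Good T' p' A) (hp : ∀ y, p (φ y) = p' y)
    (hT : Ceq (Rs φ ∘L T ∘L Is φ ∘L Pr A) (T' ∘L Pr A)) :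
    sidx T p (φ '' A) = sidx T' p' A := by
  have hpt : ∀ b, pt p (φ '' A) b = φ '' (pt p' A b) := fun b => by
    ext x
    constructor
    · rintro ⟨⟨y, hy, rfl⟩, h2⟩
      exact ⟨y, ⟨hy, (hp y).symm.trans h2⟩, rfl⟩
    · rintro ⟨y, ⟨hy, h2⟩, rfl⟩
      exact ⟨⟨y, hy, rfl⟩, (hp y).trans h2⟩
  rw [← h.sidx_congr (T' := Rs φ ∘L T ∘L Is φ) (by simpa only [ContinuousLinearMap.comp_assoc]),
    sidx, hpt, hpt, bidx, fidx_blk_image]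
  rfl

theorem even_ker_blk {T : L2 X →L[ℂ] L2 X} {A B : Set X} (J : L2 X →ₛₗ[starRingEnd ℂ] L2 X)
    (hJ : ∀ x, J (J x) = -x) (hT : ∀ x, J (T x) = T (J x)) (hA : ∀ x, J (Pr A x) = Pr A (J x))
    (hB : ∀ x, J (Pr B x) = Pr B (J x)) :
    Even (Module.finrank ℂ (blk T A B).toLinearMap.ker) := by
  have eA : ∀ x, Pr A (Is (incl A) x) = Is (incl A) x := fun x => 
    congrArg (fun T => T x) (Pr_Is (le_refl A))
  have eB : ∀ x, Rs (incl B) (Pr B x) = Rs (incl B) x := fun x => 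
    congrArg (fun T => T x) (Rs_Pr (le_refl B))
  have eJ : ∀ x, Pr A (J (Is (incl A) x)) = J (Is (incl A) x) := fun x => by rw [← hA, eA]
  let K : L2 A → L2 A := fun x => Rs (incl A) (J (Is (incl A) x))
  have hK : ∀ x, Is (incl A) (K x) = J (Is (incl A) x) := eJ
  have hmem : ∀ x, blk T A B x = 0 → blk T A B (K x) = 0 := by
    intro x hx
    change Rs (incl B) (T (Is (incl A) (K x))) = 0
    rw [hK, ← hT, ← eB, ← hB]
    have : Pr B (T (Is (incl A) x)) = Is (incl B) (blk T A B x) := rfl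
    rw [this, hx]; simp
  refine even_finrank_of_quaternionic
    { toFun := fun v => ⟨K v, hmem v v.2⟩
      map_add' := fun v w => Subtype.ext (by simp [K])
      map_smul' := fun c v => Subtype.ext (by simp [K]) } fun v => Subtype.ext ?_
  change Rs (incl A) (J (Is (incl A) (K v))) = -v.1
  rw [hK, hJ, map_neg, Rs_Is]

theorem Good.even {T : L2 X →L[ℂ] L2 X} {p : X → Bool} {A : Set X} (h : Good T p A)
    (J : L2 X →ₛₗ[starRingEnd ℂ] L2 X) (hJ : ∀ x, J (J x) = -x) (hT : ∀ x, J (T x) = T (J x))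
    (hA : ∀ b x, J (Pr (pt p A b) x) = Pr (pt p A b) (J x)) : Even (sidx T p A) := by
  have := (h.fred true).fidx_eq
  rw [adjoint_blk h.sa] at this
  rw [sidx, bidx]
  refine Eq.subst (motive := Even) this.symm ?_
  exact ((Int.even_coe_nat _).2 (even_ker_blk J hJ hT (hA _) (hA _))).sub
    ((Int.even_coe_nat _).2 (even_ker_blk J hJ hT (hA _) (hA _)))

end SuperIndex

/-- `ℂ⁸`. -/
abbrev E8 := EuclideanSpace ℂ (Fin 8)

/-- The unit sphere of `ℂ⁸`. -/
abbrev S15 := Metric.sphere (0 : E8) 1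

/-- Multi-indices. -/
abbrev MI := Fin 8 → ℕ

section SphereMeasure
open MeasureTheory
open scoped Pointwise

/-- Lebesgue measure on `ℂ⁸`. -/
def muE : Measure E8 := (volume : Measure (Fin 8 → ℂ)).map (MeasurableEquiv.toLp 2 (Fin 8 → ℂ))

theorem mp_toLp : MeasurePreserving (MeasurableEquiv.toLp 2 (Fin 8 → ℂ)) volume muE :=
  ⟨(MeasurableEquiv.toLp 2 (Fin 8 → ℂ)).measurable, rfl⟩

instance : muE.IsAddHaarMeasure :=
  (PiLp.continuousLinearEquiv 2 ℝ (fun _ : Fin 8 => ℂ)).symm.isAddHaarMeasure_map volume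

/-- The surface measure of the sphere. -/
def sig : Measure S15 := muE.toSphere

instance : IsFiniteMeasure sig := inferInstanceAs (IsFiniteMeasure muE.toSphere)
instance : sig.IsOpenPosMeasure := inferInstanceAs muE.toSphere.IsOpenPosMeasure

/-- Coordinatewise application of real isometries of `ℂ`. -/
def rotE (r : Fin 8 → ℂ ≃ₗᵢ[ℝ] ℂ) : E8 ≃ₗᵢ[ℝ] E8 :=
  LinearIsometryEquiv.piLpCongrRight 2 r

theorem rotE_apply (r : Fin 8 → ℂ ≃ₗᵢ[ℝ] ℂ) (x : E8) (i : Fin 8) : rotE r x i = r i (x i) := rfl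

/-- Coordinatewise application of real isometries of `ℂ`, on the sphere. -/
def rotS (r : Fin 8 → ℂ ≃ₗᵢ[ℝ] ℂ) : C(S15, S15) where
  toFun x := ⟨rotE r x, by simp⟩
  continuous_toFun := by fun_prop

theorem rotS_apply (r : Fin 8 → ℂ ≃ₗᵢ[ℝ] ℂ) (x : S15) (i : Fin 8) :
    (rotS r x : E8) i = r i ((x : E8) i) := rfl

theorem mp_rotE (r : Fin 8 → ℂ ≃ₗᵢ[ℝ] ℂ) : MeasurePreserving (rotE r) muE muE := by
  have h1 : MeasurePreserving (fun (x : Fin 8 → ℂ) i => r i (x i)) volume volume :=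
    volume_preserving_pi fun i => (r i).measurePreserving
  exact (mp_toLp.comp h1).comp (mp_toLp.symm _)

theorem mp_rotS (r : Fin 8 → ℂ ≃ₗᵢ[ℝ] ℂ) : MeasurePreserving (rotS r) sig sig := by
  refine ⟨(rotS r).continuous.measurable, Measure.ext fun s hs => ?_⟩
  rw [Measure.map_apply (rotS r).continuous.measurable hs, sig,
    Measure.toSphere_apply' _ ((rotS r).continuous.measurable hs), Measure.toSphere_apply' _ hs]
  congr 1
  rw [← (mp_rotE r).measure_preimage_equiv (f := (rotE r).toMeasurableEquiv) (Ioo (0:ℝ) 1 • (Subtype.val '' s))]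
  congr 1
  ext x
  simp only [mem_smul, mem_image, mem_preimage]
  constructor
  · rintro ⟨t, ht, _, ⟨u, hu, rfl⟩, rfl⟩
    exact ⟨t, ht, _, ⟨_, hu, rfl⟩, by
      change t • rotE r u = rotE r (t • (u : E8))
      rw [map_smul]⟩
  · rintro ⟨t, ht, _, ⟨u, hu, rfl⟩, h⟩
    refine ⟨t, ht, _, ⟨⟨(rotE r).symm u, by simp⟩, ?_, rfl⟩, ?_⟩
    · change (⟨rotE r ((rotE r).symm u), _⟩ : S15) ∈ s
      simpa using hu
    · change t • (rotE r).symm (u : E8) = x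
      rw [← map_smul, LinearIsometryEquiv.symm_apply_eq]
      exact h

theorem integral_rotS (r : Fin 8 → ℂ ≃ₗᵢ[ℝ] ℂ) (f : C(S15, ℂ)) :
    ∫ x, f (rotS r x) ∂sig = ∫ x, f x ∂sig := by
  have := integral_map (μ := sig) (rotS r).continuous.measurable.aemeasurable (f := f)
    f.continuous.aestronglyMeasurable
  rw [(mp_rotS r).map_eq] at this
  exact this.symm

theorem polar (G : E8 → ℝ) : ∫ x, G x ∂muE =
    ∫ p : S15 × Ioi (0:ℝ), G (p.2.1 • p.1.1) ∂sig.prod (.volumeIoiPow 15) := by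
  have hd : Module.finrank ℝ E8 = 16 := by
    rw [finrank_real_of_complex, finrank_euclideanSpace_fin]
  have := muE.measurePreserving_homeomorphUnitSphereProd.integral_comp
        (Homeomorph.measurableEmbedding _) (fun p : S15 × Ioi (0:ℝ) => G (p.2.1 • p.1.1))
  rw [hd] at this
  have h0 : ∫ x, G x ∂muE = ∫ x : ({0}ᶜ : Set E8), G x ∂(muE.comap (↑)) := by
    rw [integral_subtype_comap (measurableSet_singleton _).compl, restrict_compl_singleton]
  rw [sig, h0]
  refine Eq.trans (integral_congr_ae (ae_of_all _ fun x => ?_)) this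
  beta_reduce
  rw [homeomorphUnitSphereProd_apply_snd_coe, homeomorphUnitSphereProd_apply_fst_coe,
    smul_smul, mul_inv_cancel₀ (norm_ne_zero_iff.2 x.2), one_smul]

theorem moment (a : MI) : ∫ x : S15, ∏ i, ‖(x : E8) i‖ ^ (2 * a i) ∂sig =
    2 * Real.pi ^ 8 * (∏ i, (a i).factorial : ℕ) / (∑ i, a i + 7).factorial := by
  have h1 := polar (fun x => ∏ i, (‖x i‖ ^ (2 * a i) * Real.exp (-‖x i‖ ^ 2)))
  have h2 : ∫ x, (∏ i, (‖x i‖ ^ (2 * a i) * Real.exp (-‖x i‖ ^ 2))) ∂muE =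
      Real.pi ^ 8 * (∏ i, (a i).factorial : ℕ) := by
    rw [← mp_toLp.integral_comp']
    change ∫ x : Fin 8 → ℂ, (∏ i, (‖x i‖ ^ (2 * a i) * Real.exp (-‖x i‖ ^ 2))) = _
    rw [integral_fintype_prod_volume_eq_prod (fun i (z : ℂ) => ‖z‖ ^ (2 * a i) * Real.exp (-‖z‖ ^ 2))]
    have : ∀ i, ∫ z : ℂ, ‖z‖ ^ (2 * a i) * Real.exp (-‖z‖ ^ 2) = Real.pi * (a i).factorial := by
      intro i
      have := Complex.integral_rpow_mul_exp_neg_rpow (p := 2) (q := (2 * a i : ℕ)) (by norm_num)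
        (by have : (0:ℝ) ≤ (2 * a i : ℕ) := by positivity
            linarith)
      simp only [Real.rpow_natCast, Real.rpow_ofNat] at this
      rw [this, show (((2 * a i : ℕ) : ℝ) + 2) / 2 = a i + 1 by push_cast; ring, Real.Gamma_nat_eq_factorial]
      ring
    simp_rw [this]
    rw [Finset.prod_mul_distrib]
    simp
  have h3 : ∀ p : S15 × Ioi (0:ℝ), ∏ i, (‖(p.2.1 • p.1.1) i‖ ^ (2 * a i) * Real.exp (-‖(p.2.1 • p.1.1) i‖ ^ 2)) =
      (∏ i, ‖(p.1 : E8) i‖ ^ (2 * a i)) * (p.2.1 ^ (2 * ∑ i, a i) * Real.exp (- p.2.1 ^ 2)) := by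
    rintro ⟨u, r, hr⟩
    have hu : ∑ i, ‖(u : E8) i‖ ^ 2 = 1 := by
      rw [← EuclideanSpace.norm_sq_eq, mem_sphere_zero_iff_norm.1 u.2]; norm_num
    simp only [PiLp.smul_apply, norm_smul, Real.norm_eq_abs, abs_of_pos (mem_Ioi.1 hr), mul_pow]
    rw [Finset.prod_mul_distrib, Finset.prod_mul_distrib, Finset.prod_pow_eq_pow_sum, ← Finset.mul_sum,
      ← Real.exp_sum, Finset.sum_neg_distrib, ← Finset.mul_sum, hu]
    ring_nf
  have h4 : ∫ r : Ioi (0:ℝ), (r.1 ^ (2 * ∑ i, a i) * Real.exp (- r.1 ^ 2)) ∂.volumeIoiPow 15 =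
      (∑ i, a i + 7).factorial / 2 := by
    simp only [Measure.volumeIoiPow, ENNReal.ofReal]
    rw [integral_withDensity_eq_integral_smul,
        integral_subtype_comap measurableSet_Ioi fun b : ℝ ↦ Real.toNNReal (b ^ 15) • (b ^ (2 * ∑ i, a i) * Real.exp (- b ^ 2)),
        setIntegral_congr_fun (g := fun b : ℝ => b ^ ((2 * ∑ i, a i + 15 : ℕ) : ℝ) * Real.exp (- b ^ (2:ℝ))) measurableSet_Ioi fun x hx ↦ ?_]
    · rw [integral_rpow_mul_exp_neg_rpow (by norm_num) (by
        have : (0:ℝ) ≤ (2 * ∑ i, a i + 15 : ℕ) := by positivity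
        linarith), show (((2 * ∑ i, a i + 15 : ℕ) : ℝ) + 1) / 2 = (∑ i, a i + 7 : ℕ) + 1 by push_cast; ring,
        Real.Gamma_nat_eq_factorial]
      ring
    · simp only [NNReal.smul_def, Real.coe_toNNReal _ (pow_nonneg (mem_Ioi.1 hx).le _), smul_eq_mul,
        Real.rpow_natCast, Real.rpow_ofNat]
      ring
    · exact (measurable_subtype_coe.pow_const _).real_toNNReal
  simp_rw [h3] at h1
  rw [integral_prod_mul (fun u : S15 => ∏ i, ‖(u : E8) i‖ ^ (2 * a i)) (fun r : Ioi (0:ℝ) => r.1 ^ (2 * ∑ i, a i) * Real.exp (- r.1 ^ 2)), h4, h2] at h1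
  have : (0:ℝ) < (∑ i, a i + 7).factorial := by positivity
  field_simp
  linarith

end SphereMeasure

section Toeplitz
open MeasureTheory

/-- `L²` of the sphere. -/
abbrev LS := Lp ℂ 2 sig

/-- Continuous functions as elements of `L²`. -/
def cl : C(S15, ℂ) →L[ℂ] LS := ContinuousMap.toLp 2 sig ℂ

theorem inner_cl (f g : C(S15, ℂ)) : inner ℂ (cl f) (cl g) = ∫ x, g x * star (f x) ∂sig :=
  ContinuousMap.inner_toLp sig f g

theorem cl_denseRange : DenseRange cl := ContinuousMap.toLp_denseRange ℂ sig ℂ (by norm_num)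

/-- Multiplication operators on `L²` of the sphere. -/
def mulOp : C(S15, ℂ) →L[ℂ] (LS →L[ℂ] LS) :=
  (ContinuousLinearMap.mul ℂ ℂ).holderL sig ⊤ 2 2 ∘L ContinuousMap.toLp ⊤ sig ℂ

theorem mulOp_cl (f g : C(S15, ℂ)) : mulOp f (cl g) = cl (f * g) := by
  refine Lp.ext ?_
  have h1 := (ContinuousLinearMap.mul ℂ ℂ).coeFn_holder (r := 2) (ContinuousMap.toLp ⊤ sig ℂ f) (cl g)
  have h2 := ContinuousMap.coeFn_toLp (p := ⊤) (𝕜 := ℂ) sig f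
  have h3 := ContinuousMap.coeFn_toLp (p := 2) (𝕜 := ℂ) sig g
  have h4 := ContinuousMap.coeFn_toLp (p := 2) (𝕜 := ℂ) sig (f * g)
  filter_upwards [h1, h2, h3, h4] with x h1 h2 h3 h4
  refine h1.trans ?_
  rw [h2]
  refine Eq.trans ?_ h4.symm
  change f x * cl g x = f x * g x
  exact congrArg _ h3

theorem mulOp_mul (f g : C(S15, ℂ)) : mulOp (f * g) = mulOp f ∘L mulOp g := by
  refine ContinuousLinearMap.ext fun x => ?_
  refine cl_denseRange.induction_on x ?_ (fun h => ?_)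
  · exact isClosed_eq (by fun_prop) (by fun_prop)
  · simp [mulOp_cl, mul_assoc]

theorem mulOp_one : mulOp 1 = ContinuousLinearMap.id ℂ _ := by
  refine ContinuousLinearMap.ext fun x => ?_
  refine cl_denseRange.induction_on x ?_ (fun h => ?_)
  · exact isClosed_eq (by fun_prop) (by fun_prop)
  · simp [mulOp_cl]

theorem adjoint_mulOp (f : C(S15, ℂ)) : ContinuousLinearMap.adjoint (mulOp f) = mulOp (star f) := by
  symm
  rw [ContinuousLinearMap.eq_adjoint_iff]
  intro x y
  refine cl_denseRange.induction_on₂ ?_ (fun g h => ?_) x y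
  · exact isClosed_eq (by fun_prop) (by fun_prop)
  · rw [mulOp_cl, mulOp_cl, inner_cl, inner_cl]
    refine integral_congr_ae (ae_of_all _ fun x => ?_)
    simp
    ring

/-- Coordinate functions. -/
def crd (j : Fin 8) : C(S15, ℂ) := ⟨fun x => (x : E8) j, by fun_prop⟩

theorem crd_apply (j : Fin 8) (x : S15) : crd j x = (x : E8) j := rfl

/-- Monomials. -/
def mono (a : MI) : C(S15, ℂ) := ∏ i, crd i ^ a i

theorem mono_apply (a : MI) (x : S15) : mono a x = ∏ i, (x : E8) i ^ a i := by
  simp [mono, ContinuousMap.prod_apply, crd_apply]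

/-- The basis multi-index. -/
def e1 (j : Fin 8) : MI := Pi.single j 1

theorem mono_add (a b : MI) : mono (a + b) = mono a * mono b := by
  simp [mono, pow_add, Finset.prod_mul_distrib]

theorem mono_e1 (j : Fin 8) : mono (e1 j) = crd j := by
  rw [mono, Finset.prod_eq_single j]
  · simp [e1]
  · intro i _ h
    simp [e1, h]
  · simp

/-- Squared norms of monomials. -/
def nrm (a : MI) : ℝ := 2 * Real.pi ^ 8 * (∏ i, (a i).factorial : ℕ) / (∑ i, a i + 7).factorial

theorem nrm_pos (a : MI) : 0 < nrm a := by
  have : 0 < ∏ i, (a i).factorial := Finset.prod_pos fun i _ => Nat.factorial_pos _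
  have := Nat.factorial_pos (∑ i, a i + 7)
  rw [nrm]; positivity

theorem sum_cast_nonneg (a : MI) : (0:ℝ) ≤ ∑ i, (a i:ℝ) :=
  Finset.sum_nonneg fun _ _ => Nat.cast_nonneg _

theorem nrm_add (a : MI) (j : Fin 8) : nrm (a + e1 j) = nrm a * ((a j + 1) / (∑ i, (a i : ℝ) + 8)) := by
  have h1 : ∑ i, (a + e1 j) i + 7 = (∑ i, a i + 7) + 1 := by
    simp only [Pi.add_apply, Finset.sum_add_distrib]
    simp [e1, add_right_comm]
  have h2 : ∏ i, ((a + e1 j) i).factorial = (a j + 1) * ∏ i, (a i).factorial := by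
    rw [← Finset.mul_prod_erase _ _ (Finset.mem_univ j), ← Finset.mul_prod_erase _ (fun i => (a i).factorial) (Finset.mem_univ j)]
    rw [Finset.prod_congr rfl (g := fun i => (a i).factorial) (fun i hi => by simp [e1, Finset.ne_of_mem_erase hi])]
    simp [e1, Nat.factorial_succ]; ring
  rw [nrm, nrm, h1, h2, Nat.factorial_succ]
  have := Nat.factorial_pos (∑ i, a i + 7)
  push_cast
  have := sum_cast_nonneg a
  field_simp
  ring

theorem integral_eq_zero_of_rot (f : C(S15, ℂ)) (r : Fin 8 → ℂ ≃ₗᵢ[ℝ] ℂ) (c : ℂ) (hc : c ≠ 1)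
    (h : ∀ x, f (rotS r x) = c * f x) : ∫ x, f x ∂sig = 0 := by
  have h1 := integral_rotS r f
  simp_rw [h] at h1
  rw [integral_const_mul] at h1
  have : (c - 1) * ∫ x, f x ∂sig = 0 := by rw [sub_mul, h1]; ring
  exact (mul_eq_zero.1 this).resolve_left (sub_ne_zero.2 hc)

theorem inner_mono_self (a : MI) : inner ℂ (cl (mono a)) (cl (mono a)) = (nrm a : ℂ) := by
  rw [inner_cl, nrm, ← moment, ← integral_complex_ofReal]
  refine integral_congr_ae (ae_of_all _ fun x => ?_)
  simp only [mono_apply, star_prod, ← Finset.prod_mul_distrib, Complex.ofReal_prod, Complex.ofReal_pow]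
  refine Finset.prod_congr rfl fun i _ => ?_
  rw [star_pow, ← mul_pow, pow_mul]
  congr 1
  exact Complex.mul_conj' _

theorem inner_mono_of_ne {a b : MI} (h : a ≠ b) : inner ℂ (cl (mono a)) (cl (mono b)) = 0 := by
  obtain ⟨j, hj⟩ := Function.ne_iff.1 h
  have hj' : (b j : ℝ) - a j ≠ 0 := by
    rw [sub_ne_zero]; exact_mod_cast hj.symm
  have key : ∀ θ : ℝ, ∀ x, mono b (rotS (fun i => if i = j then rotation (Circle.exp θ) else .refl ℝ ℂ) x) *
      star (mono a (rotS (fun i => if i = j then rotation (Circle.exp θ) else .refl ℝ ℂ) x)) =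
      Complex.exp ((b j - a j) * θ * Complex.I) * (mono b x * star (mono a x)) := by
    intro θ x
    have h1 : ∀ c : MI, mono c (rotS (fun i => if i = j then rotation (Circle.exp θ) else .refl ℝ ℂ) x) =
        Complex.exp (c j * θ * Complex.I) * mono c x := by
      intro c
      rw [mono_apply, mono_apply, ← Finset.mul_prod_erase _ _ (Finset.mem_univ j), ← Finset.mul_prod_erase _ (fun i => (x : E8) i ^ c i) (Finset.mem_univ j), ← mul_assoc]
      congr 1
      · rw [rotS_apply]
        simp only [if_true, rotation_apply, Circle.coe_exp, mul_pow]
        rw [← Complex.exp_nat_mul, mul_assoc]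
      · refine Finset.prod_congr rfl fun i hi => ?_
        rw [rotS_apply, if_neg (Finset.ne_of_mem_erase hi)]; rfl
    rw [h1, h1, star_mul']
    have : star (Complex.exp (a j * θ * Complex.I)) = Complex.exp (-(a j * θ * Complex.I)) := by
      change (starRingEnd ℂ) _ = _
      rw [← Complex.exp_conj]; simp
    rw [this, sub_mul, sub_mul, sub_eq_add_neg, Complex.exp_add]
    ring
  rw [inner_cl]
  refine integral_eq_zero_of_rot (mono b * star (mono a)) (fun i => if i = j then rotation (Circle.exp (Real.pi / (b j - a j))) else .refl ℝ ℂ)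
    (-1) (by norm_num) (fun x => ?_)
  refine (key _ x).trans ?_
  congr 1
  have : (b j - a j : ℂ) ≠ 0 := by exact_mod_cast hj'
  push_cast
  rw [mul_div_cancel₀ _ this, Complex.exp_pi_mul_I]

/-- Normalised monomials. -/
def en (a : MI) : C(S15, ℂ) := (((Real.sqrt (nrm a))⁻¹ : ℝ) : ℂ) • mono a

theorem orthonormal_en : Orthonormal ℂ (fun a => cl (en a)) := by
  classical
  rw [orthonormal_iff_ite]
  intro a b
  simp only [en, map_smul, inner_smul_left, inner_smul_right]
  split_ifs with h
  · subst h
    rw [inner_mono_self, Complex.conj_ofReal]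
    norm_cast
    have := Real.sq_sqrt (nrm_pos a).le
    have := Real.sqrt_pos.2 (nrm_pos a)
    field_simp
    linarith
  · simp [inner_mono_of_ne h]

/-- The isometric inclusion of the Hardy space. -/
def hardy : L2 MI →ₗᵢ[ℂ] LS := orthonormal_en.orthogonalFamily.linearIsometry

theorem hardy_del (a : MI) : hardy (del a) = cl (en a) := by
  classical
  rw [hardy, del, OrthogonalFamily.linearIsometry_apply_single]
  simp

/-- `hardy` as a continuous linear map. -/
abbrev hW : L2 MI →L[ℂ] LS := hardy.toContinuousLinearMap

theorem hW_del (a : MI) : hW (del a) = cl (en a) := hardy_del a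

theorem adjoint_hW_hW : ContinuousLinearMap.adjoint hW ∘L hW = ContinuousLinearMap.id ℂ _ := by
  refine ContinuousLinearMap.ext fun x => ?_
  refine ext_inner_left ℂ fun y => ?_
  rw [ContinuousLinearMap.comp_apply, ContinuousLinearMap.adjoint_inner_right]
  exact hardy.inner_map_map y x

/-- Toeplitz operators, in concrete form. -/
def tauAux : C(S15, ℂ) →L[ℂ] (L2 MI →L[ℂ] L2 MI) :=
  (ContinuousLinearMap.compL ℂ (L2 MI) LS (L2 MI) (ContinuousLinearMap.adjoint hW)) ∘L
    ((ContinuousLinearMap.compL ℂ (L2 MI) LS LS).flip hW) ∘L mulOp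

theorem tauAux_eq (f : C(S15, ℂ)) : tauAux f = ContinuousLinearMap.adjoint hW ∘L mulOp f ∘L hW := rfl

theorem tauAux_one : tauAux 1 = ContinuousLinearMap.id ℂ _ := by
  rw [tauAux_eq, mulOp_one, ContinuousLinearMap.id_comp, adjoint_hW_hW]

theorem adjoint_tauAux (f : C(S15, ℂ)) : ContinuousLinearMap.adjoint (tauAux f) = tauAux (star f) := by
  rw [tauAux_eq, tauAux_eq, ContinuousLinearMap.adjoint_comp, ContinuousLinearMap.adjoint_comp,
    adjoint_mulOp, ContinuousLinearMap.adjoint_adjoint]; rfl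

theorem tauAux_del_apply (f : C(S15, ℂ)) (a b : MI) :
    tauAux f (del a) b = ∫ x, f x * en a x * star (en b x) ∂sig := by
  rw [← inner_del, tauAux_eq, ContinuousLinearMap.comp_apply, ContinuousLinearMap.adjoint_inner_right,
    ContinuousLinearMap.comp_apply, hW_del, hW_del, mulOp_cl, inner_cl]
  rfl

/-- Weights of the coordinate shifts. -/
def wt (j : Fin 8) (a : MI) : ℝ := Real.sqrt ((a j + 1) / (∑ i, (a i : ℝ) + 8))

theorem crd_mul_en (j : Fin 8) (a : MI) : crd j * en a = (wt j a : ℂ) • en (a + e1 j) := by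
  rw [en, en, mono_add, mono_e1, nrm_add, Real.sqrt_mul (nrm_pos a).le, smul_smul, mul_smul_comm,
    mul_comm (crd j), wt]
  congr 1
  norm_cast
  have := Real.sqrt_pos.2 (nrm_pos a)
  have : 0 < Real.sqrt ((a j + 1) / (∑ i, (a i : ℝ) + 8)) := Real.sqrt_pos.2
    (div_pos (by positivity) (by linarith [sum_cast_nonneg a]))
  push_cast
  field_simp

theorem mulOp_crd_hW (j : Fin 8) (a : MI) :
    mulOp (crd j) (hW (del a)) = hW ((wt j a : ℂ) • del (a + e1 j)) := by
  rw [map_smul, hW_del, hW_del, mulOp_cl, crd_mul_en, map_smul]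

theorem tauAux_crd_del (j : Fin 8) (a : MI) : tauAux (crd j) (del a) = (wt j a : ℂ) • del (a + e1 j) := by
  rw [tauAux_eq, ContinuousLinearMap.comp_apply, ContinuousLinearMap.comp_apply, mulOp_crd_hW]
  exact congrArg (· ((wt j a : ℂ) • del (a + e1 j))) adjoint_hW_hW

theorem tauAux_comp_crd (f : C(S15, ℂ)) (j : Fin 8) : tauAux f ∘L tauAux (crd j) = tauAux (f * crd j) := by
  refine clm_ext_del fun a => ?_
  rw [ContinuousLinearMap.comp_apply, tauAux_crd_del, tauAux_eq (f * crd j), ContinuousLinearMap.comp_apply, ContinuousLinearMap.comp_apply,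
    mulOp_mul, ContinuousLinearMap.comp_apply, mulOp_crd_hW]
  rfl

theorem exists_tau : ∃ τ : C(S15, ℂ) →L[ℂ] (L2 MI →L[ℂ] L2 MI), τ 1 = ContinuousLinearMap.id ℂ _ ∧
    (∀ f, ContinuousLinearMap.adjoint (τ f) = τ (star f)) ∧
    (∀ f a b, τ f (del a) b = ∫ x, f x * en a x * star (en b x) ∂sig) ∧
    (∀ j a, τ (crd j) (del a) = (wt j a : ℂ) • del (a + e1 j)) ∧
    (∀ f j, τ f ∘L τ (crd j) = τ (f * crd j)) :=
  ⟨tauAux, tauAux_one, adjoint_tauAux, tauAux_del_apply, tauAux_crd_del, tauAux_comp_crd⟩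

/-- Toeplitz operators. -/
def tau : C(S15, ℂ) →L[ℂ] (L2 MI →L[ℂ] L2 MI) := Classical.choose exists_tau

theorem tau_one : tau 1 = ContinuousLinearMap.id ℂ _ := (Classical.choose_spec exists_tau).1

theorem adjoint_tau (f : C(S15, ℂ)) : ContinuousLinearMap.adjoint (tau f) = tau (star f) :=
  (Classical.choose_spec exists_tau).2.1 f

theorem tau_del_apply (f : C(S15, ℂ)) (a b : MI) :
    tau f (del a) b = ∫ x, f x * en a x * star (en b x) ∂sig :=
  (Classical.choose_spec exists_tau).2.2.1 f a b

theorem tau_crd_del (j : Fin 8) (a : MI) : tau (crd j) (del a) = (wt j a : ℂ) • del (a + e1 j) :=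
  (Classical.choose_spec exists_tau).2.2.2.1 j a

theorem tau_comp_crd (f : C(S15, ℂ)) (j : Fin 8) : tau f ∘L tau (crd j) = tau (f * crd j) :=
  (Classical.choose_spec exists_tau).2.2.2.2 f j

theorem tau_star_crd_comp (f : C(S15, ℂ)) (j : Fin 8) :
    tau (star (crd j)) ∘L tau f = tau (star (crd j) * f) := by
  have := congrArg ContinuousLinearMap.adjoint (tau_comp_crd (star f) j)
  rw [ContinuousLinearMap.adjoint_comp, adjoint_tau, adjoint_tau, adjoint_tau] at this
  simpa [mul_comm (star (crd j))] using this

end Toeplitz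

section Diagonal
open Filter Topology
variable {X Y : Type}

theorem cpt_Pr_of_finite {A : Set X} (hA : A.Finite) : Cpt (Pr A) := by
  refine Cpt.of_finiteRange ?_
  haveI := hA.to_subtype
  haveI := Fintype.ofFinite A
  let L : (A → ℂ) →ₗ[ℂ] L2 X := Fintype.linearCombination ℂ (fun i : A => (del (i : X) : L2 X))
  have h : LinearMap.range (Pr A).toLinearMap ≤ LinearMap.range L := by
    classical
    rintro _ ⟨x, rfl⟩
    refine ⟨fun i => x i, ?_⟩
    ext j
    simp only [L, Fintype.linearCombination_apply]
    rw [lp.coeFn_sum]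
    change _ = Pr A x j
    rw [Pr_apply]
    simp only [Finset.sum_apply, lp.coeFn_smul, Pi.smul_apply, del_apply, smul_eq_mul, mul_ite, mul_one, mul_zero]
    split_ifs with hj
    · rw [Finset.sum_eq_single ⟨j, hj⟩]
      · simp
      · rintro b _ hb; rw [if_neg]; rintro rfl; exact hb rfl
      · simp
    · refine Finset.sum_eq_zero fun b _ => if_neg ?_
      rintro rfl; exact hj b.2
  exact (LinearMap.hasFiniteRange_iff_range).2 ((Module.Finite.iff_fg).1 (Submodule.finiteDimensional_of_le h))

theorem cpt_of_diag {T : L2 X →L[ℂ] L2 X} (c : X → ℂ) (h : ∀ a, T (del a) = c a • del a)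
    (hc : Tendsto c cofinite (𝓝 0)) : Cpt T := by
  classical
  refine Cpt.of_approx fun ε hε => ?_
  have hF : {a | ¬ ‖c a‖ < ε / 2}.Finite := by
    have := (Metric.tendsto_nhds.1 hc) (ε / 2) (by linarith)
    simpa [dist_zero_right] using this
  refine ⟨T ∘L Pr {a | ¬ ‖c a‖ < ε / 2}, (cpt_Pr_of_finite hF).clm_comp T, ?_⟩
  have hT : ∀ x i, T x i = c i * x i := by
    intro x i
    have : (innerSL ℂ (del i : L2 X)) ∘L T = c i • innerSL ℂ (del i : L2 X) := by
      refine clm_ext_del fun a => ?_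
      simp only [ContinuousLinearMap.comp_apply, innerSL_apply_apply, h, map_smul, inner_del, smul_apply,
        lp.coeFn_smul, Pi.smul_apply, del_apply, smul_eq_mul]
      by_cases hh : i = a <;> simp [hh]
    have := congrArg (fun L => L x) this
    simpa [inner_del] using this
  refine lt_of_le_of_lt (ContinuousLinearMap.opNorm_le_bound _ (by linarith : 0 ≤ ε / 2) fun x => ?_) (by linarith)
  have hb : ∀ i, ‖(T - T ∘L Pr {a | ¬ ‖c a‖ < ε / 2}) x i‖ ≤ ‖((ε / 2 : ℂ) • x) i‖ := by
    intro i
    change ‖T x i - T (Pr {a | ¬ ‖c a‖ < ε / 2} x) i‖ ≤ _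
    rw [hT, hT, Pr_apply, lp.coeFn_smul, Pi.smul_apply, norm_smul]
    have he : ‖(ε / 2 : ℂ)‖ = ε / 2 := by
      rw [show (ε / 2 : ℂ) = ((ε / 2 : ℝ) : ℂ) by push_cast; rfl, Complex.norm_real, Real.norm_of_nonneg (by linarith)]
    rw [he]
    split_ifs with hi
    · simp only [sub_self, norm_zero]; positivity
    · simp only [mem_setOf_eq, not_not] at hi
      rw [mul_zero, sub_zero, norm_mul]
      exact mul_le_mul_of_nonneg_right hi.le (norm_nonneg _)
  calc _ ≤ ‖(ε / 2 : ℂ) • x‖ := lp.norm_mono (by norm_num) hb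
    _ = ε / 2 * ‖x‖ := by
      rw [norm_smul, show (ε / 2 : ℂ) = ((ε / 2 : ℝ) : ℂ) by push_cast; rfl, Complex.norm_real, Real.norm_of_nonneg (by linarith)]

theorem cpt_of_del {T : L2 X →L[ℂ] L2 Y} (φ : X ↪ Y) (c : X → ℂ) (h : ∀ a, T (del a) = c a • del (φ a))
    (hc : Tendsto c cofinite (𝓝 0)) : Cpt T := by
  have h1 : Cpt (Rs φ ∘L T) := cpt_of_diag c (fun a => by
    rw [ContinuousLinearMap.comp_apply, h, map_smul, Rs_del_of]) hc
  have h2 : T = Is φ ∘L (Rs φ ∘L T) := clm_ext_del fun a => by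
    simp only [ContinuousLinearMap.comp_apply, h, map_smul, Rs_del_of, Is_del]
  rw [h2]
  exact h1.clm_comp _

end Diagonal

section ToeplitzCalculus
open Filter Topology

/-- The shift of multi-indices. -/
def shf (j : Fin 8) : MI ↪ MI := addRightEmbedding (e1 j)

theorem shf_apply (j : Fin 8) (a : MI) : shf j a = a + e1 j := rfl

theorem tendsto_deg : Tendsto (fun a : MI => ∑ i, (a i : ℝ)) cofinite atTop := by
  rw [tendsto_atTop]
  intro b
  obtain ⟨n, hn⟩ := exists_nat_ge b
  refine (Set.finite_Iic (fun _ : Fin 8 => n)).subset fun a ha => ?_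
  simp only [mem_compl_iff, mem_setOf_eq, not_le] at ha
  intro i
  have h1 : (a i : ℝ) ≤ ∑ i, (a i : ℝ) :=
    Finset.single_le_sum (f := fun i => (a i : ℝ)) (fun i _ => Nat.cast_nonneg _) (Finset.mem_univ i)
  have : (a i : ℝ) < n := by linarith
  exact_mod_cast this.le

theorem tendsto_aux : Tendsto (fun a : MI => Real.sqrt (1 / (∑ i, (a i : ℝ) + 8))) cofinite (𝓝 0) := by
  have h1 : Tendsto (fun a : MI => (∑ i, (a i : ℝ) + 8)) cofinite atTop :=
    tendsto_atTop_add_const_right _ _ tendsto_deg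
  have := (Real.continuous_sqrt.tendsto 0).comp (tendsto_inv_atTop_zero.comp h1)
  rw [Real.sqrt_zero] at this
  simpa only [one_div, Function.comp_def] using this

theorem sum_e1 (a : MI) (j : Fin 8) : ∑ i, ((a + e1 j) i : ℝ) = ∑ i, (a i : ℝ) + 1 := by
  simp only [Pi.add_apply, Nat.cast_add, Finset.sum_add_distrib]
  simp [e1, Pi.single_apply]

theorem abs_wt_sub (j k : Fin 8) (a : MI) :
    |wt k a - wt k (a + e1 j)| ≤ Real.sqrt (1 / (∑ i, (a i : ℝ) + 8)) := by
  have h0 := sum_cast_nonneg a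
  have hk : (a k : ℝ) ≤ ∑ i, (a i : ℝ) :=
    Finset.single_le_sum (f := fun i => (a i : ℝ)) (fun i _ => Nat.cast_nonneg _) (Finset.mem_univ k)
  have hk0 : (0:ℝ) ≤ a k := Nat.cast_nonneg _
  have hs : ∀ x y : ℝ, 0 ≤ y → y ≤ x → |Real.sqrt x - Real.sqrt y| ≤ Real.sqrt (x - y) := by
    intro x y hy hxy
    rw [abs_of_nonneg (sub_nonneg.2 (Real.sqrt_le_sqrt hxy))]
    rw [sub_le_iff_le_add]
    refine Real.sqrt_le_iff.2 ⟨by positivity, ?_⟩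
    nlinarith [Real.sq_sqrt hy, Real.sq_sqrt (sub_nonneg.2 hxy),
      mul_nonneg (Real.sqrt_nonneg (x - y)) (Real.sqrt_nonneg y)]
  have hs' : ∀ x y z : ℝ, 0 ≤ x → 0 ≤ y → |x - y| ≤ z → |Real.sqrt x - Real.sqrt y| ≤ Real.sqrt z := by
    intro x y z hx hy hz
    rcases le_total y x with h | h
    · exact (hs x y hy h).trans (Real.sqrt_le_sqrt ((le_abs_self _).trans hz))
    · rw [abs_sub_comm] at hz ⊢
      exact (hs y x hx h).trans (Real.sqrt_le_sqrt ((le_abs_self _).trans hz))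
  have hd : (0:ℝ) ≤ e1 j k ∧ (e1 j k : ℝ) ≤ 1 := by
    by_cases h : k = j
    · subst h; simp [e1]
    · simp [e1, h]
  rw [wt, wt, sum_e1]
  refine hs' _ _ _ (by positivity) (by positivity) ?_
  rw [Pi.add_apply, Nat.cast_add]
  set s := ∑ i, (a i : ℝ)
  set d : ℝ := (e1 j k : ℝ)
  rw [div_sub_div _ _ (by positivity) (by positivity), abs_div, abs_of_pos (by positivity : 0 < (s + 8) * (s + 1 + 8)),
    div_le_div_iff₀ (by positivity) (by positivity), one_mul]
  have : |(a k + 1 : ℝ) * (s + 1 + 8) - (s + 8) * (a k + d + 1)| ≤ s + 1 + 8 := by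
    rw [abs_le]; constructor <;> nlinarith
  nlinarith

theorem tendsto_wt_sub (j k : Fin 8) :
    Tendsto (fun a => ((wt k a - wt k (a + e1 j) : ℝ) : ℂ)) cofinite (𝓝 0) := by
  refine squeeze_zero_norm (fun a => ?_) tendsto_aux
  rw [Complex.norm_real]
  exact abs_wt_sub j k a

theorem wt_le_one (j : Fin 8) (a : MI) : |wt j a| ≤ 1 := by
  have hk : (a j : ℝ) ≤ ∑ i, (a i : ℝ) :=
    Finset.single_le_sum (f := fun i => (a i : ℝ)) (fun i _ => Nat.cast_nonneg _) (Finset.mem_univ j)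
  have hk0 : (0:ℝ) ≤ a j := Nat.cast_nonneg _
  rw [wt, abs_of_nonneg (Real.sqrt_nonneg _), Real.sqrt_le_one,
    div_le_one (by linarith)]; linarith

theorem shift_tau_crd (j k : Fin 8) :
    Ceq (Is (shf j) ∘L tau (crd k)) (tau (crd k) ∘L Is (shf j)) := by
  refine cpt_of_del ((shf k).trans (shf j)) _ (fun a => ?_) (tendsto_wt_sub j k)
  simp only [sub_apply, ContinuousLinearMap.comp_apply, tau_crd_del, map_smul, Is_del,
    Function.Embedding.trans_apply, shf_apply]
  rw [add_right_comm a, ← sub_smul, Complex.ofReal_sub]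

theorem Rs_shf_del_of_zero (j : Fin 8) (a : MI) (h : a j = 0) : Rs (shf j) (del a) = 0 := by
  refine Rs_del_of_notMem _ _ fun b hb => ?_
  rw [← hb] at h
  simp [shf_apply, e1] at h

theorem exists_shf (j : Fin 8) (a : MI) (h : a j ≠ 0) : ∃ b, a = shf j b := by
  refine ⟨a - e1 j, ?_⟩
  ext i
  by_cases hi : i = j
  · subst hi; simp [shf_apply, e1]; omega
  · simp [shf_apply, e1, hi]

theorem Is_Rs_shf (j : Fin 8) : Is (shf j) ∘L Rs (shf j) = Pr {a | a j ≠ 0} := by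
  refine clm_ext_del fun a => ?_
  rw [Pr_del, ContinuousLinearMap.comp_apply]
  split_ifs with h
  · obtain ⟨b, rfl⟩ := exists_shf j a h
    rw [Rs_del_of, Is_del]
  · rw [mem_setOf_eq, not_not] at h
    rw [Rs_shf_del_of_zero j a h, map_zero]

theorem tau_crd_Pr (j : Fin 8) : Cpt (tau (crd j) ∘L Pr {a | a j ≠ 0}ᶜ) := by
  classical
  refine cpt_of_del (shf j) (fun a => if a j = 0 then (wt j a : ℂ) else 0) (fun a => ?_) ?_
  · rw [ContinuousLinearMap.comp_apply, Pr_del]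
    by_cases h : a j = 0 <;> simp [h, tau_crd_del, shf_apply]
  · refine squeeze_zero_norm (fun a => ?_) tendsto_aux
    split_ifs with h
    · rw [Complex.norm_real, wt, h, Real.norm_of_nonneg (Real.sqrt_nonneg _)]; simp
    · rw [norm_zero]; exact Real.sqrt_nonneg _

theorem Rs_tau_crd (j k : Fin 8) :
    Ceq (Rs (shf j) ∘L tau (crd k)) (tau (crd k) ∘L Rs (shf j)) := by
  have h1 : Cpt (Rs (shf j) ∘L tau (crd k) ∘L Pr {a | a j ≠ 0}ᶜ) := by
    by_cases hjk : j = k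
    · subst hjk; exact (tau_crd_Pr j).clm_comp _
    · rw [show Rs (shf j) ∘L tau (crd k) ∘L Pr {a | a j ≠ 0}ᶜ = 0 from clm_ext_del fun a => ?_]
      · exact Cpt.zero
      · simp only [ContinuousLinearMap.comp_apply, Pr_del]
        split_ifs with h
        · simp only [mem_compl_iff, mem_setOf_eq, not_not] at h
          rw [tau_crd_del, map_smul, Rs_shf_del_of_zero, smul_zero]; rfl
          simp [e1, h, hjk]
        · simp
  have h2 := ((shift_tau_crd j k).clm_comp (Rs (shf j))).comp_clm (Rs (shf j))
  calc Rs (shf j) ∘L tau (crd k)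
    Ceq _ (Rs (shf j) ∘L tau (crd k) ∘L Pr {a | a j ≠ 0} + Rs (shf j) ∘L tau (crd k) ∘L Pr {a | a j ≠ 0}ᶜ) := by
        refine Ceq.of_eq ?_
        rw [← ContinuousLinearMap.comp_add, ← ContinuousLinearMap.comp_add, Pr_add_Pr disjoint_compl_right,
          union_compl_self, Pr_univ]; rfl
    Ceq _ (Rs (shf j) ∘L tau (crd k) ∘L Pr {a | a j ≠ 0} + 0) := (Ceq.refl _).add (ceq_zero_iff.2 h1)
    Ceq _ _ := by
      rw [add_zero, ← Is_Rs_shf]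
      refine Ceq.trans h2.symm (Ceq.of_eq ?_)
      rw [← ContinuousLinearMap.comp_assoc, Rs_comp_Is, ContinuousLinearMap.id_comp]

theorem Rs_shf_adjoint_tau_crd (j k : Fin 8) :
    Ceq (Is (shf j) ∘L tau (star (crd k))) (tau (star (crd k)) ∘L Is (shf j)) := by
  have := (Rs_tau_crd j k).adjoint
  rw [ContinuousLinearMap.adjoint_comp, ContinuousLinearMap.adjoint_comp, adjoint_tau, adjoint_Rs] at this
  exact this.symm

theorem tau_star_crd_shf (j : Fin 8) (a : MI) :
    tau (star (crd j)) (Is (shf j) (del a)) = (wt j a : ℂ) • del a := by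
  ext b
  rw [← inner_del, ← adjoint_tau, ContinuousLinearMap.adjoint_inner_right, tau_crd_del, inner_smul_left,
    inner_del, Is_del, del_apply, shf_apply, lp.coeFn_smul, Pi.smul_apply, del_apply]
  by_cases h : b = a <;> simp [h]

theorem tau_crd_eq (j : Fin 8) : tau (crd j) = Is (shf j) ∘L (Rs (shf j) ∘L tau (crd j)) := by
  refine clm_ext_del fun a => ?_
  simp only [ContinuousLinearMap.comp_apply, tau_crd_del, map_smul, ← shf_apply, Rs_del_of, Is_del]

theorem tau_crd_star_comm (j k : Fin 8) :
    Ceq (tau (crd j) ∘L tau (star (crd k))) (tau (star (crd k)) ∘L tau (crd j)) := by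
  have h1 : Ceq (tau (star (crd j)) ∘L Is (shf j) ∘L tau (crd k))
      (tau (crd k) ∘L tau (star (crd j)) ∘L Is (shf j)) := by
    refine cpt_of_del (shf k) (fun a => -((wt j a - wt j (a + e1 k) : ℝ) : ℂ) * wt k a) (fun a => ?_) ?_
    · simp only [sub_apply, ContinuousLinearMap.comp_apply, tau_star_crd_shf, map_smul,
        tau_crd_del, shf_apply, smul_smul]
      rw [← sub_smul]
      congr 1
      push_cast; ring
    · refine squeeze_zero_norm (a := fun a => ‖((wt j a - wt j (a + e1 k) : ℝ) : ℂ)‖) (fun a => ?_) ?_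
      · rw [norm_mul, norm_neg]
        refine mul_le_of_le_one_right (norm_nonneg _) ?_
        rw [Complex.norm_real]; exact wt_le_one k a
      · simpa using (tendsto_wt_sub k j).norm
  have h2 := h1.adjoint
  simp only [ContinuousLinearMap.adjoint_comp, adjoint_tau, star_star, adjoint_Is] at h2
  calc tau (crd j) ∘L tau (star (crd k))
    Ceq _ (Is (shf j) ∘L (Rs (shf j) ∘L tau (crd j)) ∘L tau (star (crd k))) := by
      conv_lhs => rw [tau_crd_eq j]
      exact Ceq.refl _
    Ceq _ (Is (shf j) ∘L tau (star (crd k)) ∘L (Rs (shf j) ∘L tau (crd j))) := h2.symm.clm_comp _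
    Ceq _ (tau (star (crd k)) ∘L Is (shf j) ∘L (Rs (shf j) ∘L tau (crd j))) :=
      (Rs_shf_adjoint_tau_crd j k).comp_clm _
    Ceq _ _ := by rw [← tau_crd_eq j]; exact Ceq.refl _

/-- Induction principle for continuous functions on the sphere. -/
theorem sphere_induction {P : C(S15, ℂ) → Prop} (hcl : IsClosed {f | P f}) (hone : P 1)
    (hsmul : ∀ (c : ℂ) f, P f → P (c • f)) (hadd : ∀ f g, P f → P g → P (f + g))
    (hz : ∀ j f, P f → P (crd j * f)) (hzs : ∀ j f, P f → P (star (crd j) * f)) (f : C(S15, ℂ)) : P f := by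
  have key : ∀ f ∈ (StarAlgebra.adjoin ℂ (range crd)), ∀ g, P g → P (f * g) := by
    intro f hf
    rw [← StarSubalgebra.mem_toSubalgebra, StarAlgebra.adjoin_toSubalgebra] at hf
    induction hf using Algebra.adjoin_induction with
    | mem x hx =>
      rcases hx with ⟨j, rfl⟩ | hx
      · exact hz j
      · obtain ⟨j, hj⟩ := Set.mem_star.1 hx
        rw [← star_star x, ← hj]
        exact hzs j
    | algebraMap r =>
      intro g hg
      rw [Algebra.algebraMap_eq_smul_one, smul_mul_assoc, one_mul]
      exact hsmul r g hg
    | add x y _ _ h1 h2 =>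
      intro g hg
      rw [add_mul]
      exact hadd _ _ (h1 g hg) (h2 g hg)
    | mul x y _ _ h1 h2 =>
      intro g hg
      rw [mul_assoc]
      exact h1 _ (h2 g hg)
  have htop := ContinuousMap.starSubalgebra_topologicalClosure_eq_top_of_separatesPoints
    (StarAlgebra.adjoin ℂ (range crd)) (by
      intro x y hxy
      have : ∃ j, (x : E8) j ≠ (y : E8) j := by
        by_contra! h
        exact hxy (Subtype.ext (PiLp.ext h))
      obtain ⟨j, hj⟩ := this
      exact ⟨crd j, ⟨crd j, StarAlgebra.subset_adjoin ℂ _ ⟨j, rfl⟩, rfl⟩, hj⟩)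
  have hf : f ∈ closure ((StarAlgebra.adjoin ℂ (range crd) : StarSubalgebra ℂ C(S15, ℂ)) : Set C(S15, ℂ)) := by
    have : f ∈ (StarAlgebra.adjoin ℂ (range crd)).topologicalClosure := by rw [htop]; trivial
    exact this
  exact closure_minimal (fun g hg => by simpa using key g hg 1 hone) hcl hf

theorem isClosed_cpt {E F : Type*} [NormedAddCommGroup E] [NormedSpace ℂ E] [NormedAddCommGroup F]
    [NormedSpace ℂ F] : IsClosed {T : E →L[ℂ] F | Cpt T} := by
  refine isClosed_of_closure_subset fun T hT => Cpt.of_approx fun ε hε => ?_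
  obtain ⟨R, hR, h⟩ := Metric.mem_closure_iff.1 hT ε hε
  exact ⟨R, hR, by rwa [dist_eq_norm] at h⟩

theorem isClosed_ceq {E F Z : Type*} [NormedAddCommGroup E] [NormedSpace ℂ E] [NormedAddCommGroup F]
    [NormedSpace ℂ F] [TopologicalSpace Z] {A B : Z → E →L[ℂ] F} (hA : Continuous A) (hB : Continuous B) :
    IsClosed {f | Ceq (A f) (B f)} :=
  isClosed_cpt.preimage (hA.sub hB)

theorem tau_crd_comm (j : Fin 8) (f : C(S15, ℂ)) :
    Ceq (tau (crd j) ∘L tau f) (tau f ∘L tau (crd j)) := by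
  induction f using sphere_induction with
  | hcl => exact isClosed_ceq (by fun_prop) (by fun_prop)
  | hone => rw [tau_one, ContinuousLinearMap.comp_id, ContinuousLinearMap.id_comp]; exact Ceq.refl _
  | hsmul c f h =>
    rw [map_smul, ContinuousLinearMap.comp_smul, ContinuousLinearMap.smul_comp]
    exact h.smul c
  | hadd f g h h' =>
    rw [map_add, ContinuousLinearMap.comp_add, ContinuousLinearMap.add_comp]
    exact h.add h'
  | hz k f h =>
    rw [mul_comm, ← tau_comp_crd, ← ContinuousLinearMap.comp_assoc]
    refine (h.comp_clm _).trans (Ceq.of_eq ?_)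
    rw [ContinuousLinearMap.comp_assoc, ContinuousLinearMap.comp_assoc, tau_comp_crd, tau_comp_crd, mul_comm]
  | hzs k f h =>
    rw [← tau_star_crd_comp, ContinuousLinearMap.comp_assoc, ← ContinuousLinearMap.comp_assoc]
    refine ((tau_crd_star_comm j k).comp_clm (tau f)).trans ?_
    rw [ContinuousLinearMap.comp_assoc]
    exact h.clm_comp _

theorem tau_mul (f g : C(S15, ℂ)) : Ceq (tau f ∘L tau g) (tau (f * g)) := by
  revert g
  induction f using sphere_induction with
  | hcl =>
    simp only [setOf_forall]
    exact isClosed_iInter fun g => isClosed_ceq (by fun_prop) (by fun_prop)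
  | hone => intro g; rw [tau_one, one_mul, ContinuousLinearMap.id_comp]; exact Ceq.refl _
  | hsmul c f h =>
    intro g
    rw [map_smul, smul_mul_assoc, map_smul, ContinuousLinearMap.smul_comp]
    exact (h g).smul c
  | hadd f f' h h' =>
    intro g
    rw [map_add, add_mul, map_add, ContinuousLinearMap.add_comp]
    exact (h g).add (h' g)
  | hz k f h =>
    intro g
    rw [mul_comm, ← tau_comp_crd]
    rw [ContinuousLinearMap.comp_assoc]
    refine Ceq.trans ((tau_crd_comm k g).clm_comp (tau f)) ?_
    rw [← ContinuousLinearMap.comp_assoc, ContinuousLinearMap.comp_assoc, tau_comp_crd, show f * crd k * g = f * (g * crd k) by ring]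
    exact h _
  | hzs k f h =>
    intro g
    rw [← tau_star_crd_comp, mul_assoc, ← tau_star_crd_comp, ContinuousLinearMap.comp_assoc]
    exact (h g).clm_comp _

theorem tau_shift (j : Fin 8) (f : C(S15, ℂ)) :
    Ceq (Is (shf j) ∘L tau f) (tau f ∘L Is (shf j)) := by
  induction f using sphere_induction with
  | hcl => exact isClosed_ceq (by fun_prop) (by fun_prop)
  | hone => rw [tau_one, ContinuousLinearMap.comp_id, ContinuousLinearMap.id_comp]; exact Ceq.refl _
  | hsmul c f h =>
    rw [map_smul, ContinuousLinearMap.comp_smul, ContinuousLinearMap.smul_comp]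
    exact h.smul c
  | hadd f g h h' =>
    rw [map_add, ContinuousLinearMap.comp_add, ContinuousLinearMap.add_comp]
    exact h.add h'
  | hz k f h =>
    rw [mul_comm, ← tau_comp_crd, ← ContinuousLinearMap.comp_assoc]
    refine (h.comp_clm (tau (crd k))).trans ?_
    rw [ContinuousLinearMap.comp_assoc, ContinuousLinearMap.comp_assoc]
    exact (shift_tau_crd j k).clm_comp (tau f)
  | hzs k f h =>
    rw [← tau_star_crd_comp, ← ContinuousLinearMap.comp_assoc]
    refine ((Rs_shf_adjoint_tau_crd j k).comp_clm (tau f)).trans ?_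
    rw [ContinuousLinearMap.comp_assoc, ContinuousLinearMap.comp_assoc]
    exact h.clm_comp (tau (star (crd k)))

/-- Multi-indices supported in `J`. -/
def NJ (J : Set (Fin 8)) : Set MI := {a | ∀ k ∉ J, a k = 0}

theorem tau_crd_NJ_of_notMem {J : Set (Fin 8)} {j : Fin 8} (hj : j ∉ J) : Cpt (tau (crd j) ∘L Pr (NJ J)) := by
  have : Pr (NJ J) = Pr {a | a j ≠ 0}ᶜ ∘L Pr (NJ J) := by
    rw [Pr_comp_of_subset]
    intro a ha
    simpa using ha j hj
  rw [this, ← ContinuousLinearMap.comp_assoc]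
  exact (tau_crd_Pr j).comp_clm (Pr (NJ J))

theorem tau_star_crd_del (j : Fin 8) (a : MI) (h : a j = 0) : tau (star (crd j)) (del a) = 0 := by
  ext b
  rw [← inner_del, ← adjoint_tau, ContinuousLinearMap.adjoint_inner_right, tau_crd_del, inner_smul_left,
    inner_del, del_apply, if_neg]
  · simp
  · intro hh
    rw [← hh] at h
    simp [e1] at h

theorem tau_star_crd_NJ_of_notMem {J : Set (Fin 8)} {j : Fin 8} (hj : j ∉ J) :
    tau (star (crd j)) ∘L Pr (NJ J) = 0 := by
  refine clm_ext_del fun a => ?_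
  rw [ContinuousLinearMap.comp_apply, Pr_del]
  split_ifs with h
  · rw [tau_star_crd_del j a (h j hj)]; rfl
  · rw [map_zero]; rfl

/-- The coordinate subsphere indexed by `J`. -/
def SJ (J : Set (Fin 8)) : Set S15 := {x | ∀ k ∉ J, (x : E8) k = 0}

theorem tau_NJ_cpt {J : Set (Fin 8)} {f : C(S15, ℂ)} (hf : ∀ x ∈ SJ J, f x = 0) :
    Cpt (tau f ∘L Pr (NJ J)) := by
  let K : Ideal C(S15, ℂ) :=
    { carrier := {f | Cpt (tau f ∘L Pr (NJ J))}
      add_mem' := fun {a b} ha hb => by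
        rw [mem_setOf_eq] at *
        rw [map_add, ContinuousLinearMap.add_comp]; exact Cpt.add ha hb
      zero_mem' := by
        rw [mem_setOf_eq, map_zero, ContinuousLinearMap.zero_comp]; exact Cpt.zero
      smul_mem' := fun c {f} hf => by
        rw [mem_setOf_eq] at *
        have := (tau_mul c f).symm.comp_clm (Pr (NJ J))
        rw [ContinuousLinearMap.comp_assoc] at this
        exact ((Cpt.congr_right this).2 (hf.clm_comp _)) }
  have hK : IsClosed (K : Set C(S15, ℂ)) := by
    change IsClosed {f | Cpt (tau f ∘L Pr (NJ J))}
    exact isClosed_cpt.preimage (by fun_prop)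
  have h := ContinuousMap.idealOfSet_ofIdeal_isClosed hK
  have hmem : f ∈ ContinuousMap.idealOfSet ℂ (ContinuousMap.setOfIdeal K) := by
    rw [ContinuousMap.mem_idealOfSet]
    intro x hx
    refine hf x fun k hk => ?_
    rw [mem_compl_iff, ContinuousMap.mem_setOfIdeal] at hx
    push Not at hx
    exact hx (crd k) (tau_crd_NJ_of_notMem hk)
  rw [h] at hmem
  exact hmem

theorem tau_NJ (J : Set (Fin 8)) (f : C(S15, ℂ)) :
    Ceq (tau f ∘L Pr (NJ J)) (Pr (NJ J) ∘L tau f ∘L Pr (NJ J)) := by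
  have hz : ∀ j, Ceq (tau (crd j) ∘L Pr (NJ J)) (Pr (NJ J) ∘L tau (crd j) ∘L Pr (NJ J)) := by
    intro j
    by_cases hj : j ∈ J
    · refine Ceq.of_eq (clm_ext_del fun a => ?_)
      simp only [ContinuousLinearMap.comp_apply, Pr_del]
      split_ifs with h
      · rw [tau_crd_del, map_smul, Pr_del, if_pos]
        intro k hk
        have : k ≠ j := by rintro rfl; exact hk hj
        simp [h k hk, e1, this]
      · simp
    · exact ((tau_crd_NJ_of_notMem hj).sub ((tau_crd_NJ_of_notMem hj).clm_comp (Pr (NJ J))))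
  have hzs : ∀ j, Ceq (tau (star (crd j)) ∘L Pr (NJ J)) (Pr (NJ J) ∘L tau (star (crd j)) ∘L Pr (NJ J)) := by
    intro j
    by_cases hj : j ∈ J
    · refine Ceq.of_eq (clm_ext_del fun a => ?_)
      simp only [ContinuousLinearMap.comp_apply, Pr_del]
      split_ifs with h
      · by_cases h0 : a j = 0
        · rw [tau_star_crd_del j a h0, map_zero]
        · obtain ⟨b, rfl⟩ := exists_shf j a h0
          rw [← Is_del, tau_star_crd_shf, map_smul, Pr_del, if_pos]
          intro k hk
          have := h k hk
          rw [shf_apply] at this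
          exact (Nat.add_eq_zero_iff.1 this).1
      · simp
    · rw [tau_star_crd_NJ_of_notMem hj, ContinuousLinearMap.comp_zero]; exact Ceq.refl _
  have hmul : ∀ g f, Ceq (tau g ∘L Pr (NJ J)) (Pr (NJ J) ∘L tau g ∘L Pr (NJ J)) →
      Ceq (tau f ∘L Pr (NJ J)) (Pr (NJ J) ∘L tau f ∘L Pr (NJ J)) →
      Ceq (tau (g * f) ∘L Pr (NJ J)) (Pr (NJ J) ∘L tau (g * f) ∘L Pr (NJ J)) := by
    intro g f hg hf
    have h1 : Ceq (tau (g * f) ∘L Pr (NJ J)) (tau g ∘L Pr (NJ J) ∘L tau f ∘L Pr (NJ J)) := by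
      refine ((tau_mul g f).symm.comp_clm (Pr (NJ J))).trans ?_
      rw [ContinuousLinearMap.comp_assoc]
      exact hf.clm_comp (tau g)
    have h2 : Ceq (tau g ∘L Pr (NJ J) ∘L tau f ∘L Pr (NJ J)) (Pr (NJ J) ∘L tau g ∘L Pr (NJ J) ∘L tau f ∘L Pr (NJ J)) := by
      have := hg.comp_clm (tau f ∘L Pr (NJ J))
      rwa [ContinuousLinearMap.comp_assoc, ContinuousLinearMap.comp_assoc, ContinuousLinearMap.comp_assoc] at this
    exact (h1.trans h2).trans (h1.symm.clm_comp (Pr (NJ J)))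
  induction f using sphere_induction with
  | hcl => exact isClosed_ceq (by fun_prop) (by fun_prop)
  | hone => rw [tau_one, ContinuousLinearMap.id_comp, Pr_comp_Pr, inter_self]; exact Ceq.refl _
  | hsmul c f h =>
    rw [map_smul, ContinuousLinearMap.smul_comp, ContinuousLinearMap.comp_smul]
    exact h.smul c
  | hadd f g h h' =>
    rw [map_add, ContinuousLinearMap.add_comp, ContinuousLinearMap.comp_add]
    exact h.add h'
  | hz k f h => exact hmul _ _ (hz k) h
  | hzs k f h => exact hmul _ _ (hzs k) h

end ToeplitzCalculus

section MatrixToeplitz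

variable {n : Type}

/-- The slice of `MI × n` at `i`. -/
def sl (i : n) : MI ↪ MI × n := ⟨fun a => (a, i), fun _ _ h => congrArg Prod.fst h⟩

theorem sl_apply (i : n) (a : MI) : sl i a = (a, i) := rfl

theorem Rs_sl_del (i : n) [DecidableEq n] (p : MI × n) :
    Rs (sl i) (del p) = if p.2 = i then del p.1 else 0 := by
  obtain ⟨a, j⟩ := p
  split_ifs with h
  · cases h; exact Rs_del_of (sl j) a
  · exact Rs_del_of_notMem _ _ fun b hb => h (congrArg Prod.snd hb).symm

variable [Fintype n]

/-- The Toeplitz operator of a matrix symbol. -/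
def op (D : Matrix n n C(S15, ℂ)) : L2 (MI × n) →L[ℂ] L2 (MI × n) :=
  ∑ i, ∑ j, Is (sl i) ∘L tau (D i j) ∘L Rs (sl j)

theorem op_del (D : Matrix n n C(S15, ℂ)) (a : MI) (j : n) :
    op D (del (a, j)) = ∑ i, Is (sl i) (tau (D i j) (del a)) := by
  classical
  simp only [op, sum_apply, ContinuousLinearMap.comp_apply, Rs_sl_del]
  refine Finset.sum_congr rfl fun i _ => ?_
  rw [Finset.sum_eq_single j]
  · simp
  · intro k _ hk; rw [if_neg (Ne.symm hk), map_zero, map_zero]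
  · simp

theorem Is_sl_apply [DecidableEq n] (i : n) (x : L2 MI) (p : MI × n) :
    Is (sl i) x p = if p.2 = i then x p.1 else 0 := by
  obtain ⟨a, j⟩ := p
  split_ifs with h
  · cases h; exact Is_apply (sl j) x a
  · exact Is_apply_of_notMem _ _ _ fun b hb => h (congrArg Prod.snd hb).symm

theorem op_del_apply (D : Matrix n n C(S15, ℂ)) (a b : MI) (i j : n) :
    op D (del (a, j)) (b, i) = tau (D i j) (del a) b := by
  classical
  rw [op_del, lp.coeFn_sum, Finset.sum_apply]
  simp [Is_sl_apply]

theorem op_comp_Is (D : Matrix n n C(S15, ℂ)) (j : n) :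
    op D ∘L Is (sl j) = ∑ i, Is (sl i) ∘L tau (D i j) := by
  refine clm_ext_del fun a => ?_
  rw [ContinuousLinearMap.comp_apply, Is_del, sl_apply, op_del, sum_apply]
  rfl

theorem ceq_of_slices {E : Type*} [NormedAddCommGroup E] [NormedSpace ℂ E] {T S : L2 (MI × n) →L[ℂ] E}
    (h : ∀ j, Ceq (T ∘L Is (sl j)) (S ∘L Is (sl j))) : Ceq T S := by
  classical
  have e : ∀ T : L2 (MI × n) →L[ℂ] E, T = ∑ j, (T ∘L Is (sl j)) ∘L Rs (sl j) := by
    intro T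
    refine clm_ext_del fun p => ?_
    simp only [sum_apply, ContinuousLinearMap.comp_apply, Rs_sl_del]
    rw [Finset.sum_eq_single p.2]
    · simp [sl_apply]
    · intro k _ hk; rw [if_neg (Ne.symm hk), map_zero, map_zero]
    · simp
  rw [e T, e S]
  exact Ceq.sum _ fun j _ => (h j).comp_clm _

theorem op_mul (D E : Matrix n n C(S15, ℂ)) : Ceq (op D ∘L op E) (op (D * E)) := by
  refine ceq_of_slices fun j => ?_
  rw [clm_comp_assoc, op_comp_Is, op_comp_Is, ContinuousLinearMap.comp_finsetSum]
  simp only [Matrix.mul_apply, map_sum, ContinuousLinearMap.comp_finsetSum]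
  rw [Finset.sum_comm]
  refine Ceq.sum _ fun k _ => ?_
  rw [← clm_comp_assoc, op_comp_Is, ContinuousLinearMap.finsetSum_comp]
  refine Ceq.sum _ fun i _ => ?_
  rw [clm_comp_assoc]
  exact (tau_mul _ _).clm_comp _

theorem op_sub (D E : Matrix n n C(S15, ℂ)) : op (D - E) = op D - op E := by
  simp only [op, Matrix.sub_apply, map_sub, ContinuousLinearMap.comp_sub, ContinuousLinearMap.sub_comp,
    Finset.sum_sub_distrib]

theorem op_one [DecidableEq n] : op (1 : Matrix n n C(S15, ℂ)) = ContinuousLinearMap.id ℂ _ := by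
  refine clm_ext_del fun p => ?_
  obtain ⟨a, j⟩ := p
  rw [op_del, Finset.sum_eq_single j]
  · rw [Matrix.one_apply_eq, tau_one]; exact Is_del _ _
  · intro k _ hk; rw [Matrix.one_apply_ne hk, map_zero]; exact map_zero _
  · simp

theorem adjoint_op (D : Matrix n n C(S15, ℂ)) : ContinuousLinearMap.adjoint (op D) = op D.conjTranspose := by
  simp only [op, map_sum, ContinuousLinearMap.adjoint_comp, adjoint_Is, adjoint_Rs, adjoint_tau,
    Matrix.conjTranspose_apply]
  rw [Finset.sum_comm]
  simp only [clm_comp_assoc]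

theorem continuous_op {Z : Type*} [TopologicalSpace Z] {D : Z → Matrix n n C(S15, ℂ)} {s : Set Z}
    (h : ∀ i j, ContinuousOn (fun t => D t i j) s) : ContinuousOn (fun t => op (D t)) s := by
  refine continuousOn_finsetSum _ fun i _ => continuousOn_finsetSum _ fun j _ => ?_
  exact continuousOn_const.clm_comp ((tau.continuous.comp_continuousOn (h i j)).clm_comp continuousOn_const)

/-- The part of `MI × n` over the multi-indices supported in `J`. -/
def YN (n : Type) (J : Set (Fin 8)) : Set (MI × n) := {p | p.1 ∈ NJ J}

theorem Pr_YN_Is (J : Set (Fin 8)) (j : n) : Pr (YN n J) ∘L Is (sl j) = Is (sl j) ∘L Pr (NJ J) := by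
  classical
  refine clm_ext_del fun a => ?_
  simp only [ContinuousLinearMap.comp_apply, Is_del, Pr_del]
  have : (sl j a ∈ YN n J) ↔ a ∈ NJ J := Iff.rfl
  by_cases h : a ∈ NJ J <;> simp [this, h]

theorem op_cpt {D : Matrix n n C(S15, ℂ)} {J : Set (Fin 8)} (h : ∀ x ∈ SJ J, ∀ i j, D i j x = 0) :
    Cpt (op D ∘L Pr (YN n J)) := by
  rw [← ceq_zero_iff]
  refine ceq_of_slices fun j => ?_
  rw [clm_comp_assoc, Pr_YN_Is, ← clm_comp_assoc, op_comp_Is, ContinuousLinearMap.zero_comp,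
    ContinuousLinearMap.finsetSum_comp, ← Finset.sum_const_zero (s := (Finset.univ : Finset n))]
  refine Ceq.sum _ fun i _ => ?_
  rw [ceq_zero_iff, clm_comp_assoc]
  exact (tau_NJ_cpt fun x hx => h x hx i j).clm_comp _

theorem op_ceq {D E : Matrix n n C(S15, ℂ)} {J : Set (Fin 8)} (h : ∀ x ∈ SJ J, ∀ i j, D i j x = E i j x) :
    Ceq (op D ∘L Pr (YN n J)) (op E ∘L Pr (YN n J)) := by
  have := op_cpt (D := D - E) (J := J) fun x hx i j => by
    rw [Matrix.sub_apply, ContinuousMap.sub_apply, h x hx, sub_self]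
  rwa [op_sub, ContinuousLinearMap.sub_comp] at this

theorem op_YN (D : Matrix n n C(S15, ℂ)) (J : Set (Fin 8)) :
    Ceq (op D ∘L Pr (YN n J)) (Pr (YN n J) ∘L op D ∘L Pr (YN n J)) := by
  refine ceq_of_slices fun j => ?_
  rw [clm_comp_assoc, clm_comp_assoc, clm_comp_assoc, Pr_YN_Is, ← clm_comp_assoc (op D), op_comp_Is,
    ContinuousLinearMap.finsetSum_comp, ContinuousLinearMap.comp_finsetSum]
  refine Ceq.sum _ fun i _ => ?_
  rw [clm_comp_assoc, ← clm_comp_assoc (Pr (YN n J)), Pr_YN_Is, clm_comp_assoc]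
  exact (tau_NJ J _).clm_comp _

/-- `A` is invariant under the operator with symbol `D`. -/
def Stab (D : Matrix n n C(S15, ℂ)) (A : Set (MI × n)) : Prop :=
  ∀ a b i j, tau (D i j) (del a) b ≠ 0 → ((a, j) ∈ A ↔ (b, i) ∈ A)

theorem Stab.comm {D : Matrix n n C(S15, ℂ)} {A : Set (MI × n)} (h : Stab D A) :
    op D ∘L Pr A = Pr A ∘L op D := by
  classical
  refine clm_ext_del fun p => ?_
  obtain ⟨a, j⟩ := p
  ext ⟨b, i⟩
  rw [ContinuousLinearMap.comp_apply, ContinuousLinearMap.comp_apply, Pr_del, Pr_apply]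
  have := h a b i j
  rw [← op_del_apply] at this
  by_cases h0 : op D (del (a, j)) (b, i) = 0
  · rw [h0]
    split_ifs <;> simp [h0]
  · have := this h0
    by_cases h1 : (a, j) ∈ A
    · rw [if_pos h1, if_pos (this.1 h1)]
    · rw [if_neg h1, if_neg (fun hh => h1 (this.2 hh))]; simp

theorem Stab.univ (D : Matrix n n C(S15, ℂ)) : Stab D Set.univ := fun _ _ _ _ _ => by simp

/-- An odd self-adjoint symbol squaring to one over the subsphere of `J`. -/
structure Cliff (D : Matrix n n C(S15, ℂ)) (par : n → Bool) (J : Set (Fin 8)) : Prop where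
  herm : ∀ i j, star (D i j) = D j i
  odd : ∀ i j, par i = par j → D i j = 0
  sq : ∀ x ∈ SJ J, ∀ i j, ∑ k, D i k x * D k j x = open Classical in if i = j then 1 else 0

theorem SJ_mono {J K : Set (Fin 8)} (h : J ⊆ K) : SJ J ⊆ SJ K := fun _ hx k hk => hx k fun hh => hk (h hh)

theorem Cliff.mono {D : Matrix n n C(S15, ℂ)} {par : n → Bool} {J K : Set (Fin 8)} (h : Cliff D par K)
    (hJ : J ⊆ K) : Cliff D par J := ⟨h.herm, h.odd, fun x hx => h.sq x (SJ_mono hJ hx)⟩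

theorem Cliff.good {D : Matrix n n C(S15, ℂ)} {par : n → Bool} {J : Set (Fin 8)} (h : Cliff D par J)
    {A : Set (MI × n)} (hA : Stab D A) : Good (op D) (fun p => par p.2) (YN n J ∩ A) where
  sa := by
    rw [adjoint_op]; congr 1; ext1 i j; exact h.herm j i
  odd := by
    rintro ⟨a, j⟩ ⟨b, i⟩ hp
    rw [op_del_apply, h.odd i j hp.symm, map_zero]; rfl
  loc := by
    have h1 := (op_YN D J).comp_clm (Pr A)
    rw [clm_comp_assoc, clm_comp_assoc, clm_comp_assoc, Pr_comp_Pr] at h1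
    refine h1.trans (Ceq.of_eq ?_)
    rw [← Pr_comp_Pr, clm_comp_assoc, ← clm_comp_assoc (Pr A), ← hA.comm, Pr_comp_Pr,
      clm_comp_assoc (op D), Pr_comp_Pr, inter_left_comm, inter_self]
  inv := by
    classical
    have h1 := (op_mul D D).comp_clm (Pr (YN n J))
    have h2 : Ceq (op (D * D) ∘L Pr (YN n J)) (op 1 ∘L Pr (YN n J)) := op_ceq fun x hx i j => by
      rw [Matrix.mul_apply, ContinuousMap.sum_apply, Matrix.one_apply]
      simp only [ContinuousMap.mul_apply]
      rw [h.sq x hx i j]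
      split_ifs <;> simp
    have h3 := (h1.trans h2).comp_clm (Pr A)
    rwa [op_one, ContinuousLinearMap.id_comp, Pr_comp_Pr, clm_comp_assoc, clm_comp_assoc, Pr_comp_Pr] at h3

/-- The index of the symbol `D` over `J`, restricted to an invariant subset. -/
def idx (D : Matrix n n C(S15, ℂ)) (par : n → Bool) (J : Set (Fin 8)) (A : Set (MI × n)) : ℤ :=
  sidx (op D) (fun p => par p.2) (YN n J ∩ A)

end MatrixToeplitz

theorem Good.diff {X : Type} {T : L2 X →L[ℂ] L2 X} {p : X → Bool} {A C : Set X} (hA : Good T p A)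
    (hC : Good T p C) (h : C ⊆ A) : Good T p (A \ C) where
  sa := hA.sa
  odd := hA.odd
  loc := by
    have h1 := hA.loc.comp_clm (Pr (A \ C))
    rw [clm_comp_assoc, clm_comp_assoc, clm_comp_assoc, Pr_comp_of_subset diff_subset] at h1
    have e : Pr A = Pr C + Pr (A \ C) := by
      rw [Pr_add_Pr disjoint_sdiff_self_right, union_diff_cancel h]
    have h2 := hC.loc_adj.comp_clm (Pr (A \ C))
    rw [clm_comp_assoc, clm_comp_assoc, clm_comp_assoc, Pr_comp_Pr, inter_diff_self, Pr_empty,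
      ContinuousLinearMap.comp_zero, ContinuousLinearMap.comp_zero] at h2
    refine h1.trans ?_
    rw [e, ContinuousLinearMap.add_comp]
    simpa using h2.add (Ceq.refl (Pr (A \ C) ∘L T ∘L Pr (A \ C)))
  inv := by
    have h1 := hA.inv.comp_clm (Pr (A \ C))
    rwa [clm_comp_assoc, clm_comp_assoc, Pr_comp_of_subset diff_subset] at h1

section Idx

variable {n : Type} [Fintype n] {D D' : Matrix n n C(S15, ℂ)} {par : n → Bool} {J : Set (Fin 8)}
  {A B : Set (MI × n)}

theorem idx_set (h : ∀ p ∈ YN n J, p ∈ A ↔ p ∈ B) : idx D par J A = idx D par J B := by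
  have : YN n J ∩ A = YN n J ∩ B := by
    ext p; exact and_congr_right fun hp => h p hp
  rw [idx, idx, this]

theorem idx_congr (hD : Cliff D par J) (hA : Stab D A) (h : ∀ x ∈ SJ J, ∀ i j, D' i j x = D i j x) :
    idx D' par J A = idx D par J A := by
  refine (hD.good hA).sidx_congr ?_
  have := (op_ceq h).comp_clm (Pr A)
  rwa [clm_comp_assoc, clm_comp_assoc, Pr_comp_Pr] at this

theorem idx_path {D : ℝ → Matrix n n C(S15, ℂ)} (hc : ∀ i j, ContinuousOn (fun t => D t i j) (Icc 0 1))
    (hD : ∀ t ∈ Icc (0:ℝ) 1, Cliff (D t) par J) (hA : ∀ t ∈ Icc (0:ℝ) 1, Stab (D t) A) :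
    idx (D 0) par J A = idx (D 1) par J A := by
  have h : ∀ t ∈ Icc (0:ℝ) 1, Good (op (D t)) (fun p => par p.2) (YN n J ∩ A) :=
    fun t ht => (hD t ht).good (hA t ht)
  have h0 := Good.sidx_path (T := fun t => op (D t)) (continuous_op hc) h
  exact h0

theorem idx_empty : idx D par J ∅ = 0 := by
  rw [idx, inter_empty]; exact Good.sidx_empty

theorem idx_flip (hD : Cliff D par J) (hA : Stab D A) : idx D (fun i => !(par i)) J A = - idx D par J A := by
  rw [idx, idx]
  exact Good.sidx_flip (p := fun p : MI × n => par p.2) (hD.good hA)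

theorem Stab.inter (hA : Stab D A) (hB : Stab D B) : Stab D (A ∩ B) := fun a b i j h =>
  and_congr (hA a b i j h) (hB a b i j h)

theorem idx_union (hD : Cliff D par J) (hA : Stab D A) (hB : Stab D B) (d : Disjoint A B) :
    idx D par J (A ∪ B) = idx D par J A + idx D par J B := by
  rw [idx, inter_union_distrib_left]
  exact (hD.good hA).sidx_union (hD.good hB) (d.mono inter_subset_right inter_subset_right)

theorem idx_sum {ι : Type} [Fintype ι] {A : ι → Set (MI × n)} (hD : Cliff D par J)
    (hA : ∀ g, Stab D (A g)) (d : Pairwise fun i j => Disjoint (A i) (A j)) {U : Set (MI × n)} (hu : ⋃ g, A g = U) :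
    idx D par J U = ∑ g, idx D par J (A g) := by
  have := (Good.biUnion Finset.univ (A := fun g => YN n J ∩ A g) (hD.good (hA := Stab.univ D)).sa
    (hD.good (hA := Stab.univ D)).odd (fun g _ => hD.good (hA g))
    fun i j hij => (d hij).mono inter_subset_right inter_subset_right).2
  rw [idx, ← hu, inter_iUnion]
  simp only [Finset.mem_univ, iUnion_true] at this
  exact this

/-- The shift of the `j`-th exponent. -/
def sh (n : Type) (j : Fin 8) : MI × n ↪ MI × n := (shf j).prodMap (Function.Embedding.refl n)

theorem sh_apply (j : Fin 8) (a : MI) (i : n) : sh n j (a, i) = (a + e1 j, i) := rfl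

theorem Is_sh_sl (j : Fin 8) (i : n) : Is (sh n j) ∘L Is (sl i) = Is (sl i) ∘L Is (shf j) := by
  refine clm_ext_del fun a => ?_
  simp only [ContinuousLinearMap.comp_apply, Is_del]; rfl

theorem op_shift (j : Fin 8) (D : Matrix n n C(S15, ℂ)) :
    Ceq (op D ∘L Is (sh n j)) (Is (sh n j) ∘L op D) := by
  refine ceq_of_slices fun i => ?_
  rw [clm_comp_assoc, Is_sh_sl, ← clm_comp_assoc, op_comp_Is, clm_comp_assoc, op_comp_Is,
    ContinuousLinearMap.finsetSum_comp, ContinuousLinearMap.comp_finsetSum]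
  refine Ceq.sum _ fun k _ => ?_
  rw [clm_comp_assoc, ← clm_comp_assoc (Is (sh n j)), Is_sh_sl, clm_comp_assoc]
  exact (tau_shift j _).symm.clm_comp _

theorem idx_remove (hD : Cliff D par J) {j : Fin 8} (hj : j ∈ J) (hA : Stab D A) (hB : Stab D B)
    (hAB : ∀ a i, (a, i) ∈ B ↔ (a + e1 j, i) ∈ A) :
    idx D par J A = idx D par (J \ {j}) A + idx D par J B := by
  have e : sh n j '' (YN n J ∩ B) = (YN n J ∩ A) \ (YN n (J \ {j}) ∩ A) := by
    ext ⟨a, i⟩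
    simp only [mem_image, mem_diff, mem_inter_iff, YN, mem_setOf_eq, NJ]
    constructor
    · rintro ⟨⟨b, k⟩, ⟨h1, h2⟩, h3⟩
      rw [sh_apply, Prod.mk.injEq] at h3
      obtain ⟨rfl, rfl⟩ := h3
      rw [hAB] at h2
      refine ⟨⟨fun k hk => ?_, h2⟩, fun h => ?_⟩
      · have : k ≠ j := fun h => hk (h ▸ hj)
        simpa [e1, this] using h1 k hk
      · simpa [e1] using h.1 j (by simp)
    · rintro ⟨⟨h1, h2⟩, h3⟩
      have h4 : a j ≠ 0 := fun h => h3 ⟨fun k hk => by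
        by_cases hkj : k = j
        · rw [hkj, h]
        · exact h1 k fun hh => hk ⟨hh, hkj⟩, h2⟩
      have h5 : Function.update a j (a j - 1) + e1 j = a := by
        ext k
        by_cases hkj : k = j
        · subst hkj; simp [e1]; omega
        · simp [e1, hkj]
      refine ⟨(Function.update a j (a j - 1), i), ⟨fun k hk => ?_, ?_⟩, ?_⟩
      · have : k ≠ j := fun h => hk (h ▸ hj)
        simpa [this] using h1 k hk
      · rw [hAB, h5]; exact h2
      · rw [sh_apply, h5]
  have hsub : YN n (J \ {j}) ∩ A ⊆ YN n J ∩ A := by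
    rintro ⟨a, i⟩ ⟨h1, h2⟩
    exact ⟨fun k hk => h1 k fun h => hk h.1, h2⟩
  have g1 := hD.good hA
  have g2 := (hD.mono diff_subset : Cliff D par (J \ {j})).good hA
  have g3 := g1.diff g2 hsub
  have h1 := g2.sidx_union g3 disjoint_sdiff_self_right
  rw [union_diff_cancel hsub] at h1
  rw [idx, h1, ← e]
  refine congrArg₂ (· + ·) rfl ?_
  refine sidx_image _ (hD.good hB) (fun _ => rfl) ?_
  have h2 := ((op_shift j D).clm_comp (Rs (sh n j))).comp_clm (Pr (YN n J ∩ B))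
  rw [← clm_comp_assoc (Rs (sh n j)) (Is (sh n j)), Rs_comp_Is, ContinuousLinearMap.id_comp, clm_comp_assoc, clm_comp_assoc] at h2
  exact h2

variable {m : Type} [Fintype m]

/-- Reindexing of the matrix index. -/
def ri (κ : m ↪ n) : MI × m ↪ MI × n := (Function.Embedding.refl MI).prodMap κ

theorem ri_apply (κ : m ↪ n) (a : MI) (i : m) : ri κ (a, i) = (a, κ i) := rfl

theorem op_ri (κ : m ↪ n) : Rs (ri κ) ∘L op D ∘L Is (ri κ) = op (D.submatrix κ κ) := by
  refine clm_ext_del fun p => ?_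
  obtain ⟨a, j⟩ := p
  ext ⟨b, i⟩
  rw [ContinuousLinearMap.comp_apply, ContinuousLinearMap.comp_apply, Is_del, Rs_apply, ri_apply, ri_apply,
    op_del_apply, op_del_apply]
  rfl

theorem idx_image {E : Matrix m m C(S15, ℂ)} {par' : m → Bool} (κ : m ↪ n) {A : Set (MI × m)}
    (hE : Cliff E par' J) (hA : Stab E A) (hp : ∀ i, par (κ i) = par' i)
    (h : ∀ x ∈ SJ J, ∀ i j, D (κ i) (κ j) x = E i j x) :
    idx D par J (ri κ '' A) = idx E par' J A := by
  have e : ri κ '' (YN m J ∩ A) = YN n J ∩ ri κ '' A := by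
    ext ⟨a, i⟩
    constructor
    · rintro ⟨⟨b, k⟩, ⟨h1, h2⟩, h3⟩
      rw [ri_apply, Prod.mk.injEq] at h3
      obtain ⟨rfl, rfl⟩ := h3
      exact ⟨h1, _, h2, rfl⟩
    · rintro ⟨h1, ⟨b, k⟩, h2, h3⟩
      rw [ri_apply, Prod.mk.injEq] at h3
      obtain ⟨rfl, rfl⟩ := h3
      exact ⟨_, ⟨h1, h2⟩, rfl⟩
  rw [idx, ← e]
  refine sidx_image _ (hE.good hA) (fun y => hp y.2) ?_
  have h1 := (op_ceq (D := D.submatrix κ κ) (E := E) h).comp_clm (Pr A)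
  rw [clm_comp_assoc, clm_comp_assoc, Pr_comp_Pr, ← op_ri] at h1
  simpa only [clm_comp_assoc] using h1

theorem Stab.of_eq_or (hA : Stab D A) (h : ∀ i j, D' i j = D i j ∨ D' i j = 0) : Stab D' A := by
  intro a b i j h0
  rcases h i j with h | h
  · rw [h] at h0; exact hA a b i j h0
  · rw [h, map_zero] at h0; exact absurd rfl h0

/-- The set of indices over a subset of the matrix index set. -/
def ov (S : Set n) : Set (MI × n) := {p | p.2 ∈ S}

theorem idx_split {ι : Type} [Fintype ι] (b : n → ι) (hD : Cliff D par J) (hA : Stab D A)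
    (h : ∀ x ∈ SJ J, ∀ i j, b i ≠ b j → D i j x = 0) :
    idx D par J A = ∑ k, idx D par J (A ∩ ov {i | b i = k}) := by
  classical
  let E : Matrix n n C(S15, ℂ) := fun i j => if b i = b j then D i j else 0
  have hE : ∀ x ∈ SJ J, ∀ i j, D i j x = E i j x := fun x hx i j => by
    by_cases hb : b i = b j
    · simp only [E, if_pos hb]
    · simp only [E, if_neg hb]; exact h x hx i j hb
  have hC : Cliff E par J :=
    { herm := fun i j => by
        by_cases hb : b i = b j
        · simp only [E, if_pos hb, if_pos hb.symm]; exact hD.herm i j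
        · simp only [E, if_neg hb, if_neg (Ne.symm hb)]; exact star_zero _
      odd := fun i j hp => by
        simp only [E]; split_ifs
        · exact hD.odd i j hp
        · rfl
      sq := fun x hx i j => by
        simp only [← hE x hx]; exact hD.sq x hx i j }
  have hS : ∀ k, Stab E (ov {i | b i = k}) := by
    intro k a b' i j h0
    by_cases hb : b i = b j
    · simp [ov, hb]
    · simp only [E, if_neg hb, map_zero] at h0; exact absurd rfl h0
  have hEA : Stab E A := hA.of_eq_or fun i j => by simp only [E]; split_ifs <;> simp
  have h1 := fun k => hEA.inter (hS k)
  rw [idx_congr hC hEA hE, idx_sum hC h1]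
  · exact Finset.sum_congr rfl fun k _ => (idx_congr hC (h1 k) hE).symm
  · intro k l hkl
    refine Set.disjoint_left.2 ?_
    rintro p ⟨_, hp⟩ ⟨_, hp'⟩
    exact hkl (hp.symm.trans hp')
  · ext p; simp [ov]

end Idx

/-- Coordinatewise rotation of the sphere. -/
def rc (s : Fin 8 → Circle) : C(S15, S15) := rotS fun k => rotation (s k)

theorem rc_apply (s : Fin 8 → Circle) (x : S15) (k : Fin 8) : (rc s x : E8) k = s k * (x : E8) k := by
  rw [rc, rotS_apply, rotation_apply]

/-- The character of a multi-index. -/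
def chi (s : Fin 8 → Circle) (a : MI) : Circle := ∏ k, s k ^ a k

theorem en_rc (s : Fin 8 → Circle) (a : MI) (x : S15) : en a (rc s x) = chi s a * en a x := by
  have : mono a (rc s x) = chi s a * mono a x := by
    simp only [mono_apply, rc_apply, mul_pow, Finset.prod_mul_distrib, chi]
    congr 1
  simp only [en, ContinuousMap.smul_apply, smul_eq_mul, this]; ring

theorem tau_coef_ne_zero {s : Fin 8 → Circle} {f : C(S15, ℂ)} {c : Circle} (h : ∀ x, f (rc s x) = c * f x)
    {a b : MI} (h0 : tau f (del a) b ≠ 0) : c * chi s a = chi s b := by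
  by_contra hc
  refine h0 ?_
  rw [tau_del_apply]
  refine integral_eq_zero_of_rot (f * en a * star (en b)) (fun k => rotation (s k))
    ((c * chi s a / chi s b : Circle) : ℂ) ?_ fun x => ?_
  · rw [← Circle.coe_one, Ne, Circle.coe_inj, div_eq_one]; exact hc
  · have : ∀ g : C(S15, ℂ), g (rotS (fun k => rotation (s k)) x) = g (rc s x) := fun g => rfl
    rw [this]
    simp only [ContinuousMap.mul_apply, ContinuousMap.star_apply, h, en_rc, star_mul]
    rw [Circle.coe_div, Circle.coe_mul, div_eq_mul_inv, ← Circle.coe_inv, Circle.coe_inv_eq_conj]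
    simp only [RCLike.star_def]; ring

section Grading

variable {n : Type} [Fintype n] {D : Matrix n n C(S15, ℂ)} {par : n → Bool} {J : Set (Fin 8)}

/-- Equivariance of a symbol under a rotation. -/
def Equi (s : Fin 8 → Circle) (t : n → Circle) (D : Matrix n n C(S15, ℂ)) : Prop :=
  ∀ i j x, (t i : ℂ) * D i j (rc s x) = t j * D i j x

/-- The isotypic pieces of `MI × n`. -/
def gr (s : Fin 8 → Circle) (t : n → Circle) (g : Circle) : Set (MI × n) := {p | chi s p.1 * t p.2 = g}

theorem Equi.stab {s : Fin 8 → Circle} {t : n → Circle} (h : Equi s t D) (g : Circle) : Stab D (gr s t g) := by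
  intro a b i j h0
  have h1 : ∀ x, D i j (rc s x) = (t j / t i : Circle) * D i j x := fun x => by
    have := h i j x
    rw [Circle.coe_div, div_mul_eq_mul_div, ← this, mul_comm, mul_div_assoc, div_self (Circle.coe_ne_zero _), mul_one]
  have h2 := tau_coef_ne_zero h1 h0
  simp only [gr, mem_setOf_eq]
  rw [← h2, div_mul_eq_mul_div, div_mul_cancel, mul_comm]

theorem chi_add_e1 (s : Fin 8 → Circle) (a : MI) (j : Fin 8) : chi s (a + e1 j) = s j * chi s a := by
  simp only [chi, Pi.add_apply, pow_add, Finset.prod_mul_distrib]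
  rw [mul_comm]
  congr 1
  rw [Finset.prod_eq_single j]
  · simp [e1]
  · intro k _ hk; simp [e1, hk]
  · simp

theorem Equi.idx_remove {s : Fin 8 → Circle} {t : n → Circle} (h : Equi s t D) (hD : Cliff D par J)
    {j : Fin 8} (hj : j ∈ J) (g : Circle) :
    idx D par J (gr s t (s j * g)) = idx D par (J \ {j}) (gr s t (s j * g)) + idx D par J (gr s t g) := by
  refine _root_.idx_remove hD hj (h.stab _) (h.stab _) fun a i => ?_
  simp only [gr, mem_setOf_eq, chi_add_e1]
  rw [mul_assoc, mul_right_inj]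

/-- The index difference of the two pieces of a sign grading. -/
def dif (s : Fin 8 → Circle) (t : n → Circle) (D : Matrix n n C(S15, ℂ)) (par : n → Bool) (J : Set (Fin 8)) : ℤ :=
  idx D par J (gr s t 1) - idx D par J (gr s t (-1))

theorem Equi.dif_remove {s : Fin 8 → Circle} {t : n → Circle} (h : Equi s t D) (hD : Cliff D par J)
    {j : Fin 8} (hj : j ∈ J) (hs : s j = -1) :
    dif s t D par (J \ {j}) = 2 * dif s t D par J := by
  have h1 := h.idx_remove hD hj 1
  have h2 := h.idx_remove hD hj (-1)
  rw [hs, mul_one] at h1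
  rw [hs, neg_mul_neg, one_mul] at h2
  simp only [dif]; linarith

theorem Equi.dif_univ {s : Fin 8 → Circle} {t : n → Circle} (h : Equi s t D) (hD : Cliff D par J)
    (hs : ∀ k, s k = 1 ∨ s k = -1) (ht : ∀ i, t i = 1 ∨ t i = -1) :
    idx D par J univ = idx D par J (gr s t 1) + idx D par J (gr s t (-1)) := by
  have hne : (1 : Circle) ≠ -1 := fun h => by
    have := congrArg (fun z : Circle => (z : ℂ)) h
    norm_num [Circle.coe_neg] at this
  rw [← idx_union hD (h.stab _) (h.stab _)]
  · congr 1
    refine (eq_univ_of_forall fun p => ?_).symm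
    have h1 : ∀ x y : Circle, (x = 1 ∨ x = -1) → (y = 1 ∨ y = -1) → (x * y = 1 ∨ x * y = -1) := by
      rintro x y (rfl | rfl) (rfl | rfl) <;> simp
    refine h1 _ _ ?_ (ht _)
    refine Finset.prod_induction (fun k => s k ^ p.1 k) (fun x => x = 1 ∨ x = -1) (fun x y => h1 x y) (Or.inl rfl)
      fun k _ => ?_
    rcases hs k with h | h <;> rw [h]
    · simp
    · exact neg_one_pow_eq_or _ _
  · rw [Set.disjoint_left]; rintro p hp hp'; exact hne (hp.symm.trans hp')

/-- The rotation of a single coordinate. -/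
def ro (j : Fin 8) (u : Circle) : Fin 8 → Circle := Function.update 1 j u

theorem chi_ro (j : Fin 8) (u : Circle) (a : MI) : chi (ro j u) a = u ^ a j := by
  rw [chi, Finset.prod_eq_single j]
  · simp [ro]
  · intro k _ hk; simp [ro, hk]
  · simp

theorem idx_rank_one (hD : Cliff D par J) {j : Fin 8} (hj : j ∈ J) (S : Set n) (d : ℤ)
    (h : open Classical in ∀ u : Circle, Equi (ro j u) (fun i => if i ∈ S then u ^ d else 1) D) :
    idx D par J univ = - d * idx D par (J \ {j}) (ov S) := by
  classical
  have key : ∀ m : ℕ, m ≠ 0 → ((idx D par J univ + d * idx D par (J \ {j}) (ov S) : ℤ) : ZMod m) = 0 := by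
    intro m hm
    haveI : NeZero m := ⟨hm⟩
    let w : n → ZMod m := fun i => if i ∈ S then (d : ZMod m) else 0
    let A : ZMod m → Set (MI × n) := fun g => {p | (p.1 j : ZMod m) + w p.2 = g}
    let u : Circle := ZMod.toCircle (1 : ZMod m)
    have hu : ∀ k : ℤ, u ^ k = ZMod.toCircle (k : ZMod m) := fun k => by
      rw [← AddChar.map_zsmul_eq_zpow]; simp
    have hA : ∀ g, A g = gr (ro j u) (fun i => if i ∈ S then u ^ d else 1) (ZMod.toCircle g) := fun g => by
      ext ⟨a, i⟩
      simp only [A, gr, mem_setOf_eq, chi_ro, w]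
      have h1 : u ^ a j = ZMod.toCircle (a j : ZMod m) := by
        have := hu (a j); simpa using this
      have h2 : (if i ∈ S then u ^ d else 1) = ZMod.toCircle (if i ∈ S then (d : ZMod m) else 0) := by
        split_ifs
        · exact hu d
        · simp
      rw [h1, h2, ← AddChar.map_add_eq_mul, ZMod.injective_toCircle.eq_iff]
    have st : ∀ g, Stab D (A g) := fun g => by rw [hA]; exact (h u).stab _
    have h1 := idx_sum hD st (fun g g' hg => by
      refine Set.disjoint_left.2 ?_; rintro p hp hp'; exact hg (hp.symm.trans hp'))
      (eq_univ_of_forall fun p => mem_iUnion.2 ⟨_, rfl⟩)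
    have h2 : ∀ g, idx D par J (A (g + 1)) = idx D par (J \ {j}) (A (g + 1)) + idx D par J (A g) := fun g =>
      _root_.idx_remove hD hj (st _) (st _) fun a i => by
        simp only [A, mem_setOf_eq, Pi.add_apply, e1, Pi.single_eq_same, Nat.cast_add, Nat.cast_one]
        constructor <;> intro h
        · rw [← h]; ring
        · linear_combination h
    have h3 : ∀ g, idx D par (J \ {j}) (A g) = idx D par (J \ {j}) (ov {i | w i = g}) := fun g =>
      idx_set fun p hp => by
        have : p.1 j = 0 := hp j (by simp)
        simp [A, ov, this]
    have h4 : ∑ g : ZMod m, g * ((idx D par (J \ {j}) (A g) : ℤ) : ZMod m) = - ((idx D par J univ : ℤ) : ZMod m) := by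
      have e1 : ∑ g : ZMod m, g * ((idx D par (J \ {j}) (A g) : ℤ) : ZMod m)
          = ∑ g : ZMod m, (g + 1) * ((idx D par (J \ {j}) (A (g + 1)) : ℤ) : ZMod m) :=
        (Equiv.sum_comp (Equiv.addRight (1 : ZMod m)) fun g => g * ((idx D par (J \ {j}) (A g) : ℤ) : ZMod m)).symm
      have e2 : ∑ g : ZMod m, g * ((idx D par J (A g) : ℤ) : ZMod m)
          = ∑ g : ZMod m, (g + 1) * ((idx D par J (A (g + 1)) : ℤ) : ZMod m) :=
        (Equiv.sum_comp (Equiv.addRight (1 : ZMod m)) fun g => g * ((idx D par J (A g) : ℤ) : ZMod m)).symm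
      rw [e1, h1, Int.cast_sum, ← Finset.sum_neg_distrib]
      have e3 : ∀ g : ZMod m, (g + 1) * ((idx D par (J \ {j}) (A (g + 1)) : ℤ) : ZMod m)
          = (g + 1) * ((idx D par J (A (g + 1)) : ℤ) : ZMod m) - g * ((idx D par J (A g) : ℤ) : ZMod m)
            - ((idx D par J (A g) : ℤ) : ZMod m) := fun g => by
        rw [h2]; push_cast; ring
      rw [Finset.sum_congr rfl fun g _ => e3 g, Finset.sum_sub_distrib, Finset.sum_sub_distrib, ← e2, sub_self,
        zero_sub, Finset.sum_neg_distrib]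
    have h5 : ∑ g : ZMod m, g * ((idx D par (J \ {j}) (A g) : ℤ) : ZMod m)
        = d * ((idx D par (J \ {j}) (ov S) : ℤ) : ZMod m) := by
      rw [Finset.sum_eq_single (d : ZMod m)]
      · by_cases hd : (d : ZMod m) = 0
        · rw [hd, zero_mul, zero_mul]
        · rw [h3]
          congr 4
          ext i
          by_cases hi : i ∈ S <;> simp [w, hi]
          exact fun h => hd h.symm
      · intro g _ hg
        by_cases hg0 : g = 0
        · rw [hg0, zero_mul]
        · rw [h3]
          have : {i | w i = g} = ∅ := by
            ext i
            by_cases hi : i ∈ S <;> simp [w, hi, Ne.symm hg, Ne.symm hg0]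
          rw [this]
          have : ov (∅ : Set n) = ∅ := by ext; simp [ov]
          rw [this, idx_empty]; simp
      · simp
    push_cast
    rw [← h5, h4]; ring
  have h0 : ∀ x : ℤ, (∀ m : ℕ, m ≠ 0 → (x : ZMod m) = 0) → x = 0 := fun x hx => by
    have := (ZMod.intCast_zmod_eq_zero_iff_dvd x (x.natAbs + 1)).1 (hx _ (Nat.succ_ne_zero _))
    refine Int.eq_zero_of_abs_lt_dvd this ?_
    rw [Int.abs_eq_natAbs]; push_cast; omega
  linarith [h0 _ key]

end Grading

section Sharp
open scoped Kronecker

variable {n m : Type} [Fintype n] [Fintype m] [DecidableEq n] [DecidableEq m]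
  {D : Matrix n n C(S15, ℂ)} {E : Matrix m m C(S15, ℂ)} {par : n → Bool} {par' : m → Bool}
  {c c' : C(S15, ℂ)} {J : Set (Fin 8)}

/-- An odd self-adjoint symbol with scalar square. -/
structure Dir (D : Matrix n n C(S15, ℂ)) (par : n → Bool) (c : C(S15, ℂ)) : Prop where
  herm : ∀ i j, star (D i j) = D j i
  odd : ∀ i j, par i = par j → D i j = 0
  sq : D * D = Matrix.diagonal fun _ => c

theorem Dir.cliff (h : Dir D par c) (hc : ∀ x ∈ SJ J, c x = 1) : Cliff D par J where
  herm := h.herm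
  odd := h.odd
  sq x hx i j := by
    classical
    have := congrArg (fun M : Matrix n n C(S15, ℂ) => M i j x) h.sq
    simp only [Matrix.mul_apply, Matrix.diagonal_apply, ContinuousMap.sum_apply,
      ContinuousMap.mul_apply] at this
    rw [this]
    split_ifs
    · exact hc x hx
    · rfl

/-- The grading sign. -/
def sgn (b : Bool) : C(S15, ℂ) := if b then 1 else -1

/-- The grading operator. -/
def grd (par : n → Bool) : Matrix n n C(S15, ℂ) := Matrix.diagonal fun i => sgn (par i)

theorem sgn_mul_self (b : Bool) : sgn b * sgn b = 1 := by cases b <;> simp only [sgn] <;> simp <;> ring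

theorem star_sgn (b : Bool) : star (sgn b) = sgn b := by cases b <;> simp [sgn]

/-- The sharp product of symbols. -/
def shp (D : Matrix n n C(S15, ℂ)) (par : n → Bool) (E : Matrix m m C(S15, ℂ)) :
    Matrix (n × m) (n × m) C(S15, ℂ) := D ⊗ₖ (1 : Matrix m m C(S15, ℂ)) + grd par ⊗ₖ E

/-- The grading of a sharp product. -/
def xpar (par : n → Bool) (par' : m → Bool) : n × m → Bool := fun p => xor (par p.1) (par' p.2)

theorem shp_apply (i j : n) (k l : m) : shp D par E (i, k) (j, l) =
    (if k = l then D i j else 0) + if i = j then sgn (par i) * E k l else 0 := by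
  simp only [shp, Matrix.add_apply, Matrix.kroneckerMap_apply, Matrix.one_apply, grd, Matrix.diagonal_apply]
  congr 1
  · split_ifs <;> simp
  · split_ifs <;> simp

theorem Dir.shp (hD : Dir D par c) (hE : Dir E par' c') : Dir (shp D par E) (xpar par par') (c + c') where
  herm := by
    rintro ⟨i, k⟩ ⟨j, l⟩
    rw [shp_apply, shp_apply, star_add, ← hD.herm i j, ← hE.herm k l]
    congr 1
    · by_cases h : k = l
      · simp [h]
      · simp [h, Ne.symm h]
    · by_cases h : i = j
      · simp [h, star_sgn, mul_comm]
      · simp [h, Ne.symm h]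
  odd := by
    rintro ⟨i, k⟩ ⟨j, l⟩ h
    simp only [xpar] at h
    rw [shp_apply]
    have h1 : (if k = l then D i j else 0) = 0 := by
      split_ifs with hk
      · subst hk
        exact hD.odd i j (by simpa using h)
      · rfl
    have h2 : (if i = j then sgn (par i) * E k l else 0) = 0 := by
      split_ifs with hk
      · subst hk
        rw [hE.odd k l (by simpa using h), mul_zero]
      · rfl
    rw [h1, h2, add_zero]
  sq := by
    have a1 : D * grd par + grd par * D = 0 := by
      ext1 i j
      simp only [Matrix.add_apply, grd, Matrix.mul_diagonal, Matrix.diagonal_mul, Matrix.zero_apply]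
      by_cases h : par i = par j
      · rw [hD.odd i j h]; simp
      · rw [Bool.eq_not_of_ne h]
        cases par j <;> simp [sgn] <;> ring
    have a2 : grd par * grd par = (1 : Matrix n n C(S15, ℂ)) := by
      rw [grd, Matrix.diagonal_mul_diagonal]
      simp only [sgn_mul_self]; exact Matrix.diagonal_one
    rw [_root_.shp, Matrix.add_mul, Matrix.mul_add, Matrix.mul_add, ← Matrix.mul_kronecker_mul, ← Matrix.mul_kronecker_mul,
      ← Matrix.mul_kronecker_mul, ← Matrix.mul_kronecker_mul, hD.sq, hE.sq, a2, mul_one, one_mul, mul_one,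
      ← Matrix.diagonal_one, ← Matrix.diagonal_one, Matrix.diagonal_kronecker_diagonal,
      Matrix.diagonal_kronecker_diagonal]
    have : (D * grd par) ⊗ₖ E + (grd par * D) ⊗ₖ E = 0 := by
      rw [← Matrix.add_kronecker, a1, Matrix.zero_kronecker]
    rw [add_assoc, ← add_assoc (Matrix.kroneckerMap _ _ _), this, zero_add, Matrix.diagonal_add]
    simp only [mul_one, one_mul]

/-- The slice of an index set at `k`. -/
def slc (A : Set (MI × n × m)) (k : m) : Set (MI × n) := {p | (p.1, (p.2, k)) ∈ A}

theorem Stab.slice {A : Set (MI × n × m)} (hA : Stab (shp D par E) A) (hE : Dir E par' c')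
    (k : m) : Stab D (slc A k) := by
  intro a b i j h
  refine hA a b (i, k) (j, k) ?_
  rw [shp_apply, if_pos rfl, hE.odd k k rfl, mul_zero, ite_self, add_zero]
  exact h

/-- The inclusion of a slice of the matrix index set. -/
def sli (n : Type) {m : Type} (k : m) : n ↪ n × m := ⟨fun i => (i, k), fun _ _ h => congrArg Prod.fst h⟩

theorem sli_apply (k : m) (i : n) : sli n k i = (i, k) := rfl

theorem idx_shp_slice (hD : Cliff D par J) (h0 : ∀ x ∈ SJ J, ∀ k l, E k l x = 0) (k : m) {A : Set (MI × n)}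
    (hA : Stab D A) : idx (shp D par E) (xpar par par') J (ri (sli n k) '' A)
      = (if par' k then -1 else 1) * idx D par J A := by
  have h : ∀ x ∈ SJ J, ∀ i j, shp D par E (sli n k i) (sli n k j) x = D i j x := by
    intro x hx i j
    rw [sli_apply, sli_apply, shp_apply, if_pos rfl]
    split_ifs <;> simp [h0 x hx]
  cases hk : par' k
  · rw [if_neg (by simp), one_mul]
    exact idx_image _ hD hA (fun i => by simp [xpar, sli_apply, hk]) h
  · rw [if_pos rfl, neg_one_mul, ← idx_flip hD hA]
    exact idx_image _ ⟨hD.herm, fun i j h => hD.odd i j (by simpa using h), hD.sq⟩ hA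
      (fun i => by simp [xpar, sli_apply, hk]) h

theorem idx_shp_zero (hD : Dir D par c) (hE : Dir E par' c') {A : Set (MI × n × m)}
    (hA : Stab (shp D par E) A) (hc : ∀ x ∈ SJ J, c x = 1) (h0 : ∀ x ∈ SJ J, ∀ k l, E k l x = 0)
    (hc' : ∀ x ∈ SJ J, c' x = 0) :
    idx (shp D par E) (xpar par par') J A
      = ∑ k, (if par' k then -1 else 1) * idx D par J (slc A k) := by
  have hC := (hD.shp hE).cliff (J := J) fun x hx => by simp [hc x hx, hc' x hx]
  rw [idx_split (fun p : n × m => p.2) hC hA]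
  · refine Finset.sum_congr rfl fun k _ => ?_
    have e : A ∩ ov {i : n × m | i.2 = k} = ri (sli n k) '' slc A k := by
      ext ⟨a, i, l⟩
      constructor
      · rintro ⟨h1, h2⟩
        have h2 : l = k := h2
        subst h2
        exact ⟨(a, i), h1, rfl⟩
      · rintro ⟨⟨b, j⟩, h1, h2⟩
        rw [ri_apply, sli_apply, Prod.mk.injEq, Prod.mk.injEq] at h2
        obtain ⟨rfl, rfl, rfl⟩ := h2
        exact ⟨h1, rfl⟩
    rw [e]
    exact idx_shp_slice (hD.cliff hc) h0 k (hA.slice hE k)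
  · rintro x hx ⟨i, k⟩ ⟨j, l⟩ hkl
    rw [shp_apply, if_neg (show k ≠ l from hkl)]
    split_ifs <;> simp [h0 x hx]

/-- The elementary symbol of a function. -/
def wm (ω : C(S15, ℂ)) : Matrix Bool Bool C(S15, ℂ) := fun k l =>
  if k = l then 0 else if k then ω else star ω

theorem dir_wm (ω : C(S15, ℂ)) : Dir (wm ω) id (star ω * ω) where
  herm i j := by cases i <;> cases j <;> simp [wm]
  odd i j h := if_pos h
  sq := by
    ext1 i j
    cases i <;> cases j <;> simp [wm, Matrix.mul_apply, mul_comm]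

theorem Equi.shp {s : Fin 8 → Circle} {t : n → Circle} {t' : m → Circle} (hD : Equi s t D) (hE : Equi s t' E) :
    Equi s (fun p : n × m => t p.1 * t' p.2) (shp D par E) := by
  rintro ⟨i, k⟩ ⟨j, l⟩ x
  have h1 := hD i j x
  have h2 := hE k l x
  have hs : ∀ b y, sgn b y = if b then 1 else -1 := fun b y => by cases b <;> simp [sgn]
  simp only [shp_apply, ContinuousMap.add_apply, Circle.coe_mul, mul_add]
  congr 1
  · split_ifs with h
    · subst h; linear_combination (t' k : ℂ) * h1
    · simp
  · split_ifs with h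
    · subst h
      simp only [ContinuousMap.mul_apply, hs]
      linear_combination ((t i : ℂ) * if par i then 1 else -1) * h2
    · simp

theorem equi_wm {s : Fin 8 → Circle} {ω : C(S15, ℂ)} {u : Circle} (h : ∀ x, ω (rc s x) = u * ω x) :
    Equi s (fun k : Bool => if k then u⁻¹ else 1) (wm ω) := by
  have hu : (star (u : ℂ)) * u = 1 := by
    rw [RCLike.star_def, ← Circle.coe_inv_eq_conj, ← Circle.coe_mul, inv_mul_cancel, Circle.coe_one]
  intro i j x
  cases i <;> cases j <;>
    simp only [wm, Circle.coe_inv_eq_conj, ContinuousMap.star_apply, h, star_mul, if_true, if_false, Circle.coe_one,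
      one_mul, RCLike.star_def, Bool.false_eq_true, reduceIte, Bool.true_eq_false, ContinuousMap.zero_apply, mul_zero]
  · ring
  · rw [← mul_assoc, ← RCLike.star_def, hu, one_mul]

theorem crd_ro_self (j : Fin 8) (u : Circle) (x : S15) : crd j (rc (ro j u) x) = u * crd j x := by
  rw [crd_apply, rc_apply, ro, Function.update_self]; rfl

theorem idx_shp_crd (hD : Dir D par c) {j : Fin 8} (hj : j ∈ J) (hi : ∀ u : Circle, Equi (ro j u) (fun _ => 1) D)
    (hc : ∀ x ∈ SJ J, c x + star (crd j x) * crd j x = 1) :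
    idx (shp D par (wm (crd j))) (xpar par id) J univ = - idx D par (J \ {j}) univ := by
  have h0 : ∀ x ∈ SJ (J \ {j}), crd j x = 0 := fun x hx => hx j (by simp)
  have hs := hD.shp (dir_wm (crd j))
  have hC := hs.cliff (J := J) fun x hx => hc x hx
  have e : ∀ u : Circle, Equi (ro j u) (fun p : n × Bool => 1 * if p.2 then u⁻¹ else 1) (shp D par (wm (crd j))) :=
    fun u => (hi u).shp (equi_wm (crd_ro_self j u))
  rw [idx_rank_one hC hj {p | p.2 = true} (-1) (fun u => by simpa using e u), neg_neg, one_mul]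
  have hov : ov {p : n × Bool | p.2 = true} = ri (sli n true) '' univ := by
    ext ⟨a, i, k⟩
    constructor
    · intro h
      have h : k = true := h
      exact ⟨(a, i), mem_univ _, by rw [h]; rfl⟩
    · rintro ⟨⟨b, j⟩, _, h2⟩
      rw [ri_apply, sli_apply, Prod.mk.injEq, Prod.mk.injEq] at h2
      exact h2.2.2.symm
  have hD' := hD.cliff (J := J \ {j}) fun x hx => by
    have := hc x (SJ_mono diff_subset hx)
    rwa [h0 x hx, mul_zero, add_zero] at this
  rw [hov, idx_shp_slice hD' (fun x hx k l => ?_) true (Stab.univ D)]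
  · simp
  · simp only [wm]
    split_ifs <;> simp [h0 x hx]

theorem sidx_singleton {X : Type} (T : L2 X →L[ℂ] L2 X) (p : X → Bool) {A : Set X} (i : X) (hp : p i = true)
    (hA : A = {i}) : sidx T p A = 1 := by
  subst hA
  have e0 : pt p {i} false = ∅ := by
    ext x
    simp only [pt, mem_setOf_eq, mem_singleton_iff, mem_empty_iff_false, iff_false, not_and]
    rintro rfl
    simp [hp]
  have e1 : pt p {i} true = {i} := by
    ext x
    simp only [pt, mem_setOf_eq, mem_singleton_iff, and_iff_left_iff_imp]
    rintro rfl
    exact hp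
  rw [sidx, e0, e1, bidx, fidx]
  have : Subsingleton (L2 (∅ : Set X)) := ⟨fun x y => by ext i; exact i.2.elim⟩
  have hk : LinearMap.ker (blk T {i} ∅).toLinearMap = ⊤ := by
    rw [eq_top_iff]
    intro x _
    exact Subsingleton.elim _ _
  have h1 : Module.finrank ℂ (L2 ({i} : Set X)) = 1 := by
    refine finrank_eq_one (del (⟨i, rfl⟩ : ({i} : Set X))) ?_ ?_
    · intro h
      have := congrArg (fun x : L2 ({i} : Set X) => x ⟨i, rfl⟩) h
      simp [del_apply] at this
    · intro w
      refine ⟨w ⟨i, rfl⟩, ?_⟩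
      ext ⟨j, rfl⟩
      simp [del_apply]
  rw [hk, finrank_top, h1, Module.finrank_zero_of_subsingleton]
  simp

/-- The base case: the index of a power of the first coordinate. -/
theorem idx_wm {j : Fin 8} {f : C(S15, ℂ)} (d : ℤ) (h : ∀ u : Circle, ∀ x, f (rc (ro j u) x) = (u ^ d : Circle) * f x)
    (hf : ∀ x ∈ SJ {j}, star (f x) * f x = 1) : idx (wm f) id {j} univ = d := by
  have hC := (dir_wm f).cliff (J := {j}) fun x hx => hf x hx
  rw [idx_rank_one hC rfl {k | k = true} (-d) (fun u => by simpa using equi_wm (h u)), neg_neg, idx,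
    sidx_singleton _ _ ((0 : MI), true) rfl, mul_one]
  ext ⟨a, k⟩
  constructor
  · rintro ⟨h1, h2⟩
    exact Prod.ext (funext fun k => h1 k (by simp)) h2
  · rintro ⟨⟩
    exact ⟨fun _ _ => rfl, rfl⟩

end Sharp

section RealStructure
open MeasureTheory

/-- Complex conjugation of the sphere. -/
def cj : C(S15, S15) := rotS fun _ => Complex.conjLIE

theorem cj_apply (x : S15) (k : Fin 8) : (cj x : E8) k = star ((x : E8) k) := rfl

theorem cj_cj (x : S15) : cj (cj x) = x := by
  refine Subtype.ext ?_
  ext k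
  rw [cj_apply, cj_apply, star_star]

theorem en_cj (a : MI) (x : S15) : en a (cj x) = star (en a x) := by
  simp only [en, ContinuousMap.smul_apply, smul_eq_mul, mono_apply, cj_apply, star_mul', star_prod, star_pow]
  congr 1
  exact (Complex.conj_ofReal _).symm

theorem tau_cj {f g : C(S15, ℂ)} (h : ∀ x, f (cj x) = star (g x)) (a b : MI) :
    tau f (del a) b = star (tau g (del a) b) := by
  rw [tau_del_apply, tau_del_apply, RCLike.star_def, ← integral_conj]
  refine (integral_rotS (fun _ => Complex.conjLIE) (f * en a * star (en b))).symm.trans ?_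
  · refine integral_congr_ae (Filter.Eventually.of_forall fun x => ?_)
    have e : rotS (fun _ => Complex.conjLIE) x = cj x := rfl
    simp only [ContinuousMap.mul_apply, ContinuousMap.star_apply, e, h, en_cj, map_mul, RCLike.star_def,
      Complex.conj_conj]

end RealStructure

section AntiUnitary
variable {n : Type}

/-- Signs: `true` is `1` and `false` is `-1`. -/
def sv (b : Bool) : ℂ := if b then 1 else -1

theorem norm_sv (b : Bool) : ‖sv b‖ = 1 := by cases b <;> simp [sv]

theorem star_sv (b : Bool) : star (sv b) = sv b := by cases b <;> simp [sv]

theorem sv_mul_self (b : Bool) : sv b * sv b = 1 := by cases b <;> simp [sv]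

theorem sgn_apply (b : Bool) (x : S15) : sgn b x = sv b := by cases b <;> simp [sgn, sv]

/-- The antiunitary operator permuting the components by `π` with signs `κ`. -/
def anti (π : n ↪ n) (κ : n → Bool) : L2 (MI × n) →SL[starRingEnd ℂ] L2 (MI × n) :=
  LinearMap.mkContinuous
    { toFun := fun y => ⟨fun p => sv (κ (π p.2)) * star (y (p.1, π p.2)),
        (memℓp_gen_iff (by norm_num)).2 (by
          have := (L2.summable_sq y).comp_injective (ri π).injective
          refine this.congr fun p => ?_
          rw [norm_mul, norm_sv, one_mul, norm_star]; rfl)⟩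
      map_add' := fun x y => by
        ext p
        exact (by simp [mul_add] : sv (κ (π p.2)) * star (x (p.1, π p.2) + y (p.1, π p.2)) = 
          sv (κ (π p.2)) * star (x (p.1, π p.2)) + sv (κ (π p.2)) * star (y (p.1, π p.2)))
      map_smul' := fun c x => by
        ext p
        exact (by simp; ring : sv (κ (π p.2)) * star (c * x (p.1, π p.2)) =
          starRingEnd ℂ c * (sv (κ (π p.2)) * star (x (p.1, π p.2)))) } 1 (fun y => by
      rw [one_mul]
      refine lp.norm_le_of_tsum_le (by norm_num) (norm_nonneg _) ?_
      rw [lp.norm_rpow_eq_tsum (by norm_num)]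
      refine le_trans (le_of_eq ?_) (tsum_comp_le_tsum_of_inj (L2.summable_sq y) (fun i => by positivity) (ri π).injective)
      refine tsum_congr fun p => ?_
      change ‖sv (κ (π p.2)) * star (y (p.1, π p.2))‖ ^ _ = _
      rw [norm_mul, norm_sv, one_mul, norm_star]; rfl)

theorem anti_apply (π : n ↪ n) (κ : n → Bool) (x : L2 (MI × n)) (a : MI) (i : n) :
    anti π κ x (a, i) = sv (κ (π i)) * star (x (a, π i)) := rfl

theorem L2.hasSum_smul_del {X : Type} (x : L2 X) : HasSum (fun i => x i • (del i : L2 X)) x := by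
  classical
  have hx := lp.hasSum_single (p := 2) (by norm_num) x
  have hs : ∀ i, lp.single 2 i (x i) = x i • (del i : L2 X) := fun i => by
    rw [del, ← lp.single_smul]; simp
  simpa only [hs] using hx

/-- A criterion for the evenness of the index: a quaternionic structure permuting the components. -/
theorem idx_even [Fintype n] {D : Matrix n n C(S15, ℂ)} {par : n → Bool} {J : Set (Fin 8)} {A : Set (MI × n)}
    (hD : Cliff D par J) (hA : Stab D A) (π : n ↪ n) (hπ : ∀ i, π (π i) = i) (hp : ∀ i, par (π i) = par i)
    (κ : n → Bool) (hκ : ∀ i, κ (π i) = !(κ i)) (hπA : ∀ a i, (a, π i) ∈ A ↔ (a, i) ∈ A)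
    (h : ∀ i j x, sv (κ (π i)) * star (D (π i) j (cj x)) = sv (κ j) * D i (π j) x) :
    Even (idx D par J A) := by
  classical
  refine (hD.good hA).even (anti π κ).toLinearMap ?_ ?_ ?_
  · intro x
    ext ⟨a, i⟩
    change anti π κ (anti π κ x) (a, i) = -(x (a, i))
    rw [anti_apply, anti_apply, hπ, hκ]
    cases κ i <;> simp [sv]
  · intro x
    change anti π κ (op D x) = op D (anti π κ x)
    have h1 := ((L2.hasSum_smul_del x).mapL (op D)).map (anti π κ) (anti π κ).continuous
    have h2 := ((L2.hasSum_smul_del x).map (anti π κ) (anti π κ).continuous).mapL (op D)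
    have key : ∀ p, anti π κ (op D (del p)) = op D (anti π κ (del p)) := by
      rintro ⟨a, j⟩
      have e : anti π κ (del (a, j)) = sv (κ j) • (del (a, π j) : L2 (MI × n)) := by
        ext ⟨b, i⟩
        change sv (κ (π i)) * star ((del (a, j) : L2 (MI × n)) (b, π i)) = sv (κ j) * (del (a, π j) : L2 (MI × n)) (b, i)
        have hi : π i = j ↔ i = π j := ⟨fun h => by rw [← h, hπ], fun h => by rw [h, hπ]⟩
        rw [del_apply, del_apply]
        by_cases h1 : b = a ∧ i = π j
        · obtain ⟨rfl, rfl⟩ := h1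
          simp [hπ]
        · rw [if_neg, if_neg]
          · simp
          · simpa using h1
          · simpa [hi] using h1
      rw [e, map_smul]
      ext ⟨b, i⟩
      change sv (κ (π i)) * star (op D (del (a, j)) (b, π i)) = sv (κ j) * op D (del (a, π j)) (b, i)
      rw [op_del_apply, op_del_apply]
      have h1 := tau_cj (f := (sv (κ (π i)) * sv (κ j)) • D i (π j)) (g := D (π i) j) (fun x => by
        have h2 := h i j (cj x)
        rw [cj_cj] at h2
        rw [ContinuousMap.smul_apply, smul_eq_mul, mul_assoc, ← h2, ← mul_assoc, sv_mul_self, one_mul]) a b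
      rw [← h1, map_smul]
      change sv (κ (π i)) * ((sv (κ (π i)) * sv (κ j)) * _) = _
      rw [← mul_assoc, ← mul_assoc, sv_mul_self, one_mul]
      rfl
    refine h1.unique ?_
    convert h2 using 1
    ext1 p
    simp only [Function.comp_apply, map_smul, map_smulₛₗ, key]
  · intro b x
    ext ⟨a, i⟩
    change anti π κ (Pr _ x) (a, i) = Pr _ (anti π κ x) (a, i)
    have : (a, π i) ∈ pt (fun p : MI × n => par p.2) (YN n J ∩ A) b ↔ (a, i) ∈ pt (fun p : MI × n => par p.2) (YN n J ∩ A) b := by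
      change (_ ∧ _) ∧ par (π i) = b ↔ (_ ∧ _) ∧ par i = b
      rw [hπA, hp]
      exact Iff.rfl
    rw [anti_apply, Pr_apply, Pr_apply, anti_apply]
    by_cases h : (a, i) ∈ pt (fun p : MI × n => par p.2) (YN n J ∩ A) b
    · rw [if_pos h, if_pos (this.2 h)]
    · rw [if_neg h, if_neg (fun h' => h (this.1 h'))]; simp

end AntiUnitary

section Quaternionic
variable {n : Type} [Fintype n] [DecidableEq n]

/-- A (graded, possibly odd or real) quaternionic structure on a matrix of functions. -/
structure Qt (D : Matrix n n C(S15, ℂ)) (par : n → Bool) (t : n → Circle) (π : n ↪ n) (κ : n → Bool)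
    (σ η : Bool) (θ : Circle) : Prop where
  inv : ∀ i, π (π i) = i
  par : ∀ i, par (π i) = xor (par i) η
  wt : ∀ i, t (π i) = θ * t i
  sign : ∀ i, κ (π i) = xor (κ i) σ
  eq : ∀ i j x, sv (κ (π i)) * star (D (π i) j (cj x)) = sv (κ j) * D i (π j) x

/-- The permutation of the components of a sharp product with `wm ω`. -/
def flipP (π : n ↪ n) : n × Bool ↪ n × Bool :=
  ⟨fun p => (π p.1, !p.2), fun p q h => by
    rw [Prod.mk.injEq] at h
    exact Prod.ext (π.injective h.1) (Bool.not_inj h.2)⟩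

theorem flipP_apply (π : n ↪ n) (i : n) (k : Bool) : flipP π (i, k) = (π i, !k) := rfl

theorem Qt.shp {D : Matrix n n C(S15, ℂ)} {par : n → Bool} {t : n → Circle} {π : n ↪ n} {κ : n → Bool}
    {σ η : Bool} {θ c : Circle} (h : Qt D par t π κ σ η θ) {ω : C(S15, ℂ)} (hω : ∀ x, ω (cj x) = - ω x)
    (hc : c⁻¹ = c) :
    Qt (shp D par (wm ω)) (xpar par id) (fun p => t p.1 * if p.2 then c⁻¹ else 1) (flipP π)
      (fun p => xor (κ p.1) (p.2 && !η)) (xor σ (!η)) (!η) (θ * c) where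
  inv := by rintro ⟨i, k⟩; simp [flipP_apply, h.inv]
  par := by
    rintro ⟨i, k⟩
    rw [flipP_apply, xpar, xpar, h.par]
    cases k <;> cases par i <;> cases η <;> rfl
  wt := by
    rintro ⟨i, k⟩
    have hcc : c * c = 1 := by rw [← hc]; nth_rw 2 [hc]; exact inv_mul_cancel c
    simp only [flipP_apply, h.wt, hc]
    cases k
    · simp [mul_right_comm]
    · simp only [Bool.not_true, Bool.false_eq_true, if_false, if_true, mul_one]
      rw [mul_mul_mul_comm, hcc, mul_one]
  sign := by
    rintro ⟨i, k⟩
    simp only [flipP_apply, h.sign]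
    cases k <;> cases κ i <;> cases η <;> cases σ <;> rfl
  eq := by
    rintro ⟨i, k⟩ ⟨j, l⟩ x
    have h1 := h.eq i j x
    rw [flipP_apply, flipP_apply, shp_apply, shp_apply]
    simp only [ContinuousMap.add_apply, star_add, mul_add]
    have hi : π i = j ↔ i = π j := ⟨fun h' => by rw [← h', h.inv], fun h' => by rw [h', h.inv]⟩
    congr 1
    · by_cases hk : (!k) = l
      · subst hk
        have hsv : ∀ a b, sv (xor a b) = - sv a * sv b := fun a b => by cases a <;> cases b <;> simp [sv]
        simp only [if_true, Bool.not_not, hsv, neg_mul]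
        linear_combination -sv (!k && !η) * h1
      · have hk' : ¬ k = !l := fun h' => hk (by rw [h', Bool.not_not])
        rw [if_neg hk, if_neg hk']; simp
    · by_cases hj : π i = j
      · subst hj
        rw [if_pos rfl, if_pos (h.inv i).symm]
        simp only [ContinuousMap.mul_apply, sgn_apply, h.par, star_mul', star_sv]
        cases k <;> cases l <;> cases η <;> cases par i <;> cases κ (π i) <;>
          simp [sv, wm, hω]
      · rw [if_neg hj, if_neg (hi.not.1 hj)]; simp

end Quaternionic

section QuatMatrix

/-- The odd self-adjoint matrix built from the quaternion matrix with first column `(a, b)`. -/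
def qm (a b : C(S15, ℂ)) : Matrix (Bool × Bool) (Bool × Bool) C(S15, ℂ) := fun i j =>
  match i, j with
  | (false, true), (false, false) => a
  | (false, true), (true, false) => -star b
  | (true, true), (false, false) => b
  | (true, true), (true, false) => star a
  | (false, false), (false, true) => star a
  | (true, false), (false, true) => -b
  | (false, false), (true, true) => star b
  | (true, false), (true, true) => a
  | _, _ => 0

theorem dir_qm (a b : C(S15, ℂ)) : Dir (qm a b) Prod.snd (star a * a + star b * b) where
  herm := by
    rintro ⟨i, k⟩ ⟨j, l⟩
    cases i <;> cases k <;> cases j <;> cases l <;> simp [qm]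
  odd := by
    rintro ⟨i, k⟩ ⟨j, l⟩
    cases i <;> cases k <;> cases j <;> cases l <;> simp [qm]
  sq := by
    ext ⟨i, k⟩ ⟨j, l⟩ x
    cases i <;> cases k <;> cases j <;> cases l <;>
      simp [qm, Matrix.mul_apply, Fintype.sum_prod_type] <;> ring

theorem equi_qm_even {s : Fin 8 → Circle} {a b : C(S15, ℂ)} (ha : ∀ x, a (rc s x) = a x)
    (hb : ∀ x, b (rc s x) = b x) : Equi s (fun _ => 1) (qm a b) := by
  rintro ⟨i, k⟩ ⟨j, l⟩ x
  cases i <;> cases k <;> cases j <;> cases l <;> simp [qm, ha, hb]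

theorem equi_qm {s : Fin 8 → Circle} {a b : C(S15, ℂ)} (ha : ∀ x, a (rc s x) = a x)
    (hb : ∀ x, b (rc s x) = - b x) : Equi s (fun i => if i.1 then -1 else 1) (qm a b) := by
  rintro ⟨i, k⟩ ⟨j, l⟩ x
  cases i <;> cases k <;> cases j <;> cases l <;> simp [qm, ha, hb]

theorem equi_qm_odd {s : Fin 8 → Circle} {a b : C(S15, ℂ)} (ha : ∀ x, a (rc s x) = - a x)
    (hb : ∀ x, b (rc s x) = - b x) : Equi s (fun i => if i.2 then -1 else 1) (qm a b) := by
  rintro ⟨i, k⟩ ⟨j, l⟩ x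
  cases i <;> cases k <;> cases j <;> cases l <;> simp [qm, ha, hb]

/-- The permutation exchanging the two columns. -/
def swapP : Bool × Bool ↪ Bool × Bool :=
  ⟨fun p => (!p.1, p.2), fun p q h => by
    rw [Prod.mk.injEq] at h
    exact Prod.ext (Bool.not_inj h.1) h.2⟩

theorem swapP_apply (i k : Bool) : swapP (i, k) = (!i, k) := rfl

theorem qt_qm {a b : C(S15, ℂ)} (ha : ∀ x, a (cj x) = a x) (hb : ∀ x, b (cj x) = b x) :
    Qt (qm a b) Prod.snd (fun i => if i.1 then -1 else 1) swapP Prod.fst true false (-1) where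
  inv := by rintro ⟨i, k⟩; simp [swapP_apply]
  par := by rintro ⟨i, k⟩; simp [swapP_apply]
  wt := by rintro ⟨i, k⟩; cases i <;> simp [swapP_apply]
  sign := by rintro ⟨i, k⟩; simp [swapP_apply]
  eq := by
    rintro ⟨i, k⟩ ⟨j, l⟩ x
    cases i <;> cases k <;> cases j <;> cases l <;> simp [swapP_apply, qm, sv, ha, hb]

end QuatMatrix

section Weights
variable {n m : Type} [Fintype n] [Fintype m] [DecidableEq n] [DecidableEq m]
  {D : Matrix n n C(S15, ℂ)} {par : n → Bool} {E : Matrix m m C(S15, ℂ)} {par' : m → Bool}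
  {J : Set (Fin 8)} {c c' : C(S15, ℂ)} {s : Fin 8 → Circle} {t : n → Circle}

theorem Qt.even {π : n ↪ n} {κ : n → Bool} (h : Qt D par t π κ true false 1) (hD : Cliff D par J)
    (he : Equi s t D) (g : Circle) : Even (idx D par J (gr s t g)) := by
  refine idx_even hD (he.stab g) π h.inv (fun i => by simp [h.par]) κ (fun i => by simp [h.sign]) ?_ h.eq
  intro a i
  simp only [gr, mem_setOf_eq, h.wt, one_mul]

theorem dif_shp_zero (hD : Dir D par c) (hE : Dir E par' c') (heD : Equi s t D)
    (heE : Equi s (fun k => if par' k then -1 else 1) E) (hc : ∀ x ∈ SJ J, c x = 1)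
    (h0 : ∀ x ∈ SJ J, ∀ k l, E k l x = 0) (hc' : ∀ x ∈ SJ J, c' x = 0) :
    dif s (fun p : n × m => t p.1 * if par' p.2 then -1 else 1) (shp D par E) (xpar par par') J
      = Fintype.card m * dif s t D par J := by
  have he := heD.shp (par := par) heE
  rw [dif, idx_shp_zero hD hE (he.stab 1) hc h0 hc', idx_shp_zero hD hE (he.stab (-1)) hc h0 hc',
    ← Finset.sum_sub_distrib]
  have key : ∀ k, (if par' k then -1 else 1) * idx D par J
      (slc (gr s (fun p : n × m => t p.1 * if par' p.2 then -1 else 1) 1) k) -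
      (if par' k then -1 else 1) * idx D par J
      (slc (gr s (fun p : n × m => t p.1 * if par' p.2 then -1 else 1) (-1)) k) = dif s t D par J := by
    intro k
    have hs : ∀ g, slc (gr s (fun p : n × m => t p.1 * if par' p.2 then -1 else 1) g) k
        = gr s t (g * if par' k then -1 else 1) := by
      intro g
      ext p
      simp only [slc, gr, mem_setOf_eq]
      by_cases hk : par' k = true
      · simp only [hk, if_true, mul_neg, mul_one]
        exact neg_eq_iff_eq_neg
      · simp only [hk, if_false, mul_one, Bool.false_eq_true]
    rw [hs, hs, dif]
    by_cases hk : par' k = true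
    · simp [hk]; ring
    · simp [hk]
  rw [Finset.sum_congr rfl fun k _ => key k]
  simp

end Weights

section Families

/-- The map of the plane of the first two coordinates. -/
def emb (ξ : ℂ) : EuclideanSpace ℝ (Fin 8) := !₂[ξ.re, ξ.im, 0, 0, 0, 0, 0, 0]

theorem continuous_emb : Continuous emb := by
  refine (PiLp.continuous_toLp 2 _).comp (continuous_pi fun i => ?_)
  fin_cases i <;> simp <;> fun_prop

/-- The reflection of the last six coordinates. -/
def tauR (v : EuclideanSpace ℝ (Fin 8)) : EuclideanSpace ℝ (Fin 8) :=
  !₂[v 0, v 1, -v 2, -v 3, -v 4, -v 5, -v 6, -v 7]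

/-- Homogeneous extensions of the components of a map `S⁷ → S³` which is equivariant for an involution and
given on a fixed circle. -/
structure Hopf (a b : C(EuclideanSpace ℝ (Fin 8), ℂ)) : Prop where
  nsq : ∀ v, star (a v) * a v + star (b v) * b v = ((∑ i, v i ^ 2 : ℝ) : ℂ)
  even : ∀ v, a (tauR v) = a v
  odd : ∀ v, b (tauR v) = - b v
  circ : ∀ ξ, a (emb ξ) = - Complex.I * (starRingEnd ℂ ξ) ^ 8 / (‖ξ‖ : ℂ) ^ 7

theorem Hopf.emb_b {a b : C(EuclideanSpace ℝ (Fin 8), ℂ)} (h : Hopf a b) (ξ : ℂ) : b (emb ξ) = 0 := by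
  have h1 := h.odd (emb ξ)
  have : tauR (emb ξ) = emb ξ := by
    ext i
    fin_cases i <;> simp [tauR, emb]
  rw [this] at h1
  exact self_eq_neg.1 h1

/-- The rotating family of vectors. -/
def rotX : C(ℝ × S15, EuclideanSpace ℝ (Fin 8)) where
  toFun p := !₂[((p.2 : E8) 0).re,
    Real.cos (p.1 * (Real.pi / 2)) * ((p.2 : E8) 4).re - Real.sin (p.1 * (Real.pi / 2)) * ((p.2 : E8) 0).im,
    ((p.2 : E8) 1).re,
    Real.cos (p.1 * (Real.pi / 2)) * ((p.2 : E8) 5).re - Real.sin (p.1 * (Real.pi / 2)) * ((p.2 : E8) 1).im,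
    ((p.2 : E8) 2).re,
    Real.cos (p.1 * (Real.pi / 2)) * ((p.2 : E8) 6).re - Real.sin (p.1 * (Real.pi / 2)) * ((p.2 : E8) 2).im,
    ((p.2 : E8) 3).re,
    Real.cos (p.1 * (Real.pi / 2)) * ((p.2 : E8) 7).re - Real.sin (p.1 * (Real.pi / 2)) * ((p.2 : E8) 3).im]
  continuous_toFun := by
    refine (PiLp.continuous_toLp 2 _).comp (continuous_pi fun i => ?_)
    fin_cases i <;> simp <;> fun_prop

/-- The rotating family of complementary coordinates. -/
def rotW (j k : Fin 8) : C(ℝ × S15, ℂ) where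
  toFun p := ((Real.cos (p.1 * (Real.pi / 2)) * ((p.2 : E8) j).im +
    Real.sin (p.1 * (Real.pi / 2)) * ((p.2 : E8) k).re : ℝ) : ℂ) + (((p.2 : E8) k).im : ℂ) * Complex.I
  continuous_toFun := by fun_prop

theorem rotW_nsq (j k : Fin 8) (t : ℝ) (x : S15) : star (rotW j k (t, x)) * rotW j k (t, x) =
    (((Real.cos (t * (Real.pi / 2)) * ((x : E8) j).im +
    Real.sin (t * (Real.pi / 2)) * ((x : E8) k).re) ^ 2 + ((x : E8) k).im ^ 2 : ℝ) : ℂ) := by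
  rw [RCLike.star_def, Complex.conj_mul', ← Complex.ofReal_pow]
  congr 1
  rw [← Complex.normSq_eq_norm_sq]
  simp only [rotW, ContinuousMap.coe_mk, Complex.normSq_add_mul_I]

theorem S15_sum (x : S15) : ∑ k, (((x : E8) k).re ^ 2 + ((x : E8) k).im ^ 2) = 1 := by
  have h : ‖(x : E8)‖ = 1 := by simp
  have h2 := EuclideanSpace.norm_sq_eq (x : E8)
  rw [h, one_pow] at h2
  rw [h2]
  refine Finset.sum_congr rfl fun k _ => ?_
  rw [← Complex.normSq_eq_norm_sq, Complex.normSq_apply]; ring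

theorem rot_sum (t : ℝ) (x : S15) : ∑ i, rotX (t, x) i ^ 2 +
    ((Real.cos (t * (Real.pi / 2)) * ((x : E8) 0).im + Real.sin (t * (Real.pi / 2)) * ((x : E8) 4).re) ^ 2
      + ((x : E8) 4).im ^ 2) +
    ((Real.cos (t * (Real.pi / 2)) * ((x : E8) 1).im + Real.sin (t * (Real.pi / 2)) * ((x : E8) 5).re) ^ 2
      + ((x : E8) 5).im ^ 2) +
    ((Real.cos (t * (Real.pi / 2)) * ((x : E8) 2).im + Real.sin (t * (Real.pi / 2)) * ((x : E8) 6).re) ^ 2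
      + ((x : E8) 6).im ^ 2) +
    ((Real.cos (t * (Real.pi / 2)) * ((x : E8) 3).im + Real.sin (t * (Real.pi / 2)) * ((x : E8) 7).re) ^ 2
      + ((x : E8) 7).im ^ 2) = 1 := by
  have h := S15_sum x
  have hc := Real.cos_sq_add_sin_sq (t * (Real.pi / 2))
  rw [Fin.sum_univ_eight] at h ⊢
  simp only [rotX, ContinuousMap.coe_mk]
  simp
  linear_combination h + (((x : E8) 4).re ^ 2 + ((x : E8) 0).im ^ 2 + ((x : E8) 5).re ^ 2 + ((x : E8) 1).im ^ 2 +
    ((x : E8) 6).re ^ 2 + ((x : E8) 2).im ^ 2 + ((x : E8) 7).re ^ 2 + ((x : E8) 3).im ^ 2) * hc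

/-- The parities of the iterated sharp product. -/
def par4 : ((((Bool × Bool) × Bool) × Bool) × Bool) × Bool → Bool :=
  xpar (xpar (xpar (xpar Prod.snd id) id) id) id

/-- The iterated sharp product. -/
def big (a b w0 w1 w2 w3 : C(S15, ℂ)) : Matrix (((((Bool × Bool) × Bool) × Bool) × Bool) × Bool)
    (((((Bool × Bool) × Bool) × Bool) × Bool) × Bool) C(S15, ℂ) :=
  shp (shp (shp (shp (qm a b) Prod.snd (wm w0)) (xpar Prod.snd id) (wm w1)) (xpar (xpar Prod.snd id) id) (wm w2))
    (xpar (xpar (xpar Prod.snd id) id) id) (wm w3)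

theorem dir_big (a b w0 w1 w2 w3 : C(S15, ℂ)) : Dir (big a b w0 w1 w2 w3) par4
    (star a * a + star b * b + star w0 * w0 + star w1 * w1 + star w2 * w2 + star w3 * w3) :=
  ((((dir_qm a b).shp (dir_wm w0)).shp (dir_wm w1)).shp (dir_wm w2)).shp (dir_wm w3)

theorem continuous_wm {f : ℝ → C(S15, ℂ)} (h : Continuous f) (i j : Bool) : Continuous fun t => wm (f t) i j := by
  cases i <;> cases j <;> simp [wm] <;> fun_prop

theorem continuous_qm {f g : ℝ → C(S15, ℂ)} (hf : Continuous f) (hg : Continuous g) (i j : Bool × Bool) :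
    Continuous fun t => qm (f t) (g t) i j := by
  obtain ⟨i, k⟩ := i
  obtain ⟨j, l⟩ := j
  cases i <;> cases j <;> cases k <;> cases l <;> simp [qm] <;> fun_prop

theorem continuous_shp {n m : Type} [Fintype n] [Fintype m] [DecidableEq n] [DecidableEq m] {par : n → Bool}
    {D : ℝ → Matrix n n C(S15, ℂ)} {E : ℝ → Matrix m m C(S15, ℂ)} (hD : ∀ i j, Continuous fun t => D t i j)
    (hE : ∀ i j, Continuous fun t => E t i j) (i j : n × m) : Continuous fun t => shp (D t) par (E t) i j := by
  obtain ⟨i, k⟩ := i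
  obtain ⟨j, l⟩ := j
  simp only [shp_apply]
  have h1 := hD i j
  have h2 := hE k l
  refine Continuous.add ?_ ?_
  · split_ifs
    · exact h1
    · exact continuous_const
  · split_ifs
    · exact continuous_const.mul h2
    · exact continuous_const

end Families

section Rotation
variable {a b : C(EuclideanSpace ℝ (Fin 8), ℂ)}

/-- The rotating family of matrices. -/
def bigT (a b : C(EuclideanSpace ℝ (Fin 8), ℂ)) (t : ℝ) :=
  big ((a.comp rotX).curry t) ((b.comp rotX).curry t) ((rotW 0 4).curry t) ((rotW 1 5).curry t)
    ((rotW 2 6).curry t) ((rotW 3 7).curry t)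

/-- The subset of the first four coordinates. -/
def J4 : Set (Fin 8) := (((univ \ {7}) \ {6}) \ {5}) \ {4}

theorem Hopf.bigT_nsq (h : Hopf a b) (t : ℝ) (x : S15) :
    (star ((a.comp rotX).curry t) * ((a.comp rotX).curry t) + star ((b.comp rotX).curry t) * ((b.comp rotX).curry t)
      + star ((rotW 0 4).curry t) * ((rotW 0 4).curry t) + star ((rotW 1 5).curry t) * ((rotW 1 5).curry t)
      + star ((rotW 2 6).curry t) * ((rotW 2 6).curry t) + star ((rotW 3 7).curry t) * ((rotW 3 7).curry t)) x = 1 := by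
  have h1 := h.nsq (rotX (t, x))
  simp only [ContinuousMap.add_apply, ContinuousMap.mul_apply, ContinuousMap.star_apply, ContinuousMap.curry_apply,
    ContinuousMap.comp_apply, rotW_nsq]
  rw [h1]
  exact_mod_cast rot_sum t x

theorem Hopf.bigT_cliff (h : Hopf a b) (t : ℝ) (J : Set (Fin 8)) : Cliff (bigT a b t) par4 J :=
  (dir_big _ _ _ _ _ _).cliff fun x _ => h.bigT_nsq t x

theorem continuous_bigT (i j : ((((Bool × Bool) × Bool) × Bool) × Bool) × Bool) :
    Continuous fun t => bigT a b t i j := by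
  have hc : ∀ f : C(ℝ × S15, ℂ), Continuous fun t => f.curry t := fun f => f.curry.continuous
  refine continuous_shp (D := fun t => _) (E := fun t => wm ((rotW 3 7).curry t))
    (continuous_shp (D := fun t => _) (E := fun t => wm ((rotW 2 6).curry t))
      (continuous_shp (D := fun t => _) (E := fun t => wm ((rotW 1 5).curry t))
        (continuous_shp (D := fun t => qm ((a.comp rotX).curry t) ((b.comp rotX).curry t))
          (E := fun t => wm ((rotW 0 4).curry t)) ?_ ?_) ?_) ?_) ?_ i j
  · exact continuous_qm (hc _) (hc _)
  all_goals exact continuous_wm (hc _)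

theorem rotW_one (j k : Fin 8) : (rotW j k).curry 1 = crd k := by
  ext x
  simp [rotW, crd_apply]

theorem ro_apply_of_ne {j k : Fin 8} (h : k ≠ j) (u : Circle) (x : S15) : (rc (ro j u) x : E8) k = (x : E8) k := by
  rw [rc_apply, ro, Function.update_of_ne h]; simp

theorem crd_ro_of_ne {j k : Fin 8} (h : k ≠ j) (u : Circle) (x : S15) : crd k (rc (ro j u) x) = crd k x :=
  ro_apply_of_ne h u x

theorem rotX_one_ro {j : Fin 8} (hj : 4 ≤ j) (u : Circle) (x : S15) : rotX (1, rc (ro j u) x) = rotX (1, x) := by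
  have h : ∀ k : Fin 8, k < 4 → (rc (ro j u) x : E8) k = (x : E8) k := fun k hk =>
    ro_apply_of_ne (fun h => absurd (h ▸ hk) (not_lt.2 hj)) u x
  ext i
  fin_cases i <;> simp [rotX, h]

theorem equi_wm_one {s : Fin 8 → Circle} {ω : C(S15, ℂ)} (h : ∀ x, ω (rc s x) = ω x) :
    Equi s (fun _ => 1) (wm ω) := by
  simpa using equi_wm (u := 1) (ω := ω) (s := s) (by simpa using h)

theorem equi_shp_one {n m : Type} [Fintype n] [Fintype m] [DecidableEq n] [DecidableEq m] {par : n → Bool}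
    {D : Matrix n n C(S15, ℂ)} {E : Matrix m m C(S15, ℂ)} {s : Fin 8 → Circle}
    (hD : Equi s (fun _ => 1) D) (hE : Equi s (fun _ => 1) E) : Equi s (fun _ => 1) (shp D par E) := by
  simpa using hD.shp (par := par) hE

theorem Hopf.idx_bigT (h : Hopf a b) : idx (bigT a b 0) par4 univ univ =
    idx (qm ((a.comp rotX).curry 1) ((b.comp rotX).curry 1)) Prod.snd J4 univ := by
  rw [idx_path (D := bigT a b) (fun i j => (continuous_bigT i j).continuousOn)
    (fun t _ => h.bigT_cliff t univ) (fun t _ => Stab.univ _)]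
  have hx := h.bigT_nsq 1
  rw [bigT]
  simp only [rotW_one] at hx ⊢
  have hq : ∀ j : Fin 8, 4 ≤ j → ∀ u, Equi (ro j u) (fun _ => 1)
      (qm ((a.comp rotX).curry 1) ((b.comp rotX).curry 1)) := fun j hj u =>
    equi_qm_even (fun x => congrArg a (rotX_one_ro hj u x)) (fun x => congrArg b (rotX_one_ro hj u x))
  have hw : ∀ j k : Fin 8, k ≠ j → ∀ u, Equi (ro j u) (fun _ => 1) (wm (crd k)) := fun j k hk u =>
    equi_wm_one (crd_ro_of_ne hk u)
  have d0 := dir_qm ((a.comp rotX).curry 1) ((b.comp rotX).curry 1)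
  have d1 := d0.shp (dir_wm (crd 4))
  have d2 := d1.shp (dir_wm (crd 5))
  have d3 := d2.shp (dir_wm (crd 6))
  have z : ∀ (J : Set (Fin 8)) (k : Fin 8), k ∉ J → ∀ x ∈ SJ J, crd k x = 0 := fun J k hk x hx => hx k hk
  rw [big, par4, idx_shp_crd d3 (mem_univ _) (fun u => equi_shp_one (equi_shp_one (equi_shp_one (hq 7 (by decide) u)
      (hw 7 4 (by decide) u)) (hw 7 5 (by decide) u)) (hw 7 6 (by decide) u)) (fun x _ => by
        simpa only [ContinuousMap.add_apply, ContinuousMap.mul_apply, ContinuousMap.star_apply] using hx x),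
    idx_shp_crd d2 (by simp) (fun u => equi_shp_one (equi_shp_one (hq 6 (by decide) u) (hw 6 4 (by decide) u))
      (hw 6 5 (by decide) u)) (fun x hJ => by
        have := hx x
        have z7 := z _ 7 (by simp) x hJ
        simpa only [ContinuousMap.add_apply, ContinuousMap.mul_apply, ContinuousMap.star_apply, z7, mul_zero,
          add_zero] using this),
    idx_shp_crd d1 (by simp) (fun u => equi_shp_one (hq 5 (by decide) u) (hw 5 4 (by decide) u)) (fun x hJ => by
        have := hx x
        have z7 := z _ 7 (by simp) x hJ
        have z6 := z _ 6 (by simp) x hJ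
        simpa only [ContinuousMap.add_apply, ContinuousMap.mul_apply, ContinuousMap.star_apply, z7, z6, mul_zero,
          add_zero] using this),
    idx_shp_crd d0 (by simp) (hq 4 le_rfl) (fun x hJ => by
        have := hx x
        have z7 := z _ 7 (by simp) x hJ
        have z6 := z _ 6 (by simp) x hJ
        have z5 := z _ 5 (by simp) x hJ
        simpa only [ContinuousMap.add_apply, ContinuousMap.mul_apply, ContinuousMap.star_apply, z7, z6, z5, mul_zero,
          add_zero] using this)]
  simp only [neg_neg, J4]

end Rotation

section Doubling
variable {a b : C(EuclideanSpace ℝ (Fin 8), ℂ)}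

/-- The two rotated copies of the four-dimensional complex space. -/
def symX (e : ℝ) : C(S15, EuclideanSpace ℝ (Fin 8)) where
  toFun x := !₂[((x : E8) 0).re + e * ((x : E8) 4).re, -(((x : E8) 0).im + e * ((x : E8) 4).im),
    ((x : E8) 1).re + e * ((x : E8) 5).re, -(((x : E8) 1).im + e * ((x : E8) 5).im),
    ((x : E8) 2).re + e * ((x : E8) 6).re, -(((x : E8) 2).im + e * ((x : E8) 6).im),
    ((x : E8) 3).re + e * ((x : E8) 7).re, -(((x : E8) 3).im + e * ((x : E8) 7).im)]
  continuous_toFun := by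
    refine (PiLp.continuous_toLp 2 _).comp (continuous_pi fun i => ?_)
    fin_cases i <;> simp <;> fun_prop

/-- The sign of the last four coordinates. -/
def s4 : Fin 8 → Circle := fun k => if 4 ≤ k then -1 else 1

theorem symX_rc (e : ℝ) (x : S15) : symX e (rc s4 x) = symX (-e) x := by
  have h : ∀ k, (rc s4 x : E8) k = if 4 ≤ k then - (x : E8) k else (x : E8) k := fun k => by
    rw [rc_apply, s4]
    split_ifs <;> simp
  ext i
  fin_cases i <;> simp [symX, h, Fin.le_def]

theorem symX_J4 (e : ℝ) {x : S15} (hx : x ∈ SJ J4) : symX e x = rotX (1, x) := by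
  have h4 : (x : E8) 4 = 0 := hx 4 (by simp [J4])
  have h5 : (x : E8) 5 = 0 := hx 5 (by simp [J4])
  have h6 : (x : E8) 6 = 0 := hx 6 (by simp [J4])
  have h7 : (x : E8) 7 = 0 := hx 7 (by simp [J4])
  ext i
  fin_cases i <;> simp [symX, rotX, h4, h5, h6, h7]

theorem symX_sum (x : S15) : ∑ i, symX 1 x i ^ 2 + ∑ i, symX (-1) x i ^ 2 = 2 := by
  have h := S15_sum x
  rw [Fin.sum_univ_eight] at h ⊢
  rw [Fin.sum_univ_eight]
  simp only [symX, ContinuousMap.coe_mk]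
  simp
  linear_combination 2 * h

/-- The symmetric and antisymmetric parts. -/
def sym (a : C(EuclideanSpace ℝ (Fin 8), ℂ)) (e : ℝ) : C(S15, ℂ) :=
  (1 / 2 : ℂ) • (a.comp (symX 1) + (e : ℂ) • a.comp (symX (-1)))

theorem sym_apply (a : C(EuclideanSpace ℝ (Fin 8), ℂ)) (e : ℝ) (x : S15) :
    sym a e x = 1 / 2 * (a (symX 1 x) + e * a (symX (-1) x)) := rfl

theorem Hopf.sym_nsq (h : Hopf a b) (x : S15) : ((star (sym a 1) * sym a 1 + star (sym b 1) * sym b 1)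
    + (star (sym a (-1)) * sym a (-1) + star (sym b (-1)) * sym b (-1))) x = 1 := by
  have h1 := h.nsq (symX 1 x)
  have h2 := h.nsq (symX (-1) x)
  have h3 : ((∑ i, symX 1 x i ^ 2 : ℝ) : ℂ) + ((∑ i, symX (-1) x i ^ 2 : ℝ) : ℂ) = 2 := by
    exact_mod_cast symX_sum x
  rw [← h1, ← h2] at h3
  simp only [ContinuousMap.add_apply, ContinuousMap.mul_apply, ContinuousMap.star_apply, sym_apply]
  simp
  simp at h3
  linear_combination h3 / 2

theorem Hopf.idx_J4 (h : Hopf a b) : ∃ k : ℤ,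
    idx (qm ((a.comp rotX).curry 1) ((b.comp rotX).curry 1)) Prod.snd J4 univ = 4 * k := by
  have ep : Equi s4 (fun _ => 1) (qm (sym a 1) (sym b 1)) :=
    equi_qm_even (fun x => by simp [sym_apply, symX_rc, add_comm]) (fun x => by simp [sym_apply, symX_rc, add_comm])
  have em : Equi s4 (fun i => if i.2 then -1 else 1) (qm (sym a (-1)) (sym b (-1))) :=
    equi_qm_odd (fun x => by simp [sym_apply, symX_rc]; ring) (fun x => by simp [sym_apply, symX_rc]; ring)
  have dp := dir_qm (sym a 1) (sym b 1)
  have dm := dir_qm (sym a (-1)) (sym b (-1))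
  have d := dp.shp dm
  have e := ep.shp (par := Prod.snd) em
  have hC : ∀ J, Cliff _ _ J := fun J => d.cliff (J := J) fun x _ => h.sym_nsq x
  have hs : ∀ j : Fin 8, 4 ≤ j → s4 j = -1 := fun j hj => if_pos hj
  have r7 := e.dif_remove (hC _) (mem_univ 7) (hs 7 (by decide))
  have r6 := e.dif_remove (hC (univ \ {7})) (j := 6) (by simp) (hs 6 (by decide))
  have r5 := e.dif_remove (hC ((univ \ {7}) \ {6})) (j := 5) (by simp) (hs 5 (by decide))
  have r4 := e.dif_remove (hC (((univ \ {7}) \ {6}) \ {5})) (j := 4) (by simp) (hs 4 (by decide))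
  have z : ∀ (f : C(EuclideanSpace ℝ (Fin 8), ℂ)), ∀ x ∈ SJ J4, sym f (-1) x = 0 := fun f x hx => by
    rw [sym_apply, symX_J4 1 hx, symX_J4 (-1) hx]; simp
  have q : ∀ (f : C(EuclideanSpace ℝ (Fin 8), ℂ)), ∀ x ∈ SJ J4, sym f 1 x = (f.comp rotX).curry 1 x := fun f x hx => by
    rw [sym_apply, symX_J4 1 hx, symX_J4 (-1) hx, ContinuousMap.curry_apply, ContinuousMap.comp_apply]
    simp; ring
  have zc : ∀ x ∈ SJ J4, (star (sym a (-1)) * sym a (-1) + star (sym b (-1)) * sym b (-1)) x = 0 := fun x hx => by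
    simp only [ContinuousMap.add_apply, ContinuousMap.mul_apply, z _ x hx]; simp
  have pc : ∀ x ∈ SJ J4, (star (sym a 1) * sym a 1 + star (sym b 1) * sym b 1) x = 1 := fun x hx => by
    have := h.sym_nsq x
    rwa [ContinuousMap.add_apply, zc x hx, add_zero] at this
  have hz := dif_shp_zero (J := J4) dp dm ep em pc (fun x hx => by
    rintro ⟨i, k⟩ ⟨j, l⟩
    cases i <;> cases j <;> cases k <;> cases l <;> simp [qm, z _ x hx]) zc
  have hn : ∀ p ∈ YN (Bool × Bool) J4, chi s4 p.1 * 1 = 1 := by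
    intro p hp
    rw [mul_one, chi]
    refine Finset.prod_eq_one fun k _ => ?_
    by_cases hk : 4 ≤ k
    · rw [hp k (by revert k; simp [J4]; decide), pow_zero]
    · rw [s4, if_neg hk, one_pow]
  have hd : dif s4 (fun _ => 1) (qm (sym a 1) (sym b 1)) Prod.snd J4 =
      idx (qm ((a.comp rotX).curry 1) ((b.comp rotX).curry 1)) Prod.snd J4 univ := by
    rw [dif, idx_set (A := gr s4 (fun _ => 1) 1) (B := univ) (fun p hp => by simpa [gr] using hn p hp),
      idx_set (A := gr s4 (fun _ => 1) (-1)) (B := ∅), idx_empty, sub_zero]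
    · symm
      refine idx_congr (dp.cliff pc) (Stab.univ _) fun x hx => ?_
      rintro ⟨i, k⟩ ⟨j, l⟩
      cases i <;> cases j <;> cases k <;> cases l <;> simp only [qm, ContinuousMap.neg_apply,
        ContinuousMap.star_apply, q _ x hx] <;> rfl
    · intro p hp
      simp only [gr, mem_setOf_eq, hn p hp, mem_empty_iff_false, iff_false]
      intro h'
      have := congrArg (fun z : Circle => (z : ℂ)) h'
      norm_num [Circle.coe_neg] at this
  rw [hd] at hz
  refine ⟨dif s4 (fun p : (Bool × Bool) × (Bool × Bool) => 1 * if p.2.2 then -1 else 1)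
    (shp (qm (sym a 1) (sym b 1)) Prod.snd (qm (sym a (-1)) (sym b (-1)))) (xpar Prod.snd Prod.snd) univ, ?_⟩
  rw [show (((univ \ {7}) \ {6}) \ {5}) \ {4} = J4 from rfl, hz] at r4
  rw [r5, r6, r7] at r4
  simp only [Fintype.card_prod, Fintype.card_bool] at r4
  push_cast at r4
  linarith

end Doubling

section Base
variable {a b : C(EuclideanSpace ℝ (Fin 8), ℂ)}

/-- The pair of coordinates remaining after the removals. -/
def J0 : Set (Fin 8) := (((((univ \ {1}) \ {2}) \ {3}) \ {5}) \ {6}) \ {7}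

theorem J0_diff : J0 \ {4} = {0} := by
  ext k; fin_cases k <;> simp [J0]

theorem rotX_J0 (t : ℝ) {x : S15} (hx : x ∈ SJ J0) : rotX (t, x) = emb ⟨((x : E8) 0).re,
    Real.cos (t * (Real.pi / 2)) * ((x : E8) 4).re - Real.sin (t * (Real.pi / 2)) * ((x : E8) 0).im⟩ := by
  have h : ∀ k, k ∉ J0 → (x : E8) k = 0 := hx
  have h1 := h 1 (by simp [J0])
  have h2 := h 2 (by simp [J0])
  have h3 := h 3 (by simp [J0])
  have h5 := h 5 (by simp [J0])
  have h6 := h 6 (by simp [J0])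
  have h7 := h 7 (by simp [J0])
  ext i
  fin_cases i <;> simp [rotX, emb, h1, h2, h3, h5, h6, h7]

theorem rotW_J0 (t : ℝ) {x : S15} (hx : x ∈ SJ J0) {j k : Fin 8} (hj : j ∉ J0) (hk : k ∉ J0) :
    rotW j k (t, x) = 0 := by
  have h1 : (x : E8) j = 0 := hx j hj
  have h2 : (x : E8) k = 0 := hx k hk
  simp [rotW, h1, h2]

theorem Hopf.nsq_J0 (h : Hopf a b) (t : ℝ) {x : S15} (hx : x ∈ SJ J0) :
    star (a (rotX (t, x))) * a (rotX (t, x)) + star (rotW 0 4 (t, x)) * rotW 0 4 (t, x) = 1 := by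
  have h1 := h.bigT_nsq t x
  simp only [ContinuousMap.add_apply, ContinuousMap.mul_apply, ContinuousMap.star_apply, ContinuousMap.curry_apply,
    ContinuousMap.comp_apply] at h1
  rw [rotW_J0 t hx (j := 1) (k := 5) (by simp [J0]) (by simp [J0]),
    rotW_J0 t hx (j := 2) (k := 6) (by simp [J0]) (by simp [J0]),
    rotW_J0 t hx (j := 3) (k := 7) (by simp [J0]) (by simp [J0])] at h1
  have h2 : b (rotX (t, x)) = 0 := by rw [rotX_J0 t hx, h.emb_b]
  simpa [h2] using h1

/-- Conditional conjugation. -/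
def cst (e : Bool) (f : C(S15, ℂ)) : C(S15, ℂ) := if e then star f else f

theorem star_cst (e : Bool) (f : C(S15, ℂ)) (x : S15) : star (cst e f x) * cst e f x = star (f x) * f x := by
  cases e <;> simp [cst, mul_comm]

/-- The terminal function on the sphere. -/
def trm (a : C(EuclideanSpace ℝ (Fin 8), ℂ)) : C(S15, ℂ) :=
  a.comp ⟨fun x => emb (star (crd 0 x)), continuous_emb.comp (by fun_prop)⟩

theorem Hopf.trm_apply (h : Hopf a b) (x : S15) :
    trm a x = - Complex.I * (crd 0 x) ^ 8 / (‖crd 0 x‖ : ℂ) ^ 7 := by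
  change a (emb (star (crd 0 x))) = _
  rw [h.circ]
  simp

theorem Hopf.trm_ro (h : Hopf a b) (u : Circle) (x : S15) : trm a (rc (ro 0 u) x) = (u : ℂ) ^ 8 * trm a x := by
  rw [h.trm_apply, h.trm_apply, crd_ro_self, norm_mul, Circle.norm_coe, one_mul, mul_pow]
  ring

theorem Hopf.cst_ro (h : Hopf a b) (e : Bool) (u : Circle) (x : S15) :
    cst e (trm a) (rc (ro 0 u) x) = (u ^ (if e then -8 else 8 : ℤ) : Circle) * cst e (trm a) x := by
  cases e
  · change trm a _ = _
    rw [h.trm_ro]; norm_cast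
  · change star (trm a _) = _
    rw [h.trm_ro]
    simp only [if_true, zpow_neg, Circle.coe_inv_eq_conj, star_mul']
    norm_cast

/-- The inclusion of one column. -/
def colI (e : Bool) : Bool × Bool ↪ (Bool × Bool) × Bool :=
  ⟨fun p => ((e, p.1), p.2), fun p q h => by simpa [Prod.ext_iff] using h⟩

theorem colI_apply (e i k : Bool) : colI e (i, k) = ((e, i), k) := rfl

theorem Hopf.idx_col (h : Hopf a b) (e : Bool) :
    idx (shp (qm ((a.comp rotX).curry 0) ((b.comp rotX).curry 0)) Prod.snd (wm ((rotW 0 4).curry 0)))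
      (xpar Prod.snd id) J0 (ov {p | p.1.1 = e}) = - (if e then -8 else 8 : ℤ) := by
  have hc : ∀ f : C(ℝ × S15, ℂ), Continuous fun t => f.curry t := fun f => f.curry.continuous
  have hd := fun t => (dir_wm (cst e ((a.comp rotX).curry t))).shp (dir_wm ((rotW 0 4).curry t))
  have hC : ∀ t, Cliff _ _ J0 := fun t => (hd t).cliff (J := J0) fun x hx => by
    have := h.nsq_J0 t hx
    simp only [ContinuousMap.add_apply, ContinuousMap.mul_apply, ContinuousMap.star_apply, ContinuousMap.curry_apply,
      ContinuousMap.comp_apply, star_cst]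
    exact this
  have hs : ov {p : (Bool × Bool) × Bool | p.1.1 = e} = ri (colI e) '' univ := by
    ext ⟨m, ⟨i, j⟩, k⟩
    simp only [ov, mem_setOf_eq, image_univ, mem_range, Prod.exists, ri_apply, colI_apply, Prod.mk.injEq]
    constructor
    · rintro rfl
      exact ⟨m, j, k, rfl, ⟨rfl, rfl⟩, rfl⟩
    · rintro ⟨_, _, _, _, ⟨rfl, _⟩, _⟩
      rfl
  rw [hs, idx_image (colI e) (hC 0) (Stab.univ _) (fun _ => rfl),
    idx_path (D := fun t => shp (wm (cst e ((a.comp rotX).curry t))) id (wm ((rotW 0 4).curry t)))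
      (fun i j => (continuous_shp (continuous_wm (by
          cases e
          · exact hc _
          · exact (hc _).star)) (continuous_wm (hc _)) i j).continuousOn) (fun t _ => hC t) (fun t _ => Stab.univ _)]
  · have hx : ∀ x ∈ SJ J0, trm a x = (a.comp rotX).curry 1 x := fun x hx => by
      change a _ = a (rotX (1, x))
      rw [rotX_J0 1 hx]
      refine congrArg a (congrArg emb ?_ : emb (star (crd 0 x)) = _)
      apply Complex.ext <;> simp [crd_apply]
    have hy : ∀ x ∈ SJ J0, cst e ((a.comp rotX).curry 1) x = cst e (trm a) x := fun x hx' => by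
      cases e
      · exact (hx x hx').symm
      · exact congrArg star (hx x hx').symm
    have hn : ∀ x ∈ SJ J0, star (cst e (trm a) x) * cst e (trm a) x + star (crd 4 x) * crd 4 x = 1 := fun x hx' => by
      rw [star_cst, hx x hx', ← rotW_one 0 4]
      exact h.nsq_J0 1 hx'
    rw [idx_congr (D := shp (wm (cst e (trm a))) id (wm (crd 4)))
      (((dir_wm _).shp (dir_wm _)).cliff fun x hx' => by
        simpa only [ContinuousMap.add_apply, ContinuousMap.mul_apply, ContinuousMap.star_apply] using hn x hx')
      (Stab.univ _),
      idx_shp_crd (dir_wm _) (by simp [J0]) (fun u => equi_wm_one fun x => by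
        have : crd 0 (rc (ro 4 u) x) = crd 0 x := crd_ro_of_ne (by decide) u x
        cases e <;> simp [cst, h.trm_apply, this])
        (fun x hx' => by simpa only [ContinuousMap.mul_apply, ContinuousMap.star_apply] using hn x hx'),
      J0_diff, idx_wm _ (h.cst_ro e)]
    · intro x hx'
      have h0 : x ∈ SJ J0 := SJ_mono (by rw [← J0_diff]; exact diff_subset) hx'
      have h4 : crd 4 x = 0 := hx' 4 (by simp)
      simpa [h4] using hn x h0
    · rintro x hx' ⟨i, k⟩ ⟨j, l⟩
      rw [rotW_one]
      simp only [shp_apply, ContinuousMap.add_apply]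
      congr 1
      have := hy x hx'
      cases i <;> cases j <;> cases k <;> cases l <;> simp [wm, this]
  · rintro x hx ⟨i, k⟩ ⟨j, l⟩
    have hb : b (rotX (0, x)) = 0 := by rw [rotX_J0 0 hx, h.emb_b]
    simp only [colI_apply, shp_apply, ContinuousMap.add_apply]
    congr 1
    · cases e <;> cases i <;> cases j <;> cases k <;> cases l <;> simp [wm, qm, cst]
    · simp

end Base

section Contradiction
variable {a b : C(EuclideanSpace ℝ (Fin 8), ℂ)}

/-- The signs of the coordinates for the involution. -/
def s2 : Fin 8 → Circle := fun k => if k = 0 ∨ k = 4 then 1 else -1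

theorem rc_s2 (x : S15) (k : Fin 8) : (rc s2 x : E8) k = if k = 0 ∨ k = 4 then (x : E8) k else - (x : E8) k := by
  rw [rc_apply, s2]
  split_ifs <;> simp

theorem rotX_s2 (x : S15) : rotX (0, rc s2 x) = tauR (rotX (0, x)) := by
  ext i
  fin_cases i <;> simp [rotX, tauR, rc_s2]

theorem rotX_cj (x : S15) : rotX (0, cj x) = rotX (0, x) := by
  ext i
  fin_cases i <;> simp [rotX, cj_apply]

theorem rotW_cj (j k : Fin 8) (x : S15) : (rotW j k).curry 0 (cj x) = - (rotW j k).curry 0 x := by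
  simp [rotW, cj_apply]; ring

theorem rotW_s2 {j k : Fin 8} (hj : ¬ (j = 0 ∨ j = 4)) (hk : ¬ (k = 0 ∨ k = 4)) (x : S15) :
    (rotW j k).curry 0 (rc s2 x) = (-1 : Circle) * (rotW j k).curry 0 x := by
  simp [rotW, rc_s2, if_neg hj, if_neg hk]; ring

theorem rotW_s2_zero (x : S15) : (rotW 0 4).curry 0 (rc s2 x) = (1 : Circle) * (rotW 0 4).curry 0 x := by
  simp [rotW, rc_s2]

theorem equi_wm_neg {s : Fin 8 → Circle} {ω : C(S15, ℂ)} (h : ∀ x, ω (rc s x) = (-1 : Circle) * ω x) :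
    Equi s (fun k => if id k then -1 else 1) (wm ω) := by
  simpa using equi_wm h

theorem neg_one_inv_circle : (-1 : Circle)⁻¹ = -1 := by
  rw [inv_eq_iff_mul_eq_one]; simp

theorem not_hopf (h : Hopf a b) : False := by
  have e0 : Equi s2 (fun i => if i.1 then -1 else 1) (qm ((a.comp rotX).curry 0) ((b.comp rotX).curry 0)) :=
    equi_qm (fun x => (congrArg a (rotX_s2 x)).trans (h.even _)) (fun x => (congrArg b (rotX_s2 x)).trans (h.odd _))
  have e1 := e0.shp (par := Prod.snd) (equi_wm rotW_s2_zero)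
  have w1 := equi_wm_neg (rotW_s2 (j := 1) (k := 5) (by decide) (by decide))
  have w2 := equi_wm_neg (rotW_s2 (j := 2) (k := 6) (by decide) (by decide))
  have w3 := equi_wm_neg (rotW_s2 (j := 3) (k := 7) (by decide) (by decide))
  have e2 := e1.shp (par := xpar Prod.snd id) w1
  have e3 := e2.shp (par := xpar (xpar Prod.snd id) id) w2
  have e4 := e3.shp (par := xpar (xpar (xpar Prod.snd id) id) id) w3
  have hC : ∀ J, Cliff _ par4 J := h.bigT_cliff 0
  have q0 := qt_qm (a := (a.comp rotX).curry 0) (b := (b.comp rotX).curry 0)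
    (fun x => congrArg a (rotX_cj x)) (fun x => congrArg b (rotX_cj x))
  have q1 := q0.shp (rotW_cj 0 4) (c := 1) (by simp)
  have q2 := q1.shp (rotW_cj 1 5) neg_one_inv_circle
  have q3 := q2.shp (rotW_cj 2 6) neg_one_inv_circle
  have q4 := q3.shp (rotW_cj 3 7) neg_one_inv_circle
  simp only [neg_one_inv_circle] at q4
  rw [show (-1 * 1 * -1 * -1 * -1 : Circle) = 1 by simp] at q4
  have hev := fun g => Qt.even q4 (hC univ) e4 g
  obtain ⟨k, hk⟩ := h.idx_J4
  have hu := e4.dif_univ (hC univ) (fun k => by rw [s2]; split_ifs <;> simp) (by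
    rintro ⟨⟨⟨⟨⟨i, i0⟩, i1⟩, i2⟩, i3⟩, i4⟩
    cases i <;> cases i1 <;> cases i2 <;> cases i3 <;> cases i4 <;> simp)
  have r1 := e4.dif_remove (hC _) (mem_univ 1) (if_neg (by decide))
  have r2 := e4.dif_remove (hC (univ \ {1})) (j := 2) (by simp) (if_neg (by decide))
  have r3 := e4.dif_remove (hC ((univ \ {1}) \ {2})) (j := 3) (by simp) (if_neg (by decide))
  have r5 := e4.dif_remove (hC (((univ \ {1}) \ {2}) \ {3})) (j := 5) (by simp) (if_neg (by decide))
  have r6 := e4.dif_remove (hC ((((univ \ {1}) \ {2}) \ {3}) \ {5})) (j := 6) (by simp) (if_neg (by decide))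
  have r7 := e4.dif_remove (hC (((((univ \ {1}) \ {2}) \ {3}) \ {5}) \ {6})) (j := 7) (by simp)
    (if_neg (by decide))
  have d0 := dir_qm ((a.comp rotX).curry 0) ((b.comp rotX).curry 0)
  have d1 := d0.shp (dir_wm ((rotW 0 4).curry 0))
  have d2 := d1.shp (dir_wm ((rotW 1 5).curry 0))
  have d3 := d2.shp (dir_wm ((rotW 2 6).curry 0))
  have z1 : ∀ x ∈ SJ J0, (rotW 1 5).curry 0 x = 0 := fun x hx => rotW_J0 0 hx (by simp [J0]) (by simp [J0])
  have z2 : ∀ x ∈ SJ J0, (rotW 2 6).curry 0 x = 0 := fun x hx => rotW_J0 0 hx (by simp [J0]) (by simp [J0])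
  have z3 : ∀ x ∈ SJ J0, (rotW 3 7).curry 0 x = 0 := fun x hx => rotW_J0 0 hx (by simp [J0]) (by simp [J0])
  have zw : ∀ ω : C(S15, ℂ), (∀ x ∈ SJ J0, ω x = 0) → ∀ x ∈ SJ J0, ∀ k l, wm ω k l x = 0 := fun ω hω x hx k l => by
    cases k <;> cases l <;> simp [wm, hω x hx]
  have zc : ∀ ω : C(S15, ℂ), (∀ x ∈ SJ J0, ω x = 0) → ∀ x ∈ SJ J0, (star ω * ω) x = 0 := fun ω hω x hx => by
    simp [hω x hx]
  have c1 : ∀ x ∈ SJ J0, (star ((a.comp rotX).curry 0) * (a.comp rotX).curry 0 +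
      star ((b.comp rotX).curry 0) * (b.comp rotX).curry 0 +
      star ((rotW 0 4).curry 0) * (rotW 0 4).curry 0) x = 1 := fun x hx => by
    have := h.bigT_nsq 0 x
    simpa [z1 x hx, z2 x hx, z3 x hx] using this
  have c2 : ∀ x ∈ SJ J0, (star ((a.comp rotX).curry 0) * (a.comp rotX).curry 0 +
      star ((b.comp rotX).curry 0) * (b.comp rotX).curry 0 +
      star ((rotW 0 4).curry 0) * (rotW 0 4).curry 0 +
      star ((rotW 1 5).curry 0) * (rotW 1 5).curry 0) x = 1 := fun x hx => by
    rw [ContinuousMap.add_apply, zc _ z1 x hx, add_zero]; exact c1 x hx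
  have c3 : ∀ x ∈ SJ J0, (star ((a.comp rotX).curry 0) * (a.comp rotX).curry 0 +
      star ((b.comp rotX).curry 0) * (b.comp rotX).curry 0 +
      star ((rotW 0 4).curry 0) * (rotW 0 4).curry 0 +
      star ((rotW 1 5).curry 0) * (rotW 1 5).curry 0 +
      star ((rotW 2 6).curry 0) * (rotW 2 6).curry 0) x = 1 := fun x hx => by
    rw [ContinuousMap.add_apply, zc _ z2 x hx, add_zero]; exact c2 x hx
  have f3 := dif_shp_zero d3 (dir_wm _) e3 w3 c3 (zw _ z3) (zc _ z3)
  have f2 := dif_shp_zero d2 (dir_wm _) e2 w2 c2 (zw _ z2) (zc _ z2)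
  have f1 := dif_shp_zero d1 (dir_wm _) e1 w1 c1 (zw _ z1) (zc _ z1)
  have hchi : ∀ p ∈ NJ J0, chi s2 p = 1 := by
    intro p hp
    rw [chi]
    refine Finset.prod_eq_one fun k _ => ?_
    by_cases hk : k = 0 ∨ k = 4
    · rw [s2, if_pos hk, one_pow]
    · rw [hp k (by fin_cases k <;> simp [J0] at hk ⊢), pow_zero]
  have hne : (1 : Circle) ≠ -1 := fun h' => by
    have := congrArg (fun z : Circle => (z : ℂ)) h'
    norm_num [Circle.coe_neg] at this
  have f0 : dif s2 _ _ _ J0 = -8 - 8 := congrArg₂ (· - ·)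
    ((idx_set (A := gr s2 (fun p : (Bool × Bool) × Bool => (if p.1.1 then -1 else 1) * if p.2 then 1⁻¹ else 1) 1)
      (by
        rintro ⟨m, ⟨i, j⟩, l⟩ hp
        simp only [gr, ov, mem_setOf_eq, hchi m hp]
        cases i <;> cases l <;> simp [hne.symm])).trans (h.idx_col false))
    ((idx_set (A := gr s2 (fun p : (Bool × Bool) × Bool => (if p.1.1 then -1 else 1) * if p.2 then 1⁻¹ else 1) (-1))
      (by
        rintro ⟨m, ⟨i, j⟩, l⟩ hp
        simp only [gr, ov, mem_setOf_eq, hchi m hp]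
        cases i <;> cases l <;> simp [hne])).trans (h.idx_col true))
  have g1 := hev 1
  have g2 := hev (-1)
  have hb := h.idx_bigT.trans hk
  change dif s2 _ _ _ J0 = _ at r7
  have r8 := r7.symm.trans f3
  rw [f2, f1, f0, r6, r5, r3, r2, r1] at r8
  simp only [Fintype.card_bool, dif] at r8
  have key : ∀ P Q : ℤ, Even P → Even Q → P + Q = 4 * k →
      2 * (2 * (2 * (2 * (2 * (2 * (P - Q)))))) = ((2 : ℕ) : ℤ) * (((2 : ℕ) : ℤ) * (((2 : ℕ) : ℤ) * (-8 - 8))) →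
      False := by
    rintro P Q ⟨m, rfl⟩ ⟨n, rfl⟩ h1 h2
    push_cast at h2
    omega
  exact key _ _ (hev 1) (hev (-1)) (hu.symm.trans hb) r8

end Contradiction

section Homogeneous

/-- The homogeneous extension of a function on the sphere is continuous. -/
theorem continuous_homog {d : ℕ} {G : Type*} [NormedAddCommGroup G] [NormedSpace ℝ G]
    {α : EuclideanSpace ℝ (Fin d) → G}
    (hα : ContinuousOn α (Metric.sphere 0 1)) (hb : ∀ v ∈ Metric.sphere (0 : EuclideanSpace ℝ (Fin d)) 1, ‖α v‖ ≤ 1) :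
    Continuous fun v => ‖v‖ • α (‖v‖⁻¹ • v) := by
  have hm : ∀ v : EuclideanSpace ℝ (Fin d), v ≠ 0 → ‖v‖⁻¹ • v ∈ Metric.sphere (0 : EuclideanSpace ℝ (Fin d)) 1 :=
    fun v hv => by simp [norm_smul, hv]
  rw [continuous_iff_continuousAt]
  intro v
  by_cases hv : v = 0
  · subst hv
    rw [ContinuousAt, norm_zero, zero_smul, tendsto_zero_iff_norm_tendsto_zero]
    refine squeeze_zero (fun _ => norm_nonneg _) (fun w => ?_) (continuous_norm.tendsto' (0 : EuclideanSpace ℝ (Fin d)) 0 norm_zero)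
    rw [norm_smul, norm_norm]
    by_cases hw : w = 0
    · simp [hw]
    · exact mul_le_of_le_one_right (norm_nonneg _) (hb _ (hm w hw))
  · refine continuousAt_id.norm.smul ?_
    have h1 : ContinuousOn (fun w : EuclideanSpace ℝ (Fin d) => α (‖w‖⁻¹ • w)) {0}ᶜ := by
      refine hα.comp ?_ fun w hw => hm w hw
      exact (continuousOn_id.norm.inv₀ fun w hw => norm_ne_zero_iff.2 hw).smul continuousOn_id
    exact h1.continuousAt (isOpen_compl_singleton.mem_nhds hv)

theorem norm_tauR (v : EuclideanSpace ℝ (Fin 8)) : ‖tauR v‖ = ‖v‖ := by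
  rw [EuclideanSpace.norm_eq, EuclideanSpace.norm_eq, Fin.sum_univ_eight, Fin.sum_univ_eight]
  simp [tauR]

theorem tauR_smul (c : ℝ) (v : EuclideanSpace ℝ (Fin 8)) : tauR (c • v) = c • tauR v := by
  ext i; fin_cases i <;> simp [tauR]

theorem norm_emb (ξ : ℂ) : ‖emb ξ‖ = ‖ξ‖ := by
  rw [EuclideanSpace.norm_eq, Fin.sum_univ_eight, Complex.norm_eq_sqrt_sq_add_sq]
  simp [emb]

theorem emb_smul (c : ℝ) (ξ : ℂ) : emb (c • ξ) = c • emb ξ := by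
  ext i; fin_cases i <;> simp [emb]

/-- There is no equivariant map of spheres with the prescribed values on a circle. -/
theorem no_equivariant_map {α β : EuclideanSpace ℝ (Fin 8) → ℂ} (hα : ContinuousOn α (Metric.sphere 0 1))
    (hβ : ContinuousOn β (Metric.sphere 0 1))
    (hn : ∀ v ∈ Metric.sphere (0 : EuclideanSpace ℝ (Fin 8)) 1, ‖α v‖ ^ 2 + ‖β v‖ ^ 2 = 1)
    (he : ∀ v ∈ Metric.sphere (0 : EuclideanSpace ℝ (Fin 8)) 1, α (tauR v) = α v)
    (ho : ∀ v ∈ Metric.sphere (0 : EuclideanSpace ℝ (Fin 8)) 1, β (tauR v) = - β v)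
    (hc : ∀ ξ : ℂ, ‖ξ‖ = 1 → α (emb ξ) = - Complex.I * (starRingEnd ℂ ξ) ^ 8) : False := by
  have hm : ∀ v : EuclideanSpace ℝ (Fin 8), v ≠ 0 → ‖v‖⁻¹ • v ∈ Metric.sphere (0 : EuclideanSpace ℝ (Fin 8)) 1 :=
    fun v hv => by simp [norm_smul, hv]
  have ca := continuous_homog hα fun v hv => by
    nlinarith [hn v hv, sq_nonneg (‖β v‖), norm_nonneg (α v)]
  have cb := continuous_homog hβ fun v hv => by
    nlinarith [hn v hv, sq_nonneg (‖α v‖), norm_nonneg (β v)]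
  refine not_hopf (a := ⟨_, ca⟩) (b := ⟨_, cb⟩) ⟨fun v => ?_, fun v => ?_, fun v => ?_, fun ξ => ?_⟩
  · have h1 : ∑ i, v i ^ 2 = ‖v‖ ^ 2 := by
      rw [EuclideanSpace.norm_sq_eq]; simp
    rw [h1]
    by_cases hv : v = 0
    · subst hv; simp
    · have h2 := hn _ (hm v hv)
      have h3 : (‖α (‖v‖⁻¹ • v)‖ : ℂ) ^ 2 + (‖β (‖v‖⁻¹ • v)‖ : ℂ) ^ 2 = 1 := by exact_mod_cast h2
      simp only [ContinuousMap.coe_mk, RCLike.star_def, Complex.conj_mul', norm_smul, norm_norm]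
      push_cast
      linear_combination (‖v‖ : ℂ) ^ 2 * h3
  · by_cases hv : v = 0
    · subst hv; simp [norm_tauR]
    · simp only [ContinuousMap.coe_mk, norm_tauR, ← tauR_smul, he _ (hm v hv)]
  · by_cases hv : v = 0
    · subst hv; simp [norm_tauR]
    · simp only [ContinuousMap.coe_mk, norm_tauR, ← tauR_smul, ho _ (hm v hv), smul_neg]
  · by_cases hv : ξ = 0
    · subst hv; simp [norm_emb]
    · have hx : ‖ξ‖ ≠ 0 := norm_ne_zero_iff.2 hv
      have hx' : (‖ξ‖ : ℂ) ≠ 0 := by exact_mod_cast hx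
      simp only [ContinuousMap.coe_mk, norm_emb, ← emb_smul]
      rw [hc _ (by simp [norm_smul, hv])]
      simp only [Complex.real_smul, map_mul, Complex.ofReal_inv, map_inv₀, Complex.conj_ofReal]
      field_simp

end Homogeneous

section Lifting
open Quaternion

/-- The quaternion with given components. -/
def mkq (a b c d : ℝ) : ℍ[ℝ] := ⟨a, b, c, d⟩

theorem continuous_mkq {X : Type*} [TopologicalSpace X] {f0 f1 f2 f3 : X → ℝ} (h0 : Continuous f0)
    (h1 : Continuous f1) (h2 : Continuous f2) (h3 : Continuous f3) :
    Continuous fun x => mkq (f0 x) (f1 x) (f2 x) (f3 x) := by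
  have : Continuous fun x => linearIsometryEquivTuple.symm !₂[f0 x, f1 x, f2 x, f3 x] := by
    refine linearIsometryEquivTuple.symm.continuous.comp ((PiLp.continuous_toLp 2 _).comp (continuous_pi fun i => ?_))
    fin_cases i <;> simpa
  exact this

/-- The quaternion of the first four coordinates. -/
def qy (v : EuclideanSpace ℝ (Fin 5)) : ℍ[ℝ] := mkq (v 0) (v 1) (v 2) (v 3)

theorem continuous_qy : Continuous qy :=
  continuous_mkq (by fun_prop) (by fun_prop) (by fun_prop) (by fun_prop)

theorem qy_sub (v w : EuclideanSpace ℝ (Fin 5)) : qy (v - w) = qy v - qy w := by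
  ext <;> rfl

theorem normSq_qy (v : EuclideanSpace ℝ (Fin 5)) : normSq (qy v) = ‖v‖ ^ 2 - v 4 ^ 2 := by
  rw [normSq_def', EuclideanSpace.norm_sq_eq, Fin.sum_univ_five]
  simp [qy, mkq]

/-- The quaternionic line of a point of the four-sphere. -/
def Fx (v : EuclideanSpace ℝ (Fin 5)) (p q : ℍ[ℝ]) : Prop :=
  qy v * q = (1 - v 4) • p ∧ star (qy v) * p = (1 + v 4) • q

theorem mul_star_smul (y p : ℍ[ℝ]) : y * (star y * p) = normSq y • p := by
  rw [← mul_assoc, self_mul_star, coe_mul_eq_smul]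

theorem star_mul_smul (y p : ℍ[ℝ]) : star y * (y * p) = normSq y • p := by
  rw [← mul_assoc, star_mul_self, coe_mul_eq_smul]

theorem Fx_proj {v : EuclideanSpace ℝ (Fin 5)} (hv : ‖v‖ = 1) (p q : ℍ[ℝ]) :
    Fx v ((1 + v 4) • p + qy v * q) (star (qy v) * p + (1 - v 4) • q) := by
  have h := normSq_qy v
  rw [hv] at h
  constructor
  · rw [mul_add, mul_star_smul, h, mul_smul_comm]
    module
  · rw [mul_add, star_mul_smul, h, mul_smul_comm]
    module

theorem Fx.proj_ne {v w : EuclideanSpace ℝ (Fin 5)} {p q : ℍ[ℝ]} (h : Fx v p q) (hd : ‖v - w‖ < 2)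
    (h1 : (1 + w 4) • p + qy w * q = 0) (h2 : star (qy w) * p + (1 - w 4) • q = 0) : p = 0 ∧ q = 0 := by
  have hn := normSq_qy (v - w)
  have e1 : qy (v - w) * q = (2 - (v - w) 4) • p := by
    rw [qy_sub, sub_mul, h.1, eq_neg_of_add_eq_zero_right h1, PiLp.sub_apply]
    module
  have e2 : star (qy (v - w)) * p = (2 + (v - w) 4) • q := by
    rw [qy_sub, star_sub, sub_mul, h.2, eq_neg_of_add_eq_zero_left h2, PiLp.sub_apply]
    module
  have hpos : 4 - ‖v - w‖ ^ 2 ≠ 0 := by nlinarith [norm_nonneg (v - w)]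
  constructor
  · have h3 := mul_star_smul (qy (v - w)) p
    rw [e2, mul_smul_comm, e1, hn] at h3
    refine (smul_eq_zero_iff_right hpos).1 ?_
    rw [← sub_eq_zero] at h3
    rw [← h3]; module
  · have h3 := star_mul_smul (qy (v - w)) q
    rw [e1, mul_smul_comm, e2, hn] at h3
    refine (smul_eq_zero_iff_right hpos).1 ?_
    rw [← sub_eq_zero] at h3
    rw [← h3]; module

variable {S : Type} [TopologicalSpace S]

/-- A map to the four-sphere lifts to a nonvanishing section of the tautological bundle. -/
def Lifts (g : S → EuclideanSpace ℝ (Fin 5)) : Prop :=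
  ∃ p q : C(S, ℍ[ℝ]), ∀ x, Fx (g x) (p x) (q x) ∧ ¬ (p x = 0 ∧ q x = 0)

theorem Lifts.near {g g' : S → EuclideanSpace ℝ (Fin 5)} (h : Lifts g) (hc : Continuous g') (hg : ∀ x, ‖g' x‖ = 1)
    (hd : ∀ x, ‖g x - g' x‖ < 2) : Lifts g' := by
  obtain ⟨p, q, h⟩ := h
  have hq := continuous_qy.comp hc
  have h4 : Continuous fun x => g' x 4 := by fun_prop
  refine ⟨⟨fun x => (1 + g' x 4) • p x + qy (g' x) * q x, ?_⟩, ⟨fun x => star (qy (g' x)) * p x + (1 - g' x 4) • q x, ?_⟩,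
    fun x => ⟨Fx_proj (hg x) _ _, fun hx => (h x).2 ((h x).1.proj_ne (hd x) hx.1 hx.2)⟩⟩
  · exact ((continuous_const.add h4).smul p.continuous).add (hq.mul q.continuous)
  · exact (hq.star.mul p.continuous).add ((continuous_const.sub h4).smul q.continuous)

theorem lifts_const {v : EuclideanSpace ℝ (Fin 5)} (hv : ‖v‖ = 1) : Lifts fun _ : S => v := by
  by_cases h4 : v 4 = -1
  · have h := normSq_qy v
    rw [hv, h4] at h
    have h0 : qy v = 0 := normSq_eq_zero.1 (by rw [h]; norm_num)
    refine ⟨0, 1, fun x => ⟨⟨?_, ?_⟩, ?_⟩⟩ <;> simp [h0, h4]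
  · refine ⟨.const _ (((1 + v 4) • 1 + qy v * 0)), .const _ (star (qy v) * 1 + (1 - v 4) • 0),
      fun x => ⟨Fx_proj hv _ _, fun hx => h4 ?_⟩⟩
    have := congrArg (fun z : ℍ[ℝ] => z.re) hx.1
    simp at this
    linarith

/-- The homotopy lifting property. -/
theorem Lifts.homotopy [CompactSpace S] {H : C(unitInterval × S, EuclideanSpace ℝ (Fin 5))} (hn : ∀ p, ‖H p‖ = 1)
    (h : Lifts fun x => H (1, x)) : Lifts fun x => H (0, x) := by
  have hl : IsLocallyConstant fun t => Lifts fun x => H (t, x) := by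
    rw [IsLocallyConstant.iff_eventually_eq]
    intro t
    have h1 : ∀ᶠ s in nhds t, dist (H.curry s) (H.curry t) < 2 :=
      (Metric.tendsto_nhds.1 (H.curry.continuous.tendsto t)) 2 (by norm_num)
    filter_upwards [h1] with s hs
    have hd : ∀ x, ‖H (s, x) - H (t, x)‖ < 2 := fun x => by
      rw [← dist_eq_norm]
      exact (ContinuousMap.dist_apply_le_dist (f := H.curry s) (g := H.curry t) x).trans_lt hs
    refine propext ⟨fun h => h.near (by fun_prop) (fun x => hn _) hd, fun h => h.near (by fun_prop) (fun x => hn _)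
      fun x => ?_⟩
    rw [norm_sub_rev]; exact hd x
  rw [hl.apply_eq_of_preconnectedSpace 0 1]
  exact h

end Lifting

section Reference

/-- The real part of `2 z conj w` for `z = a + i b`, `w = c + i d`. -/
def hopfRe (a b c d : ℝ) : ℝ := 2 * (a * c + b * d)

/-- The imaginary part of `2 z conj w` for `z = a + i b`, `w = c + i d`. -/
def hopfIm (a b c d : ℝ) : ℝ := 2 * (b * c - a * d)

/-- The height `|z|² - |w|²` for `z = a + i b`, `w = c + i d`. -/
def hopfHt (a b c d : ℝ) : ℝ := a ^ 2 + b ^ 2 - c ^ 2 - d ^ 2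

theorem hopf_sq (a b c d : ℝ) :
    hopfRe a b c d ^ 2 + hopfIm a b c d ^ 2 + hopfHt a b c d ^ 2 = (a ^ 2 + b ^ 2 + c ^ 2 + d ^ 2) ^ 2 := by
  unfold hopfRe hopfIm hopfHt; ring

/-- The polynomial suspension of the Hopf polynomial. -/
def susp4 (X : EuclideanSpace ℝ (Fin 6)) : EuclideanSpace ℝ (Fin 5) :=
  !₂[hopfRe (X 0) (X 2) (X 1) (X 3), hopfIm (X 0) (X 2) (X 1) (X 3), hopfHt (X 0) (X 2) (X 1) (X 3), X 4, X 5]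

/-- The second polynomial suspension of the Hopf polynomial. -/
def susp3 (Y : EuclideanSpace ℝ (Fin 5)) : EuclideanSpace ℝ (Fin 4) :=
  !₂[hopfRe (Y 0) (Y 1) (Y 2) (Y 3), hopfIm (Y 0) (Y 1) (Y 2) (Y 3), hopfHt (Y 0) (Y 1) (Y 2) (Y 3), Y 4]

/-- The Hopf polynomial. -/
def hopf2 (Z : EuclideanSpace ℝ (Fin 4)) : EuclideanSpace ℝ (Fin 3) :=
  !₂[hopfRe (Z 0) (Z 1) (Z 2) (Z 3), hopfIm (Z 0) (Z 1) (Z 2) (Z 3), hopfHt (Z 0) (Z 1) (Z 2) (Z 3)]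

/-- A polynomial map representing the generator of the fifth homotopy group of the two-sphere. -/
def fpoly (X : EuclideanSpace ℝ (Fin 6)) : EuclideanSpace ℝ (Fin 3) := hopf2 (susp3 (susp4 X))

theorem contDiff_fpoly : ContDiff ℝ 1 fpoly := by
  have h4 : ContDiff ℝ 1 susp4 := by
    rw [contDiff_euclidean]
    intro i; fin_cases i <;> simp [susp4, hopfRe, hopfIm, hopfHt] <;> fun_prop
  have h3 : ContDiff ℝ 1 susp3 := by
    rw [contDiff_euclidean]
    intro i; fin_cases i <;> simp [susp3, hopfRe, hopfIm, hopfHt] <;> fun_prop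
  have h2 : ContDiff ℝ 1 hopf2 := by
    rw [contDiff_euclidean]
    intro i; fin_cases i <;> simp [hopf2, hopfRe, hopfIm, hopfHt] <;> fun_prop
  exact h2.comp (h3.comp h4)

theorem norm_hopf2 (Z : EuclideanSpace ℝ (Fin 4)) : ‖hopf2 Z‖ = ‖Z‖ ^ 2 := by
  rw [← sq_eq_sq₀ (norm_nonneg _) (by positivity), EuclideanSpace.norm_sq_eq, EuclideanSpace.norm_sq_eq, Fin.sum_univ_three,
    Fin.sum_univ_four]
  simpa [hopf2] using hopf_sq _ _ _ _

theorem hopf_zero {a b c d : ℝ} (h1 : hopfRe a b c d = 0) (h2 : hopfIm a b c d = 0) (h3 : hopfHt a b c d = 0) :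
    a = 0 ∧ b = 0 ∧ c = 0 ∧ d = 0 := by
  have h := hopf_sq a b c d
  rw [h1, h2, h3] at h
  have h' : a ^ 2 + b ^ 2 + c ^ 2 + d ^ 2 = 0 := pow_eq_zero_iff two_ne_zero |>.1 (by rw [← h]; ring)
  refine ⟨?_, ?_, ?_, ?_⟩ <;> nlinarith [sq_nonneg a, sq_nonneg b, sq_nonneg c, sq_nonneg d]

theorem fpoly_ne {X : EuclideanSpace ℝ (Fin 6)} (hX : X ≠ 0) : fpoly X ≠ 0 := by
  contrapose! hX
  have h2 : susp3 (susp4 X) = 0 := by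
    have := norm_hopf2 (susp3 (susp4 X))
    rw [show hopf2 (susp3 (susp4 X)) = 0 from hX, norm_zero] at this
    exact norm_eq_zero.1 (pow_eq_zero_iff two_ne_zero |>.1 this.symm)
  have h3 : ∀ i, susp3 (susp4 X) i = 0 := fun i => by rw [h2]; rfl
  obtain ⟨k0, k1, k2, k3⟩ := hopf_zero (h3 0) (h3 1) (h3 2)
  obtain ⟨m0, m2, m1, m3⟩ := hopf_zero k0 k1 k2
  ext i; fin_cases i
  exacts [m0, m1, m2, m3, k3, h3 3]

/-- The generator of the fifth homotopy group of the two-sphere. -/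
def fsph (X : EuclideanSpace ℝ (Fin 6)) : EuclideanSpace ℝ (Fin 3) := ‖fpoly X‖⁻¹ • fpoly X

theorem norm_fsph {X : EuclideanSpace ℝ (Fin 6)} (hX : X ≠ 0) : ‖fsph X‖ = 1 := by
  rw [fsph, norm_smul, norm_inv, norm_norm, inv_mul_cancel₀ (norm_ne_zero_iff.2 (fpoly_ne hX))]

theorem contDiffOn_fsph : ContDiffOn ℝ 1 fsph {0}ᶜ := fun _ hX =>
  ((contDiff_fpoly.contDiffAt.norm ℝ (fpoly_ne hX)).inv (norm_ne_zero_iff.2 (fpoly_ne hX))).smul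
    contDiff_fpoly.contDiffAt |>.contDiffWithinAt

/-- The homogeneous extension of `fsph`. -/
def fhom (X : EuclideanSpace ℝ (Fin 6)) : EuclideanSpace ℝ (Fin 3) := ‖X‖ • fsph (‖X‖⁻¹ • X)

theorem continuous_fhom : Continuous fhom := by
  refine continuous_homog (contDiffOn_fsph.continuousOn.mono fun v hv => ?_) fun v hv => (norm_fsph ?_).le
  all_goals
    rintro rfl
    simp at hv

theorem norm_fhom (X : EuclideanSpace ℝ (Fin 6)) : ‖fhom X‖ = ‖X‖ := by
  by_cases hX : X = 0
  · simp [fhom, hX]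
  · rw [fhom, norm_smul, norm_norm, norm_fsph, mul_one]
    simp [hX]

/-- The first six coordinates. -/
def fst6 : EuclideanSpace ℝ (Fin 8) →L[ℝ] EuclideanSpace ℝ (Fin 6) :=
  (EuclideanSpace.equiv (Fin 6) ℝ).symm.toContinuousLinearMap ∘L
    ContinuousLinearMap.pi fun i => EuclideanSpace.proj (Fin.castLE (by norm_num) i)

theorem fst6_apply (v : EuclideanSpace ℝ (Fin 8)) (i : Fin 6) : fst6 v i = v (Fin.castLE (by norm_num) i) := rfl

/-- The reference map: a join of `fsph` with a circle. -/
def Fref (v : EuclideanSpace ℝ (Fin 8)) : EuclideanSpace ℝ (Fin 5) :=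
  !₂[fhom (fst6 v) 0, fhom (fst6 v) 1, fhom (fst6 v) 2, v 6, v 7]

theorem continuous_Fref : Continuous Fref := by
  have := continuous_fhom.comp fst6.continuous
  refine (PiLp.continuous_toLp 2 _).comp (continuous_pi fun i => ?_)
  have h (j : Fin 3) : Continuous fun v => fhom (fst6 v) j := (EuclideanSpace.proj (𝕜 := ℝ) j).continuous.comp this
  fin_cases i <;> simp [h] <;> fun_prop

theorem norm_Fref (v : EuclideanSpace ℝ (Fin 8)) : ‖Fref v‖ = ‖v‖ := by
  have h : ‖fhom (fst6 v)‖ ^ 2 = ‖fst6 v‖ ^ 2 := by rw [norm_fhom]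
  rw [EuclideanSpace.norm_sq_eq, EuclideanSpace.norm_sq_eq, Fin.sum_univ_three, Fin.sum_univ_six] at h
  rw [← sq_eq_sq₀ (norm_nonneg _) (norm_nonneg _), EuclideanSpace.norm_sq_eq, EuclideanSpace.norm_sq_eq, Fin.sum_univ_five,
    Fin.sum_univ_eight]
  simp [Fref, fst6_apply] at h ⊢
  linarith

/-- Conjugation in six variables. -/
def tau6 (X : EuclideanSpace ℝ (Fin 6)) : EuclideanSpace ℝ (Fin 6) := !₂[X 0, X 1, -X 2, -X 3, -X 4, -X 5]

/-- Conjugation in three variables. -/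
def tau3 (X : EuclideanSpace ℝ (Fin 3)) : EuclideanSpace ℝ (Fin 3) := !₂[X 0, -X 1, X 2]

theorem fpoly_tau6 (X : EuclideanSpace ℝ (Fin 6)) : fpoly (tau6 X) = tau3 (fpoly X) := by
  ext i; fin_cases i <;> simp [fpoly, hopf2, susp3, susp4, tau6, tau3, hopfRe, hopfIm, hopfHt] <;> ring

theorem norm_tau6 (X : EuclideanSpace ℝ (Fin 6)) : ‖tau6 X‖ = ‖X‖ := by
  simp [EuclideanSpace.norm_eq, Fin.sum_univ_six, tau6]

theorem norm_tau3 (X : EuclideanSpace ℝ (Fin 3)) : ‖tau3 X‖ = ‖X‖ := by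
  simp [EuclideanSpace.norm_eq, Fin.sum_univ_three, tau3]

theorem tau6_smul (c : ℝ) (X : EuclideanSpace ℝ (Fin 6)) : tau6 (c • X) = c • tau6 X := by
  ext i; fin_cases i <;> simp [tau6]

theorem tau3_smul (c : ℝ) (X : EuclideanSpace ℝ (Fin 3)) : tau3 (c • X) = c • tau3 X := by
  ext i; fin_cases i <;> simp [tau3]

theorem fst6_tauR (v : EuclideanSpace ℝ (Fin 8)) : fst6 (tauR v) = tau6 (fst6 v) := by
  ext i; fin_cases i <;> simp [tau6, tauR, fst6_apply]

theorem fhom_tauR (v : EuclideanSpace ℝ (Fin 8)) : fhom (fst6 (tauR v)) = tau3 (fhom (fst6 v)) := by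
  rw [fst6_tauR, fhom, fhom, tau3_smul, norm_tau6, ← tau6_smul, fsph, fsph, fpoly_tau6, norm_tau3, tau3_smul]

theorem fhom_emb {ξ : ℂ} (hξ : ‖ξ‖ = 1) :
    fhom (fst6 (emb ξ)) = !₂[((- Complex.I * (starRingEnd ℂ ξ) ^ 8).re), 0, (- Complex.I * (starRingEnd ℂ ξ) ^ 8).im] := by
  have h0 : ξ.re ^ 2 + ξ.im ^ 2 = 1 := by
    have := Complex.normSq_eq_norm_sq ξ
    rw [hξ, Complex.normSq_apply] at this
    linarith
  have h1 : ‖fst6 (emb ξ)‖ = 1 := by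
    rw [EuclideanSpace.norm_eq, Fin.sum_univ_six]
    simp [fst6_apply, emb, h0]
  have h2 : fpoly (fst6 (emb ξ)) = !₂[((- Complex.I * (starRingEnd ℂ ξ) ^ 8).re), 0, (- Complex.I * (starRingEnd ℂ ξ) ^ 8).im] := by
    ext i; fin_cases i <;> simp [fpoly, hopf2, susp3, susp4, hopfRe, hopfIm, hopfHt, fst6_apply, emb, pow_succ] <;> ring
  have h3 : ‖fpoly (fst6 (emb ξ))‖ = 1 := by
    rw [h2, EuclideanSpace.norm_eq, Fin.sum_univ_three, Real.sqrt_eq_one]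
    have : ‖- Complex.I * (starRingEnd ℂ ξ) ^ 8‖ ^ 2 = 1 := by simp [hξ]
    rw [← Complex.normSq_eq_norm_sq, Complex.normSq_apply] at this
    simp only [Real.norm_eq_abs, sq_abs]
    simp only [PiLp.toLp_apply, Matrix.cons_val]
    linarith
  rw [fhom, h1, inv_one, one_smul, one_smul, fsph, h3, inv_one, one_smul, h2]

end Reference

section Nontrivial
open Quaternion

/-- The seven-dimensional unit sphere. -/
abbrev S7 : Set (EuclideanSpace ℝ (Fin 8)) := Metric.sphere 0 1

/-- The conjugation fixing `1` and `j`. -/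
def tauq (y : ℍ[ℝ]) : ℍ[ℝ] := mkq y.re (-y.imI) y.imJ (-y.imK)

theorem continuous_tauq : Continuous tauq :=
  continuous_mkq continuous_re continuous_imI.neg continuous_imJ continuous_imK.neg

theorem tauq_tauq (y : ℍ[ℝ]) : tauq (tauq y) = y := by
  ext <;> simp [tauq, mkq]

theorem norm_tauq (y : ℍ[ℝ]) : ‖tauq y‖ = ‖y‖ := by
  rw [← sq_eq_sq₀ (norm_nonneg _) (norm_nonneg _), sq, sq, ← normSq_eq_norm_mul_self, ← normSq_eq_norm_mul_self, normSq_def', normSq_def']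
  simp [tauq, mkq]

theorem qy_Fref (v : EuclideanSpace ℝ (Fin 8)) :
    qy (Fref v) = mkq (fhom (fst6 v) 0) (fhom (fst6 v) 1) (fhom (fst6 v) 2) (v 6) := rfl

theorem tauq_mkq (a b c d : ℝ) : tauq (mkq a b c d) = mkq a (-b) c (-d) := rfl

theorem qy_Fref_tauR {v : EuclideanSpace ℝ (Fin 8)} : qy (Fref (tauR v)) = tauq (qy (Fref v)) := by
  rw [qy_Fref, qy_Fref, fhom_tauR, tauq_mkq]
  simp only [tau3, tauR, PiLp.toLp_apply, Matrix.cons_val]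

theorem Fref_four (v : EuclideanSpace ℝ (Fin 8)) : Fref v 4 = v 7 := rfl

/-- Replacement of the last coordinate by another one of the same size. -/
def repl (r : ℝ → ℝ) (v : EuclideanSpace ℝ (Fin 8)) : EuclideanSpace ℝ (Fin 8) :=
  !₂[v 0, v 1, v 2, v 3, v 4, v 5, v 6, r (v 7)]

theorem repl_self {r : ℝ → ℝ} {v : EuclideanSpace ℝ (Fin 8)} (h : r (v 7) = v 7) : repl r v = v := by
  ext i; fin_cases i <;> simp [repl, h]

theorem norm_repl {r : ℝ → ℝ} (hr : ∀ t, r t ^ 2 = t ^ 2) (v : EuclideanSpace ℝ (Fin 8)) : ‖repl r v‖ = ‖v‖ := by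
  rw [← sq_eq_sq₀ (norm_nonneg _) (norm_nonneg _), EuclideanSpace.norm_sq_eq, EuclideanSpace.norm_sq_eq, Fin.sum_univ_eight,
    Fin.sum_univ_eight]
  simp [repl, hr]

theorem continuous_repl {r : ℝ → ℝ} (hr : Continuous r) : Continuous (repl r) := by
  refine (PiLp.continuous_toLp 2 _).comp (continuous_pi fun i => ?_)
  fin_cases i <;> simp <;> fun_prop

/-- `repl` on the sphere. -/
def replS (r : C(ℝ, ℝ)) (hr : ∀ t, r t ^ 2 = t ^ 2) : C(S7, S7) :=
  ⟨fun v => ⟨repl r v, by simp [norm_repl hr]⟩, by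
    have := continuous_repl r.continuous
    fun_prop⟩

/-- The reflection on the sphere. -/
def tauS : C(S7, S7) :=
  ⟨fun v => ⟨tauR v, by simp [norm_tauR]⟩, by
    have : Continuous tauR := by
      refine (PiLp.continuous_toLp 2 _).comp (continuous_pi fun i => ?_)
      fin_cases i <;> simp <;> fun_prop
    fun_prop⟩

theorem tauS_tauS (v : S7) : tauS (tauS v) = v := by
  ext i; fin_cases i <;> simp [tauS, tauR]

/-- A lift yields a unit quaternionic function on the sphere, extending the equator of `Fref`. -/
theorem exists_hemisphere (h : Lifts fun v : S7 => Fref v) :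
    ∃ N : C(S7, ℍ[ℝ]), (∀ v, ‖N v‖ = 1) ∧ ∀ v : S7, v.1 7 = 0 → N v = qy (Fref v) := by
  obtain ⟨p, q, h⟩ := h
  let a : C(S7, S7) := replS ⟨fun t => |t|, continuous_abs⟩ fun t => sq_abs t
  let b : C(S7, S7) := replS ⟨fun t => -|t|, continuous_abs.neg⟩ fun t => by simp
  have ha : ∀ v, p (a v) ≠ 0 := fun v h0 => by
    have h1 := h (a v)
    rw [Fx, h0, mul_zero, Fref_four] at h1
    have h2 : (1 : ℝ) + (a v).1 7 ≠ 0 := by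
      have : (a v).1 7 = |v.1 7| := rfl
      rw [this]; positivity
    exact h1.2 ⟨rfl, (smul_eq_zero_iff_right h2).1 h1.1.2.symm⟩
  have hb : ∀ v, q (b v) ≠ 0 := fun v h0 => by
    have h1 := h (b v)
    rw [Fx, h0, mul_zero, Fref_four] at h1
    have h2 : (1 : ℝ) - (b v).1 7 ≠ 0 := by
      have : (b v).1 7 = -|v.1 7| := rfl
      rw [this, sub_neg_eq_add]; positivity
    exact h1.2 ⟨(smul_eq_zero_iff_right h2).1 h1.1.1.symm, rfl⟩
  have hc : Continuous fun v => p (a v) * (q (b v))⁻¹ := by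
    have := (q.comp b).continuous.inv₀ hb
    exact (p.comp a).continuous.mul this
  have hne : ∀ v, p (a v) * (q (b v))⁻¹ ≠ 0 := fun v => mul_ne_zero (ha v) (inv_ne_zero (hb v))
  refine ⟨⟨fun v => ‖p (a v) * (q (b v))⁻¹‖⁻¹ • (p (a v) * (q (b v))⁻¹),
    (hc.norm.inv₀ fun v => norm_ne_zero_iff.2 (hne v)).smul hc⟩, fun v => ?_, fun v hv => ?_⟩
  · simp only [ContinuousMap.coe_mk]
    rw [norm_smul, norm_inv, norm_norm, inv_mul_cancel₀ (norm_ne_zero_iff.2 (hne v))]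
  · have e1 : a v = v := Subtype.ext (repl_self (by simp [hv]))
    have e2 : b v = v := Subtype.ext (repl_self (by simp [hv]))
    have e3 := (h v).1.1
    have e4 := normSq_qy (Fref v)
    rw [Fref_four, hv, sub_zero, one_smul] at e3
    rw [Fref_four, hv, norm_Fref, mem_sphere_zero_iff_norm.1 v.2, normSq_eq_norm_mul_self] at e4
    have e5 : ‖qy (Fref v)‖ = 1 := by nlinarith [norm_nonneg (qy (Fref v))]
    have hq := hb v
    simp only [ContinuousMap.coe_mk, e1]
    rw [e2] at hq ⊢
    rw [← e3, mul_assoc, mul_inv_cancel₀ hq, mul_one, e5, inv_one, one_smul]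

open Classical in
/-- The reference map does not lift. -/
theorem not_lifts_Fref : ¬ Lifts fun v : S7 => Fref v := fun h => by
  obtain ⟨N, hN, hE⟩ := exists_hemisphere h
  let u : S7 → ℍ[ℝ] := fun v => if 0 ≤ v.1 7 then N v else tauq (N (tauS v))
  have h7 (v : S7) : (tauS v).1 7 = - v.1 7 := rfl
  have hs : ∀ v : S7, v.1 7 = 0 → N v = tauq (N (tauS v)) := fun v hv => by
    rw [hE v hv, hE (tauS v) (by rw [h7, hv, neg_zero]), show (tauS v).1 = tauR v.1 from rfl, qy_Fref_tauR, tauq_tauq]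
  have hu : Continuous u := by
    refine Continuous.if_le N.continuous (continuous_tauq.comp (N.comp tauS).continuous) continuous_const (by fun_prop)
      fun v hv => hs v hv.symm
  have hτ : ∀ v, u (tauS v) = tauq (u v) := fun v => by
    rcases lt_trichotomy (v.1 7) 0 with hv | hv | hv
    · simp only [u, h7]
      rw [if_pos (by linarith), if_neg (by linarith), tauq_tauq]
    · simp only [u, h7]
      rw [if_pos (by linarith), if_pos (by linarith), hs v hv, tauq_tauq]
    · simp only [u, h7]
      rw [if_neg (by linarith), if_pos (by linarith), tauS_tauS]
  have hn : ∀ v, ‖u v‖ = 1 := fun v => by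
    simp only [u]
    split_ifs
    exacts [hN _, by rw [norm_tauq, hN]]
  let α : EuclideanSpace ℝ (Fin 8) → ℂ := fun v => if hv : v ∈ S7 then ⟨(u ⟨v, hv⟩).re, (u ⟨v, hv⟩).imJ⟩ else 0
  let β : EuclideanSpace ℝ (Fin 8) → ℂ := fun v => if hv : v ∈ S7 then ⟨(u ⟨v, hv⟩).imI, (u ⟨v, hv⟩).imK⟩ else 0
  have cpx {f g : S7 → ℝ} (hf : Continuous f) (hg : Continuous g) : Continuous fun v => (⟨f v, g v⟩ : ℂ) := by
    have : (fun v => (⟨f v, g v⟩ : ℂ)) = fun v => (f v : ℂ) + g v * Complex.I := by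
      funext v; exact Complex.mk_eq_add_mul_I _ _
    rw [this]; fun_prop
  have ha {v} (hv : v ∈ S7) : α v = ⟨(u ⟨v, hv⟩).re, (u ⟨v, hv⟩).imJ⟩ := dif_pos hv
  have hb {v} (hv : v ∈ S7) : β v = ⟨(u ⟨v, hv⟩).imI, (u ⟨v, hv⟩).imK⟩ := dif_pos hv
  have ht {v} (hv : v ∈ S7) : tauR v ∈ S7 := by simpa [norm_tauR] using hv
  have hut {v} (hv : v ∈ S7) : u ⟨tauR v, ht hv⟩ = tauq (u ⟨v, hv⟩) := hτ ⟨v, hv⟩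
  refine no_equivariant_map (α := α) (β := β) ?_ ?_ (fun v hv => ?_) (fun v hv => ?_) (fun v hv => ?_) fun ξ hξ => ?_
  · rw [continuousOn_iff_continuous_restrict]
    refine (cpx (continuous_re.comp hu) (continuous_imJ.comp hu)).congr fun v => ?_
    exact (ha v.2).symm
  · rw [continuousOn_iff_continuous_restrict]
    refine (cpx (continuous_imI.comp hu) (continuous_imK.comp hu)).congr fun v => ?_
    exact (hb v.2).symm
  · have := normSq_eq_norm_mul_self (u ⟨v, hv⟩)
    rw [hn, normSq_def'] at this
    rw [ha hv, hb hv, ← Complex.normSq_eq_norm_sq, ← Complex.normSq_eq_norm_sq, Complex.normSq_mk, Complex.normSq_mk]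
    linarith
  · rw [ha hv]; refine (ha (ht hv)).trans ?_; rw [hut hv]; rfl
  · rw [hb hv]; refine (hb (ht hv)).trans ?_; rw [hut hv]; apply Complex.ext <;> rfl
  · have hv : emb ξ ∈ S7 := by simp [norm_emb, hξ]
    have hq : u ⟨emb ξ, hv⟩ = qy (Fref (emb ξ)) := by
      have : (emb ξ) 7 = 0 := rfl
      simp only [u]
      rw [if_pos this.ge, hE _ this]
    rw [ha hv, hq]
    have h1 : (qy (Fref (emb ξ))).re = fhom (fst6 (emb ξ)) 0 := rfl
    have h2 : (qy (Fref (emb ξ))).imJ = fhom (fst6 (emb ξ)) 2 := rfl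
    rw [h1, h2, fhom_emb hξ]
    rfl

/-- A map of spheres that is homotopic to the reference map is not homotopic to a constant. -/
theorem not_null {F : C(S7, EuclideanSpace ℝ (Fin 5))} {H K : C(unitInterval × S7, EuclideanSpace ℝ (Fin 5))}
    (hH : ∀ x, ‖H x‖ = 1) (hK : ∀ x, ‖K x‖ = 1) (h0 : ∀ v : S7, H (0, v) = Fref v) (h1 : ∀ v, H (1, v) = F v)
    (k0 : ∀ v, K (0, v) = F v) {y : EuclideanSpace ℝ (Fin 5)} (k1 : ∀ v, K (1, v) = y) : False := by
  refine not_lifts_Fref ?_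
  simp only [← h0]
  refine Lifts.homotopy hH ?_
  simp only [h1, ← k0]
  refine Lifts.homotopy hK ?_
  simp only [k1]
  refine lifts_const ?_
  rw [← k1 ⟨EuclideanSpace.single 0 1, by simp⟩, hK]

end Nontrivial

section Bump

/-- Inverse stereographic projection in five of the seven variables. -/
def stereoInv (w : EuclideanSpace ℝ (Fin 7)) : EuclideanSpace ℝ (Fin 6) :=
  (1 + (w 0 ^ 2 + w 1 ^ 2 + w 2 ^ 2 + w 4 ^ 2 + w 5 ^ 2))⁻¹ •
    !₂[2 * w 0, 2 * w 1, 2 * w 2, 2 * w 4, 2 * w 5, 1 - (w 0 ^ 2 + w 1 ^ 2 + w 2 ^ 2 + w 4 ^ 2 + w 5 ^ 2)]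

theorem stereoInv_den_pos (w : EuclideanSpace ℝ (Fin 7)) :
    0 < 1 + (w 0 ^ 2 + w 1 ^ 2 + w 2 ^ 2 + w 4 ^ 2 + w 5 ^ 2) := by positivity

theorem norm_stereoInv (w : EuclideanSpace ℝ (Fin 7)) : ‖stereoInv w‖ = 1 := by
  have h := stereoInv_den_pos w
  rw [stereoInv, norm_smul, norm_inv, Real.norm_of_nonneg h.le, inv_mul_eq_one₀ h.ne',
    ← sq_eq_sq₀ h.le (norm_nonneg _), EuclideanSpace.real_norm_sq_eq, Fin.sum_univ_six]
  simp
  ring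

theorem contDiff_stereoInv : ContDiff ℝ 1 stereoInv := by
  refine ContDiff.smul (ContDiff.inv (by fun_prop) fun w => (stereoInv_den_pos w).ne') ?_
  rw [contDiff_euclidean]
  intro i; fin_cases i <;> simp <;> fun_prop

/-- The pole of the stereographic projection. -/
def pole6 : EuclideanSpace ℝ (Fin 6) := !₂[0, 0, 0, 0, 0, -1]

theorem norm_stereoInv_sub (w : EuclideanSpace ℝ (Fin 7)) :
    ‖stereoInv w - pole6‖ ^ 2 = 4 * (1 + (w 0 ^ 2 + w 1 ^ 2 + w 2 ^ 2 + w 4 ^ 2 + w 5 ^ 2))⁻¹ := by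
  have h := stereoInv_den_pos w
  rw [EuclideanSpace.real_norm_sq_eq, Fin.sum_univ_six]
  simp [stereoInv, pole6]
  field_simp
  ring

theorem fsph_pole6 : fsph pole6 = !₂[0, 0, -1] := by
  have h : fpoly pole6 = !₂[0, 0, -1] := by
    ext i; fin_cases i <;> simp [fpoly, hopf2, susp3, susp4, hopfRe, hopfIm, hopfHt, pole6]
  have h1 : ‖fpoly pole6‖ = 1 := by
    rw [h, EuclideanSpace.norm_eq, Fin.sum_univ_three]; simp
  rw [fsph, h1, inv_one, one_smul, h]

theorem ne_zero_of_norm_one {E : Type*} [NormedAddCommGroup E] {x : E} (h : ‖x‖ = 1) : x ≠ 0 :=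
  norm_ne_zero_iff.1 (by rw [h]; norm_num)

/-- The composite of `fsph` with inverse stereographic projection. -/
def fst5 (w : EuclideanSpace ℝ (Fin 7)) : EuclideanSpace ℝ (Fin 3) := fsph (stereoInv w)

theorem norm_fst5 (w : EuclideanSpace ℝ (Fin 7)) : ‖fst5 w‖ = 1 := norm_fsph (ne_zero_of_norm_one (norm_stereoInv w))

theorem contDiff_fst5 : ContDiff ℝ 1 fst5 :=
  contDiffOn_fsph.comp_contDiff contDiff_stereoInv fun w => ne_zero_of_norm_one (norm_stereoInv w)

/-- The join of the five-dimensional map with the two remaining variables. -/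
def joinMap (w : EuclideanSpace ℝ (Fin 7)) : EuclideanSpace ℝ (Fin 5) :=
  !₂[fst5 w 0, fst5 w 1, fst5 w 2, w 3, w 6]

theorem contDiff_joinMap : ContDiff ℝ 1 joinMap := by
  have h := contDiff_fst5
  rw [contDiff_euclidean] at h ⊢
  intro i
  fin_cases i
  exacts [h 0, h 1, h 2, by simp [joinMap]; fun_prop, by simp [joinMap]; fun_prop]

theorem fst5_sq (w : EuclideanSpace ℝ (Fin 7)) : fst5 w 0 ^ 2 + fst5 w 1 ^ 2 + fst5 w 2 ^ 2 = 1 := by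
  have h : ‖fst5 w‖ ^ 2 = 1 := by rw [norm_fst5, one_pow]
  rw [EuclideanSpace.real_norm_sq_eq, Fin.sum_univ_three] at h
  simpa using h

/-- The base point of the four-sphere. -/
def vinf : EuclideanSpace ℝ (Fin 5) := !₂[0, 0, -1, 0, 0]

theorem norm_vinf : ‖vinf‖ = 1 := by
  rw [EuclideanSpace.norm_eq, Fin.sum_univ_five]; simp [vinf]

/-- The cutoff on the join. -/
def cutoff (W : EuclideanSpace ℝ (Fin 5)) : ℝ :=
  Real.smoothTransition (W 2 + 1 / 2) * Real.smoothTransition (2 - (W 3 ^ 2 + W 4 ^ 2))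

theorem contDiff_cutoff : ContDiff ℝ 1 cutoff := by
  have h : ContDiff ℝ 1 Real.smoothTransition := Real.smoothTransition.contDiff
  exact (h.comp (by fun_prop)).mul (h.comp (by fun_prop))

theorem cutoff_nonneg (W : EuclideanSpace ℝ (Fin 5)) : 0 ≤ cutoff W :=
  mul_nonneg (Real.smoothTransition.nonneg _) (Real.smoothTransition.nonneg _)

theorem cutoff_le_one (W : EuclideanSpace ℝ (Fin 5)) : cutoff W ≤ 1 :=
  mul_le_one₀ (Real.smoothTransition.le_one _) (Real.smoothTransition.nonneg _) (Real.smoothTransition.le_one _)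

/-- The interpolation of the join with the base point. -/
def interp (W : EuclideanSpace ℝ (Fin 5)) : EuclideanSpace ℝ (Fin 5) := cutoff W • W + (1 - cutoff W) • vinf

theorem contDiff_interp : ContDiff ℝ 1 interp := by
  have := contDiff_cutoff
  exact (this.smul contDiff_id).add ((contDiff_const.sub this).smul contDiff_const)

/-- The interpolation is never antipodal to the join. -/
theorem interp_add_ne {W : EuclideanSpace ℝ (Fin 5)} (hW : W 0 ^ 2 + W 1 ^ 2 + W 2 ^ 2 = 1) {c : ℝ} (hc : 0 ≤ c) :
    interp W + c • W ≠ 0 := fun h => by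
  have e (i : Fin 5) : (cutoff W + c) * W i + (1 - cutoff W) * vinf i = 0 := by
    have := congrArg (fun v : EuclideanSpace ℝ (Fin 5) => v i) h
    simp [interp] at this
    linear_combination this
  have h0 := cutoff_nonneg W
  have h1 := cutoff_le_one W
  have e0 := e 0; have e1 := e 1; have e2 := e 2; have e3 := e 3; have e4 := e 4
  simp [vinf] at e0 e1 e2 e3 e4
  have hp : cutoff W + c ≠ 0 := fun hz => by
    rw [hz] at e2; linarith
  have w0 := e0.resolve_left hp
  have w1 := e1.resolve_left hp
  have w3 := e3.resolve_left hp
  have w4 := e4.resolve_left hp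
  have w2 : W 2 = 1 := by
    rw [w0, w1] at hW
    have : 0 < cutoff W + c := lt_of_le_of_ne (by linarith) hp.symm
    have h2 : 0 ≤ W 2 := by
      by_contra hn
      nlinarith
    nlinarith
  have hφ : cutoff W = 1 := by
    rw [cutoff, w2, w3, w4, Real.smoothTransition.one_of_one_le (by norm_num), Real.smoothTransition.one_of_one_le (by norm_num),
      one_mul]
  rw [hφ, w2] at e2
  linarith

theorem interp_ne {W : EuclideanSpace ℝ (Fin 5)} (hW : W 0 ^ 2 + W 1 ^ 2 + W 2 ^ 2 = 1) : interp W ≠ 0 := by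
  simpa using interp_add_ne hW le_rfl

/-- The normalized interpolation. -/
def collapse (W : EuclideanSpace ℝ (Fin 5)) : EuclideanSpace ℝ (Fin 5) := ‖interp W‖⁻¹ • interp W

theorem norm_collapse {W : EuclideanSpace ℝ (Fin 5)} (hW : W 0 ^ 2 + W 1 ^ 2 + W 2 ^ 2 = 1) : ‖collapse W‖ = 1 := by
  rw [collapse, norm_smul, norm_inv, norm_norm, inv_mul_cancel₀ (norm_ne_zero_iff.2 (interp_ne hW))]

theorem contDiffAt_collapse {W : EuclideanSpace ℝ (Fin 5)} (hW : W 0 ^ 2 + W 1 ^ 2 + W 2 ^ 2 = 1) :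
    ContDiffAt ℝ 1 collapse W :=
  ((contDiff_interp.contDiffAt.norm ℝ (interp_ne hW)).inv (norm_ne_zero_iff.2 (interp_ne hW))).smul
    contDiff_interp.contDiffAt

theorem collapse_of_cutoff {W : EuclideanSpace ℝ (Fin 5)} (h : cutoff W = 0) : collapse W = vinf := by
  have : interp W = vinf := by rw [interp, h, zero_smul, sub_zero, one_smul, zero_add]
  rw [collapse, this, norm_vinf, inv_one, one_smul]

/-- The local model of the map to the four-sphere. -/
def bump (w : EuclideanSpace ℝ (Fin 7)) : EuclideanSpace ℝ (Fin 5) := collapse (joinMap w) - vinf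

theorem norm_add_bump (w : EuclideanSpace ℝ (Fin 7)) : ‖vinf + bump w‖ = 1 := by
  rw [bump, add_sub_cancel, norm_collapse (fst5_sq w)]

theorem contDiff_bump : ContDiff ℝ 1 bump := by
  rw [contDiff_iff_contDiffAt]
  exact fun w => ((contDiffAt_collapse (fst5_sq w)).comp w contDiff_joinMap.contDiffAt).sub contDiffAt_const

theorem exists_bump_eq_zero : ∃ R : ℝ, 0 < R ∧ ∀ w, R / 4 ≤ ‖w‖ → bump w = 0 := by
  have hp : pole6 ≠ 0 := fun h => by
    have := congrArg (fun v : EuclideanSpace ℝ (Fin 6) => v 5) h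
    simp [pole6] at this
  have hc : ContinuousAt (fun X => fsph X 2) pole6 :=
    (EuclideanSpace.proj (𝕜 := ℝ) (2 : Fin 3)).continuous.continuousAt.comp
      (contDiffOn_fsph.continuousOn.continuousAt (isOpen_compl_singleton.mem_nhds hp))
  have h2 : fsph pole6 2 = -1 := by rw [fsph_pole6]; rfl
  obtain ⟨δ, hδ, hball⟩ := Metric.eventually_nhds_iff.1 (hc.eventually (p := fun y => y < -1 / 2) (Iio_mem_nhds (by change fsph pole6 2 < -1 / 2; rw [h2]; norm_num)))
  refine ⟨4 * (4 / δ ^ 2 + 2), by positivity, fun w hw => ?_⟩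
  have hw' : 4 / δ ^ 2 + 2 ≤ ‖w‖ := by linarith
  have hT : 4 / δ ^ 2 + 2 ≤ ‖w‖ ^ 2 := by
    have : 0 < 4 / δ ^ 2 := by positivity
    nlinarith
  rw [EuclideanSpace.real_norm_sq_eq, Fin.sum_univ_seven] at hT
  simp only [Real.norm_eq_abs, sq_abs] at hT
  rw [bump, collapse_of_cutoff, sub_self]
  by_cases hb : 2 ≤ w 3 ^ 2 + w 6 ^ 2
  · rw [cutoff, Real.smoothTransition.zero_of_nonpos (x := 2 - _), mul_zero]
    simpa [joinMap] using hb
  · rw [cutoff, Real.smoothTransition.zero_of_nonpos (x := _ + 1 / 2), zero_mul]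
    have h3 := stereoInv_den_pos w
    have h4 : dist (stereoInv w) pole6 < δ := by
      rw [dist_eq_norm, ← sq_lt_sq₀ (norm_nonneg _) hδ.le, norm_stereoInv_sub, ← div_eq_mul_inv, div_lt_iff₀ h3,
        ← div_lt_iff₀' (by positivity)]
      linarith
    have h5 := hball h4
    have h6 : joinMap w 2 = fsph (stereoInv w) 2 := rfl
    rw [h6]
    linarith

/-- In directions killed by a map to a plane, the derivative of the bump is controlled by two coordinates. -/
theorem exists_bump_fderiv : ∃ C : ℝ, 0 ≤ C ∧ ∀ w, ‖fderiv ℝ bump w‖ ≤ C ∧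
    ∃ Q : EuclideanSpace ℝ (Fin 7) →L[ℝ] EuclideanSpace ℝ (Fin 3), ∃ a : EuclideanSpace ℝ (Fin 3), ‖a‖ = 1 ∧
      (∀ σ, ⟪a, Q σ⟫ = 0) ∧ ∀ σ, Q σ = 0 → ‖fderiv ℝ bump w σ‖ ≤ C * (|σ 3| + |σ 6|) := by
  obtain ⟨R, hR, hz⟩ := exists_bump_eq_zero
  have hK := isCompact_closedBall (0 : EuclideanSpace ℝ (Fin 7)) R
  have c1 : ContinuousOn (fun w => fderiv ℝ bump w) (Metric.closedBall 0 R) :=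
    (contDiff_bump.continuous_fderiv one_ne_zero).continuousOn
  have c2 : ContinuousOn (fun w => fderiv ℝ collapse (joinMap w)) (Metric.closedBall 0 R) := fun w _ =>
    (((contDiffAt_collapse (fst5_sq w)).fderiv_right (m := 0) le_rfl).continuousAt.comp
      contDiff_joinMap.continuous.continuousAt).continuousWithinAt
  obtain ⟨C1, h1⟩ := hK.exists_bound_of_continuousOn c1
  obtain ⟨C2, h2⟩ := hK.exists_bound_of_continuousOn c2
  have e1 := h1 0 (by simp [hR.le])
  have e2 := h2 0 (by simp [hR.le])
  have p1 := (norm_nonneg _).trans e1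
  have p2 := (norm_nonneg _).trans e2
  have hd (w) : DifferentiableAt ℝ fst5 w := contDiff_fst5.differentiable one_ne_zero w
  refine ⟨C1 + C2, by linarith, fun w => ?_⟩
  by_cases hw : w ∈ Metric.closedBall (0 : EuclideanSpace ℝ (Fin 7)) R
  · refine ⟨by linarith [h1 w hw], fderiv ℝ fst5 w, fst5 w, norm_fst5 w, fun σ => ?_, fun σ hσ => ?_⟩
    · have k1 : HasFDerivAt (fun w => ⟪fst5 w, fst5 w⟫) _ w := (hd w).hasFDerivAt.inner ℝ (hd w).hasFDerivAt
      have k2 : (fun w => ⟪fst5 w, fst5 w⟫) = fun _ => 1 := by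
        funext w; rw [real_inner_self_eq_norm_sq, norm_fst5, one_pow]
      rw [k2] at k1
      have k3 := congrArg (fun T : EuclideanSpace ℝ (Fin 7) →L[ℝ] ℝ => T σ) (k1.unique (hasFDerivAt_const (1 : ℝ) w))
      simp [real_inner_comm (fderiv ℝ fst5 w σ)] at k3
      rw [real_inner_comm]
      linarith
    · have k1 : HasFDerivAt bump (fderiv ℝ collapse (joinMap w) ∘L fderiv ℝ joinMap w) w :=
        (((contDiffAt_collapse (fst5_sq w)).differentiableAt one_ne_zero).hasFDerivAt.comp w
          (contDiff_joinMap.differentiable one_ne_zero w).hasFDerivAt).sub_const _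
      have k2 (i : Fin 5) : (fderiv ℝ joinMap w σ) i = fderiv ℝ (fun w => joinMap w i) w σ := by
        have := ((EuclideanSpace.proj (𝕜 := ℝ) (i : Fin 5)).hasFDerivAt.comp w
          (contDiff_joinMap.differentiable one_ne_zero w).hasFDerivAt).fderiv
        exact (congrArg (fun T : EuclideanSpace ℝ (Fin 7) →L[ℝ] ℝ => T σ) this).symm
      have k3 (i : Fin 3) : fderiv ℝ (fun w => fst5 w i) w σ = 0 := by
        have := ((EuclideanSpace.proj (𝕜 := ℝ) (i : Fin 3)).hasFDerivAt.comp w (hd w).hasFDerivAt).fderiv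
        refine (congrArg (fun T : EuclideanSpace ℝ (Fin 7) →L[ℝ] ℝ => T σ) this).trans ?_
        simp [hσ]
      have k4 (i : Fin 7) : fderiv ℝ (fun w : EuclideanSpace ℝ (Fin 7) => w i) w σ = σ i :=
        congrArg (fun T : EuclideanSpace ℝ (Fin 7) →L[ℝ] ℝ => T σ)
          (EuclideanSpace.proj (𝕜 := ℝ) (i : Fin 7)).hasFDerivAt.fderiv
      have k5 : ‖fderiv ℝ joinMap w σ‖ ≤ |σ 3| + |σ 6| := by
        rw [← sq_le_sq₀ (norm_nonneg _) (by positivity), EuclideanSpace.real_norm_sq_eq, Fin.sum_univ_five, k2 0, k2 1, k2 2, k2 3,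
          k2 4, show (fun w => joinMap w 0) = fun w => fst5 w 0 from rfl, show (fun w => joinMap w 1) = fun w => fst5 w 1 from rfl,
          show (fun w => joinMap w 2) = fun w => fst5 w 2 from rfl, k3, k3, k3,
          show (fun w => joinMap w 3) = fun w => w 3 from rfl, show (fun w => joinMap w 4) = fun w => w 6 from rfl, k4, k4]
        simp only [norm_zero, Real.norm_eq_abs]
        nlinarith [mul_nonneg (abs_nonneg (σ 3)) (abs_nonneg (σ 6)), sq_abs (σ 3), sq_abs (σ 6)]
      rw [k1.fderiv]
      refine ((fderiv ℝ collapse (joinMap w)).le_opNorm _).trans (mul_le_mul (by linarith [h2 w hw]) k5 (norm_nonneg _) (by linarith))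
  · have h0 : bump =ᶠ[nhds w] fun _ => 0 := by
      filter_upwards [(Metric.isClosed_closedBall.isOpen_compl).mem_nhds hw] with x hx
      refine hz x ?_
      simp at hx
      linarith
    have h3 : fderiv ℝ bump w = 0 := by rw [h0.fderiv_eq]; simp
    refine ⟨by rw [h3, norm_zero]; linarith, 0, EuclideanSpace.single 0 1, by simp, fun σ => by simp, fun σ _ => ?_⟩
    rw [h3]
    simp only [ContinuousLinearMap.zero_apply, norm_zero]
    positivity

end Bump

section Lattice

/-- The upper triangular linear map used to twist the polar coordinates. -/
def latL (M : ℝ) : EuclideanSpace ℝ (Fin 7) →L[ℝ] EuclideanSpace ℝ (Fin 7) :=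
  LinearMap.toContinuousLinearMap
    { toFun := fun y => !₂[M ^ 2 * y 0 - y 1, M ^ 2 * y 1 - y 2, M ^ 2 * y 2 - M * y 3 + y 4, y 3 / M ^ 5,
        M ^ 2 * y 4 - y 5, M ^ 2 * y 5 - y 6, y 6 / M ^ 5]
      map_add' := fun x y => by ext i; fin_cases i <;> simp <;> ring
      map_smul' := fun a x => by ext i; fin_cases i <;> simp <;> ring }

theorem latL_apply (M : ℝ) (y : EuclideanSpace ℝ (Fin 7)) : latL M y =
    !₂[M ^ 2 * y 0 - y 1, M ^ 2 * y 1 - y 2, M ^ 2 * y 2 - M * y 3 + y 4, y 3 / M ^ 5,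
        M ^ 2 * y 4 - y 5, M ^ 2 * y 5 - y 6, y 6 / M ^ 5] := rfl

theorem norm_le_sum_seven (y : EuclideanSpace ℝ (Fin 7)) :
    ‖y‖ ≤ |y 0| + |y 1| + |y 2| + |y 3| + |y 4| + |y 5| + |y 6| := by
  have h := EuclideanSpace.real_norm_sq_eq y
  rw [Fin.sum_univ_seven] at h
  refine abs_le_of_sq_le_sq' ?_ (by positivity) |>.2
  rw [h, ← sq_abs (y 0), ← sq_abs (y 1), ← sq_abs (y 2), ← sq_abs (y 3), ← sq_abs (y 4), ← sq_abs (y 5), ← sq_abs (y 6)]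
  generalize hA : |y 0| + |y 1| + |y 2| = A
  have h0 := abs_nonneg (y 0)
  have h1 := abs_nonneg (y 1)
  have h2 := abs_nonneg (y 2)
  have h3 := abs_nonneg (y 3)
  have h4 := abs_nonneg (y 4)
  have h5 := abs_nonneg (y 5)
  have h6 := abs_nonneg (y 6)
  generalize |y 0| = a0 at *
  generalize |y 1| = a1 at *
  generalize |y 2| = a2 at *
  generalize |y 3| = a3 at *
  generalize |y 4| = a4 at *
  generalize |y 5| = a5 at *
  generalize |y 6| = a6 at *
  have hab : ∀ {a b : ℝ}, 0 ≤ a → 0 ≤ b → a ^ 2 + b ^ 2 ≤ (a + b) ^ 2 := fun ha hb => by nlinarith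
  have e1 := hab h0 h1
  have e2 := hab (add_nonneg h0 h1) h2
  rw [hA] at e2
  have hA0 : 0 ≤ A := by linarith
  have e3 := hab hA0 h3
  have e4 := hab (add_nonneg hA0 h3) h4
  have e5 := hab (add_nonneg (add_nonneg hA0 h3) h4) h5
  have e6 := hab (add_nonneg (add_nonneg (add_nonneg hA0 h3) h4) h5) h6
  linarith

theorem abs_coord_le {n : ℕ} (y : EuclideanSpace ℝ (Fin n)) (i : Fin n) : |y i| ≤ ‖y‖ := by
  simpa using PiLp.norm_apply_le y i

theorem norm_latL_le {M : ℝ} (hM : 10 ≤ M) (y : EuclideanSpace ℝ (Fin 7)) : ‖latL M y‖ ≤ 20 * M ^ 2 * ‖y‖ := by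
  have hM1 : M ≤ M ^ 2 := by nlinarith
  have h5 : |(latL M y) 3| ≤ M ^ 2 * ‖y‖ ∧ |(latL M y) 6| ≤ M ^ 2 * ‖y‖ := by
    have hdiv : ∀ i, |y i / M ^ 5| ≤ M ^ 2 * ‖y‖ := fun i => by
      rw [abs_div, abs_of_nonneg (by positivity : (0:ℝ) ≤ M ^ 5)]
      have : (1:ℝ) ≤ M ^ 5 := one_le_pow₀ (by linarith)
      refine (div_le_self (abs_nonneg _) this).trans ((abs_coord_le y i).trans ?_)
      have := norm_nonneg y
      nlinarith
    exact ⟨hdiv 3, hdiv 6⟩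
  have hy := fun i => abs_le.1 (abs_coord_le y i)
  have n0 := norm_nonneg y
  have hm : ∀ i, |M ^ 2 * y i| ≤ M ^ 2 * ‖y‖ := fun i => by
    rw [abs_mul, abs_of_nonneg (by positivity : (0:ℝ) ≤ M ^ 2)]
    exact mul_le_mul_of_nonneg_left (abs_coord_le y i) (by positivity)
  have hm' : |M * y 3| ≤ M ^ 2 * ‖y‖ := by
    rw [abs_mul, abs_of_nonneg (by linarith : (0:ℝ) ≤ M)]
    exact mul_le_mul hM1 (abs_coord_le y 3) (abs_nonneg _) (by positivity)
  have hone : ‖y‖ ≤ M ^ 2 * ‖y‖ := by nlinarith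
  have hs : ∀ i j, |M ^ 2 * y i - y j| ≤ 2 * (M ^ 2 * ‖y‖) := fun i j => by
    have := abs_sub (M ^ 2 * y i) (y j)
    have := hm i; have := abs_coord_le y j
    linarith
  have h2 : |M ^ 2 * y 2 - M * y 3 + y 4| ≤ 3 * (M ^ 2 * ‖y‖) := by
    have := abs_add_le (M ^ 2 * y 2 - M * y 3) (y 4)
    have := abs_sub (M ^ 2 * y 2) (M * y 3)
    have := hm 2; have := abs_coord_le y 4
    linarith
  refine (norm_le_sum_seven _).trans ?_
  have a0 : |(latL M y) 0| ≤ 2 * (M ^ 2 * ‖y‖) := hs 0 1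
  have a1 : |(latL M y) 1| ≤ 2 * (M ^ 2 * ‖y‖) := hs 1 2
  have a2 : |(latL M y) 2| ≤ 3 * (M ^ 2 * ‖y‖) := h2
  have a4 : |(latL M y) 4| ≤ 2 * (M ^ 2 * ‖y‖) := hs 4 5
  have a5 : |(latL M y) 5| ≤ 2 * (M ^ 2 * ‖y‖) := hs 5 6
  linarith [h5.1, h5.2, mul_nonneg (sq_nonneg M) n0]

/-- The lattice of integral vectors with vanishing first coordinate. -/
def latZ : AddSubgroup (EuclideanSpace ℝ (Fin 7)) where
  carrier := {k | k 0 = 0 ∧ ∀ i, ∃ n : ℤ, k i = n}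
  zero_mem' := ⟨rfl, fun _ => ⟨0, by simp⟩⟩
  add_mem' := fun {a b} ha hb => ⟨by simp [ha.1, hb.1], fun i => by
    obtain ⟨n, hn⟩ := ha.2 i; obtain ⟨m, hm⟩ := hb.2 i
    exact ⟨n + m, by simp [hn, hm]⟩⟩
  neg_mem' := fun {a} ha => ⟨by simp [ha.1], fun i => by
    obtain ⟨n, hn⟩ := ha.2 i
    exact ⟨-n, by simp [hn]⟩⟩

theorem latZ_eq_zero {M : ℕ} (hM : 10 ≤ M) {k : EuclideanSpace ℝ (Fin 7)} (hk : k ∈ latZ)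
    (h : ‖latL M k‖ < 1) : k = 0 := by
  obtain ⟨k0, hk⟩ := hk
  choose n hn using hk
  have hi := fun i => (abs_coord_le (latL M k) i).trans_lt h
  have b0 : |(M:ℝ) ^ 2 * k 0 - k 1| < 1 := hi 0
  have b1 : |(M:ℝ) ^ 2 * k 1 - k 2| < 1 := hi 1
  have b2 : |(M:ℝ) ^ 2 * k 2 - M * k 3 + k 4| < 1 := hi 2
  have b4 : |(M:ℝ) ^ 2 * k 4 - k 5| < 1 := hi 4
  have b5 : |(M:ℝ) ^ 2 * k 5 - k 6| < 1 := hi 5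
  have b6 : |k 6 / (M:ℝ) ^ 5| < 1 := hi 6
  have hz : ∀ m : ℤ, |(m:ℝ)| < 1 → m = 0 := fun m hm => by
    rw [← Int.cast_abs, ← Int.cast_one, Int.cast_lt] at hm
    exact Int.abs_lt_one_iff.1 hm
  have hM0 : (0:ℝ) < (M:ℝ) ^ 5 := by positivity
  rw [k0, hn 1] at b0
  have e1 : n 1 = 0 := by simpa using hz (-n 1) (by push_cast; simpa using b0)
  rw [hn 1, e1, hn 2] at b1
  have e2 : n 2 = 0 := by simpa using hz (-n 2) (by push_cast; simpa using b1)
  rw [hn 2, e2, hn 3, hn 4] at b2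
  have e4 := hz (- M * n 3 + n 4) (by push_cast; simpa using b2)
  rw [hn 4, hn 5] at b4
  have e5 := hz (M ^ 2 * n 4 - n 5) (by push_cast; exact b4)
  rw [hn 5, hn 6] at b5
  have e6 := hz (M ^ 2 * n 5 - n 6) (by push_cast; exact b5)
  have e6' : n 6 = M ^ 5 * n 3 := by
    have : n 4 = M * n 3 := by linarith
    have : n 5 = M ^ 2 * n 4 := by linarith
    have : n 6 = M ^ 2 * n 5 := by linarith
    rw [this, ‹n 5 = _›, ‹n 4 = _›]; ring
  rw [hn 6, e6'] at b6
  have e3 : n 3 = 0 := hz _ (by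
    rw [show ((M ^ 5 * n 3 : ℤ) : ℝ) / (M:ℝ) ^ 5 = n 3 by push_cast; field_simp] at b6
    exact b6)
  have f4 : n 4 = 0 := by rw [e3] at e4; simpa using e4
  have f5 : n 5 = 0 := by rw [f4] at e5; simpa using e5
  have f6 : n 6 = 0 := by rw [f5] at e6; simpa using e6
  ext i
  fin_cases i
  · exact k0
  all_goals simp [hn, *]

theorem latL_eq_zero {M : ℝ} (hM : 10 ≤ M) {y : EuclideanSpace ℝ (Fin 7)} (h : latL M y = 0) : y = 0 := by
  have hi := fun i => congrArg (fun v : EuclideanSpace ℝ (Fin 7) => v i) h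
  have b0 : M ^ 2 * y 0 - y 1 = 0 := hi 0
  have b1 : M ^ 2 * y 1 - y 2 = 0 := hi 1
  have b2 : M ^ 2 * y 2 - M * y 3 + y 4 = 0 := hi 2
  have b3 : y 3 / M ^ 5 = 0 := hi 3
  have b4 : M ^ 2 * y 4 - y 5 = 0 := hi 4
  have b5 : M ^ 2 * y 5 - y 6 = 0 := hi 5
  have b6 : y 6 / M ^ 5 = 0 := hi 6
  have hM0 : M ≠ 0 := by linarith
  have e6 : y 6 = 0 := by simpa [hM0] using b6
  have e3 : y 3 = 0 := by simpa [hM0] using b3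
  have e5 : y 5 = 0 := by simpa [hM0, e6] using b5
  have e4 : y 4 = 0 := by simpa [hM0, e5] using b4
  have e2 : y 2 = 0 := by simpa [hM0, e3, e4] using b2
  have e1 : y 1 = 0 := by simpa [hM0, e2] using b1
  have e0 : y 0 = 0 := by simpa [hM0, e1] using b0
  ext i
  fin_cases i <;> simp [*]

theorem abs_first_lt {M : ℝ} (hM : 10 ≤ M) {y : EuclideanSpace ℝ (Fin 7)} (h : ‖latL M y‖ < 1 / 2) : |y 0| < 3 / 4 := by
  have hi := fun i => abs_lt.1 ((abs_coord_le (latL M y) i).trans_lt h)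
  have hM0 : M ≠ 0 := by linarith
  have key : y 0 = (latL M y) 3 + M⁻¹ * (M⁻¹ * ((latL M y) 0 + M⁻¹ * (M⁻¹ * ((latL M y) 1 + M⁻¹ * (M⁻¹ * ((latL M y) 2 - M⁻¹ * (M⁻¹ * (
      (latL M y) 4 + M⁻¹ * (M⁻¹ * (latL M y) 5))))))))) - M⁻¹ * (M⁻¹ * (M⁻¹ * (M⁻¹ * (M⁻¹ * (latL M y) 6)))) := by
    have c0 : (latL M y) 0 = M ^ 2 * y 0 - y 1 := rfl
    have c1 : (latL M y) 1 = M ^ 2 * y 1 - y 2 := rfl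
    have c2 : (latL M y) 2 = M ^ 2 * y 2 - M * y 3 + y 4 := rfl
    have c3 : (latL M y) 3 = y 3 / M ^ 5 := rfl
    have c4 : (latL M y) 4 = M ^ 2 * y 4 - y 5 := rfl
    have c5 : (latL M y) 5 = M ^ 2 * y 5 - y 6 := rfl
    have c6 : (latL M y) 6 = y 6 / M ^ 5 := rfl
    rw [c0, c1, c2, c3, c4, c5, c6]
    field_simp
    ring
  have hinv : M⁻¹ ≤ 1 / 10 := by rw [inv_le_comm₀ (by linarith) (by norm_num)]; linarith
  have hinv0 : 0 ≤ M⁻¹ := by positivity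
  have step : ∀ a : ℝ, ∀ C, |a| ≤ C → |M⁻¹ * a| ≤ C / 10 := fun a C ha => by
    rw [abs_mul, abs_of_nonneg hinv0]
    have := abs_nonneg a
    nlinarith
  have hh : ∀ i, |(latL M y) i| ≤ 1 / 2 := fun i => abs_le.2 ⟨(hi i).1.le, (hi i).2.le⟩
  have s6 := step _ _ (step _ _ (step _ _ (step _ _ (step _ _ (hh 6)))))
  have s5 := step _ _ (step _ _ (hh 5))
  have s4 := step _ _ (step _ _ ((abs_add_le ((latL M y) 4) _).trans (add_le_add (hh 4) s5)))
  have s2 := step _ _ (step _ _ ((abs_sub ((latL M y) 2) _).trans (add_le_add (hh 2) s4)))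
  have s1 := step _ _ (step _ _ ((abs_add_le ((latL M y) 1) _).trans (add_le_add (hh 1) s2)))
  have s0 := step _ _ (step _ _ ((abs_add_le ((latL M y) 0) _).trans (add_le_add (hh 0) s1)))
  have s3 := hh 3
  rw [abs_le] at *
  rw [key, abs_lt]
  constructor <;> linarith [s0.1, s0.2, s6.1, s6.2, s3.1, s3.2]

open Classical in
/-- The representative of `L y` modulo the lattice that is small, or else a default vector. -/
def lred (M : ℝ) (y : EuclideanSpace ℝ (Fin 7)) : EuclideanSpace ℝ (Fin 7) :=
  if h : ∃ k ∈ latZ, ‖latL M (y + k)‖ < 1 / 2 then latL M (y + h.choose) else EuclideanSpace.single 0 1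

theorem lred_eq {M : ℕ} (hM : 10 ≤ M) {y k : EuclideanSpace ℝ (Fin 7)} (hk : k ∈ latZ)
    (h : ‖latL M (y + k)‖ < 1 / 2) : lred M y = latL M (y + k) := by
  have hex : ∃ k ∈ latZ, ‖latL M (y + k)‖ < 1 / 2 := ⟨k, hk, h⟩
  rw [lred, dif_pos hex]
  obtain ⟨h1, h2⟩ := hex.choose_spec
  have : k - hex.choose = 0 := by
    refine latZ_eq_zero hM (latZ.sub_mem hk h1) ?_
    rw [show k - hex.choose = (y + k) - (y + hex.choose) by abel, map_sub]
    exact (norm_sub_le _ _).trans_lt (by linarith)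
  rw [← sub_eq_zero.1 this]

theorem exists_of_norm_lred_lt {M : ℝ} {y : EuclideanSpace ℝ (Fin 7)} (h : ‖lred M y‖ < 1 / 4) :
    ∃ k ∈ latZ, lred M y = latL M (y + k) := by
  by_cases hex : ∃ k ∈ latZ, ‖latL M (y + k)‖ < 1 / 2
  · exact ⟨hex.choose, hex.choose_spec.1, by rw [lred, dif_pos hex]⟩
  · rw [lred, dif_neg hex] at h
    norm_num at h

open Filter Topology in
theorem lred_local {M : ℕ} (hM : 10 ≤ M) {X : Type*} [TopologicalSpace X] {c d : X → EuclideanSpace ℝ (Fin 7)} {x : X}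
    (hd : ContinuousAt d x) (hcd : ∀ᶠ y in 𝓝 x, d y - c y ∈ latZ) :
    (∀ᶠ y in 𝓝 x, 1 / 4 ≤ ‖lred M (c y)‖) ∨ ∃ k ∈ latZ, ∀ᶠ y in 𝓝 x, lred M (c y) = latL M (d y + k) := by
  have hL : ContinuousAt (fun y => latL M (d y)) x := (latL M).continuous.continuousAt.comp hd
  by_cases hex : ∃ k ∈ latZ, ‖latL M (d x + k)‖ < 1 / 2
  · right
    obtain ⟨k, hk, hlt⟩ := hex
    refine ⟨k, hk, ?_⟩
    have hc : ContinuousAt (fun y => ‖latL M (d y + k)‖) x := by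
      simp only [map_add]; exact (hL.add continuousAt_const).norm
    filter_upwards [hcd, hc.eventually (Iio_mem_nhds hlt)] with y h1 h2
    have := lred_eq hM (y := c y) (latZ.add_mem h1 hk) (by rwa [show c y + (d y - c y + k) = d y + k by abel])
    rwa [show c y + (d y - c y + k) = d y + k by abel] at this
  · left
    push Not at hex
    filter_upwards [hcd, Metric.continuousAt_iff'.1 hL (1 / 4) (by norm_num)] with y h1 h2
    by_contra hlt
    obtain ⟨k, hk, he⟩ := exists_of_norm_lred_lt (not_le.1 hlt)
    rw [he] at hlt
    have h3 := hex (-(d y - c y) + k) (latZ.add_mem (latZ.neg_mem h1) hk)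
    rw [dist_eq_norm] at h2
    have h4 : latL M (d x + (-(d y - c y) + k)) = latL M (c y + k) - (latL M (d y) - latL M (d x)) := by
      rw [← map_sub, ← map_sub]; congr 1; abel
    rw [h4] at h3
    have := norm_sub_le (latL M (c y + k)) (latL M (d y) - latL M (d x))
    linarith [not_le.1 hlt]

end Lattice

section Polar

open Filter Topology

variable {E F G : Type*} [NormedAddCommGroup E] [NormedSpace ℝ E] [NormedAddCommGroup F] [NormedSpace ℝ F]
  [NormedAddCommGroup G] [NormedSpace ℝ G]

/-- A function is `C¹` at a point, with a derivative of norm at most `B` there. -/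
def DerivBd (B : ℝ) (f : E → F) (x : E) : Prop := ContDiffAt ℝ 1 f x ∧ ‖fderiv ℝ f x‖ ≤ B

theorem DerivBd.comp {A B : ℝ} {g : F → G} {f : E → F} {x : E} (hg : DerivBd A g (f x)) (hf : DerivBd B f x) :
    DerivBd (A * B) (fun y => g (f y)) x := by
  refine ⟨hg.1.comp x hf.1, ?_⟩
  rw [fderiv_fun_comp x (hg.1.differentiableAt one_ne_zero) (hf.1.differentiableAt one_ne_zero)]
  exact (ContinuousLinearMap.opNorm_comp_le _ _).trans
    (mul_le_mul hg.2 hf.2 (norm_nonneg _) ((norm_nonneg _).trans hg.2))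

theorem DerivBd.mono {A B : ℝ} {f : E → F} {x : E} (hf : DerivBd A f x) (h : A ≤ B) : DerivBd B f x :=
  ⟨hf.1, hf.2.trans h⟩

theorem derivBd_clm {A : ℝ} (l : E →L[ℝ] F) (hl : ‖l‖ ≤ A) (x : E) : DerivBd A l x :=
  ⟨l.contDiff.contDiffAt, by rwa [l.fderiv]⟩

theorem DerivBd.add {A B : ℝ} {f g : E → F} {x : E} (hf : DerivBd A f x) (hg : DerivBd B g x) :
    DerivBd (A + B) (fun y => f y + g y) x := by
  refine ⟨hf.1.add hg.1, ?_⟩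
  rw [fderiv_fun_add (hf.1.differentiableAt one_ne_zero) (hg.1.differentiableAt one_ne_zero)]
  exact (norm_add_le _ _).trans (add_le_add hf.2 hg.2)

theorem DerivBd.sub_const {A : ℝ} {f : E → F} {x : E} (hf : DerivBd A f x) (c : F) :
    DerivBd A (fun y => f y - c) x :=
  ⟨hf.1.sub contDiffAt_const, by rw [fderiv_sub_const]; exact hf.2⟩

theorem derivBd_norm {z : ℂ} (hz : z ≠ 0) : DerivBd 1 (fun w : ℂ => ‖w‖) z :=
  ⟨contDiffAt_norm ℝ hz, by simpa using norm_fderiv_le_of_lipschitz ℝ (lipschitzWith_one_norm (E := ℂ)) (x₀ := z)⟩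

/-- The argument near `z`, in turns, as a smooth function. -/
def turn (z w : ℂ) : ℝ := ((2 * Real.pi)⁻¹ • Complex.imCLM) (Complex.log (z⁻¹ * w)) + z.arg / (2 * Real.pi)

theorem turn_eq (z w : ℂ) : turn z w = (z.arg + (z⁻¹ * w).arg) / (2 * Real.pi) := by
  simp [turn, Complex.log_im]; ring

theorem derivBd_turn {z : ℂ} (hz : 1 / 4 ≤ ‖z‖) : DerivBd 4 (turn z) z := by
  have hz0 : z ≠ 0 := norm_pos_iff.1 (by linarith)
  have hlog : DerivBd 1 Complex.log (ContinuousLinearMap.mul ℝ ℂ z⁻¹ z) := by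
    rw [ContinuousLinearMap.mul_apply', inv_mul_cancel₀ hz0]
    refine ⟨(Complex.contDiffAt_log Complex.one_mem_slitPlane).restrict_scalars ℝ, ?_⟩
    rw [(Complex.hasStrictFDerivAt_log_real Complex.one_mem_slitPlane).hasFDerivAt.fderiv]
    simp
  have hmul : DerivBd 4 (ContinuousLinearMap.mul ℝ ℂ z⁻¹) z := by
    refine derivBd_clm _ ?_ z
    refine (ContinuousLinearMap.opNorm_mul_apply_le ℝ ℂ _).trans ?_
    rw [norm_inv, inv_le_comm₀ (by linarith) (by norm_num)]
    linarith
  have him : ‖(2 * Real.pi)⁻¹ • Complex.imCLM‖ ≤ 1 := by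
    rw [norm_smul, Complex.imCLM_norm, mul_one, Real.norm_of_nonneg (by positivity)]
    refine inv_le_one_of_one_le₀ ?_
    linarith [Real.pi_gt_three]
  have h := ((derivBd_clm _ him _).comp (hlog.comp hmul)).sub_const (-(z.arg / (2 * Real.pi)))
  norm_num only [sub_neg_eq_add] at h
  exact h

theorem exists_int_turn {z : ℂ} (hz : z ≠ 0) {w : ℂ} (hw : w ≠ 0) : ∃ n : ℤ, turn z w - w.arg / (2 * Real.pi) = n := by
  have h := Complex.arg_mul_coe_angle hz (mul_ne_zero (inv_ne_zero hz) hw)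
  rw [mul_inv_cancel_left₀ hz, ← Real.Angle.coe_add] at h
  obtain ⟨n, hn⟩ := Real.Angle.angle_eq_iff_two_pi_dvd_sub.1 h.symm
  refine ⟨n, ?_⟩
  rw [turn_eq, ← sub_div, hn]
  have := Real.pi_pos
  field_simp

/-- Coordinates indexed by all natural numbers. -/
def xco (n : ℕ) (x : EuclideanSpace ℝ (Fin 7)) : ℝ := if h : n < 7 then x ⟨n, h⟩ else 0

/-- The successive radii of the nested polar coordinates. -/
def rho : ℕ → EuclideanSpace ℝ (Fin 7) → ℝ
  | 0, x => x 0
  | n + 1, x => ‖(⟨rho n x, xco (n + 1) x⟩ : ℂ)‖ - 32 / 2 ^ n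

/-- The successive complex numbers of the nested polar coordinates. -/
def zco (n : ℕ) (x : EuclideanSpace ℝ (Fin 7)) : ℂ := ⟨rho n x, xco (n + 1) x⟩

theorem rho_succ (n : ℕ) (x : EuclideanSpace ℝ (Fin 7)) : rho (n + 1) x = ‖zco n x‖ - 32 / 2 ^ n := rfl

theorem xco_succ (j : Fin 6) : xco (j + 1) = fun x : EuclideanSpace ℝ (Fin 7) => x j.succ := by
  funext x
  exact dif_pos (by omega)

theorem continuous_xco (n : ℕ) : Continuous (xco n) := by
  unfold xco
  split_ifs with h
  · exact (EuclideanSpace.proj (𝕜 := ℝ) (⟨n, h⟩ : Fin 7)).continuous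
  · exact continuous_const

theorem continuous_complex_mk {X : Type*} [TopologicalSpace X] {f g : X → ℝ} (hf : Continuous f) (hg : Continuous g) :
    Continuous (fun x => (⟨f x, g x⟩ : ℂ)) :=
  Complex.equivRealProdCLM.symm.continuous.comp (hf.prodMk hg)

theorem continuous_rho (n : ℕ) : Continuous (rho n) := by
  induction n with
  | zero => exact (EuclideanSpace.proj (𝕜 := ℝ) (0 : Fin 7)).continuous
  | succ n ih => exact (continuous_complex_mk ih (continuous_xco _)).norm.sub continuous_const

theorem continuous_zco (n : ℕ) : Continuous (zco n) := continuous_complex_mk (continuous_rho n) (continuous_xco _)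

/-- The nested polar coordinates, the last radius coming first and the angles measured in turns. -/
def polarCo (x : EuclideanSpace ℝ (Fin 7)) : EuclideanSpace ℝ (Fin 7) :=
  WithLp.toLp 2 (Fin.cons (rho 6 x) fun j : Fin 6 => (zco j x).arg / (2 * Real.pi))

theorem polar_zero (x : EuclideanSpace ℝ (Fin 7)) : polarCo x 0 = rho 6 x := rfl

theorem polar_succ (x : EuclideanSpace ℝ (Fin 7)) (j : Fin 6) : polarCo x j.succ = (zco j x).arg / (2 * Real.pi) := rfl

/-- The nested polar coordinates continued smoothly from a point. -/
def polarAt (x y : EuclideanSpace ℝ (Fin 7)) : EuclideanSpace ℝ (Fin 7) :=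
  WithLp.toLp 2 (Fin.cons (rho 6 y) fun j : Fin 6 => turn (zco j x) (zco j y))

theorem derivBd_zco {x : EuclideanSpace ℝ (Fin 7)} (j : Fin 6) {B : ℝ} (h : DerivBd B (rho j) x) : DerivBd (B + 1) (zco j) x := by
  have h1 := (derivBd_clm Complex.ofRealCLM (Complex.ofRealCLM_norm).le (rho j x)).comp h
  have h2 : DerivBd 1 (ContinuousLinearMap.smulRight (EuclideanSpace.proj (𝕜 := ℝ) (j.succ : Fin 7)) Complex.I :
      EuclideanSpace ℝ (Fin 7) →L[ℝ] ℂ) x := by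
    refine derivBd_clm _ (ContinuousLinearMap.opNorm_le_bound _ zero_le_one fun v => ?_) x
    simpa using abs_coord_le v j.succ
  have h3 := (h1.add h2).mono (B := B + 1) (by linarith)
  have e : zco j = fun y => Complex.ofRealCLM (rho j y) + (ContinuousLinearMap.smulRight (EuclideanSpace.proj (𝕜 := ℝ) (j.succ : Fin 7)) Complex.I :
      EuclideanSpace ℝ (Fin 7) →L[ℝ] ℂ) y := by
    funext y
    apply Complex.ext <;> simp [zco, xco_succ]
  rw [e]; exact h3

theorem derivBd_rho {x : EuclideanSpace ℝ (Fin 7)} (hx : ∀ j : Fin 6, 1 / 4 ≤ ‖zco j x‖) (n : ℕ) (hn : n ≤ 6) :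
    DerivBd (n + 1) (rho n) x := by
  induction n with
  | zero =>
    refine (derivBd_clm (EuclideanSpace.proj (𝕜 := ℝ) (0 : Fin 7)) (A := 1)
      (ContinuousLinearMap.opNorm_le_bound _ zero_le_one fun v => ?_) x).mono (by simp)
    simpa using abs_coord_le v 0
  | succ n ih =>
    have h := derivBd_zco ⟨n, by omega⟩ (ih (by omega))
    have hz : zco n x ≠ 0 := norm_pos_iff.1 (by have : 1 / 4 ≤ ‖zco n x‖ := hx ⟨n, by omega⟩; linarith)
    refine (((derivBd_norm hz).comp h).sub_const (32 / 2 ^ n)).mono ?_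
    push_cast; linarith

theorem DerivBd.euclidean {f : E → EuclideanSpace ℝ (Fin 7)} {x : E} {B : ℝ} (h : ∀ i, DerivBd B (fun y => f y i) x) :
    DerivBd (7 * B) f x := by
  have hc : ContDiffAt ℝ 1 f x := contDiffAt_euclidean.2 fun i => (h i).1
  have hB : 0 ≤ B := (norm_nonneg _).trans (h 0).2
  refine ⟨hc, ContinuousLinearMap.opNorm_le_bound _ (by positivity) fun v => ?_⟩
  have key : ∀ i, |fderiv ℝ f x v i| ≤ B * ‖v‖ := fun i => by
    have h1 := (EuclideanSpace.proj (𝕜 := ℝ) (i : Fin 7)).hasFDerivAt.comp x (hc.differentiableAt one_ne_zero).hasFDerivAt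
    have h2 : fderiv ℝ (fun y => f y i) x = (EuclideanSpace.proj (𝕜 := ℝ) (i : Fin 7)).comp (fderiv ℝ f x) := h1.fderiv
    have h3 := (fderiv ℝ (fun y => f y i) x).le_of_opNorm_le (h i).2 v
    rw [h2] at h3
    exact h3
  have := norm_le_sum_seven (fderiv ℝ f x v)
  linarith [key 0, key 1, key 2, key 3, key 4, key 5, key 6]

theorem derivBd_polarAt {x : EuclideanSpace ℝ (Fin 7)} (hx : ∀ j : Fin 6, 1 / 4 ≤ ‖zco j x‖) :
    DerivBd 196 (polarAt x) x := by
  have : DerivBd (7 * 28) (polarAt x) x := by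
    refine DerivBd.euclidean fun i => ?_
    refine Fin.cases ?_ (fun j => ?_) i
    · exact (derivBd_rho hx 6 le_rfl).mono (by norm_num)
    · have h1 := (derivBd_turn (hx j)).comp (derivBd_zco j (derivBd_rho hx j (by omega)))
      refine h1.mono ?_
      have : ((j:ℕ):ℝ) ≤ 5 := by exact_mod_cast (by omega : (j:ℕ) ≤ 5)
      linarith
  norm_num at this
  exact this

theorem polarAt_sub_polar {x : EuclideanSpace ℝ (Fin 7)} (hx : ∀ j : Fin 6, 1 / 4 ≤ ‖zco j x‖) :
    ∀ᶠ y in 𝓝 x, polarAt x y - polarCo y ∈ latZ := by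
  have h : ∀ᶠ y in 𝓝 x, ∀ j : Fin 6, zco j y ≠ 0 := by
    refine eventually_all.2 fun j => (continuous_zco j).continuousAt.eventually_ne ?_
    exact norm_pos_iff.1 (by linarith [hx j])
  filter_upwards [h] with y hy
  refine ⟨by change rho 6 y - rho 6 y = 0; ring, fun i => ?_⟩
  refine Fin.cases ⟨0, by change rho 6 y - rho 6 y = _; simp⟩ (fun j => ?_) i
  exact exists_int_turn (norm_pos_iff.1 (by linarith [hx j])) (hy j)

theorem abs_rho_le_norm_zco (n : ℕ) (x : EuclideanSpace ℝ (Fin 7)) : |rho n x| ≤ ‖zco n x‖ := Complex.abs_re_le_norm (zco n x)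

theorem abs_rho_six {x : EuclideanSpace ℝ (Fin 7)} (j : Fin 6) (h : ‖zco j x‖ < 1 / 4) : 3 / 4 ≤ |rho 6 x| := by
  have hr : ∀ n, ‖zco n x‖ = rho (n + 1) x + 32 / 2 ^ n := fun n => by rw [rho_succ]; ring
  have a := fun n => abs_le.1 ((abs_rho_le_norm_zco n x).trans_eq (hr n))
  rw [hr] at h
  have a1 := (a 1).1
  have a2 := (a 2).1
  have a3 := (a 3).1
  have a4 := (a 4).1
  have a5 := (a 5).1
  have c2 := (a 2).2
  have c3 := (a 3).2
  have c4 := (a 4).2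
  have c5 := (a 5).2
  norm_num at a1 a2 a3 a4 a5 c2 c3 c4 c5
  rw [le_abs]
  fin_cases j <;> norm_num at h
  · left; linarith
  · left; linarith
  · left; linarith
  · left; linarith
  · left; linarith
  · right; linarith

theorem norm_le_of_abs_rho_six {x : EuclideanSpace ℝ (Fin 7)} (h : |rho 6 x| < 3 / 4) : ‖x‖ ≤ 200 := by
  have hr : ∀ n, ‖zco n x‖ = rho (n + 1) x + 32 / 2 ^ n := fun n => by rw [rho_succ]; ring
  have a := fun n => (le_abs_self _).trans ((abs_rho_le_norm_zco n x).trans_eq (hr n))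
  have b : ∀ j : Fin 6, |x j.succ| ≤ rho (j + 1) x + 32 / 2 ^ (j:ℕ) := fun j => by
    rw [← hr]
    have := Complex.abs_im_le_norm (zco j x)
    simpa [zco, xco_succ] using this
  have h0 : |x 0| ≤ rho 1 x + 32 / 2 ^ 0 := (abs_rho_le_norm_zco 0 x).trans_eq (hr 0)
  have h6 := (abs_lt.1 h).2
  have a1 := a 1
  have a2 := a 2
  have a3 := a 3
  have a4 := a 4
  have a5 := a 5
  have b0 : |x 1| ≤ rho 1 x + 32 / 2 ^ 0 := b 0
  have b1 : |x 2| ≤ rho 2 x + 32 / 2 ^ 1 := b 1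
  have b2 : |x 3| ≤ rho 3 x + 32 / 2 ^ 2 := b 2
  have b3 : |x 4| ≤ rho 4 x + 32 / 2 ^ 3 := b 3
  have b4 : |x 5| ≤ rho 5 x + 32 / 2 ^ 4 := b 4
  have b5 : |x 6| ≤ rho 6 x + 32 / 2 ^ 5 := b 5
  norm_num at a1 a2 a3 a4 a5 b0 b1 b2 b3 b4 b5 h0
  have := norm_le_sum_seven x
  linarith

/-- The twisted nested polar coordinates. -/
def polL (M : ℝ) (x : EuclideanSpace ℝ (Fin 7)) : EuclideanSpace ℝ (Fin 7) := lred M (polarCo x)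

theorem abs_rho_of_norm_polL_lt {M : ℝ} (hM : 10 ≤ M) {x : EuclideanSpace ℝ (Fin 7)} (h : ‖polL M x‖ < 1 / 4) :
    |rho 6 x| < 3 / 4 := by
  obtain ⟨k, hk, he⟩ := exists_of_norm_lred_lt h
  rw [polL, he] at h
  have := abs_first_lt hM (h.trans (by norm_num))
  simpa [hk.1, polar_zero] using this

theorem norm_le_of_norm_polL_lt {M : ℝ} (hM : 10 ≤ M) {x : EuclideanSpace ℝ (Fin 7)} (h : ‖polL M x‖ < 1 / 4) :
    ‖x‖ ≤ 200 := norm_le_of_abs_rho_six (abs_rho_of_norm_polL_lt hM h)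

theorem polL_local {M : ℕ} (hM : 10 ≤ M) (x : EuclideanSpace ℝ (Fin 7)) : (∀ᶠ y in 𝓝 x, 1 / 4 ≤ ‖polL M y‖) ∨
    ∃ g : EuclideanSpace ℝ (Fin 7) → EuclideanSpace ℝ (Fin 7), DerivBd 196 g x ∧ ∀ᶠ y in 𝓝 x, polL M y = latL M (g y) := by
  have hM' : (10:ℝ) ≤ M := by exact_mod_cast hM
  by_cases hx : ∀ j : Fin 6, 1 / 4 ≤ ‖zco j x‖
  · have hd := derivBd_polarAt hx
    refine (lred_local hM hd.1.continuousAt (polarAt_sub_polar hx)).imp id ?_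
    rintro ⟨k, -, hk⟩
    refine ⟨fun y => polarAt x y - (-k), hd.sub_const _, ?_⟩
    simpa only [sub_neg_eq_add, polL] using hk
  · left
    push Not at hx
    obtain ⟨j, hj⟩ := hx
    filter_upwards [(continuous_zco j).norm.continuousAt.eventually (Iio_mem_nhds hj)] with y hy
    by_contra h
    exact absurd (abs_rho_of_norm_polL_lt hM' (not_le.1 h)) (not_lt.2 (abs_rho_six j hy))

end Polar

section Dilation

variable {E F : Type*} [NormedAddCommGroup E] [InnerProductSpace ℝ E] [NormedAddCommGroup F] [InnerProductSpace ℝ F]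

/-- The Gram matrix of a triple of vectors. -/
def gramM (u : Fin 3 → F) : Matrix (Fin 3) (Fin 3) ℝ := Matrix.of fun i j => ⟪u i, u j⟫

theorem det_gramM_le (u : Fin 3 → F) : (gramM u).det ≤ 6 * (∏ i, ‖u i‖) ^ 2 := by
  rw [Matrix.det_apply]
  have h : ∀ σ : Equiv.Perm (Fin 3), Equiv.Perm.sign σ • ∏ i, gramM u (σ i) i ≤ (∏ i, ‖u i‖) ^ 2 := fun σ => by
    refine (le_abs_self _).trans ?_
    have h1 : |Equiv.Perm.sign σ • ∏ i, gramM u (σ i) i| = |∏ i, gramM u (σ i) i| := by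
      rcases Int.units_eq_one_or (Equiv.Perm.sign σ) with h | h <;> rw [h] <;> simp
    rw [h1, Finset.abs_prod, sq]
    refine (Finset.prod_le_prod (fun i _ => abs_nonneg _) fun i _ => abs_real_inner_le_norm (u (σ i)) (u i)).trans ?_
    rw [Finset.prod_mul_distrib, Equiv.prod_comp σ fun i => ‖u i‖]
  refine (Finset.sum_le_sum fun σ _ => h σ).trans ?_
  rw [Finset.sum_const, Finset.card_univ, Fintype.card_perm, Fintype.card_fin]
  norm_num [Nat.factorial]

theorem det_gramM_update (u : Fin 3 → F) (c : Fin 3 → ℝ) (j : Fin 3) (hc : c j = 1) :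
    (gramM (Function.update u j (∑ i, c i • u i))).det = (gramM u).det := by
  set U : Matrix (Fin 3) (Fin 3) ℝ := (1 : Matrix (Fin 3) (Fin 3) ℝ).updateCol j c with hU
  have hdet : U.det = 1 := by
    rw [hU, ← Matrix.cramer_apply, Matrix.cramer_one]; exact hc
  have hu : ∀ i, Function.update u j (∑ i, c i • u i) i = ∑ k, U k i • u k := fun i => by
    by_cases hij : i = j
    · subst hij; simp [hU]
    · rw [Function.update_of_ne hij]
      simp [hU, Matrix.updateCol_ne hij, Matrix.one_apply]
  have hG : gramM (Function.update u j (∑ i, c i • u i)) = U.transpose * gramM u * U := by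
    ext a b
    rw [gramM, Matrix.of_apply, hu, hu, sum_inner, Matrix.mul_apply]
    simp only [inner_sum, real_inner_smul_left, real_inner_smul_right, Matrix.mul_apply, Matrix.transpose_apply, gramM,
      Matrix.of_apply, Finset.sum_mul]
    rw [Finset.sum_comm]
    exact Finset.sum_congr rfl fun x _ => Finset.sum_congr rfl fun y _ => by ring
  rw [hG, Matrix.det_mul, Matrix.det_mul, Matrix.det_transpose, hdet]; ring

theorem lamNorm_three_le {A : E →ₗ[ℝ] F} {K κ : ℝ} (hK0 : 0 ≤ K) (hκ : 0 ≤ κ) (hK : ∀ v, ‖A v‖ ≤ K * ‖v‖)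
    (h : ∀ e : Fin 3 → E, ∃ c : Fin 3 → ℝ, (∃ i, c i ≠ 0) ∧ ‖A (∑ i, c i • e i)‖ ≤ κ * ‖∑ i, c i • e i‖) :
    lamNorm 3 A ≤ 9 * κ * K ^ 2 := by
  refine Real.iSup_le (fun v => ?_) (by positivity)
  obtain ⟨e, he⟩ := v
  obtain ⟨c, ⟨i, hi⟩, hc⟩ := h e
  obtain ⟨j, hj⟩ := Finite.exists_max fun i => |c i|
  have hcj : 0 < |c j| := (abs_pos.2 hi).trans_le (hj i)
  have hcj0 : c j ≠ 0 := abs_pos.1 hcj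
  set d : Fin 3 → ℝ := fun i => (c j)⁻¹ * c i with hd
  have hdj : d j = 1 := inv_mul_cancel₀ hcj0
  have hd1 : ∀ i, |d i| ≤ 1 := fun i => by
    rw [hd, abs_mul, abs_inv, inv_mul_le_one₀ hcj]; exact hj i
  have hsum : ∑ i, d i • e i = (c j)⁻¹ • ∑ i, c i • e i := by
    rw [Finset.smul_sum]; simp only [hd, smul_smul]
  have hsmall : ‖A (∑ i, d i • e i)‖ ≤ κ * 3 := by
    have h1 : ‖A (∑ i, d i • e i)‖ ≤ κ * ‖∑ i, d i • e i‖ := by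
      rw [hsum, map_smul, norm_smul, norm_smul, mul_left_comm]
      exact mul_le_mul_of_nonneg_left hc (norm_nonneg _)
    refine h1.trans (mul_le_mul_of_nonneg_left ?_ hκ)
    refine (norm_sum_le _ _).trans ((Finset.sum_le_sum (g := fun _ => (1:ℝ)) fun i _ => ?_).trans (by simp))
    rw [norm_smul, he.1 i, mul_one]; exact hd1 i
  have hub : ∀ i, ‖A (e i)‖ ≤ K := fun i => by simpa [he.1 i] using hK (e i)
  have hg := det_gramM_update (fun i => A (e i)) d j hdj
  have hle := det_gramM_le (Function.update (fun i => A (e i)) j (∑ i, d i • A (e i)))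
  rw [hg] at hle
  have hprod : ∏ i, ‖Function.update (fun i => A (e i)) j (∑ i, d i • A (e i)) i‖ ≤ 3 * κ * K ^ 2 := by
    rw [← Finset.mul_prod_erase _ _ (Finset.mem_univ j), Function.update_self]
    refine mul_le_mul ?_ ?_ (Finset.prod_nonneg fun _ _ => norm_nonneg _) (by positivity)
    · rw [map_sum] at hsmall
      simp only [map_smul] at hsmall
      linarith
    · have hcard : (Finset.univ.erase j).card = 2 := by rw [Finset.card_erase_of_mem (Finset.mem_univ j)]; rfl
      rw [← hcard, ← Finset.prod_const]
      refine Finset.prod_le_prod (fun _ _ => norm_nonneg _) fun i hi => ?_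
      rw [Function.update_of_ne (Finset.ne_of_mem_erase hi)]
      exact hub i
  refine Real.sqrt_le_iff.2 ⟨by positivity, ?_⟩
  change (gramM fun i => A (e i)).det ≤ _
  have h0 : 0 ≤ ∏ i, ‖Function.update (fun i => A (e i)) j (∑ i, d i • A (e i)) i‖ :=
    Finset.prod_nonneg fun _ _ => norm_nonneg _
  have hsq := pow_le_pow_left₀ h0 hprod 2
  have : 0 ≤ (κ * K ^ 2) ^ 2 := sq_nonneg _
  nlinarith

theorem exists_dependence (Q : E →ₗ[ℝ] EuclideanSpace ℝ (Fin 3)) {a : EuclideanSpace ℝ (Fin 3)} (ha : ‖a‖ = 1)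
    (hQ : ∀ s, ⟪a, Q s⟫ = 0) (e : Fin 3 → E) : ∃ c : Fin 3 → ℝ, (∃ i, c i ≠ 0) ∧ Q (∑ i, c i • e i) = 0 := by
  have h : ¬ LinearIndependent ℝ fun i => Q (e i) := fun hli => by
    have htop := hli.span_eq_top_of_card_eq_finrank (by simp)
    have hle : Submodule.span ℝ (Set.range fun i => Q (e i)) ≤ (ℝ ∙ a)ᗮ :=
      Submodule.span_le.2 (by rintro _ ⟨i, rfl⟩; exact Submodule.mem_orthogonal_singleton_iff_inner_right.2 (hQ _))
    rw [htop] at hle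
    have := Submodule.mem_orthogonal_singleton_iff_inner_right.1 (hle (Submodule.mem_top (x := a)))
    rw [real_inner_self_eq_norm_sq, ha] at this
    norm_num at this
  obtain ⟨c, hc, hi⟩ := Fintype.not_linearIndependent_iff.1 h
  exact ⟨c, hi, by rw [map_sum]; simpa only [map_smul] using hc⟩

/-- The properties of the compactly supported map used to build maps of small dilation. -/
structure IsBump (C : ℝ) (f : EuclideanSpace ℝ (Fin 7) → EuclideanSpace ℝ (Fin 5)) : Prop where
  nonneg : 0 ≤ C
  contDiff : ContDiff ℝ 1 f
  eq_zero : ∀ w, 1 / 4 ≤ ‖w‖ → f w = 0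
  norm_add : ∀ w, ‖vinf + f w‖ = 1
  norm_fderiv : ∀ w, ‖fderiv ℝ f w‖ ≤ C
  rank : ∀ w, ∃ Q : EuclideanSpace ℝ (Fin 7) →L[ℝ] EuclideanSpace ℝ (Fin 3), ∃ a : EuclideanSpace ℝ (Fin 3), ‖a‖ = 1 ∧
    (∀ s, ⟪a, Q s⟫ = 0) ∧ ∀ s, Q s = 0 → ‖fderiv ℝ f w s‖ ≤ C * (|s 3| + |s 6|)

theorem exists_isBump : ∃ R : ℝ, 0 < R ∧ ∃ C, IsBump C fun w => bump (R • w) := by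
  obtain ⟨R, hR, hR'⟩ := exists_bump_eq_zero
  obtain ⟨C, hC, hC'⟩ := exists_bump_fderiv
  have hd : ∀ w, fderiv ℝ (fun w => bump (R • w)) w = R • fderiv ℝ bump (R • w) := fun w => by
    have h1 : HasFDerivAt (fun w : EuclideanSpace ℝ (Fin 7) => R • w) (R • ContinuousLinearMap.id ℝ _) w :=
      (hasFDerivAt_id w).const_smul R
    have h2 := ((contDiff_bump.differentiable one_ne_zero (R • w)).hasFDerivAt.comp w h1).fderiv
    rw [ContinuousLinearMap.comp_smul, ContinuousLinearMap.comp_id] at h2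
    exact h2
  refine ⟨R, hR, R * C, by positivity, contDiff_bump.comp (contDiff_id.const_smul R), fun w hw => ?_, fun w => norm_add_bump _,
    fun w => ?_, fun w => ?_⟩
  · refine hR' _ ?_
    rw [norm_smul, Real.norm_of_nonneg hR.le]
    nlinarith
  · rw [hd, norm_smul, Real.norm_of_nonneg hR.le]
    exact mul_le_mul_of_nonneg_left (hC' _).1 hR.le
  · obtain ⟨Q, a, h1, h2, h3⟩ := (hC' (R • w)).2
    refine ⟨Q, a, h1, h2, fun s hs => ?_⟩
    rw [hd, smul_apply, norm_smul, Real.norm_of_nonneg hR.le, mul_assoc]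
    exact mul_le_mul_of_nonneg_left (h3 s hs) hR.le

theorem lamNorm_bump_le {C : ℝ} {f : EuclideanSpace ℝ (Fin 7) → EuclideanSpace ℝ (Fin 5)} (hf : IsBump C f) {M B : ℝ}
    (hM : 10 ≤ M) (w : EuclideanSpace ℝ (Fin 7)) (P : E →ₗ[ℝ] EuclideanSpace ℝ (Fin 7)) (hP : ∀ v, ‖P v‖ ≤ B * ‖v‖)
    (hB : 0 ≤ B) {A : E →ₗ[ℝ] EuclideanSpace ℝ (Fin 5)} (hA : ∀ v, A v = fderiv ℝ f w (latL M (P v))) :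
    lamNorm 3 A ≤ 7200 * (C * B) ^ 3 / M := by
  have hC := hf.nonneg
  have hM0 : 0 < M := by linarith
  have := lamNorm_three_le (A := A) (K := C * (20 * M ^ 2 * B)) (κ := 2 * C * B / M ^ 5) (by positivity) (by positivity)
    (fun v => ?_) fun e => ?_
  · refine this.trans_eq ?_
    field_simp
    ring
  · rw [hA]
    refine ((fderiv ℝ f w).le_of_opNorm_le (hf.norm_fderiv w) _).trans ?_
    rw [mul_assoc]
    refine mul_le_mul_of_nonneg_left ((norm_latL_le hM _).trans ?_) hC
    rw [mul_assoc (20 * M ^ 2)]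
    exact mul_le_mul_of_nonneg_left (hP v) (by positivity)
  · obtain ⟨Q, a, ha, hQ, hb⟩ := hf.rank w
    obtain ⟨c, hc, h0⟩ := exists_dependence (Q.toLinearMap ∘ₗ (latL M).toLinearMap ∘ₗ P) ha (fun s => hQ _) e
    refine ⟨c, hc, ?_⟩
    rw [hA]
    refine (hb _ h0).trans ?_
    set v := ∑ i, c i • e i
    have hcoord : ∀ i, |(P v) i / M ^ 5| ≤ B * ‖v‖ / M ^ 5 := fun i => by
      rw [abs_div, abs_of_pos (by positivity : 0 < M ^ 5)]
      gcongr
      exact (abs_coord_le _ i).trans (hP v)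
    have h3 : |(latL M (P v)) 3| ≤ B * ‖v‖ / M ^ 5 := hcoord 3
    have h6 : |(latL M (P v)) 6| ≤ B * ‖v‖ / M ^ 5 := hcoord 6
    calc C * (|(latL M (P v)) 3| + |(latL M (P v)) 6|) ≤ C * (B * ‖v‖ / M ^ 5 + B * ‖v‖ / M ^ 5) :=
          mul_le_mul_of_nonneg_left (add_le_add h3 h6) hC
      _ = 2 * C * B / M ^ 5 * ‖v‖ := by ring

/-- The coordinates on the sphere near the centre of the support. -/
def tau7 : EuclideanSpace ℝ (Fin 8) →L[ℝ] EuclideanSpace ℝ (Fin 7) :=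
  LinearMap.toContinuousLinearMap
    { toFun := fun v => !₂[v 0, v 1, v 2, v 6, v 3, v 4, v 7]
      map_add' := fun x y => by ext i; fin_cases i <;> simp
      map_smul' := fun a x => by ext i; fin_cases i <;> simp }

theorem tau7_apply (v : EuclideanSpace ℝ (Fin 8)) : tau7 v = !₂[v 0, v 1, v 2, v 6, v 3, v 4, v 7] := rfl

theorem norm_tau7_sq (v : EuclideanSpace ℝ (Fin 8)) : ‖tau7 v‖ ^ 2 = ‖v‖ ^ 2 - v 5 ^ 2 := by
  rw [EuclideanSpace.real_norm_sq_eq, EuclideanSpace.real_norm_sq_eq, Fin.sum_univ_seven, Fin.sum_univ_eight, tau7_apply]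
  simp
  ring

theorem norm_tau7_le (v : EuclideanSpace ℝ (Fin 8)) : ‖tau7 v‖ ≤ ‖v‖ := by
  refine (sq_le_sq₀ (norm_nonneg _) (norm_nonneg _)).1 ?_
  rw [norm_tau7_sq]
  linarith [sq_nonneg (v 5)]

/-- The affine chart into the domain of the nested polar coordinates. -/
def chart7 (v : EuclideanSpace ℝ (Fin 8)) : EuclideanSpace ℝ (Fin 7) := EuclideanSpace.single 0 63 + (512:ℝ) • tau7 v

theorem contDiff_chart7 : ContDiff ℝ 1 chart7 := contDiff_const.add (tau7.contDiff.const_smul _)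

theorem fderiv_chart7 (v : EuclideanSpace ℝ (Fin 8)) : fderiv ℝ chart7 v = (512:ℝ) • tau7 :=
  ((tau7.hasFDerivAt.const_smul (512:ℝ)).const_add _).fderiv

theorem norm_tau7_lt {M : ℝ} (hM : 10 ≤ M) {v : EuclideanSpace ℝ (Fin 8)} (h : ‖polL M (chart7 v)‖ < 1 / 4) :
    ‖tau7 v‖ ^ 2 < 1 / 2 := by
  have h1 := norm_le_of_norm_polL_lt hM h
  have h2 : ‖(512:ℝ) • tau7 v‖ ≤ 263 := by
    have : (512:ℝ) • tau7 v = chart7 v - EuclideanSpace.single 0 63 := by rw [chart7]; abel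
    rw [this]
    refine (norm_sub_le _ _).trans ?_
    have : ‖(EuclideanSpace.single 0 63 : EuclideanSpace ℝ (Fin 7))‖ = 63 := by simp
    linarith
  rw [norm_smul, Real.norm_of_nonneg (by norm_num)] at h2
  nlinarith [norm_nonneg (tau7 v)]

open Filter Topology

theorem IsBump.comp_polL {C : ℝ} {f : EuclideanSpace ℝ (Fin 7) → EuclideanSpace ℝ (Fin 5)} (hf : IsBump C f) {M : ℕ}
    (hM : 10 ≤ M) (x : EuclideanSpace ℝ (Fin 7)) : ContDiffAt ℝ 1 (fun y => f (polL M y)) x ∧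
    ∃ w, ∃ P : EuclideanSpace ℝ (Fin 7) →L[ℝ] EuclideanSpace ℝ (Fin 7), ‖P‖ ≤ 196 ∧
      ∀ s, fderiv ℝ (fun y => f (polL M y)) x s = fderiv ℝ f w (latL M (P s)) := by
  rcases polL_local hM x with h | ⟨g, hg, he⟩
  · have h0 : (fun y => f (polL M y)) =ᶠ[𝓝 x] fun _ => 0 := h.mono fun y hy => hf.eq_zero _ hy
    refine ⟨contDiffAt_const.congr_of_eventuallyEq h0, 0, 0, by simp, fun s => ?_⟩
    rw [h0.fderiv_eq]; simp
  · have h0 : (fun y => f (polL M y)) =ᶠ[𝓝 x] fun y => f (latL M (g y)) := he.mono fun y hy => congrArg f hy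
    have hLg : ContDiffAt ℝ 1 (fun y => latL M (g y)) x := (latL M).contDiff.contDiffAt.comp x hg.1
    refine ⟨(hf.contDiff.contDiffAt.comp x hLg).congr_of_eventuallyEq h0, latL M (g x), fderiv ℝ g x, hg.2, fun s => ?_⟩
    have h1 := (latL (M:ℝ)).hasFDerivAt.comp x (hg.1.differentiableAt one_ne_zero).hasFDerivAt
    have h2 := ((hf.contDiff.differentiable one_ne_zero (latL M (g x))).hasFDerivAt.comp x h1).fderiv
    rw [h0.fderiv_eq]
    exact congrArg (fun l : EuclideanSpace ℝ (Fin 7) →L[ℝ] EuclideanSpace ℝ (Fin 5) => l s) h2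

/-- The map with small three-dilation. -/
def smallMap (f : EuclideanSpace ℝ (Fin 7) → EuclideanSpace ℝ (Fin 5)) (M : ℝ) (v : EuclideanSpace ℝ (Fin 8)) :
    EuclideanSpace ℝ (Fin 5) := vinf + Real.smoothTransition (4 * v 5) • f (polL M (chart7 v))

theorem contDiff_smallMap {C : ℝ} {f : EuclideanSpace ℝ (Fin 7) → EuclideanSpace ℝ (Fin 5)} (hf : IsBump C f) {M : ℕ}
    (hM : 10 ≤ M) : ContDiff ℝ 1 (smallMap f M) := by
  have h1 : ContDiff ℝ 1 fun v : EuclideanSpace ℝ (Fin 8) => Real.smoothTransition (4 * v 5) :=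
    Real.smoothTransition.contDiff.comp (by fun_prop)
  have h2 : ContDiff ℝ 1 fun v => f (polL M (chart7 v)) :=
    (contDiff_iff_contDiffAt.2 fun x => (hf.comp_polL hM x).1).comp contDiff_chart7
  exact contDiff_const.add (h1.smul h2)

theorem smallMap_eq {C : ℝ} {f : EuclideanSpace ℝ (Fin 7) → EuclideanSpace ℝ (Fin 5)} (hf : IsBump C f) {M : ℝ}
    (hM : 10 ≤ M) {v : EuclideanSpace ℝ (Fin 8)} (hv : ‖v‖ = 1) :
    smallMap f M v = vinf + f (if 0 < v 5 then polL M (chart7 v) else EuclideanSpace.single 0 1) := by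
  rw [smallMap]
  split_ifs with h
  · by_cases h4 : 1 / 4 ≤ v 5
    · rw [Real.smoothTransition.one_of_one_le (by linarith), one_smul]
    · have : f (polL M (chart7 v)) = 0 := hf.eq_zero _ (by
        by_contra h'
        have h1 := norm_tau7_lt hM (not_le.1 h')
        rw [norm_tau7_sq, hv] at h1
        nlinarith)
      rw [this, smul_zero]
  · rw [Real.smoothTransition.zero_of_nonpos (by linarith), zero_smul, hf.eq_zero _ (by norm_num)]

theorem fderiv_smallMap {C : ℝ} {f : EuclideanSpace ℝ (Fin 7) → EuclideanSpace ℝ (Fin 5)} (hf : IsBump C f) {M : ℕ}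
    (hM : 10 ≤ M) {v : EuclideanSpace ℝ (Fin 8)} (hv : ‖v‖ = 1) :
    ∃ w, ∃ P : EuclideanSpace ℝ (Fin 8) →L[ℝ] EuclideanSpace ℝ (Fin 7), ‖P‖ ≤ 100352 ∧
      ∀ s, fderiv ℝ (smallMap f M) v s = fderiv ℝ f w (latL M (P s)) := by
  have hM' : (10:ℝ) ≤ M := by exact_mod_cast hM
  by_cases h4 : 1 / 2 ≤ v 5
  · have h0 : smallMap f M =ᶠ[𝓝 v] fun v => vinf + f (polL M (chart7 v)) := by
      have : ∀ᶠ y : EuclideanSpace ℝ (Fin 8) in 𝓝 v, 1 / 4 < y 5 :=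
        (EuclideanSpace.proj (𝕜 := ℝ) (5 : Fin 8)).continuous.continuousAt.eventually (Ioi_mem_nhds (by change _ < v 5; linarith))
      filter_upwards [this] with y hy
      rw [smallMap, Real.smoothTransition.one_of_one_le (by linarith), one_smul]
    obtain ⟨h1, w, P, hP, hd⟩ := hf.comp_polL hM (chart7 v)
    have h2 := ((h1.differentiableAt one_ne_zero).hasFDerivAt.comp v
      (contDiff_chart7.differentiable one_ne_zero v).hasFDerivAt).const_add vinf
    refine ⟨w, (512:ℝ) • P.comp tau7, ?_, fun s => ?_⟩
    · refine ContinuousLinearMap.opNorm_le_bound _ (by norm_num) fun s => ?_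
      rw [smul_apply, norm_smul, Real.norm_of_nonneg (by norm_num), ContinuousLinearMap.comp_apply]
      have h3 := P.le_of_opNorm_le hP (tau7 s)
      have := norm_tau7_le s
      linarith
    · rw [h0.fderiv_eq]
      refine (congrArg (fun l : EuclideanSpace ℝ (Fin 8) →L[ℝ] EuclideanSpace ℝ (Fin 5) => l s) h2.fderiv).trans ?_
      rw [ContinuousLinearMap.comp_apply, hd, fderiv_chart7]
      simp
  · have h0 : smallMap f M =ᶠ[𝓝 v] fun _ => vinf := by
      by_cases h5 : v 5 < 0
      · have : ∀ᶠ y : EuclideanSpace ℝ (Fin 8) in 𝓝 v, y 5 < 0 :=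
          (EuclideanSpace.proj (𝕜 := ℝ) (5 : Fin 8)).continuous.continuousAt.eventually (Iio_mem_nhds h5)
        filter_upwards [this] with y hy
        rw [smallMap, Real.smoothTransition.zero_of_nonpos (by linarith), zero_smul, add_zero]
      have : ∀ᶠ y in 𝓝 v, 1 / 2 < ‖tau7 y‖ ^ 2 := by
        refine (tau7.continuous.norm.pow 2).continuousAt.eventually (Ioi_mem_nhds ?_)
        change _ < ‖tau7 v‖ ^ 2
        rw [norm_tau7_sq, hv]
        nlinarith
      filter_upwards [this] with y hy
      have : f (polL M (chart7 y)) = 0 := hf.eq_zero _ (by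
        by_contra h'
        linarith [norm_tau7_lt hM' (not_le.1 h')])
      rw [smallMap, this, smul_zero, add_zero]
    refine ⟨0, 0, by simp, fun s => ?_⟩
    rw [h0.fderiv_eq]; simp

theorem kDilation_smallMap_le {C : ℝ} {f : EuclideanSpace ℝ (Fin 7) → EuclideanSpace ℝ (Fin 5)} (hf : IsBump C f) {M : ℕ}
    (hM : 10 ≤ M) : kDilation 3 (smallMap f M) ≤ 7200 * (C * 100352) ^ 3 / M := by
  have hC := hf.nonneg
  have hM' : (10:ℝ) ≤ M := by exact_mod_cast hM
  refine Real.iSup_le (fun v => ?_) (by positivity)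
  obtain ⟨w, P, hP, hd⟩ := fderiv_smallMap hf hM (v := v) (by simpa [usph] using v.2)
  refine lamNorm_bump_le hf hM' w (P.toLinearMap ∘ₗ ((ℝ ∙ (v : EucA 8))ᗮ).subtype) (fun s => ?_) (by norm_num) fun s => hd s
  exact P.le_of_opNorm_le hP s

end Dilation

section UnitHomotopy

open Filter Topology

variable {T : Type*} [TopologicalSpace T] {E F : Type*} [NormedAddCommGroup E] [NormedSpace ℝ E]
  [NormedAddCommGroup F] [NormedSpace ℝ F]

/-- Homotopy through maps into the unit sphere. -/
def UnitHomotopic (g h : C(T, F)) : Prop := ContinuousMap.HomotopicWith g h fun k => ∀ v, ‖k v‖ = 1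

theorem UnitHomotopic.trans {g h k : C(T, F)} (h1 : UnitHomotopic g h) (h2 : UnitHomotopic h k) : UnitHomotopic g k :=
  ContinuousMap.HomotopicWith.trans h1 h2

theorem UnitHomotopic.symm {g h : C(T, F)} (h1 : UnitHomotopic g h) : UnitHomotopic h g :=
  ContinuousMap.HomotopicWith.symm h1

theorem UnitHomotopic.mk {g h : C(T, F)} {H : unitInterval × T → F} (hc : Continuous H) (hn : ∀ x, ‖H x‖ = 1)
    (h0 : ∀ v, H (0, v) = g v) (h1 : ∀ v, H (1, v) = h v) : UnitHomotopic g h :=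
  ⟨{ toFun := H
     continuous_toFun := hc
     map_zero_left := h0
     map_one_left := h1
     prop' := fun t v => hn (t, v) }⟩

theorem unitHomotopic_of_line {g h : C(T, F)} (hg : ∀ v, ‖g v‖ = 1) (hh : ∀ v, ‖h v‖ = 1)
    (hne : ∀ v, ∀ c : ℝ, 0 ≤ c → g v + c • h v ≠ 0) : UnitHomotopic g h := by
  have hw : ∀ x : unitInterval × T, (1 - (x.1 : ℝ)) • g x.2 + (x.1 : ℝ) • h x.2 ≠ 0 := fun x h0 => by
    by_cases h1 : (x.1 : ℝ) = 1
    · rw [h1, sub_self, zero_smul, zero_add, one_smul] at h0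
      have := hh x.2
      rw [h0, norm_zero] at this
      exact zero_ne_one this
    · have hlt : 0 < 1 - (x.1 : ℝ) := sub_pos.2 (lt_of_le_of_ne x.1.2.2 h1)
      refine hne x.2 ((1 - (x.1 : ℝ))⁻¹ * x.1) (mul_nonneg (inv_nonneg.2 hlt.le) x.1.2.1) ?_
      have := congrArg (fun z => (1 - (x.1 : ℝ))⁻¹ • z) h0
      simpa [smul_smul, hlt.ne'] using this
  have hcw : Continuous fun x : unitInterval × T => (1 - (x.1 : ℝ)) • g x.2 + (x.1 : ℝ) • h x.2 := by fun_prop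
  refine UnitHomotopic.mk (H := fun x => ‖(1 - (x.1 : ℝ)) • g x.2 + (x.1 : ℝ) • h x.2‖⁻¹ •
    ((1 - (x.1 : ℝ)) • g x.2 + (x.1 : ℝ) • h x.2)) ?_ (fun x => ?_) (fun v => ?_) fun v => ?_
  · exact (hcw.norm.inv₀ fun x => norm_ne_zero_iff.2 (hw x)).smul hcw
  · rw [norm_smul, norm_inv, norm_norm]
    exact inv_mul_cancel₀ (norm_ne_zero_iff.2 (hw x))
  · simp [hg]
  · simp [hh]

/-- At every point the map is continuous or avoids the ball of radius `1/4` nearby. -/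
def Tame (Φ : T → E) : Prop := ∀ v, ContinuousAt Φ v ∨ ∀ᶠ w in 𝓝 v, 1 / 4 ≤ ‖Φ w‖

theorem Tame.continuous_comp {Φ : T → E} (h : Tame Φ) {f : E → F} (hf : Continuous f) (h0 : ∀ w, 1 / 4 ≤ ‖w‖ → f w = 0) :
    Continuous fun v => f (Φ v) := by
  refine continuous_iff_continuousAt.2 fun v => ?_
  rcases h v with h | h
  · exact hf.continuousAt.comp h
  · have : (fun v => f (Φ v)) =ᶠ[𝓝 v] fun _ => 0 := h.mono fun w hw => h0 _ hw
    exact continuousAt_const.congr this.symm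

theorem Tame.smul {Φ : T → E} (h : Tame Φ) {S : Type*} [TopologicalSpace S] {l : S → ℝ} (hl : Continuous l)
    (h1 : ∀ t, 1 ≤ l t) : Tame fun x : S × T => l x.1 • Φ x.2 := by
  rintro ⟨t, v⟩
  refine (h v).imp (fun h => ?_) fun h => ?_
  · exact (hl.comp continuous_fst).continuousAt.smul (ContinuousAt.comp (x := (t, v)) h continuous_snd.continuousAt)
  · filter_upwards [(continuous_snd.tendsto (t, v)).eventually h] with x hx
    rw [norm_smul, Real.norm_of_nonneg (by linarith [h1 x.1])]
    nlinarith [h1 x.1]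

variable {f : E → F} {c : F}

theorem unitHomotopic_smul (hf : Continuous f) (h0 : ∀ w, 1 / 4 ≤ ‖w‖ → f w = 0) (hn : ∀ w, ‖c + f w‖ = 1)
    {Φ : T → E} (h : Tame Φ) {l : ℝ} (hl : 1 ≤ l) {g k : C(T, F)} (hg : ∀ v, g v = c + f (Φ v))
    (hk : ∀ v, k v = c + f (l • Φ v)) : UnitHomotopic g k := by
  have := h.smul (S := unitInterval) (l := fun t => 1 + t * (l - 1)) (by fun_prop)
    fun t => by have := mul_nonneg t.2.1 (sub_nonneg.2 hl); linarith
  refine UnitHomotopic.mk (continuous_const.add (this.continuous_comp hf h0)) (fun x => hn _) (fun v => ?_) fun v => ?_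
  · simp [hg]
  · simp [hk]

theorem exists_lower_bound {X : Type*} [TopologicalSpace X] {K : Set X} (hK : IsCompact K) {g : X → ℝ}
    (h : ∀ x ∈ K, ∃ m > 0, ∀ᶠ y in 𝓝 x, m ≤ g y) : ∃ m > 0, ∀ x ∈ K, m ≤ g x := by
  refine hK.induction_on (p := fun s => ∃ m > 0, ∀ x ∈ s, m ≤ g x) ⟨1, one_pos, by simp⟩ ?_ ?_ fun x hx => ?_
  · rintro s t hst ⟨m, hm, h⟩
    exact ⟨m, hm, fun x hx => h x (hst hx)⟩
  · rintro s t ⟨m, hm, h⟩ ⟨n, hn, h'⟩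
    refine ⟨min m n, lt_min hm hn, fun x hx => ?_⟩
    rcases hx with hx | hx
    · exact (min_le_left _ _).trans (h x hx)
    · exact (min_le_right _ _).trans (h' x hx)
  · obtain ⟨m, hm, h'⟩ := h x hx
    exact ⟨_, mem_nhdsWithin_of_mem_nhds h', m, hm, fun y hy => hy⟩

theorem exists_lower_of_continuousAt {X : Type*} [TopologicalSpace X] {Φ : X → E} {x : X} (h : ContinuousAt Φ x)
    (hx : Φ x ≠ 0) : ∃ m > 0, ∀ᶠ y in 𝓝 x, m ≤ ‖Φ y‖ := by
  have hp := norm_pos_iff.2 hx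
  exact ⟨‖Φ x‖ / 2, by positivity, (h.norm.eventually (Ioi_mem_nhds (half_lt_self hp))).mono fun y hy => (mem_Ioi.1 hy).le⟩

theorem Tame.exists_lower {Φ : T → E} (h : Tame Φ) {x : T} (hx : Φ x ≠ 0) : ∃ m > 0, ∀ᶠ y in 𝓝 x, m ≤ ‖Φ y‖ := by
  rcases h x with h | h
  · exact exists_lower_of_continuousAt h hx
  · exact ⟨1 / 4, by norm_num, h⟩

open Classical in
theorem unitHomotopic_of_local {T : Type*} [MetricSpace T] [CompactSpace T] (hf : Continuous f)
    (h0 : ∀ w, 1 / 4 ≤ ‖w‖ → f w = 0) (hn : ∀ w, ‖c + f w‖ = 1) {e : E} (he : 1 / 4 ≤ ‖e‖) {Φ Ψ : T → E} (hΦ : Tame Φ) (hΨ : Tame Ψ)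
    {p : T} (hp : ∀ᶠ v in 𝓝 p, ContinuousAt Φ v ∧ ContinuousAt Ψ v ∧ ∀ t : unitInterval, v ≠ p → (1 - (t:ℝ)) • Φ v + (t:ℝ) • Ψ v ≠ 0)
    (hΦ0 : ∀ v, v ≠ p → Φ v ≠ 0) (hΨ0 : ∀ v, v ≠ p → Ψ v ≠ 0) {g k : C(T, F)} (hg : ∀ v, g v = c + f (Φ v))
    (hk : ∀ v, k v = c + f (Ψ v)) : UnitHomotopic g k := by
  obtain ⟨r, hr, hball⟩ := Metric.nhds_basis_closedBall.eventually_iff.1 hp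
  have hne : ∀ v, r / 2 ≤ dist v p → v ≠ p := fun v hv h => by rw [h, dist_self] at hv; linarith
  have hcl : IsClosed {v : T | r / 2 ≤ dist v p} := isClosed_le continuous_const (by fun_prop)
  obtain ⟨m0, hm0, hm0'⟩ := exists_lower_bound hcl.isCompact fun v hv => hΦ.exists_lower (hΦ0 v (hne v hv))
  obtain ⟨m1, hm1, hm1'⟩ := exists_lower_bound hcl.isCompact fun v hv => hΨ.exists_lower (hΨ0 v (hne v hv))
  have hcont : ∀ x : unitInterval × T, dist x.2 p ≤ r → ContinuousAt (fun x : unitInterval × T => (1 - (x.1:ℝ)) • Φ x.2 + (x.1:ℝ) • Ψ x.2) x := by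
    rintro ⟨t, v⟩ hv
    obtain ⟨h1, h2, -⟩ := hball hv
    have h1' : ContinuousAt (fun x : unitInterval × T => Φ x.2) (t, v) := ContinuousAt.comp (x := (t, v)) h1 continuous_snd.continuousAt
    have h2' : ContinuousAt (fun x : unitInterval × T => Ψ x.2) (t, v) := ContinuousAt.comp (x := (t, v)) h2 continuous_snd.continuousAt
    have ht : ContinuousAt (fun x : unitInterval × T => (x.1:ℝ)) (t, v) := by fun_prop
    exact ((continuousAt_const.sub ht).smul h1').add (ht.smul h2')
  have hcl2 : IsClosed {x : unitInterval × T | r / 2 ≤ dist x.2 p ∧ dist x.2 p ≤ r} :=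
    isClosed_Icc.preimage (f := fun x : unitInterval × T => dist x.2 p) (by fun_prop)
  obtain ⟨m2, hm2, hm2'⟩ := exists_lower_bound hcl2.isCompact fun x hx =>
    exists_lower_of_continuousAt (hcont x hx.2) ((hball hx.2).2.2 x.1 (hne _ hx.1))
  set m := min m0 (min m1 m2)
  have hm : 0 < m := lt_min hm0 (lt_min hm1 hm2)
  set l := 1 + m⁻¹
  have hl : 1 ≤ l := by have := inv_pos.2 hm; linarith
  have hlm : ∀ {z : E}, m ≤ ‖z‖ → 1 / 4 ≤ ‖l • z‖ := fun {z} hz => by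
    rw [norm_smul, Real.norm_of_nonneg (by linarith)]
    have : 1 ≤ l * m := by rw [add_mul, inv_mul_cancel₀ hm.ne']; linarith
    nlinarith
  have hT : ∀ {X : T → E}, Tame X → Tame fun v => l • X v := fun {X} hX v => by
    refine (hX v).imp (fun h => h.const_smul l) fun h => h.mono fun w hw => ?_
    rw [norm_smul, Real.norm_of_nonneg (by linarith)]
    nlinarith
  let g' : C(T, F) := ⟨fun v => c + f (l • Φ v), continuous_const.add ((hT hΦ).continuous_comp hf h0)⟩
  let k' : C(T, F) := ⟨fun v => c + f (l • Ψ v), continuous_const.add ((hT hΨ).continuous_comp hf h0)⟩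
  refine (unitHomotopic_smul hf h0 hn hΦ hl hg (k := g') fun v => rfl).trans (UnitHomotopic.trans (h := k') ?_
    (unitHomotopic_smul hf h0 hn hΨ hl hk (k := k') fun v => rfl).symm)
  let X : unitInterval × T → E := fun x => if dist x.2 p < r then l • ((1 - (x.1:ℝ)) • Φ x.2 + (x.1:ℝ) • Ψ x.2) else e
  have hX : Tame X := fun x => by
    by_cases hx : dist x.2 p < r
    · left
      have : ∀ᶠ y : unitInterval × T in 𝓝 x, dist y.2 p < r :=
        ((Continuous.continuousAt (f := fun y : unitInterval × T => dist y.2 p) (x := x) (by fun_prop)).eventually (Iio_mem_nhds hx))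
      refine ((hcont x hx.le).const_smul l).congr ?_
      filter_upwards [this] with y hy
      simp only [X, if_pos hy]
      rfl
    · right
      have : ∀ᶠ y : unitInterval × T in 𝓝 x, r / 2 < dist y.2 p :=
        ((Continuous.continuousAt (f := fun y : unitInterval × T => dist y.2 p) (x := x) (by fun_prop)).eventually (Ioi_mem_nhds (by linarith)))
      filter_upwards [this] with y hy
      by_cases hy' : dist y.2 p < r
      · simp only [X, if_pos hy']
        exact hlm (((min_le_right _ _).trans (min_le_right _ _)).trans (hm2' y ⟨hy.le, hy'.le⟩))
      · simp only [X, if_neg hy']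
        exact he
  have hout : ∀ v, ¬ dist v p < r → f (l • Φ v) = 0 ∧ f (l • Ψ v) = 0 := fun v hv => by
    have hv' : r / 2 ≤ dist v p := by linarith
    exact ⟨h0 _ (hlm ((min_le_left _ _).trans (hm0' v hv'))), h0 _ (hlm (((min_le_right _ _).trans (min_le_left _ _)).trans (hm1' v hv')))⟩
  refine UnitHomotopic.mk (continuous_const.add (hX.continuous_comp hf h0)) (fun x => hn _) (fun v => ?_) fun v => ?_
  · change c + f (X (0, v)) = c + f (l • Φ v)
    by_cases hv : dist v p < r
    · simp [X, hv]
    · simp only [X, if_neg hv]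
      rw [h0 e he, (hout v hv).1]
  · change c + f (X (1, v)) = c + f (l • Ψ v)
    by_cases hv : dist v p < r
    · simp [X, hv]
    · simp only [X, if_neg hv]
      rw [h0 e he, (hout v hv).2]

end UnitHomotopy

section Center

open Filter Topology

/-- The centre of the nested polar coordinates. -/
def ctr7 : EuclideanSpace ℝ (Fin 7) := EuclideanSpace.single 0 63

theorem rho_succ_of_eq_zero {n : ℕ} {x : EuclideanSpace ℝ (Fin 7)} (h : xco (n + 1) x = 0) (h0 : 0 ≤ rho n x) :
    rho (n + 1) x = rho n x - 32 / 2 ^ n := by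
  have : zco n x = (rho n x : ℂ) := by apply Complex.ext <;> simp [zco, h]
  rw [rho_succ, this, Complex.norm_real, Real.norm_of_nonneg h0]

theorem xco_ctr7 (n : ℕ) : xco (n + 1) ctr7 = 0 := by
  unfold xco
  split_ifs with h
  · have : (⟨n + 1, h⟩ : Fin 7) ≠ 0 := by simp [Fin.ext_iff]
    simp [ctr7, this]
  · rfl

theorem rho_ctr7 (n : ℕ) (hn : n ≤ 6) : rho n ctr7 = 64 / 2 ^ n - 1 := by
  induction n with
  | zero => simp [rho, ctr7]; norm_num
  | succ n ih =>
    have h := ih (by omega)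
    have : (0:ℝ) ≤ 64 / 2 ^ n - 1 := by
      rw [sub_nonneg, one_le_div (by positivity)]
      calc (2:ℝ) ^ n ≤ 2 ^ 6 := pow_le_pow_right₀ one_le_two (by omega)
        _ = 64 := by norm_num
    rw [rho_succ_of_eq_zero (xco_ctr7 n) (by rwa [h]), h, pow_succ]
    field_simp
    ring

theorem polarCo_ctr7 : polarCo ctr7 = 0 := by
  ext i
  refine Fin.cases ?_ (fun j => ?_) i
  · change rho 6 ctr7 = 0
    rw [rho_ctr7 6 le_rfl]; norm_num
  · change (zco j ctr7).arg / (2 * Real.pi) = 0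
    have : (zco j ctr7).arg = 0 := by
      refine Complex.arg_eq_zero_iff.2 ⟨?_, xco_ctr7 j⟩
      change 0 ≤ rho j ctr7
      rw [rho_ctr7 j (by omega), sub_nonneg, one_le_div (by positivity)]
      calc (2:ℝ) ^ (j:ℕ) ≤ 2 ^ 6 := pow_le_pow_right₀ one_le_two (by omega)
        _ = 64 := by norm_num
    rw [this, zero_div]

theorem eq_ctr7 {x : EuclideanSpace ℝ (Fin 7)} (h0 : rho 6 x = 0) (h : ∀ j : Fin 6, (zco j x).arg = 0) : x = ctr7 := by
  have h1 : ∀ j : Fin 6, 0 ≤ rho j x ∧ x j.succ = 0 := fun j => by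
    have := Complex.arg_eq_zero_iff.1 (h j)
    exact ⟨this.1, by rw [← this.2]; simp [zco, xco_succ]⟩
  have h2 : ∀ j : Fin 6, rho (j + 1) x = rho j x - 32 / 2 ^ (j:ℕ) := fun j =>
    rho_succ_of_eq_zero (by rw [xco_succ]; exact (h1 j).2) (h1 j).1
  have a0 : rho 1 x = x 0 - 32 / 2 ^ 0 := h2 0
  have a1 : rho 2 x = rho 1 x - 32 / 2 ^ 1 := h2 1
  have a2 : rho 3 x = rho 2 x - 32 / 2 ^ 2 := h2 2
  have a3 : rho 4 x = rho 3 x - 32 / 2 ^ 3 := h2 3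
  have a4 : rho 5 x = rho 4 x - 32 / 2 ^ 4 := h2 4
  have a5 : rho 6 x = rho 5 x - 32 / 2 ^ 5 := h2 5
  norm_num at a0 a1 a2 a3 a4 a5
  ext i
  refine Fin.cases ?_ (fun j => ?_) i
  · simp only [ctr7, EuclideanSpace.single_apply, if_true]; linarith
  · rw [(h1 j).2]; simp [ctr7]

theorem eq_ctr7_of_polL_eq_zero {M : ℝ} (hM : 10 ≤ M) {x : EuclideanSpace ℝ (Fin 7)} (h : polL M x = 0) : x = ctr7 := by
  obtain ⟨k, hk, he⟩ := exists_of_norm_lred_lt (M := M) (y := polarCo x) (by rw [← polL, h]; norm_num)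
  rw [← polL, h] at he
  have h1 := latL_eq_zero hM he.symm
  have hi := fun i => congrArg (fun v : EuclideanSpace ℝ (Fin 7) => v i) h1
  refine eq_ctr7 ?_ fun j => ?_
  · have : rho 6 x + k 0 = 0 := hi 0
    rwa [hk.1, add_zero] at this
  · have h2 : (zco j x).arg / (2 * Real.pi) + k j.succ = 0 := hi j.succ
    obtain ⟨n, hn⟩ := hk.2 j.succ
    rw [hn] at h2
    have hpi := Real.pi_pos
    have h3 := Complex.abs_arg_le_pi (zco j x)
    have h4 : |(n:ℝ)| < 1 := by
      rw [eq_neg_of_add_eq_zero_right h2, abs_neg, abs_div, abs_of_pos (by positivity : 0 < 2 * Real.pi),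
        div_lt_one (by positivity)]
      linarith
    rw [← Int.cast_abs, ← Int.cast_one, Int.cast_lt] at h4
    rw [Int.abs_lt_one_iff.1 h4] at h2
    simpa [hpi.ne'] using h2

theorem continuousAt_polarCo {x : EuclideanSpace ℝ (Fin 7)} (hx : ∀ j : Fin 6, 0 < rho j x) : ContinuousAt polarCo x := by
  refine (PiLp.continuous_toLp 2 _).continuousAt.comp (continuousAt_pi.2 fun i => ?_)
  refine Fin.cases ?_ (fun j => ?_) i
  · exact (continuous_rho 6).continuousAt
  · exact ((Complex.continuousAt_arg (Or.inl (hx j))).comp (continuous_zco j).continuousAt).div_const _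

theorem eventually_polL {M : ℕ} (hM : 10 ≤ M) : ∀ᶠ x in 𝓝 ctr7, ContinuousAt (polL M) x ∧
    polL M x = latL M (polarCo x) ∧ ∀ j : Fin 6, 0 < rho j x := by
  have h1 : ∀ᶠ x in 𝓝 ctr7, ∀ j : Fin 6, 0 < rho j x := by
    refine eventually_all.2 fun j => (continuous_rho j).continuousAt.eventually (Ioi_mem_nhds ?_)
    rw [rho_ctr7 j (by omega), sub_pos, one_lt_div (by positivity)]
    calc (2:ℝ) ^ (j:ℕ) < 2 ^ 6 := pow_lt_pow_right₀ one_lt_two (by omega)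
      _ = 64 := by norm_num
  have hc : ∀ x, (∀ j : Fin 6, 0 < rho j x) → ContinuousAt (fun x => latL M (polarCo x)) x := fun x hx =>
    (latL (M:ℝ)).continuous.continuousAt.comp (continuousAt_polarCo hx)
  have h2 : ∀ᶠ x in 𝓝 ctr7, ‖latL M (polarCo x)‖ < 1 / 2 := by
    refine (hc _ h1.self_of_nhds).norm.eventually (Iio_mem_nhds ?_)
    change ‖latL (M:ℝ) (polarCo ctr7)‖ < 1 / 2
    rw [polarCo_ctr7, map_zero, norm_zero]; norm_num
  have heq : ∀ x, ‖latL M (polarCo x)‖ < 1 / 2 → polL M x = latL M (polarCo x) := fun x hx => by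
    have := lred_eq hM (y := polarCo x) latZ.zero_mem (by rwa [add_zero])
    rwa [add_zero] at this
  filter_upwards [(h1.and h2).eventually_nhds] with x hx
  obtain ⟨h3, h4⟩ := hx.self_of_nhds
  refine ⟨(hc x h3).congr ?_, heq x h4, h3⟩
  filter_upwards [hx] with y hy
  exact (heq y hy.2).symm

theorem sign_arg {x : EuclideanSpace ℝ (Fin 7)} {j : Fin 6} (hx : 0 < rho j x) :
    0 ≤ polarCo x j.succ * x j.succ ∧ (polarCo x j.succ = 0 → x j.succ = 0) := by
  have him : (zco j x).im = x j.succ := by simp [zco, xco_succ]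
  have hpi := Real.pi_pos
  rw [polar_succ, ← him]
  refine ⟨?_, fun h => ?_⟩
  · rcases le_or_gt 0 (zco j x).im with h | h
    · exact mul_nonneg (div_nonneg (Complex.arg_nonneg_iff.2 h) (by positivity)) h
    · exact mul_nonneg_of_nonpos_of_nonpos (div_nonpos_of_nonpos_of_nonneg (Complex.arg_neg_iff.2 h).le (by positivity)) h.le
  · have : (zco j x).arg = 0 := by simpa [hpi.ne'] using h
    exact (Complex.arg_eq_zero_iff.1 this).2

theorem polarCo_succ_eq_zero {x : EuclideanSpace ℝ (Fin 7)} {j : Fin 6} (hx : 0 < rho j x) (h : x j.succ = 0) :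
    polarCo x j.succ = 0 := by
  have him : (zco j x).im = x j.succ := by simp [zco, xco_succ]
  rw [polar_succ, Complex.arg_eq_zero_iff.2 ⟨hx.le, him.trans h⟩, zero_div]

theorem rho_six_eq {x : EuclideanSpace ℝ (Fin 7)} (hx : ∀ j : Fin 6, 0 < rho j x) (h : ∀ j : Fin 6, x j.succ = 0) :
    polarCo x 0 = x 0 - 63 := by
  have h2 : ∀ j : Fin 6, rho (j + 1) x = rho j x - 32 / 2 ^ (j:ℕ) := fun j =>
    rho_succ_of_eq_zero (by rw [xco_succ]; exact h j) (hx j).le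
  have a0 : rho 1 x = x 0 - 32 / 2 ^ 0 := h2 0
  have a1 : rho 2 x = rho 1 x - 32 / 2 ^ 1 := h2 1
  have a2 : rho 3 x = rho 2 x - 32 / 2 ^ 2 := h2 2
  have a3 : rho 4 x = rho 3 x - 32 / 2 ^ 3 := h2 3
  have a4 : rho 5 x = rho 4 x - 32 / 2 ^ 4 := h2 4
  have a5 : rho 6 x = rho 5 x - 32 / 2 ^ 5 := h2 5
  norm_num at a0 a1 a2 a3 a4 a5
  change rho 6 x = _
  linarith

theorem eq_zero_of_sign {a s t k m : ℝ} (ha : 0 ≤ a * s) (h0 : a = 0 → s = 0) (ht : 0 ≤ t) (ht' : t ≤ 1) (hk : 0 < k)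
    (hm : 0 < m) (h : (1 - t) * (m * a) + t * (k * s) = 0) : s = 0 := by
  rcases ht.eq_or_lt with rfl | ht
  · refine h0 ?_
    simpa [hm.ne'] using h
  · have h1 : (1 - t) * m * (a * s) + t * k * s ^ 2 = 0 := by linear_combination s * h
    have h2 : 0 ≤ (1 - t) * m * (a * s) := mul_nonneg (mul_nonneg (by linarith) hm.le) ha
    have h3 : 0 < t * k := mul_pos ht hk
    have h4 : s ^ 2 ≤ 0 := by nlinarith [sq_nonneg s]
    exact pow_eq_zero_iff two_ne_zero |>.1 (le_antisymm h4 (sq_nonneg s))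

theorem eq_ctr7_of_segment {M : ℝ} (hM : 0 < M) {x u : EuclideanSpace ℝ (Fin 7)} (hx : ∀ j : Fin 6, 0 < rho j x) {κ : Fin 7 → ℝ}
    (hκ : ∀ i, 0 < κ i) (hu : ∀ i, u i = κ i * (x - ctr7) i) {t : ℝ} (ht : 0 ≤ t) (ht' : t ≤ 1)
    (h : (1 - t) • latL M (polarCo x) + t • u = 0) : x = ctr7 := by
  have hi := fun i => congrArg (fun v : EuclideanSpace ℝ (Fin 7) => v i) h
  set y := polarCo x
  have hs : ∀ j : Fin 6, (x - ctr7) j.succ = x j.succ := fun j => by simp [ctr7]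
  have hj : ∀ (j : Fin 6) (m : ℝ), 0 < m → (1 - t) * (m * y j.succ) + t * u j.succ = 0 → x j.succ = 0 := fun j m hm he => by
    rw [hu, hs] at he
    exact eq_zero_of_sign (sign_arg (hx j)).1 (sign_arg (hx j)).2 ht ht' (hκ _) hm he
  have hy : ∀ j : Fin 6, x j.succ = 0 → y j.succ = 0 := fun j => polarCo_succ_eq_zero (hx j)
  have b0 : (1 - t) * (M ^ 2 * y 0 - y 1) + t * u 0 = 0 := hi 0
  have b1 : (1 - t) * (M ^ 2 * y 1 - y 2) + t * u 1 = 0 := hi 1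
  have b2 : (1 - t) * (M ^ 2 * y 2 - M * y 3 + y 4) + t * u 2 = 0 := hi 2
  have b3 : (1 - t) * (y 3 / M ^ 5) + t * u 3 = 0 := hi 3
  have b4 : (1 - t) * (M ^ 2 * y 4 - y 5) + t * u 4 = 0 := hi 4
  have b5 : (1 - t) * (M ^ 2 * y 5 - y 6) + t * u 5 = 0 := hi 5
  have b6 : (1 - t) * (y 6 / M ^ 5) + t * u 6 = 0 := hi 6
  have hM2 : 0 < M ^ 2 := by positivity
  have hM5 : 0 < (M ^ 5)⁻¹ := by positivity
  have x6 : x 6 = 0 := hj 5 _ hM5 (by rw [← div_eq_inv_mul]; exact b6)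
  have y6 : y 6 = 0 := hy 5 x6
  have x3 : x 3 = 0 := hj 2 _ hM5 (by rw [← div_eq_inv_mul]; exact b3)
  have y3 : y 3 = 0 := hy 2 x3
  rw [y6, sub_zero] at b5
  have x5 : x 5 = 0 := hj 4 _ hM2 b5
  have y5 : y 5 = 0 := hy 4 x5
  rw [y5, sub_zero] at b4
  have x4 : x 4 = 0 := hj 3 _ hM2 b4
  have y4 : y 4 = 0 := hy 3 x4
  rw [y3, y4, mul_zero, sub_zero, add_zero] at b2
  have x2 : x 2 = 0 := hj 1 _ hM2 b2
  have y2 : y 2 = 0 := hy 1 x2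
  rw [y2, sub_zero] at b1
  have x1 : x 1 = 0 := hj 0 _ hM2 b1
  have y1 : y 1 = 0 := hy 0 x1
  have hall : ∀ j : Fin 6, x j.succ = 0 := fun j => by fin_cases j <;> assumption
  have e0 : (x - ctr7) 0 = x 0 - 63 := by simp [ctr7]
  have y0 : y 0 = x 0 - 63 := rho_six_eq hx hall
  rw [y1, sub_zero, hu, e0, y0] at b0
  have x0 := eq_zero_of_sign (a := x 0 - 63) (mul_self_nonneg _) id ht ht' (hκ _) hM2 b0
  ext i
  refine Fin.cases ?_ (fun j => ?_) i
  · simp only [ctr7, EuclideanSpace.single_apply, if_true]; linarith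
  · rw [hall j]; simp [ctr7]

end Center

section Comparison

open Filter Topology

/-- The value outside the charts. -/
def far7 : EuclideanSpace ℝ (Fin 7) := EuclideanSpace.single 0 1

theorem norm_far7 : ‖far7‖ = 1 := by simp [far7]

theorem eq_pole8 {v : EuclideanSpace ℝ (Fin 8)} (hv : ‖v‖ = 1) (h : tau7 v = 0) (h5 : 0 < v 5) :
    v = EuclideanSpace.single 5 1 := by
  have h1 := norm_tau7_sq v
  rw [h, hv, norm_zero] at h1
  have h2 : v 5 = 1 := by nlinarith
  have hi := fun i => congrArg (fun v : EuclideanSpace ℝ (Fin 7) => v i) h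
  have i0 := hi 0; have i1 := hi 1; have i2 := hi 2; have i3 := hi 3; have i4 := hi 4; have i5 := hi 5; have i6 := hi 6
  simp [tau7_apply] at i0 i1 i2 i3 i4 i5 i6
  ext i; fin_cases i <;> simp [*]

open Classical in
/-- The argument of the small map, without cutoff. -/
def cellMap (M : ℝ) (v : EuclideanSpace ℝ (Fin 8)) : EuclideanSpace ℝ (Fin 7) :=
  if 0 < v 5 then polL M (chart7 v) else far7

theorem chart7_sub (v : EuclideanSpace ℝ (Fin 8)) : chart7 v - ctr7 = (512:ℝ) • tau7 v := by
  rw [chart7, ctr7, add_sub_cancel_left]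

theorem tau7_eq_zero {v : EuclideanSpace ℝ (Fin 8)} (h : chart7 v = ctr7) : tau7 v = 0 := by
  have := chart7_sub v
  rw [h, sub_self, eq_comm, smul_eq_zero] at this
  exact this.resolve_left (by norm_num)

theorem cellMap_ne {M : ℝ} (hM : 10 ≤ M) {v : EuclideanSpace ℝ (Fin 8)} (hv : ‖v‖ = 1) (h : v ≠ EuclideanSpace.single 5 1) :
    cellMap M v ≠ 0 := fun h0 => by
  rw [cellMap] at h0
  split_ifs at h0 with h5
  · exact h (eq_pole8 hv (tau7_eq_zero (eq_ctr7_of_polL_eq_zero hM h0)) h5)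
  · exact ne_zero_of_norm_one norm_far7 h0

theorem eventually_pos_coord {v : EuclideanSpace ℝ (Fin 8)} (h : 0 < v 5) : ∀ᶠ w in 𝓝 v, 0 < w 5 :=
  (EuclideanSpace.proj (𝕜 := ℝ) (5 : Fin 8)).continuous.continuousAt.eventually (Ioi_mem_nhds h)

theorem cellMap_tame {M : ℕ} (hM : 10 ≤ M) {v : EuclideanSpace ℝ (Fin 8)} (hv : ‖v‖ = 1) :
    ContinuousAt (cellMap M) v ∨ ∀ᶠ w in 𝓝 v, 1 / 4 ≤ ‖cellMap M w‖ := by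
  have hM' : (10:ℝ) ≤ M := by exact_mod_cast hM
  have hfar : ∀ w : EuclideanSpace ℝ (Fin 8), ¬ 0 < w 5 → 1 / 4 ≤ ‖cellMap M w‖ := fun w hw => by
    rw [cellMap, if_neg hw, norm_far7]; norm_num
  rcases lt_trichotomy (v 5) 0 with h | h | h
  · right
    have : ∀ᶠ w in 𝓝 v, w 5 < 0 :=
      (EuclideanSpace.proj (𝕜 := ℝ) (5 : Fin 8)).continuous.continuousAt.eventually (Iio_mem_nhds h)
    exact this.mono fun w hw => hfar w (not_lt.2 hw.le)
  · right
    have h1 : 1 / 2 < ‖tau7 v‖ ^ 2 := by rw [norm_tau7_sq, hv, h]; norm_num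
    have h2 : ∀ᶠ w in 𝓝 v, 1 / 2 < ‖tau7 w‖ ^ 2 :=
      (tau7.continuous.norm.pow 2).continuousAt.eventually (Ioi_mem_nhds h1)
    filter_upwards [h2] with w hw
    by_cases h5 : 0 < w 5
    · rw [cellMap, if_pos h5]
      by_contra! h3
      exact (norm_tau7_lt hM' h3).not_gt hw
    · exact hfar w h5
  · have he : cellMap M =ᶠ[𝓝 v] fun w => polL M (chart7 w) :=
      (eventually_pos_coord h).mono fun w hw => if_pos hw
    have hc : ContinuousAt chart7 v := contDiff_chart7.continuous.continuousAt
    rcases polL_local hM (chart7 v) with h1 | ⟨g, hg, h1⟩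
    · right
      filter_upwards [he, hc.eventually h1] with w hw hw1
      rwa [hw]
    · left
      refine ContinuousAt.congr_of_eventuallyEq ?_ he
      have : ContinuousAt (polL M) (chart7 v) :=
        ContinuousAt.congr_of_eventuallyEq ((latL (M:ℝ)).continuous.continuousAt.comp hg.1.continuousAt) h1
      exact this.comp hc

/-- The denominator of the stereographic projection of the first six coordinates. -/
def sden (v : EuclideanSpace ℝ (Fin 8)) : ℝ := ‖fst6 v‖ + v 5

theorem continuous_sden : Continuous sden := by
  have := (EuclideanSpace.proj (𝕜 := ℝ) (5 : Fin 8)).continuous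
  exact fst6.continuous.norm.add this

theorem norm_fst6_sq (v : EuclideanSpace ℝ (Fin 8)) :
    ‖fst6 v‖ ^ 2 = v 0 ^ 2 + v 1 ^ 2 + v 2 ^ 2 + v 3 ^ 2 + v 4 ^ 2 + v 5 ^ 2 := by
  rw [EuclideanSpace.real_norm_sq_eq, Fin.sum_univ_six]
  simp [fst6_apply]

theorem norm_sq_eq_fst6 (v : EuclideanSpace ℝ (Fin 8)) : ‖v‖ ^ 2 = ‖fst6 v‖ ^ 2 + v 6 ^ 2 + v 7 ^ 2 := by
  rw [norm_fst6_sq, EuclideanSpace.real_norm_sq_eq, Fin.sum_univ_eight]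

theorem abs_le_norm_fst6 (v : EuclideanSpace ℝ (Fin 8)) : |v 5| ≤ ‖fst6 v‖ := by
  refine abs_le_of_sq_le_sq ?_ (norm_nonneg _)
  rw [norm_fst6_sq]; nlinarith [sq_nonneg (v 0), sq_nonneg (v 1), sq_nonneg (v 2), sq_nonneg (v 3), sq_nonneg (v 4)]

theorem sden_nonneg (v : EuclideanSpace ℝ (Fin 8)) : 0 ≤ sden v := by
  have := (abs_le.1 (abs_le_norm_fst6 v)).1
  rw [sden]; linarith

theorem norm_fst6_pos {v : EuclideanSpace ℝ (Fin 8)} (h : 0 < sden v) : 0 < ‖fst6 v‖ := by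
  have := (abs_le.1 (abs_le_norm_fst6 v)).2
  rw [sden] at h; linarith

/-- The stereographic coordinates together with the slopes of the last two variables. -/
def wref (v : EuclideanSpace ℝ (Fin 8)) : EuclideanSpace ℝ (Fin 7) :=
  !₂[v 0 / sden v, v 1 / sden v, v 2 / sden v, v 6 / ‖fst6 v‖, v 3 / sden v, v 4 / sden v, v 7 / ‖fst6 v‖]

theorem norm_wref_sq {v : EuclideanSpace ℝ (Fin 8)} (h : 0 < sden v) :
    ‖wref v‖ ^ 2 = (‖fst6 v‖ - v 5) / sden v + (v 6 ^ 2 + v 7 ^ 2) / ‖fst6 v‖ ^ 2 := by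
  have hn := norm_fst6_pos h
  have h1 : v 0 ^ 2 + v 1 ^ 2 + v 2 ^ 2 + v 3 ^ 2 + v 4 ^ 2 = (‖fst6 v‖ - v 5) * sden v := by
    rw [sden]; linear_combination - norm_fst6_sq v
  rw [EuclideanSpace.real_norm_sq_eq, Fin.sum_univ_seven]
  simp only [wref]
  simp
  field_simp
  linear_combination ‖fst6 v‖ ^ 2 * h1

theorem continuousAt_wref {v : EuclideanSpace ℝ (Fin 8)} (h : 0 < sden v) : ContinuousAt wref v := by
  have hd : ContinuousAt sden v := continuous_sden.continuousAt
  have hn : ContinuousAt (fun v => ‖fst6 v‖) v := fst6.continuous.norm.continuousAt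
  have hp := norm_fst6_pos h
  have hc (i : Fin 8) : ContinuousAt (fun v : EuclideanSpace ℝ (Fin 8) => v i) v :=
    (EuclideanSpace.proj (𝕜 := ℝ) i).continuous.continuousAt
  refine (PiLp.continuous_toLp 2 _).continuousAt.comp (continuousAt_pi.2 fun i => ?_)
  fin_cases i
  exacts [(hc 0).div hd h.ne', (hc 1).div hd h.ne', (hc 2).div hd h.ne', (hc 6).div hn hp.ne', (hc 3).div hd h.ne',
    (hc 4).div hd h.ne', (hc 7).div hn hp.ne']

theorem stereoInv_wref {v : EuclideanSpace ℝ (Fin 8)} (h : 0 < sden v) : stereoInv (wref v) = ‖fst6 v‖⁻¹ • fst6 v := by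
  have hn := norm_fst6_pos h
  have h1 : v 0 ^ 2 + v 1 ^ 2 + v 2 ^ 2 + v 3 ^ 2 + v 4 ^ 2 = (‖fst6 v‖ - v 5) * sden v := by
    rw [sden]; linear_combination - norm_fst6_sq v
  have h2 : (v 0 / sden v) ^ 2 + (v 1 / sden v) ^ 2 + (v 2 / sden v) ^ 2 + (v 3 / sden v) ^ 2 + (v 4 / sden v) ^ 2 =
      (‖fst6 v‖ - v 5) / sden v := by
    field_simp; linear_combination h1
  have h3 : 1 + (‖fst6 v‖ - v 5) / sden v = 2 * ‖fst6 v‖ / sden v := by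
    field_simp; rw [sden]; ring
  have h4 : 1 - (‖fst6 v‖ - v 5) / sden v = 2 * v 5 / sden v := by
    field_simp; rw [sden]; ring
  have h5 : stereoInv (wref v) = (2 * ‖fst6 v‖ / sden v)⁻¹ •
      !₂[2 * (v 0 / sden v), 2 * (v 1 / sden v), 2 * (v 2 / sden v), 2 * (v 3 / sden v), 2 * (v 4 / sden v), 2 * v 5 / sden v] := by
    rw [← h3, ← h4, ← h2]; rfl
  rw [h5]
  ext i
  fin_cases i <;> simp [fst6_apply] <;> field_simp <;> rfl

theorem Fref_eq {v : EuclideanSpace ℝ (Fin 8)} (h : 0 < sden v) : Fref v = ‖fst6 v‖ • joinMap (wref v) := by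
  have hn := norm_fst6_pos h
  have h1 : joinMap (wref v) = !₂[fsph (‖fst6 v‖⁻¹ • fst6 v) 0, fsph (‖fst6 v‖⁻¹ • fst6 v) 1,
      fsph (‖fst6 v‖⁻¹ • fst6 v) 2, v 6 / ‖fst6 v‖, v 7 / ‖fst6 v‖] := by
    rw [joinMap, fst5, stereoInv_wref h]; rfl
  rw [h1]
  ext i
  fin_cases i <;> simp [Fref, fhom, mul_div_cancel₀, hn.ne']

open Classical in
/-- The argument of the local model that represents the reference map. -/
def refMap (R : ℝ) (v : EuclideanSpace ℝ (Fin 8)) : EuclideanSpace ℝ (Fin 7) :=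
  if 0 < sden v then R⁻¹ • wref v else far7

theorem le_norm_refMap {R : ℝ} (hR : 0 < R) {v : EuclideanSpace ℝ (Fin 8)}
    (h : 0 < sden v → (R / 4) ^ 2 ≤ ‖wref v‖ ^ 2) : 1 / 4 ≤ ‖refMap R v‖ := by
  rw [refMap]
  split_ifs with h0
  · have := (sq_le_sq₀ (by positivity) (norm_nonneg _)).1 (h h0)
    rw [norm_smul, norm_inv, Real.norm_of_nonneg hR.le, inv_mul_eq_div, le_div_iff₀ hR]
    linarith
  · rw [norm_far7]; norm_num

theorem refMap_tame {R : ℝ} (hR : 0 < R) {v : EuclideanSpace ℝ (Fin 8)} (hv : ‖v‖ = 1) :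
    ContinuousAt (refMap R) v ∨ ∀ᶠ w in 𝓝 v, 1 / 4 ≤ ‖refMap R w‖ := by
  have hc (i : Fin 8) : Continuous fun v : EuclideanSpace ℝ (Fin 8) => v i := (EuclideanSpace.proj (𝕜 := ℝ) i).continuous
  have hn : Continuous fun v => ‖fst6 v‖ := fst6.continuous.norm
  have hd := continuous_sden
  rcases (sden_nonneg v).eq_or_lt with h | h
  · right
    rcases (norm_nonneg (fst6 v)).eq_or_lt with h0 | h0
    · have h1 : (R / 4) ^ 2 * ‖fst6 v‖ ^ 2 < v 6 ^ 2 + v 7 ^ 2 := by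
        have := norm_sq_eq_fst6 v
        rw [hv, ← h0] at this
        rw [← h0]; linarith
      have h2 : ∀ᶠ w in 𝓝 v, (R / 4) ^ 2 * ‖fst6 w‖ ^ 2 < w 6 ^ 2 + w 7 ^ 2 :=
        (isOpen_lt ((hn.pow 2).const_mul _) (((hc 6).pow 2).add ((hc 7).pow 2))).mem_nhds h1
      filter_upwards [h2] with w hw
      refine le_norm_refMap hR fun hs => ?_
      have hp := norm_fst6_pos hs
      have h5 := (abs_le.1 (abs_le_norm_fst6 w)).2
      rw [norm_wref_sq hs]
      refine le_add_of_nonneg_of_le (div_nonneg (by linarith) hs.le) ((le_div_iff₀ (by positivity)).2 hw.le)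
    · have h1 : (R / 4) ^ 2 * sden v < ‖fst6 v‖ - v 5 := by
        rw [← h]; rw [sden] at h; linarith
      have h2 : ∀ᶠ w in 𝓝 v, (R / 4) ^ 2 * sden w < ‖fst6 w‖ - w 5 :=
        (isOpen_lt (hd.const_mul _) (hn.sub (hc 5))).mem_nhds h1
      filter_upwards [h2] with w hw
      refine le_norm_refMap hR fun hs => ?_
      rw [norm_wref_sq hs]
      exact le_add_of_le_of_nonneg ((le_div_iff₀ hs).2 hw.le) (by positivity)
  · left
    refine ContinuousAt.congr_of_eventuallyEq ((continuousAt_wref h).const_smul R⁻¹) ?_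
    have h2 : ∀ᶠ w in 𝓝 v, 0 < sden w := hd.continuousAt.eventually (Ioi_mem_nhds h)
    exact h2.mono fun w hw => if_pos hw

/-- The positive factors relating the reference coordinates to the chart. -/
def gain7 (R : ℝ) (v : EuclideanSpace ℝ (Fin 8)) : Fin 7 → ℝ :=
  ![R⁻¹ / (512 * sden v), R⁻¹ / (512 * sden v), R⁻¹ / (512 * sden v), R⁻¹ / (512 * ‖fst6 v‖), R⁻¹ / (512 * sden v),
    R⁻¹ / (512 * sden v), R⁻¹ / (512 * ‖fst6 v‖)]

theorem gain7_pos {R : ℝ} (hR : 0 < R) {v : EuclideanSpace ℝ (Fin 8)} (h : 0 < sden v) (i : Fin 7) : 0 < gain7 R v i := by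
  have hn := norm_fst6_pos h
  fin_cases i <;> simp [gain7] <;> positivity

theorem refMap_apply {R : ℝ} (hR : 0 < R) {v : EuclideanSpace ℝ (Fin 8)} (h : 0 < sden v) (i : Fin 7) :
    refMap R v i = gain7 R v i * (chart7 v - ctr7) i := by
  have hn := norm_fst6_pos h
  rw [refMap, if_pos h, chart7_sub, tau7_apply]
  fin_cases i <;> simp [gain7, wref] <;> field_simp

theorem refMap_ne {R : ℝ} (hR : 0 < R) {v : EuclideanSpace ℝ (Fin 8)} (hv : ‖v‖ = 1) (h : v ≠ EuclideanSpace.single 5 1) :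
    refMap R v ≠ 0 := fun h0 => by
  by_cases hs : 0 < sden v
  · have h1 : chart7 v - ctr7 = 0 := by
      ext i
      have := refMap_apply hR hs i
      rw [h0] at this
      exact (mul_eq_zero.1 this.symm).resolve_left (gain7_pos hR hs i).ne'
    have h2 := tau7_eq_zero (sub_eq_zero.1 h1)
    refine h (eq_pole8 hv h2 ?_)
    have h3 := norm_tau7_sq v
    rw [h2, norm_zero, norm_sq_eq_fst6] at h3
    have h4 : (‖fst6 v‖ - v 5) * sden v ≤ 0 := by
      rw [sden]; nlinarith [sq_nonneg (v 6), sq_nonneg (v 7)]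
    have h5 := nonpos_of_mul_nonpos_left h4 hs
    linarith [norm_fst6_pos hs]
  · rw [refMap, if_neg hs] at h0
    exact ne_zero_of_norm_one norm_far7 h0

theorem eventually_maps {R : ℝ} (hR : 0 < R) {M : ℕ} (hM : 10 ≤ M) :
    ∀ᶠ v in 𝓝 (EuclideanSpace.single 5 1 : EuclideanSpace ℝ (Fin 8)), ContinuousAt (cellMap M) v ∧ ContinuousAt (refMap R) v ∧
      ∀ t : ℝ, 0 ≤ t → t ≤ 1 → ‖v‖ = 1 → v ≠ EuclideanSpace.single 5 1 → (1 - t) • cellMap M v + t • refMap R v ≠ 0 := by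
  have hM' : (10:ℝ) ≤ M := by exact_mod_cast hM
  set p : EuclideanSpace ℝ (Fin 8) := EuclideanSpace.single 5 1 with hp
  have hp5 : 0 < p 5 := by simp [hp]
  have hpt : chart7 p = ctr7 := by
    have : tau7 p = 0 := by ext i; fin_cases i <;> simp [tau7_apply, hp]
    rw [chart7, this, smul_zero, add_zero, ctr7]
  have hps : 0 < sden p := by rw [sden]; positivity
  have hc : Continuous chart7 := contDiff_chart7.continuous
  have h1 := eventually_polL hM
  rw [← hpt] at h1
  have h2 : ∀ᶠ w in 𝓝 p, 0 < sden w := continuous_sden.continuousAt.eventually (Ioi_mem_nhds hps)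
  filter_upwards [hc.continuousAt.eventually h1, (eventually_pos_coord hp5).eventually_nhds, h2.eventually_nhds] with v hv1 hv2 hv3
  have h5 := hv2.self_of_nhds
  have hs := hv3.self_of_nhds
  refine ⟨?_, ?_, fun t ht ht' hv hne h0 => ?_⟩
  · exact ContinuousAt.congr_of_eventuallyEq (ContinuousAt.comp (g := polL M) hv1.1 hc.continuousAt) (hv2.mono fun w hw => if_pos hw)
  · exact ContinuousAt.congr_of_eventuallyEq ((continuousAt_wref hs).const_smul R⁻¹) (hv3.mono fun w hw => if_pos hw)
  · rw [cellMap, if_pos h5, hv1.2.1] at h0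
    exact hne (eq_pole8 hv (tau7_eq_zero
      (eq_ctr7_of_segment (by linarith) hv1.2.2 (gain7_pos hR hs) (refMap_apply hR hs) ht ht' h0)) h5)

end Comparison

section Assembly

open Filter Topology

theorem norm_S7 (v : S7) : ‖(v : EuclideanSpace ℝ (Fin 8))‖ = 1 := by simpa using v.2

theorem bump_refMap {R : ℝ} (hR : 0 < R) {v : EuclideanSpace ℝ (Fin 8)} (h : 0 < sden v) :
    vinf + bump (R • refMap R v) = collapse (joinMap (wref v)) := by
  rw [refMap, if_pos h, smul_inv_smul₀ hR.ne', bump, add_sub_cancel]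

theorem Fref_two_nonpos {v : EuclideanSpace ℝ (Fin 8)} (h : sden v = 0) : Fref v 2 ≤ 0 := by
  have h1 : fst6 v = ‖fst6 v‖ • pole6 := by
    have h2 := norm_fst6_sq v
    have h5 : v 5 = -‖fst6 v‖ := by rw [sden] at h; linarith
    rw [h5] at h2
    have e0 : v 0 = 0 := by nlinarith [sq_nonneg (v 0), sq_nonneg (v 1), sq_nonneg (v 2), sq_nonneg (v 3), sq_nonneg (v 4)]
    have e1 : v 1 = 0 := by nlinarith [sq_nonneg (v 0), sq_nonneg (v 1), sq_nonneg (v 2), sq_nonneg (v 3), sq_nonneg (v 4)]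
    have e2 : v 2 = 0 := by nlinarith [sq_nonneg (v 0), sq_nonneg (v 1), sq_nonneg (v 2), sq_nonneg (v 3), sq_nonneg (v 4)]
    have e3 : v 3 = 0 := by nlinarith [sq_nonneg (v 0), sq_nonneg (v 1), sq_nonneg (v 2), sq_nonneg (v 3), sq_nonneg (v 4)]
    have e4 : v 4 = 0 := by nlinarith [sq_nonneg (v 0), sq_nonneg (v 1), sq_nonneg (v 2), sq_nonneg (v 3), sq_nonneg (v 4)]
    ext i
    fin_cases i <;> simp [pole6, fst6_apply]
    exacts [e0, e1, e2, e3, e4, h5]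
  change fhom (fst6 v) 2 ≤ 0
  rcases (norm_nonneg (fst6 v)).eq_or_lt with h0 | h0
  · rw [fhom, ← h0, zero_smul]; rfl
  · have h3 : ‖fst6 v‖⁻¹ • fst6 v = pole6 := by
      conv_lhs => rw [h1, norm_smul, norm_norm]
      have h4 : ‖pole6‖ = 1 := by rw [EuclideanSpace.norm_eq, Fin.sum_univ_six]; simp [pole6]
      rw [h4, mul_one, smul_smul, inv_mul_cancel₀ h0.ne', one_smul]
    rw [fhom, h3, fsph_pole6]
    simp

theorem bump_refMap_add_ne {R : ℝ} (hR : 0 < R) {C : ℝ} (hf : IsBump C fun w => bump (R • w))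
    (v : EuclideanSpace ℝ (Fin 8)) {c : ℝ} (hc : 0 ≤ c) : vinf + bump (R • refMap R v) + c • Fref v ≠ 0 := by
  rcases (sden_nonneg v).eq_or_lt with h | h
  · have h1 : bump (R • refMap R v) = 0 := by
      refine hf.eq_zero _ ?_
      rw [refMap, if_neg (by rw [← h]; exact lt_irrefl _), norm_far7]; norm_num
    intro h0
    rw [h1, add_zero] at h0
    have h2 : -1 + c * Fref v 2 = 0 := congrArg (fun w : EuclideanSpace ℝ (Fin 5) => w 2) h0
    have := mul_nonpos_of_nonneg_of_nonpos hc (Fref_two_nonpos h.symm)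
    linarith
  · rw [bump_refMap hR h, Fref_eq h, collapse]
    set W := joinMap (wref v)
    have hW : W 0 ^ 2 + W 1 ^ 2 + W 2 ^ 2 = 1 := fst5_sq (wref v)
    have hi := norm_ne_zero_iff.2 (interp_ne hW)
    have h1 : ‖interp W‖⁻¹ • interp W + c • ‖fst6 v‖ • W =
        ‖interp W‖⁻¹ • (interp W + (‖interp W‖ * (c * ‖fst6 v‖)) • W) := by
      rw [smul_add, smul_smul, smul_smul, inv_mul_cancel_left₀ hi]
    rw [h1]
    exact smul_ne_zero (inv_ne_zero hi) (interp_add_ne hW (by positivity))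

theorem unitHomotopic_smallMap {R : ℝ} (hR : 0 < R) {C : ℝ} (hf : IsBump C fun w => bump (R • w)) {M : ℕ} (hM : 10 ≤ M)
    {F G : C(S7, EuclideanSpace ℝ (Fin 5))} (hF : ∀ v, F v = smallMap (fun w => bump (R • w)) M v) (hG : ∀ v, G v = Fref v) :
    UnitHomotopic F G := by
  have hM' : (10:ℝ) ≤ M := by exact_mod_cast hM
  have hfc : Continuous fun w => bump (R • w) := hf.contDiff.continuous
  have hT0 : Tame fun v : S7 => cellMap M v := fun v =>
    (cellMap_tame hM (norm_S7 v)).imp (fun h => ContinuousAt.comp (g := cellMap M) h continuous_subtype_val.continuousAt)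
      fun h => continuous_subtype_val.continuousAt.eventually h
  have hT1 : Tame fun v : S7 => refMap R v := fun v =>
    (refMap_tame hR (norm_S7 v)).imp (fun h => ContinuousAt.comp (g := refMap R) h continuous_subtype_val.continuousAt)
      fun h => continuous_subtype_val.continuousAt.eventually h
  obtain ⟨K, hK⟩ : ∃ K : C(S7, EuclideanSpace ℝ (Fin 5)), ∀ v, K v = vinf + bump (R • refMap R v) :=
    ⟨⟨fun v => vinf + bump (R • refMap R v), continuous_const.add (hT1.continuous_comp hfc hf.eq_zero)⟩, fun v => rfl⟩
  obtain ⟨p, hp⟩ : ∃ p : S7, (p : EuclideanSpace ℝ (Fin 8)) = EuclideanSpace.single 5 1 :=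
    ⟨⟨EuclideanSpace.single 5 1, by simp⟩, rfl⟩
  have hne : ∀ v : S7, v ≠ p → (v : EuclideanSpace ℝ (Fin 8)) ≠ EuclideanSpace.single 5 1 := fun v h h' => h (Subtype.ext (h'.trans hp.symm))
  refine UnitHomotopic.trans (h := K) ?_ ?_
  · refine unitHomotopic_of_local (c := vinf) hfc hf.eq_zero hf.norm_add (e := far7) (by rw [norm_far7]; norm_num) hT0 hT1
      (p := p) ?_ (fun v h => cellMap_ne hM' (norm_S7 v) (hne v h)) (fun v h => refMap_ne hR (norm_S7 v) (hne v h))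
      (fun v => ?_) hK
    · have h1 : Tendsto (fun v : S7 => (v : EuclideanSpace ℝ (Fin 8))) (𝓝 p) (𝓝 (EuclideanSpace.single 5 1)) :=
        hp ▸ continuous_subtype_val.continuousAt
      have := h1.eventually (eventually_maps hR hM)
      filter_upwards [this] with v hv
      exact ⟨ContinuousAt.comp (g := cellMap M) hv.1 continuous_subtype_val.continuousAt,
        ContinuousAt.comp (g := refMap R) hv.2.1 continuous_subtype_val.continuousAt,
        fun t h => hv.2.2 t t.2.1 t.2.2 (norm_S7 v) (hne v h)⟩
    · have h1 : cellMap M v = if 0 < (v : EuclideanSpace ℝ (Fin 8)) 5 then polL M (chart7 v) else EuclideanSpace.single 0 1 := by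
        rw [cellMap, far7]
      rw [hF, smallMap_eq hf hM' (norm_S7 v), h1]
  · refine unitHomotopic_of_line (fun v => ?_) (fun v => ?_) fun v c hc => ?_
    · rw [hK]; exact hf.norm_add _
    · rw [hG, norm_Fref, norm_S7]
    · rw [hK, hG]; exact bump_refMap_add_ne hR hf v hc

theorem norm_smallMap {C : ℝ} {f : EuclideanSpace ℝ (Fin 7) → EuclideanSpace ℝ (Fin 5)} (hf : IsBump C f) {M : ℝ}
    (hM : 10 ≤ M) {v : EuclideanSpace ℝ (Fin 8)} (hv : ‖v‖ = 1) : ‖smallMap f M v‖ = 1 := by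
  rw [smallMap_eq hf hM hv]; exact hf.norm_add _

theorem not_sphereNullhomotopic_smallMap {R : ℝ} (hR : 0 < R) {C : ℝ} (hf : IsBump C fun w => bump (R • w)) {M : ℕ}
    (hM : 10 ≤ M) : ¬ SphereNullhomotopic (smallMap (fun w => bump (R • w)) M) := by
  rintro ⟨y, -, K, hKc, hKm, hK0, hK1⟩
  have hmem : ∀ v : S7, (v : EuclideanSpace ℝ (Fin 8)) ∈ usph 8 := fun v => v.2
  obtain ⟨F, hF⟩ : ∃ F : C(S7, EuclideanSpace ℝ (Fin 5)), ∀ v, F v = smallMap (fun w => bump (R • w)) M v :=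
    ⟨⟨_, (contDiff_smallMap hf hM).continuous.comp continuous_subtype_val⟩, fun v => rfl⟩
  obtain ⟨G, hG⟩ : ∃ G : C(S7, EuclideanSpace ℝ (Fin 5)), ∀ v, G v = Fref v :=
    ⟨⟨_, continuous_Fref.comp continuous_subtype_val⟩, fun v => rfl⟩
  obtain ⟨L, hL⟩ : ∃ L : C(unitInterval × S7, EuclideanSpace ℝ (Fin 5)), ∀ x, L x = K x.1 x.2 :=
    ⟨⟨_, hKc.comp_continuous (f := fun x : unitInterval × S7 => ((x.1 : ℝ), (x.2 : EucA 8)))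
      (by fun_prop) fun x => ⟨x.1.2, hmem x.2⟩⟩, fun x => rfl⟩
  obtain ⟨H⟩ := (unitHomotopic_smallMap hR hf hM hF hG).symm
  refine not_null (F := F) (H := H.toHomotopy.toContinuousMap) (K := L) (y := y) (fun x => H.prop' x.1 x.2)
    (fun x => ?_) (fun v => ?_) (fun v => H.map_one_left v) (fun v => ?_) fun v => ?_
  · rw [hL]; simpa [usph] using hKm x.1 x.1.2 (hmem x.2)
  · exact (H.map_zero_left v).trans (hG v)
  · rw [hL, hF]; exact hK0 (hmem v)
  · rw [hL]; exact hK1 (hmem v)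

end Assembly

/-- For every `ε > 0` there exists a homotopically non-trivial `C¹` map from `S^7` to
`S^4` with `3`-dilation less than `ε`.  (The class of such a map is a non-trivial torsion element of `π₇(S⁴)` which is a double suspension of an element of `π₅(S²)`.)
(`S^7 = usph 8 ⊆ ℝ^8`, `S^4 = usph 5 ⊆ ℝ^5`; a `C¹` map of spheres is
represented by a `C¹` ambient map sending the unit sphere to the unit sphere.) -/
theorem nontrivial_small_3dilation_S7_S4 :
    ∀ ε : ℝ, 0 < ε →
      ∃ F : EucA 8 → EucA 5,
        ContDiff ℝ 1 F ∧
        MapsTo F (usph 8) (usph 5) ∧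
        ¬ SphereNullhomotopic F ∧
        kDilation 3 F < ε := by
  intro ε hε
  obtain ⟨R, hR, C, hf⟩ := exists_isBump
  obtain ⟨m, hm⟩ := exists_nat_gt (7200 * (C * 100352) ^ 3 / ε)
  have hM : 10 ≤ m + 10 := by omega
  have hM' : (10:ℝ) ≤ (m + 10 : ℕ) := by exact_mod_cast hM
  refine ⟨smallMap (fun w => bump (R • w)) (m + 10 : ℕ), contDiff_smallMap hf hM, fun v hv => ?_,
    not_sphereNullhomotopic_smallMap hR hf hM, (kDilation_smallMap_le hf hM).trans_lt ?_⟩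
  · have : ‖v‖ = 1 := by simpa [usph] using hv
    simpa [usph] using norm_smallMap hf hM' this
  · rw [div_lt_iff₀ (by linarith), ← div_lt_iff₀' hε]
    push_cast
    linarith
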